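/- Let n ≥ 3 and ζ > 1. Let f : ℝⁿ → ℝ be continuous with finite limit f(∞) = lim_{|x|→∞} f(x) and limsup_{|x|→∞} |x|^ζ |f(x) − f(∞)| < ∞. Let u ∈ C²(ℝⁿ) be convex and satisfy det D²u(x) = e^{n f(x)} for all x ∈ ℝⁿ. Then there exist an invertible linear map T : ℝⁿ → ℝⁿ with det T = 1 and constants C > 0, ε > 0 such that |u(Tx) − (e^{f(∞)}/2)|x|²| ≤ C|x|^{2−ε} for all |x| ≥ 1. -/

import Mathlib

open Filter

/-- The Hessian matrix `(∂ᵢ∂ⱼ u(x))` of a function on Euclidean space. -/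
noncomputable def hess {n : ℕ} (u : EuclideanSpace ℝ (Fin n) → ℝ)
    (x : EuclideanSpace ℝ (Fin n)) : Matrix (Fin n) (Fin n) ℝ :=
  Matrix.of fun i j =>
    iteratedFDeriv ℝ 2 u x ![EuclideanSpace.single i 1, EuclideanSpace.single j 1]

section PartA
set_option linter.all false
set_option linter.unusedSimpArgs false
set_option linter.unusedVariables false
set_option linter.deprecated false
open Filter MeasureTheory Set Metric
open scoped Topology InnerProductSpace ENNReal

abbrev Eu (n : ℕ) := EuclideanSpace ℝ (Fin n)

noncomputable abbrev adj {n : ℕ} (A : Eu n →L[ℝ] Eu n) : Eu n →L[ℝ] Eu n := ContinuousLinearMap.adjoint A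

structure C2 {n : ℕ} (u : Eu n → ℝ) (G : Eu n → Eu n) (H : Eu n → (Eu n →L[ℝ] Eu n)) : Prop where
  grad : ∀ x, HasFDerivAt u (innerSL ℝ (G x)) x
  hess : ∀ x, HasFDerivAt G (H x) x
  cont : Continuous H

variable {n : ℕ} {u v w : Eu n → ℝ} {G G' : Eu n → Eu n} {H H' : Eu n → (Eu n →L[ℝ] Eu n)}

namespace C2

theorem symm (h : C2 u G H) (x a b : Eu n) : ⟪H x a, b⟫_ℝ = ⟪a, H x b⟫_ℝ := by
  have h2 : HasFDerivAt (fun y => innerSL ℝ (G y)) ((innerSL ℝ).comp (H x)) x :=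
    (innerSL ℝ : Eu n →L[ℝ] _).hasFDerivAt.comp x (h.hess x)
  have := second_derivative_symmetric h.grad h2 a b
  simp only [ContinuousLinearMap.comp_apply, innerSL_apply_apply] at this
  rw [this, real_inner_comm]

theorem contG (h : C2 u G H) : Continuous G :=
  continuous_iff_continuousAt.2 fun x => (h.hess x).continuousAt
theorem contu (h : C2 u G H) : Continuous u :=
  continuous_iff_continuousAt.2 fun x => (h.grad x).continuousAt

theorem compA (h : C2 u G H) (A : Eu n →L[ℝ] Eu n) (b : Eu n) :
    C2 (fun x => u (A x + b)) (fun x => adj A (G (A x + b)))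
      (fun x => (adj A).comp ((H (A x + b)).comp A)) := by
  have hA : ∀ x, HasFDerivAt (fun x => A x + b) A x := fun x => A.hasFDerivAt.add_const b
  refine ⟨fun x => ?_, fun x => ?_, ?_⟩
  · refine ((h.grad (A x + b)).comp x (hA x)).congr_fderiv ?_
    ext y
    simp [ContinuousLinearMap.adjoint_inner_left]
  · exact (adj A).hasFDerivAt.comp x ((h.hess (A x + b)).comp x (hA x))
  · have := h.cont
    fun_prop

theorem smul (h : C2 u G H) (c : ℝ) : C2 (fun x => c * u x) (fun x => c • G x) (fun x => c • H x) := by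
  refine ⟨fun x => ?_, fun x => (h.hess x).const_smul c, h.cont.const_smul c⟩
  refine ((h.grad x).const_mul c).congr_fderiv ?_
  ext y; simp [inner_smul_left]

theorem add (h : C2 u G H) (h' : C2 v G' H') :
    C2 (fun x => u x + v x) (fun x => G x + G' x) (fun x => H x + H' x) := by
  refine ⟨fun x => ?_, fun x => (h.hess x).add (h'.hess x), h.cont.add h'.cont⟩
  refine ((h.grad x).add (h'.grad x)).congr_fderiv ?_
  ext y; simp [inner_add_left]

theorem zero : C2 (fun _ : Eu n => (0:ℝ)) (fun _ => 0) (fun _ => 0) :=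
  ⟨fun x => by simpa using hasFDerivAt_const (0:ℝ) x, fun x => hasFDerivAt_const _ x, continuous_const⟩

theorem sum {m : ℕ} {u : Fin m → Eu n → ℝ} {G : Fin m → Eu n → Eu n} {H : Fin m → Eu n → _}
    (h : ∀ i, C2 (u i) (G i) (H i)) :
    C2 (fun x => ∑ i, u i x) (fun x => ∑ i, G i x) (fun x => ∑ i, H i x) := by
  induction m with
  | zero => simpa using zero
  | succ m ih =>
    simp only [Fin.sum_univ_castSucc]
    exact (ih fun i => h i.castSucc).add (h _)

theorem lin (p : Eu n) (c : ℝ) : C2 (fun x => ⟪p, x⟫_ℝ + c) (fun _ => p) (fun _ => 0) :=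
  ⟨fun x => (innerSL ℝ p).hasFDerivAt.add_const c, fun x => hasFDerivAt_const _ x, continuous_const⟩

theorem hsq (x0 : Eu n) : C2 (fun x => ‖x - x0‖^2 / 2) (fun x => x - x0)
    (fun _ => ContinuousLinearMap.id ℝ (Eu n)) := by
  refine ⟨fun x => ?_, fun x => (hasFDerivAt_id x).sub_const x0, continuous_const⟩
  have := ((hasFDerivAt_id x).sub_const x0).norm_sq.const_mul (1/2:ℝ)
  refine (this.congr_of_eventuallyEq (Eventually.of_forall fun y => ?_)).congr_fderiv ?_
  · simp; ring
  · ext y; simp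

/-- derivative along a segment -/
theorem seg (h : C2 u G H) (x d : Eu n) (t : ℝ) :
    HasDerivAt (fun t => u (x + t • d)) ⟪G (x + t • d), d⟫_ℝ t := by
  have h1 : HasDerivAt (fun t : ℝ => x + t • d) d t := by
    simpa using ((hasDerivAt_id t).smul_const d).const_add x
  exact (h.grad _).comp_hasDerivAt t h1

theorem seg2 (h : C2 u G H) (x d : Eu n) (t : ℝ) :
    HasDerivAt (fun t => ⟪G (x + t • d), d⟫_ℝ) ⟪H (x + t • d) d, d⟫_ℝ t := by
  have h1 : HasDerivAt (fun t : ℝ => x + t • d) d t := by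
    simpa using ((hasDerivAt_id t).smul_const d).const_add x
  have := ((h.hess _).comp_hasDerivAt t h1).inner ℝ (hasDerivAt_const t d)
  simpa using this

/-- second order condition at local min -/
theorem locmin (h : C2 u G H) {x : Eu n} (hx : IsLocalMin u x) :
    G x = 0 ∧ ∀ d, 0 ≤ ⟪H x d, d⟫_ℝ := by
  have g0 : G x = 0 := by
    have := hx.hasFDerivAt_eq_zero (h.grad x)
    simpa using congrArg (fun f => f (G x)) this
  refine ⟨g0, fun d => ?_⟩
  by_contra hneg
  push Not at hneg
  have hc : Continuous fun t : ℝ => ⟪H (x + t • d) d, d⟫_ℝ := by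
    have := h.cont; fun_prop
  have e1 : ∀ᶠ t in 𝓝 (0:ℝ), ⟪H (x + t • d) d, d⟫_ℝ < 0 :=
    hc.continuousAt.eventually_lt continuousAt_const (by simpa using hneg)
  have hc2 : ContinuousAt (fun t : ℝ => x + t • d) 0 := by fun_prop
  have e2 : ∀ᶠ t in 𝓝 (0:ℝ), u x ≤ u (x + t • d) := by
    have : Tendsto (fun t : ℝ => x + t • d) (𝓝 0) (𝓝 x) := by simpa [ContinuousAt] using hc2
    exact this.eventually hx
  obtain ⟨δ, hδ, hb⟩ := Metric.eventually_nhds_iff.1 (e1.and e2)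
  have hin : ∀ t : ℝ, 0 ≤ t → t ≤ δ/2 → dist t 0 < δ := fun t h0 h1 => by
    rw [Real.dist_eq, sub_zero, abs_of_nonneg h0]; linarith
  have d1 : StrictAntiOn (fun t => ⟪G (x + t • d), d⟫_ℝ) (Icc 0 (δ/2)) := by
    refine strictAntiOn_of_deriv_neg (convex_Icc _ _) (fun t _ => (h.seg2 x d t).continuousAt.continuousWithinAt) ?_
    intro t ht
    rw [interior_Icc] at ht
    rw [(h.seg2 x d t).deriv]
    exact (hb (hin t ht.1.le ht.2.le)).1
  have d2 : StrictAntiOn (fun t => u (x + t • d)) (Icc 0 (δ/2)) := by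
    refine strictAntiOn_of_deriv_neg (convex_Icc _ _) (fun t _ => (h.seg x d t).continuousAt.continuousWithinAt) ?_
    intro t ht
    rw [interior_Icc] at ht
    rw [(h.seg x d t).deriv]
    have := d1 (a := 0) (b := t) ⟨le_rfl, by linarith⟩ ⟨ht.1.le, ht.2.le⟩ ht.1
    simpa [g0] using this
  have := d2 (a := 0) (b := δ/2) ⟨le_rfl, by linarith⟩ ⟨by linarith, le_rfl⟩ (by linarith)
  have h3 := (hb (hin (δ/2) (by linarith) le_rfl)).2
  simp at this
  linarith

end C2

/-- ABP core -/
theorem abp_core (h : C2 u G H) {K X P : Set (Eu n)} (hK : IsCompact K) (hX : X ⊆ interior K)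
    (hP : ∀ p ∈ P, ∃ x0 ∈ K, ∀ x ∈ K, x ∉ X → u x0 - ⟪p, x0⟫_ℝ < u x - ⟪p, x⟫_ℝ) :
    P ⊆ G '' {x | x ∈ X ∧ ∀ d, 0 ≤ ⟪H x d, d⟫_ℝ} := by
  intro p hp
  obtain ⟨x0, h0, h1⟩ := hP p hp
  have h2 := h.add (C2.lin (-p) 0)
  obtain ⟨y, hy, hmin⟩ := hK.exists_isMinOn ⟨x0, h0⟩ h2.contu.continuousOn
  have hyX : y ∈ X := by
    by_contra hyX
    have a1 := h1 y hy hyX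
    have a2 := hmin h0
    simp only [mem_ofPred_eq, inner_neg_left] at a2
    linarith
  have hl := h2.locmin (hmin.isLocalMin (mem_interior_iff_mem_nhds.1 (hX hyX)))
  refine ⟨y, ⟨hyX, fun d => by simpa using hl.2 d⟩, ?_⟩
  have := hl.1
  exact (add_neg_eq_zero.1 this)

theorem psd_meas (h : C2 u G H) {X : Set (Eu n)} (hX : MeasurableSet X) :
    MeasurableSet {x | x ∈ X ∧ ∀ d, 0 ≤ ⟪H x d, d⟫_ℝ} := by
  have e : {x | x ∈ X ∧ ∀ d, 0 ≤ ⟪H x d, d⟫_ℝ} = X ∩ ⋂ d, {x | 0 ≤ ⟪H x d, d⟫_ℝ} := by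
    ext x; simp
  rw [e]
  refine hX.inter (IsClosed.measurableSet (isClosed_iInter fun d => isClosed_le continuous_const ?_))
  have := h.cont
  fun_prop

/-- measure bound: image of gradient of PSD part -/
theorem abp_meas (h : C2 u G H) {K X P Bd : Set (Eu n)} (hK : IsCompact K) (hX : X ⊆ interior K)
    (hXm : MeasurableSet X)
    (hP : ∀ p ∈ P, ∃ x0 ∈ K, ∀ x ∈ K, x ∉ X → u x0 - ⟪p, x0⟫_ℝ < u x - ⟪p, x⟫_ℝ)
    {c1 c2 : ℝ} (hBd : MeasurableSet Bd)
    (hd1 : ∀ x ∈ X, x ∉ Bd → (∀ d, 0 ≤ ⟪H x d, d⟫_ℝ) → |(H x).det| ≤ c1)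
    (hd2 : ∀ x ∈ X, x ∈ Bd → (∀ d, 0 ≤ ⟪H x d, d⟫_ℝ) → |(H x).det| ≤ c2) :
    volume P ≤ ENNReal.ofReal c1 * volume X + ENNReal.ofReal c2 * volume (Bd ∩ X) := by
  set Y := {x | x ∈ X ∧ ∀ d, 0 ≤ ⟪H x d, d⟫_ℝ} with hY
  have mY : MeasurableSet Y := psd_meas h hXm
  calc volume P ≤ volume (G '' Y) := measure_mono (abp_core h hK hX hP)
    _ ≤ ∫⁻ x in Y, ENNReal.ofReal |(H x).det| :=
        addHaar_image_le_lintegral_abs_det_fderiv volume mY (fun x _ => (h.hess x).hasFDerivWithinAt)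
    _ ≤ ∫⁻ x in Y, (ENNReal.ofReal c1 + Bd.indicator (fun _ => ENNReal.ofReal c2) x) := by
        refine setLIntegral_mono_ae' mY (Eventually.of_forall fun x hx => ?_)
        by_cases hb : x ∈ Bd
        · rw [indicator_of_mem hb]
          exact (ENNReal.ofReal_le_ofReal (hd2 x hx.1 hb hx.2)).trans le_add_self
        · exact (ENNReal.ofReal_le_ofReal (hd1 x hx.1 hb hx.2)).trans le_self_add
    _ = ENNReal.ofReal c1 * volume Y + ENNReal.ofReal c2 * volume (Bd ∩ Y) := by
        rw [lintegral_add_left measurable_const, setLIntegral_const, lintegral_indicator_const hBd,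
          Measure.restrict_apply hBd]
    _ ≤ _ := by
        have : Y ⊆ X := fun x hx => hx.1
        gcongr

end PartA

section PartB
set_option linter.all false
set_option linter.unusedSimpArgs false
set_option linter.unusedVariables false
set_option linter.deprecated false
open Filter MeasureTheory Set Metric
open scoped Topology InnerProductSpace ENNReal
variable {n : ℕ} {u v w : Eu n → ℝ} {G G' : Eu n → Eu n} {H H' : Eu n → (Eu n →L[ℝ] Eu n)}
variable {c0 C0 : ℝ}

theorem det_adj (A : Eu n →L[ℝ] Eu n) : (adj A).det = A.det := by
  have b := EuclideanSpace.basisFun (Fin n) ℝ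
  have h1 := LinearMap.toMatrix_adjoint b b (A : Eu n →ₗ[ℝ] Eu n)
  have h2 := congrArg Matrix.det h1
  rw [Matrix.det_conjTranspose, LinearMap.det_toMatrix, LinearMap.det_toMatrix] at h2
  exact h2

theorem det_cmp (A B : Eu n →L[ℝ] Eu n) : (A.comp B).det = A.det * B.det :=
  LinearMap.det_comp (A : Eu n →ₗ[ℝ] Eu n) B

theorem det_smul' (c : ℝ) (A : Eu n →L[ℝ] Eu n) : (c • A).det = c ^ n * A.det := by
  have := LinearMap.det_smul c (A : Eu n →ₗ[ℝ] Eu n)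
  simpa [ContinuousLinearMap.det] using this

noncomputable def tr (A : Eu n →L[ℝ] Eu n) : ℝ := LinearMap.trace ℝ (Eu n) A

theorem tr_add (A B : Eu n →L[ℝ] Eu n) : tr (A + B) = tr A + tr B := by simp [tr]
theorem tr_smul (c : ℝ) (A : Eu n →L[ℝ] Eu n) : tr (c • A) = c * tr A := by simp [tr]
theorem tr_id : tr (ContinuousLinearMap.id ℝ (Eu n)) = n := by
  have := LinearMap.trace_id ℝ (Eu n)
  simpa [tr] using this
theorem tr_sum {m : ℕ} (A : Fin m → Eu n →L[ℝ] Eu n) : tr (∑ i, A i) = ∑ i, tr (A i) := by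
  simp [tr]

abbrev Sy (T : Eu n →L[ℝ] Eu n) : Prop := ∀ a b, ⟪T a, b⟫_ℝ = ⟪a, T b⟫_ℝ
abbrev Psd (T : Eu n →L[ℝ] Eu n) : Prop := ∀ a, 0 ≤ ⟪T a, a⟫_ℝ
abbrev Pd (T : Eu n →L[ℝ] Eu n) : Prop := ∀ a, a ≠ 0 → 0 < ⟪T a, a⟫_ℝ

theorem Pd.psd {T : Eu n →L[ℝ] Eu n} (h : Pd T) : Psd T := fun a => by
  by_cases ha : a = 0
  · simp [ha]
  · exact (h a ha).le

theorem spec {T : Eu n →L[ℝ] Eu n} (hT : Sy T) :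
    ∃ (b : OrthonormalBasis (Fin n) ℝ (Eu n)) (l : Fin n → ℝ), (∀ i, T (b i) = l i • b i) ∧
      T.det = ∏ i, l i ∧ tr T = ∑ i, l i := by
  have hs : (T : Eu n →ₗ[ℝ] Eu n).IsSymmetric := hT
  have hn : Module.finrank ℝ (Eu n) = n := by simp
  refine ⟨hs.eigenvectorBasis hn, hs.eigenvalues hn, fun i => ?_, ?_, ?_⟩
  · exact hs.apply_eigenvectorBasis hn i
  · exact hs.det_eq_prod_eigenvalues hn
  · exact hs.trace_eq_sum_eigenvalues hn

theorem spec_nonneg {T : Eu n →L[ℝ] Eu n} (h : Psd T) {b : OrthonormalBasis (Fin n) ℝ (Eu n)}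
    {l : Fin n → ℝ} (hl : ∀ i, T (b i) = l i • b i) (i : Fin n) : 0 ≤ l i := by
  have := h (b i)
  rw [hl i, inner_smul_left, real_inner_self_eq_norm_sq, b.norm_eq_one] at this
  simpa using this

theorem amgm (l : Fin n → ℝ) (hl : ∀ i, 0 ≤ l i) (hn : 0 < n) : ∏ i, l i ≤ ((∑ i, l i) / n) ^ n := by
  have hn' : (0:ℝ) < n := by exact_mod_cast hn
  have := Real.geom_mean_le_arith_mean Finset.univ (fun _ => (1:ℝ)) l (fun _ _ => zero_le_one)
    (by simpa using hn) (fun i _ => hl i)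
  simp only [Real.rpow_one, Finset.sum_const, Finset.card_univ, Fintype.card_fin, nsmul_eq_mul,
    mul_one, one_mul] at this
  have hp : 0 ≤ ∏ i, l i := Finset.prod_nonneg fun i _ => hl i
  calc ∏ i, l i = ((∏ i, l i) ^ ((n:ℝ)⁻¹)) ^ n := by
        rw [← Real.rpow_natCast, ← Real.rpow_mul hp, inv_mul_cancel₀ hn'.ne', Real.rpow_one]
    _ ≤ _ := by gcongr

theorem det_le_tr {T : Eu n →L[ℝ] Eu n} (hn : 0 < n) (hs : Sy T) (hT : Psd T) :
    0 ≤ T.det ∧ 0 ≤ tr T ∧ T.det ≤ (tr T / n) ^ n := by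
  obtain ⟨b, l, hl, hd, ht⟩ := spec hs
  have h0 := spec_nonneg hT hl
  rw [hd, ht]
  exact ⟨Finset.prod_nonneg fun i _ => h0 i, Finset.sum_nonneg fun i _ => h0 i, amgm l h0 hn⟩

theorem exS {T : Eu n →L[ℝ] Eu n} (hs : Sy T) (hT : Pd T) :
    ∃ S : Eu n →L[ℝ] Eu n, (adj S).comp (T.comp S) = ContinuousLinearMap.id ℝ (Eu n) ∧
      S.det ^ 2 * T.det = 1 := by
  obtain ⟨b, l, hl, hd, ht⟩ := spec hs
  have l0 : ∀ i, 0 < l i := fun i => by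
    have := hT (b i) (b.orthonormal.ne_zero i)
    rw [hl i, inner_smul_left, real_inner_self_eq_norm_sq, b.norm_eq_one] at this
    simpa using this
  let S : Eu n →ₗ[ℝ] Eu n :=
    { toFun := fun x => ∑ i, (x i / Real.sqrt (l i)) • b i
      map_add' := fun x y => by simp [add_div, add_smul, Finset.sum_add_distrib]
      map_smul' := fun c x => by simp [mul_div_assoc, mul_smul, Finset.smul_sum] }
  have key : (adj (S.toContinuousLinearMap)).comp (T.comp S.toContinuousLinearMap) =
      ContinuousLinearMap.id ℝ (Eu n) := by
    refine ContinuousLinearMap.ext fun x => ext_inner_right ℝ fun y => ?_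
    simp only [ContinuousLinearMap.comp_apply, ContinuousLinearMap.adjoint_inner_left,
      ContinuousLinearMap.id_apply]
    have e1 : T (S x) = ∑ i, (x i * Real.sqrt (l i)) • b i := by
      simp only [S, LinearMap.coe_mk, AddHom.coe_mk, map_sum, map_smul, hl, smul_smul]
      refine Finset.sum_congr rfl fun i _ => ?_
      congr 1
      have h3 := Real.mul_self_sqrt (l0 i).le
      have h4 := (Real.sqrt_pos.2 (l0 i)).ne'
      field_simp
      rw [pow_two, h3]
    have e2 : S y = ∑ i, (y i / Real.sqrt (l i)) • b i := rfl
    show ⟪T (S x), S y⟫_ℝ = _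
    rw [e1, e2, b.orthonormal.inner_sum, PiLp.inner_apply]
    refine Finset.sum_congr rfl fun i _ => ?_
    have h4 := (Real.sqrt_pos.2 (l0 i)).ne'
    simp
    field_simp
  refine ⟨S.toContinuousLinearMap, key, ?_⟩
  have := congrArg ContinuousLinearMap.det key
  rw [det_cmp, det_cmp, det_adj] at this
  have h1 : (ContinuousLinearMap.id ℝ (Eu n)).det = 1 := by simp [ContinuousLinearMap.det]
  rw [h1] at this
  linarith

theorem sym_conj {T S : Eu n →L[ℝ] Eu n} (h : Sy T) : Sy ((adj S).comp (T.comp S)) := fun a b => by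
  simp only [ContinuousLinearMap.comp_apply, ContinuousLinearMap.adjoint_inner_left, ContinuousLinearMap.adjoint_inner_right, h _ (S b)]
theorem psd_conj {T S : Eu n →L[ℝ] Eu n} (h : Psd T) : Psd ((adj S).comp (T.comp S)) := fun a => by
  simp only [ContinuousLinearMap.comp_apply, ContinuousLinearMap.adjoint_inner_left]; exact h _

/-- Minkowski type inequality. -/
theorem mink {m : ℕ} (hn : 0 < n) {T K : Eu n →L[ℝ] Eu n} {Hi : Fin m → Eu n →L[ℝ] Eu n}
    {α t : ℝ} {β ti : Fin m → ℝ} (hTs : Sy T) (hT : Pd T) (hKs : Sy K) (hK : Psd K)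
    (his : ∀ i, Sy (Hi i)) (hip : ∀ i, Psd (Hi i)) (hβ : ∀ i, 0 ≤ β i) (hα : 0 ≤ α) (ht : 0 ≤ t)
    (hti : ∀ i, 0 ≤ ti i) (e : α • T = K + ∑ i, β i • Hi i) (hd : T.det ≤ t ^ n)
    (hdi : ∀ i, ti i ^ n ≤ (Hi i).det) :
    0 ≤ α * t - ∑ i, β i * ti i ∧ 0 ≤ K.det ∧ K.det ≤ (α * t - ∑ i, β i * ti i) ^ n := by
  obtain ⟨S, hS, hSd⟩ := exS hTs hT
  have hn' : (0:ℝ) < n := by exact_mod_cast hn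
  have Td : 0 < T.det := by
    have := (det_le_tr hn hTs hT.psd).1
    rcases this.eq_or_lt with h | h
    · rw [← h] at hSd; simp at hSd
    · exact h
  set d : ℝ := T.det ^ ((n:ℝ)⁻¹) with hdd
  have d0 : 0 < d := Real.rpow_pos_of_pos Td _
  have dn : d ^ n = T.det := by
    rw [← Real.rpow_natCast, ← Real.rpow_mul Td.le, inv_mul_cancel₀ hn'.ne', Real.rpow_one]
  have dt : d ≤ t := le_of_pow_le_pow_left₀ hn.ne' ht (by rw [dn]; exact hd)
  set c : (Eu n →L[ℝ] Eu n) → (Eu n →L[ℝ] Eu n) := fun X => (adj S).comp (X.comp S) with hc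
  have cdet : ∀ X, (c X).det * d ^ n = X.det := fun X => by
    simp only [hc, det_cmp, det_adj, dn]
    linear_combination X.det * hSd
  have e' : α • ContinuousLinearMap.id ℝ (Eu n) = c K + ∑ i, β i • c (Hi i) := by
    rw [← hS]
    ext1 x
    have := congrArg (fun f => adj S (f (S x))) e
    simpa [hc, ContinuousLinearMap.sum_apply, map_sum] using this
  have et : α * n = tr (c K) + ∑ i, β i * tr (c (Hi i)) := by
    have := congrArg tr e'
    simpa [tr_add, tr_smul, tr_sum, tr_id] using this
  have hi : ∀ i, ti i ≤ d * (tr (c (Hi i)) / n) := fun i => by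
    obtain ⟨a1, a2, a3⟩ := det_le_tr hn (sym_conj (S := S) (his i)) (psd_conj (S := S) (hip i))
    refine le_of_pow_le_pow_left₀ hn.ne' (by positivity) ?_
    rw [mul_pow]
    calc ti i ^ n ≤ (Hi i).det := hdi i
      _ = (c (Hi i)).det * d ^ n := (cdet _).symm
      _ ≤ _ := by rw [mul_comm]; gcongr
  obtain ⟨a1, a2, a3⟩ := det_le_tr hn (sym_conj (S := S) hKs) (psd_conj (S := S) hK)
  have hs : ∑ i, β i * ti i ≤ ∑ i, β i * (d * (tr (c (Hi i)) / n)) :=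
    Finset.sum_le_sum fun i _ => mul_le_mul_of_nonneg_left (hi i) (hβ i)
  have hs2 : ∑ i, β i * (d * (tr (c (Hi i)) / n)) = d / n * ∑ i, β i * tr (c (Hi i)) := by
    rw [Finset.mul_sum]; exact Finset.sum_congr rfl fun i _ => by ring
  have key : d * (tr (c K) / n) ≤ α * t - ∑ i, β i * ti i := by
    have h1 : d * (tr (c K) / n) = α * d - d / n * ∑ i, β i * tr (c (Hi i)) := by
      have : tr (c K) = α * n - ∑ i, β i * tr (c (Hi i)) := by linarith
      rw [this]; field_simp
    have h2 := mul_le_mul_of_nonneg_left dt hα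
    linarith
  have k0 : 0 ≤ d * (tr (c K) / n) := by positivity
  refine ⟨k0.trans key, ?_, ?_⟩
  · rw [← cdet K]; positivity
  · rw [← cdet K]
    calc (c K).det * d ^ n ≤ (tr (c K) / n) ^ n * d ^ n := by gcongr
      _ = (d * (tr (c K) / n)) ^ n := by rw [mul_pow]; ring
      _ ≤ _ := by gcongr

structure Good {n : ℕ} (c0 C0 : ℝ) (u : Eu n → ℝ) (G : Eu n → Eu n) (H : Eu n → (Eu n →L[ℝ] Eu n)) : Prop
    extends C2 u G H where
  conv : ∀ x y, u x + ⟪G x, y - x⟫_ℝ ≤ u y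
  pos : ∀ x, Pd (H x)
  lo : ∀ x, c0 ≤ (H x).det
  hi : ∀ x, (H x).det ≤ C0

def bad (H : Eu n → (Eu n →L[ℝ] Eu n)) (ε : ℝ) : Set (Eu n) := {x | ε < |(H x).det - 1|}

def InW (c0 C0 : ℝ) (w : Eu n → ℝ) : Prop := ∀ r ε : ℝ, 0 < ε →
  ∃ u G H, Good c0 C0 u G H ∧ ∀ x, ‖x‖ ≤ r → |u x - w x| ≤ ε
def InK (c0 C0 : ℝ) (w : Eu n → ℝ) : Prop := ∀ r ε : ℝ, 0 < ε →
  ∃ u G H, Good c0 C0 u G H ∧ (∀ x, ‖x‖ ≤ r → |u x - w x| ≤ ε) ∧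
    volume (closedBall 0 r ∩ bad H ε) ≤ ENNReal.ofReal ε

theorem InK.toW (h : InK c0 C0 w) : InW c0 C0 w := fun r ε hε => by
  obtain ⟨u, G, H, h1, h2, h3⟩ := h r ε hε
  exact ⟨u, G, H, h1, h2⟩

theorem Good.toW (h : Good c0 C0 u G H) : InW c0 C0 u := fun r ε hε =>
  ⟨u, G, H, h, fun x _ => by simpa using hε.le⟩

theorem C2.contdet (h : C2 u G H) : Continuous fun x => (H x).det :=
  ContinuousLinearMap.continuous_det.comp h.cont

theorem C2.badm (h : C2 u G H) (ε : ℝ) : IsOpen (bad H ε) :=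
  isOpen_lt continuous_const (h.contdet.sub continuous_const).abs

theorem det_conjs {s : ℝ} (hs : 0 < s) {A : Eu n →L[ℝ] Eu n} (hA : s ^ n = A.det ^ 2) (T : Eu n →L[ℝ] Eu n) :
    (s⁻¹ • (adj A).comp (T.comp A)).det = T.det := by
  rw [det_smul', det_cmp, det_cmp, det_adj, inv_pow, hA]
  have : A.det ^ 2 ≠ 0 := by rw [← hA]; positivity
  rw [show A.det * (T.det * A.det) = A.det ^ 2 * T.det by ring, inv_mul_cancel_left₀ this]

theorem inj_of_det {A : Eu n →L[ℝ] Eu n} (hA : A.det ≠ 0) {x : Eu n} (hx : x ≠ 0) : A x ≠ 0 := fun h => by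
  have := LinearMap.bot_lt_ker_of_det_eq_zero (f := (A : Eu n →ₗ[ℝ] Eu n))
  have h2 : IsUnit (LinearMap.det (A : Eu n →ₗ[ℝ] Eu n)) := isUnit_iff_ne_zero.2 hA
  have h3 := (LinearMap.equivOfIsUnitDet h2).injective
  exact hx (h3 (a₁ := x) (a₂ := 0) (by simpa using h))

theorem Good.compA (h : Good c0 C0 u G H) {s : ℝ} (hs : 0 < s) {A : Eu n →L[ℝ] Eu n}
    (hA : s ^ n = A.det ^ 2) (b p : Eu n) (c : ℝ) :
    Good c0 C0 (fun x => s⁻¹ * u (A x + b) + (⟪p, x⟫_ℝ + c))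
      (fun x => s⁻¹ • adj A (G (A x + b)) + p)
      (fun x => s⁻¹ • (adj A).comp ((H (A x + b)).comp A) + 0) where
  toC2 := ((h.toC2.compA A b).smul s⁻¹).add (C2.lin p c)
  conv := fun x y => by
    have := h.conv (A x + b) (A y + b)
    have e : ⟪s⁻¹ • adj A (G (A x + b)) + p, y - x⟫_ℝ =
        s⁻¹ * ⟪G (A x + b), A y + b - (A x + b)⟫_ℝ + ⟪p, y⟫_ℝ - ⟪p, x⟫_ℝ := by
      rw [inner_add_left, inner_smul_left, ContinuousLinearMap.adjoint_inner_left, inner_sub_right p]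
      simp; ring
    rw [e]
    have h2 := mul_le_mul_of_nonneg_left this (inv_pos.2 hs).le
    linarith
  pos := fun x a ha => by
    have hd : A.det ≠ 0 := fun h0 => by
      rw [h0] at hA; have : 0 < s ^ n := by positivity
      simp [hA] at this
    have := h.pos (A x + b) (A a) (inj_of_det hd ha)
    simp only [add_zero, ContinuousLinearMap.smul_apply, ContinuousLinearMap.comp_apply, inner_smul_left,
      ContinuousLinearMap.adjoint_inner_left]
    have := inv_pos.2 hs
    simp; positivity
  lo := fun x => by rw [add_zero, det_conjs hs hA]; exact h.lo _
  hi := fun x => by rw [add_zero, det_conjs hs hA]; exact h.hi _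

theorem vol_pre {A : Eu n →L[ℝ] Eu n} (hA : A.det ≠ 0) (b : Eu n) (S : Set (Eu n)) :
    volume ((fun x => A x + b) ⁻¹' S) = ENNReal.ofReal |A.det⁻¹| * volume S := by
  have : (fun x => A x + b) ⁻¹' S = (A : Eu n →ₗ[ℝ] Eu n) ⁻¹' ((fun x => x + b) ⁻¹' S) := rfl
  rw [this, Measure.addHaar_preimage_linearMap volume hA, measure_preimage_add_right]

theorem norm_aff (A : Eu n →L[ℝ] Eu n) (b : Eu n) {x : Eu n} {r : ℝ} (hx : ‖x‖ ≤ r) :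
    ‖A x + b‖ ≤ ‖A‖ * r + ‖b‖ := by
  have h1 := A.le_opNorm x
  have h2 := mul_le_mul_of_nonneg_left hx (norm_nonneg A)
  have := norm_add_le (A x) b
  linarith

theorem aff_close {s : ℝ} (hs : 0 < s) {r ε : ℝ} {A : Eu n →L[ℝ] Eu n} {b p : Eu n} {c : ℝ}
    (hu : ∀ x, ‖x‖ ≤ ‖A‖ * r + ‖b‖ → |u x - w x| ≤ s * ε) (x : Eu n) (hx : ‖x‖ ≤ r) :
    |s⁻¹ * u (A x + b) + (⟪p, x⟫_ℝ + c) - (s⁻¹ * w (A x + b) + (⟪p, x⟫_ℝ + c))| ≤ ε := by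
  have := hu _ (norm_aff A b hx)
  rw [add_sub_add_right_eq_sub, ← mul_sub, abs_mul, abs_of_pos (inv_pos.2 hs), inv_mul_le_iff₀ hs]
  exact this

theorem InW.compA (h : InW c0 C0 w) {s : ℝ} (hs : 0 < s) {A : Eu n →L[ℝ] Eu n}
    (hA : s ^ n = A.det ^ 2) (b p : Eu n) (c : ℝ) :
    InW c0 C0 (fun x => s⁻¹ * w (A x + b) + (⟪p, x⟫_ℝ + c)) := fun r ε hε => by
  obtain ⟨u, G, H, h1, h2⟩ := h (‖A‖ * r + ‖b‖) (s * ε) (by positivity)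
  exact ⟨_, _, _, h1.compA hs hA b p c, aff_close hs h2⟩

theorem InK.compA (h : InK c0 C0 w) {s : ℝ} (hs : 0 < s) {A : Eu n →L[ℝ] Eu n}
    (hA : s ^ n = A.det ^ 2) (b p : Eu n) (c : ℝ) :
    InK c0 C0 (fun x => s⁻¹ * w (A x + b) + (⟪p, x⟫_ℝ + c)) := fun r ε hε => by
  have hd : A.det ≠ 0 := fun h0 => by
    rw [h0] at hA; have : 0 < s ^ n := by positivity
    rw [hA] at this; simp at this
  set e := min (s * ε) (min ε (|A.det| * ε)) with he
  have h0 : 0 < |A.det| := abs_pos.2 hd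
  have e0 : 0 < e := lt_min (by positivity) (lt_min hε (by positivity))
  obtain ⟨u, G, H, h1, h2, h3⟩ := h (‖A‖ * r + ‖b‖) e e0
  refine ⟨_, _, _, h1.compA hs hA b p c, aff_close hs fun x hx => (h2 x hx).trans (min_le_left _ _), ?_⟩
  have e1 : e ≤ ε := (min_le_right _ _).trans (min_le_left _ _)
  have e2 : e ≤ |A.det| * ε := (min_le_right _ _).trans (min_le_right _ _)
  calc _ ≤ volume ((fun x => A x + b) ⁻¹' (closedBall 0 (‖A‖ * r + ‖b‖) ∩ bad H e)) := by
        refine measure_mono fun x hx => ⟨?_, ?_⟩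
        · have := norm_aff A b (mem_closedBall_zero_iff.1 hx.1)
          exact mem_closedBall_zero_iff.2 this
        · have := hx.2
          simp only [bad, mem_ofPred_eq, add_zero, det_conjs hs hA] at this ⊢
          exact e1.trans_lt this
    _ = ENNReal.ofReal |A.det⁻¹| * volume (closedBall 0 (‖A‖ * r + ‖b‖) ∩ bad H e) := vol_pre hd b _
    _ ≤ ENNReal.ofReal |A.det⁻¹| * ENNReal.ofReal (|A.det| * ε) := by
        gcongr; exact h3.trans (ENNReal.ofReal_le_ofReal e2)
    _ = ENNReal.ofReal ε := by
        rw [← ENNReal.ofReal_mul (abs_nonneg _), abs_inv, ← mul_assoc, inv_mul_cancel₀ h0.ne', one_mul]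

/-- closed under locally uniform limits -/
theorem InK.lim (h : ∀ r ε : ℝ, 0 < ε → ∃ w', InK c0 C0 w' ∧ ∀ x, ‖x‖ ≤ r → |w' x - w x| ≤ ε) :
    InK c0 C0 w := fun r ε hε => by
  obtain ⟨w', h1, h2⟩ := h r (ε/2) (by linarith)
  obtain ⟨u, G, H, g1, g2, g3⟩ := h1 r (ε/2) (by linarith)
  refine ⟨u, G, H, g1, fun x hx => ?_, ?_⟩
  · have := abs_sub_le (u x) (w' x) (w x)
    linarith [h2 x hx, g2 x hx]
  · refine (measure_mono (inter_subset_inter_right _ fun x hx => ?_)).trans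
      (g3.trans (ENNReal.ofReal_le_ofReal (by linarith)))
    have : ε < _ := hx
    show ε/2 < _
    linarith

theorem InW.bdd (h : InW c0 C0 w) (r : ℝ) : ∃ C, ∀ x, ‖x‖ ≤ r → |w x| ≤ C := by
  obtain ⟨u, G, H, h1, h2⟩ := h r 1 one_pos
  obtain ⟨C, hC⟩ := (isCompact_closedBall (0 : Eu n) r).exists_bound_of_continuousOn h1.contu.continuousOn
  refine ⟨C + 1, fun x hx => ?_⟩
  have := hC x (mem_closedBall_zero_iff.2 hx)
  have h3 := h2 x hx
  rw [Real.norm_eq_abs] at this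
  rw [abs_le] at *
  constructor <;> linarith

/-- gradient bound from oscillation -/
theorem grad_le {x p : Eu n} {ρ M : ℝ} (hρ : 0 < ρ)
    (h : ∀ y, ‖y - x‖ ≤ ρ → ⟪p, y - x⟫_ℝ ≤ M) : ρ * ‖p‖ ≤ M := by
  by_cases hp : p = 0
  · simpa [hp] using h x (by simpa using hρ.le)
  · have h0 : 0 < ‖p‖ := norm_pos_iff.2 hp
    have := h (x + (ρ / ‖p‖) • p) (by
      rw [add_sub_cancel_left, norm_smul, Real.norm_eq_abs, abs_of_pos (by positivity)]
      field_simp; exact le_rfl)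
    rw [add_sub_cancel_left, inner_smul_right, real_inner_self_eq_norm_sq] at this
    calc ρ * ‖p‖ = ρ / ‖p‖ * ‖p‖ ^ 2 := by field_simp
      _ ≤ M := this

theorem InW.subgrad (h : InW c0 C0 w) (x : Eu n) : ∃ p : Eu n, ∀ y, w x + ⟪p, y - x⟫_ℝ ≤ w y := by
  have hk : ∀ k : ℕ, ∃ p : Eu n, ∀ y, ‖y - x‖ ≤ k + 1 → w x + ⟪p, y - x⟫_ℝ ≤ w y + 2 / (k + 1) := fun k => by
    have hk0 : (0:ℝ) < k + 1 := by positivity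
    obtain ⟨u, G, H, h1, h2⟩ := h (‖x‖ + (k + 1)) (1 / (k + 1)) (by positivity)
    refine ⟨G x, fun y hy => ?_⟩
    have a1 := h1.conv x y
    have a2 := h2 x (by linarith)
    have a3 := h2 y (by have := norm_add_le x (y - x); rw [add_sub_cancel] at this; linarith)
    rw [abs_le] at a2 a3
    have : (2:ℝ) / (k + 1) = 1 / (k+1) + 1/(k+1) := by ring
    linarith
  choose p hp using hk
  obtain ⟨C, hC⟩ := h.bdd (‖x‖ + 1)
  have hpb : ∀ k, p k ∈ closedBall (0 : Eu n) (2 * C + 2) := fun k => by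
    rw [mem_closedBall_zero_iff]
    have := grad_le (x := x) (p := p k) one_pos (M := 2 * C + 2) fun y hy => by
      have h1 := hp k y (hy.trans (by have : (0:ℝ) ≤ k := by positivity
                                      linarith))
      have h2 := hC x (by linarith)
      have h3 := hC y (by have := norm_add_le x (y - x); rw [add_sub_cancel] at this; linarith)
      have h4 : (2:ℝ) / (k + 1) ≤ 2 := by
        rw [div_le_iff₀ (by positivity)]; have : (0:ℝ) ≤ k := by positivity
        linarith
      rw [abs_le] at h2 h3
      linarith
    linarith
  obtain ⟨q, -, φ, hφ, hq⟩ := (isCompact_closedBall (0 : Eu n) _).tendsto_subseq hpb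
  refine ⟨q, fun y => ?_⟩
  have t1 : Tendsto (fun k => w x + ⟪p (φ k), y - x⟫_ℝ) atTop (𝓝 (w x + ⟪q, y - x⟫_ℝ)) :=
    (hq.inner tendsto_const_nhds).const_add _
  have t2 : Tendsto (fun k => w y + 2 / ((φ k : ℝ) + 1)) atTop (𝓝 (w y + 0)) := by
    refine Tendsto.const_add _ ?_
    have := (tendsto_const_div_atTop_nhds_zero_nat (2:ℝ)).comp (tendsto_add_atTop_nat 1)
    have := this.comp hφ.tendsto_atTop
    simpa [Function.comp_def] using this
  rw [add_zero] at t2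
  refine le_of_tendsto_of_tendsto t1 t2 ?_
  filter_upwards [eventually_ge_atTop (⌈‖y - x‖⌉₊)] with k hk
  refine hp (φ k) y ?_
  have h1 : (⌈‖y - x‖⌉₊ : ℝ) ≤ φ k := by exact_mod_cast hk.trans (hφ.id_le k)
  have := Nat.le_ceil ‖y - x‖
  linarith

theorem InW.convex (h : InW c0 C0 w) : ConvexOn ℝ univ w := by
  refine ⟨convex_univ, fun x _ y _ a b ha hb hab => ?_⟩
  obtain ⟨p, hp⟩ := h.subgrad (a • x + b • y)
  have h1 := mul_le_mul_of_nonneg_left (hp x) ha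
  have h2 := mul_le_mul_of_nonneg_left (hp y) hb
  have e : a * ⟪p, x - (a • x + b • y)⟫_ℝ + b * ⟪p, y - (a • x + b • y)⟫_ℝ = 0 := by
    rw [← inner_smul_right, ← inner_smul_right, ← inner_add_right]
    have : a • (x - (a • x + b • y)) + b • (y - (a • x + b • y)) = 0 := by
      have hb' : b = 1 - a := by linarith
      subst hb'; module
    rw [this, inner_zero_right]
  have e2 : w (a • x + b • y) = a * w (a • x + b • y) + b * w (a • x + b • y) := by
    rw [← add_mul, hab, one_mul]
  simp only [smul_eq_mul]
  linarith

theorem InW.cont (h : InW c0 C0 w) : Continuous w := by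
  have := h.convex.continuousOn isOpen_univ
  rwa [continuousOn_univ] at this

theorem abpK (hn : 0 < n) (hw : InK c0 C0 w) (hc0 : 0 < c0) (hC0 : 0 ≤ C0) {m : ℕ} {α : ℝ} {β : Fin m → ℝ}
    {A : Fin m → Eu n →L[ℝ] Eu n} {b : Fin m → Eu n} (hA : ∀ i, (A i).det ^ 2 = 1) (hα : 0 ≤ α)
    (hβ : ∀ i, 0 ≤ β i) {K X P : Set (Eu n)} (hK : IsCompact K) (hX : X ⊆ interior K)
    (hXm : MeasurableSet X) {γ : ℝ} (hγ : 0 < γ)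
    (hP : ∀ p ∈ P, ∃ x0 ∈ K, ∀ x ∈ K, x ∉ X →
      α * w x0 - ∑ i, β i * w (A i x0 + b i) - ⟪p, x0⟫_ℝ + γ ≤
        α * w x - ∑ i, β i * w (A i x + b i) - ⟪p, x⟫_ℝ) :
    volume P ≤ ENNReal.ofReal ((max (α - ∑ i, β i) 0) ^ n) * volume X := by
  set S := α + ∑ i, β i with hS
  have hβs : 0 ≤ ∑ i, β i := Finset.sum_nonneg fun i _ => hβ i
  have S0 : 0 ≤ S := by positivity
  have hXf : volume X ≠ ⊤ :=
    ((measure_mono (hX.trans interior_subset)).trans_lt hK.measure_lt_top).ne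
  obtain ⟨r, hr⟩ := hK.exists_bound_of_continuousOn
    (f := fun x => ‖x‖ + ∑ i, ‖A i x + b i‖) (by fun_prop)
  have hr1 : ∀ x ∈ K, ‖x‖ ≤ r := fun x hx => by
    have := (le_abs_self _).trans (hr x hx)
    have h2 : 0 ≤ ∑ i, ‖A i x + b i‖ := Finset.sum_nonneg fun i _ => norm_nonneg _
    linarith
  have hr2 : ∀ x ∈ K, ∀ i, ‖A i x + b i‖ ≤ r := fun x hx i => by
    have := (le_abs_self _).trans (hr x hx)
    have h2 := Finset.single_le_sum (f := fun i => ‖A i x + b i‖) (fun i _ => norm_nonneg _) (Finset.mem_univ i)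
    linarith [norm_nonneg x]
  have main : ∀ δ : ℝ, 0 < δ → δ < 1 → 2 * S * δ < γ → volume P ≤
      ENNReal.ofReal ((max (α - ∑ i, β i + S * δ) 0) ^ n * (volume X).toReal +
        (α ^ n * C0) * ((m + 1) * δ)) := by
    intro δ d0 d1 d2
    obtain ⟨u, G, H, h1, h2, h3⟩ := hw r δ d0
    have hC2 := (h1.toC2.smul α).add
      (C2.sum fun i => ((h1.toC2.compA (A i) (b i)).smul (-β i)))
    set Bd := bad H δ ∪ ⋃ i, (fun x => A i x + b i) ⁻¹' bad H δ with hBd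
    have ob := h1.badm δ
    have hBdm : MeasurableSet Bd := by
      refine (IsOpen.union ob (isOpen_iUnion fun i => ob.preimage (by fun_prop))).measurableSet
    have hg : ∀ x ∈ K, |(α * u x + ∑ i, -β i * u (A i x + b i)) -
        (α * w x - ∑ i, β i * w (A i x + b i))| ≤ S * δ := fun x hx => by
      have e : (α * u x + ∑ i, -β i * u (A i x + b i)) -
        (α * w x - ∑ i, β i * w (A i x + b i)) =
          α * (u x - w x) - ∑ i, β i * (u (A i x + b i) - w (A i x + b i)) := by
        simp only [mul_sub, Finset.sum_sub_distrib, neg_mul, Finset.sum_neg_distrib]; ring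
      rw [e, hS, add_mul, Finset.sum_mul]
      refine (abs_sub _ _).trans (add_le_add ?_ ((Finset.abs_sum_le_sum_abs _ _).trans (Finset.sum_le_sum fun i _ => ?_)))
      · rw [abs_mul, abs_of_nonneg hα]; exact mul_le_mul_of_nonneg_left (h2 x (hr1 x hx)) hα
      · rw [abs_mul, abs_of_nonneg (hβ i)]; exact mul_le_mul_of_nonneg_left (h2 _ (hr2 x hx i)) (hβ i)
    have hHe : ∀ x, α • H x = (α • H x + ∑ i, (-β i) • (adj (A i)).comp ((H (A i x + b i)).comp (A i))) +
        ∑ i, β i • (adj (A i)).comp ((H (A i x + b i)).comp (A i)) := fun x => by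
      rw [add_assoc, ← Finset.sum_add_distrib, Finset.sum_eq_zero fun i _ => ContinuousLinearMap.ext fun y => by simp, add_zero]
    have hdi : ∀ i x, ((adj (A i)).comp ((H (A i x + b i)).comp (A i))).det = (H (A i x + b i)).det := fun i x => by
      rw [det_cmp, det_cmp, det_adj]; linear_combination (H (A i x + b i)).det * hA i
    have hle : ∀ t : ℝ, 0 ≤ t → t ≤ 1 → t ^ n ≤ t := fun t a b => pow_le_of_le_one a b hn.ne'
    have := abp_meas hC2 hK hX hXm (P := P) ?_ (c1 := (max (α - ∑ i, β i + S * δ) 0) ^ n)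
      (c2 := α ^ n * C0) hBdm ?_ ?_
    · refine this.trans ?_
      rw [ENNReal.ofReal_add (by positivity) (by positivity), ENNReal.ofReal_mul (p := _ ^ n) (q := (volume X).toReal) (by positivity),
        ENNReal.ofReal_mul (p := α ^ n * C0) (q := _ * δ) (by positivity), ENNReal.ofReal_toReal hXf]
      gcongr
      calc volume (Bd ∩ X) ≤ volume ((closedBall 0 r ∩ bad H δ) ∪ ⋃ i, (fun x => A i x + b i) ⁻¹' (closedBall 0 r ∩ bad H δ)) := by
            refine measure_mono fun x hx => ?_
            have hxK := interior_subset (hX hx.2)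
            rcases hx.1 with h | h
            · exact Or.inl ⟨mem_closedBall_zero_iff.2 (hr1 x hxK), h⟩
            · obtain ⟨i, hi⟩ := mem_iUnion.1 h
              exact Or.inr (mem_iUnion.2 ⟨i, mem_closedBall_zero_iff.2 (hr2 x hxK i), hi⟩)
        _ ≤ ENNReal.ofReal δ + ∑ i : Fin m, ENNReal.ofReal δ := by
            refine (measure_union_le _ _).trans (add_le_add h3 ?_)
            refine (measure_iUnion_fintype_le _ _).trans (Finset.sum_le_sum fun i _ => ?_)
            have hne : (A i).det ≠ 0 := fun h => by have := hA i; rw [h] at this; simp at this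
            have h1 : |(A i).det⁻¹| = 1 := by
              rw [abs_inv, inv_eq_one, ← sq_eq_sq₀ (abs_nonneg _) zero_le_one, sq_abs, hA i, one_pow]
            rw [vol_pre hne, h1, ENNReal.ofReal_one, one_mul]
            exact h3
        _ = ENNReal.ofReal ((m + 1) * δ) := by
            rw [Finset.sum_const, Finset.card_univ, Fintype.card_fin, nsmul_eq_mul,
              ENNReal.ofReal_mul (by positivity), ENNReal.ofReal_add (by positivity) zero_le_one,
              ENNReal.ofReal_natCast, ENNReal.ofReal_one]; ring
    · intro p hp
      obtain ⟨x0, k0, k1⟩ := hP p hp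
      refine ⟨x0, k0, fun x hx hxX => ?_⟩
      have a1 := k1 x hx hxX
      have a2 := hg x hx
      have a3 := hg x0 k0
      rw [abs_le] at a2 a3
      linarith
    · intro x hx hxB hpsd
      have hb1 : |(H x).det - 1| ≤ δ := not_lt.1 fun h => hxB (Or.inl h)
      have hb2 : ∀ i, |(H (A i x + b i)).det - 1| ≤ δ := fun i =>
        not_lt.1 fun h => hxB (Or.inr (mem_iUnion.2 ⟨i, h⟩))
      obtain ⟨e1, e2, e3⟩ := mink hn (fun a b => h1.symm x a b) (h1.pos x) (fun a b => hC2.symm x a b) hpsd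
        (fun i => sym_conj (fun a b => h1.symm _ a b)) (fun i => psd_conj (h1.pos _).psd) hβ hα
        (t := 1 + δ) (ti := fun _ => 1 - δ) (by linarith) (fun _ => by linarith) (hHe x)
        (by have := le_self_pow₀ (show 1 ≤ 1 + δ by linarith) hn.ne'
            linarith [(abs_le.1 hb1).2])
        (fun i => by rw [hdi]; linarith [(abs_le.1 (hb2 i)).1, hle (1 - δ) (by linarith) (by linarith)])
      rw [abs_of_nonneg e2]
      refine e3.trans ?_
      rw [← Finset.sum_mul] at e1 ⊢
      refine pow_le_pow_left₀ e1 (le_max_of_le_left ?_) n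
      rw [hS]; apply le_of_eq; ring
    · intro x hx hxB hpsd
      obtain ⟨e1, e2, e3⟩ := mink hn (fun a b => h1.symm x a b) (h1.pos x) (fun a b => hC2.symm x a b) hpsd
        (fun i => sym_conj (fun a b => h1.symm _ a b)) (fun i => psd_conj (h1.pos _).psd) hβ hα
        (t := (H x).det ^ ((n:ℝ)⁻¹)) (ti := fun _ => 0) (Real.rpow_nonneg (hc0.le.trans (h1.lo x)) _)
        (fun _ => le_rfl) (hHe x)
        (by rw [← Real.rpow_natCast, ← Real.rpow_mul (hc0.le.trans (h1.lo x)), inv_mul_cancel₀ (by positivity), Real.rpow_one])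
        (fun i => by rw [hdi, zero_pow hn.ne']; exact hc0.le.trans (h1.lo _))
      rw [abs_of_nonneg e2]
      refine e3.trans ?_
      have : ((H x).det ^ ((n:ℝ)⁻¹)) ^ n = (H x).det := by
        rw [← Real.rpow_natCast, ← Real.rpow_mul (hc0.le.trans (h1.lo x)), inv_mul_cancel₀ (by positivity), Real.rpow_one]
      simp only [mul_zero, Finset.sum_const_zero, sub_zero, mul_pow, this]
      exact mul_le_mul_of_nonneg_left (h1.hi x) (by positivity)
  have hT : Tendsto (fun δ : ℝ => ENNReal.ofReal ((max (α - ∑ i, β i + S * δ) 0) ^ n * (volume X).toReal +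
        (α ^ n * C0) * ((m + 1) * δ))) (𝓝[>] 0) (𝓝 (ENNReal.ofReal ((max (α - ∑ i, β i) 0) ^ n * (volume X).toReal))) := by
    refine (ENNReal.continuous_ofReal.tendsto _).comp (Tendsto.mono_left ?_ nhdsWithin_le_nhds)
    have : Continuous fun δ : ℝ => (max (α - ∑ i, β i + S * δ) 0) ^ n * (volume X).toReal +
        (α ^ n * C0) * ((m + 1) * δ) := by fun_prop
    simpa using this.tendsto 0
  have := ge_of_tendsto hT (b := volume P) ?_
  · rwa [ENNReal.ofReal_mul (by positivity), ENNReal.ofReal_toReal hXf] at this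
  · have h1 : ∀ᶠ δ : ℝ in 𝓝[>] 0, δ < 1 := nhdsWithin_le_nhds (gt_mem_nhds one_pos)
    have h2 : ∀ᶠ δ : ℝ in 𝓝[>] 0, 2 * S * δ < γ := by
      have : Tendsto (fun δ : ℝ => 2 * S * δ) (𝓝 0) (𝓝 (2 * S * 0)) :=
        tendsto_id.const_mul _
      exact nhdsWithin_le_nhds (this.eventually_lt_const (by simpa using hγ))
    filter_upwards [h1, h2, self_mem_nhdsWithin] with δ a b c using main δ c a b

theorem abpW (hw : InW c0 C0 w) (hc0 : 0 < c0) {K X P : Set (Eu n)} (hK : IsCompact K)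
    (hX : X ⊆ interior K) (hXm : MeasurableSet X) {γ : ℝ} (hγ : 0 < γ)
    (hP : ∀ p ∈ P, ∃ x0 ∈ K, ∀ x ∈ K, x ∉ X → w x0 - ⟪p, x0⟫_ℝ + γ ≤ w x - ⟪p, x⟫_ℝ) :
    volume P ≤ ENNReal.ofReal C0 * volume X := by
  obtain ⟨r, hr⟩ := hK.isBounded.exists_norm_le
  obtain ⟨u, G, H, h1, h2⟩ := hw r (γ/4) (by linarith)
  have := abp_meas h1.toC2 hK hX hXm (P := P) (c1 := C0) (c2 := 0) (Bd := ∅) ?_ MeasurableSet.empty ?_ (by simp)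
  · simpa using this
  · intro p hp
    obtain ⟨x0, k0, k1⟩ := hP p hp
    refine ⟨x0, k0, fun x hx hxX => ?_⟩
    have a1 := k1 x hx hxX
    have a2 := h2 x (hr x hx)
    have a3 := h2 x0 (hr x0 k0)
    rw [abs_le] at a2 a3
    linarith
  · intro x hx _ _
    rw [abs_of_nonneg (hc0.le.trans (h1.lo x))]
    exact h1.hi x

theorem Good.inj (h : Good c0 C0 u G H) : Function.Injective G := by
  intro x y hxy
  by_contra hne
  have hd : y - x ≠ 0 := sub_ne_zero.2 (Ne.symm hne)
  have sm : StrictMono (fun t : ℝ => ⟪G (x + t • (y - x)), y - x⟫_ℝ) :=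
    strictMono_of_deriv_pos fun t => by rw [(h.seg2 x (y - x) t).deriv]; exact h.pos _ _ hd
  have := sm (show (0:ℝ) < 1 by norm_num)
  simp [hxy] at this

theorem LB (hn : 0 < n) (hw : InW c0 C0 w) (hc0 : 0 < c0) (hc1 : c0 ≤ 1) {c : Eu n} {ρ h : ℝ} (hρ : 0 < ρ)
    (ho : ∀ x ∈ closedBall c (2 * ρ), ∀ y ∈ closedBall c (2 * ρ), w x - w y ≤ h) : c0 * ρ ^ 2 ≤ h := by
  refine le_of_forall_pos_le_add fun δ hδ => ?_
  obtain ⟨u, G, H, h1, h2⟩ := hw (‖c‖ + 2 * ρ) (δ/2) (by linarith)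
  have hh : 0 ≤ h := by
    have := ho c (mem_closedBall_self (by linarith)) c (mem_closedBall_self (by linarith))
    simpa using this
  have hnorm : ∀ x ∈ closedBall c (2 * ρ), ‖x‖ ≤ ‖c‖ + 2 * ρ := fun x hx => by
    have h3 := norm_add_le c (x - c)
    rw [add_sub_cancel] at h3
    rw [mem_closedBall, dist_eq_norm] at hx
    linarith
  have hG : G '' ball c ρ ⊆ closedBall 0 ((h + δ) / ρ) := by
    rintro _ ⟨x, hx, rfl⟩
    rw [mem_closedBall_zero_iff, le_div_iff₀ hρ, mul_comm]
    rw [mem_ball, dist_eq_norm] at hx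
    refine grad_le (x := x) hρ fun y hy => ?_
    have hx' : x ∈ closedBall c (2 * ρ) := by rw [mem_closedBall, dist_eq_norm]; linarith
    have hy' : y ∈ closedBall c (2 * ρ) := by
      rw [mem_closedBall, dist_eq_norm]
      have := norm_add_le (y - x) (x - c)
      rw [sub_add_sub_cancel] at this; linarith
    have a1 := h1.conv x y
    have a2 := h2 x (hnorm x hx')
    have a3 := h2 y (hnorm y hy')
    have a4 := ho y hy' x hx'
    rw [abs_le] at a2 a3
    linarith
  have hv : ENNReal.ofReal c0 * volume (ball c ρ) ≤ volume (G '' ball c ρ) := by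
    rw [← lintegral_abs_det_fderiv_eq_addHaar_image volume measurableSet_ball
      (fun x _ => (h1.hess x).hasFDerivWithinAt) h1.inj.injOn, ← setLIntegral_const]
    exact lintegral_mono fun x => ENNReal.ofReal_le_ofReal ((h1.lo x).trans (le_abs_self _))
  have hv2 := hv.trans (measure_mono hG)
  rw [Measure.addHaar_ball_of_pos _ _ hρ, Measure.addHaar_closedBall _ _ (by positivity), ← mul_assoc,
    ENNReal.mul_le_mul_iff_left (measure_ball_pos _ _ one_pos).ne' measure_ball_lt_top.ne,
    ← ENNReal.ofReal_mul hc0.le, ENNReal.ofReal_le_ofReal_iff (by positivity), finrank_euclideanSpace,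
    Fintype.card_fin, div_pow, le_div_iff₀ (by positivity)] at hv2
  refine le_of_pow_le_pow_left₀ hn.ne' (by positivity) ?_
  calc (c0 * ρ ^ 2) ^ n = c0 ^ n * ρ ^ n * ρ ^ n := by rw [mul_pow, ← pow_mul]; ring
    _ ≤ c0 * ρ ^ n * ρ ^ n := by gcongr; exact pow_le_of_le_one hc0.le hc1 hn.ne'
    _ ≤ _ := hv2

noncomputable def rk (f v : Eu n) : Eu n →L[ℝ] Eu n :=
  ContinuousLinearMap.id ℝ (Eu n) + (innerSL ℝ f).smulRight v

theorem rk_apply (f v x : Eu n) : rk f v x = x + ⟪f, x⟫_ℝ • v := by simp [rk]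

theorem rk_det (f v : Eu n) : (rk f v).det = 1 + ⟪f, v⟫_ℝ := by
  have := LinearMap.transvection.det (f := ((innerSL ℝ f : Eu n →L[ℝ] ℝ) : Eu n →ₗ[ℝ] ℝ)) (v := v)
  simp only [ContinuousLinearMap.coe_coe, innerSL_apply_apply] at this
  rw [← this]
  have e : (rk f v : Eu n →ₗ[ℝ] Eu n) = LinearMap.transvection ((innerSL ℝ f : Eu n →L[ℝ] ℝ) : Eu n →ₗ[ℝ] ℝ) v := by
    ext x; simp [rk_apply, LinearMap.transvection.apply]
  exact congrArg LinearMap.det e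

structure Nm {n : ℕ} (c0 C0 : ℝ) (w : Eu n → ℝ) : Prop where
  inW : InW c0 C0 w
  nn : ∀ x, 0 ≤ w x
  z : w 0 = 0

/-- normalizing map at height `R` -/
structure Nf {n : ℕ} (w : Eu n → ℝ) (D R s : ℝ) (A : Eu n →L[ℝ] Eu n) : Prop where
  pos : 0 < s
  det : s ^ n = A.det ^ 2
  sR : s ≤ D * R
  Rs : R ≤ D * s
  bd : ∀ l, w (A l) ≤ R → ‖l‖ ≤ D
  sim : ∃ c : Eu n, ‖c‖ ≤ D ∧ ∀ l ∈ closedBall c (1 / D), w (A l) ≤ R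

theorem exs (hn : 0 < n) {d : ℝ} (hd : d ≠ 0) : ∃ s : ℝ, 0 < s ∧ s ^ n = d ^ 2 := by
  have : 0 < d ^ 2 := by positivity
  refine ⟨(d ^ 2) ^ ((n:ℝ)⁻¹), Real.rpow_pos_of_pos this _, ?_⟩
  rw [← Real.rpow_natCast, ← Real.rpow_mul this.le, inv_mul_cancel₀ (by positivity), Real.rpow_one]

noncomputable abbrev es (i : Fin n) : Eu n := EuclideanSpace.single i (1:ℝ)

theorem sum_es (l : Eu n) : ∑ i, l i • es i = l := by
  have := (EuclideanSpace.basisFun (Fin n) ℝ).sum_repr l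
  simpa using this

theorem simplex_le (hw : Nm c0 C0 w) {R : ℝ} (hR : 0 < R) {A : Eu n →L[ℝ] Eu n}
    (hA : ∀ i, w (A (es i)) ≤ R) {l : Eu n} (h0 : ∀ i, 0 ≤ l i) (h1 : ∑ i, l i ≤ 1) : w (A l) ≤ R := by
  obtain ⟨p, hp⟩ := hw.inW.subgrad (A l)
  have a1 : ∑ i, l i * (w (A l) + ⟪p, A (es i) - A l⟫_ℝ) ≤ ∑ i, l i * R :=
    Finset.sum_le_sum fun i _ => mul_le_mul_of_nonneg_left ((hp _).trans (hA i)) (h0 i)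
  have a2 := mul_le_mul_of_nonneg_left ((hp 0).trans (hw.z.le.trans hR.le)) (sub_nonneg.2 h1)
  have e : ∑ i, l i * (w (A l) + ⟪p, A (es i) - A l⟫_ℝ) =
      (∑ i, l i) * w (A l) + ⟪p, A l⟫_ℝ - (∑ i, l i) * ⟪p, A l⟫_ℝ := by
    have : ⟪p, A l⟫_ℝ = ∑ i, l i * ⟪p, A (es i)⟫_ℝ := by
      conv_lhs => rw [← sum_es l]
      simp [map_sum, inner_sum, inner_smul_right]
    conv_rhs => rw [this]
    rw [← this]
    simp only [mul_add, inner_sub_right, mul_sub, Finset.sum_add_distrib, Finset.sum_sub_distrib, ← Finset.sum_mul]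
    rw [← this]; ring
  rw [e, ← Finset.sum_mul] at a1
  simp only [zero_sub, inner_neg_right] at a2
  linarith

theorem ball_simplex (hn : 0 < n) {l : Eu n}
    (hl : l ∈ closedBall (WithLp.toLp 2 fun _ => 1 / (2 * n) : Eu n) (1 / (2 * n))) :
    (∀ i, 0 ≤ l i) ∧ ∑ i, l i ≤ 1 := by
  have hn' : (0:ℝ) < n := by exact_mod_cast hn
  rw [mem_closedBall, dist_eq_norm] at hl
  have h1 : ∀ i, |l i - 1 / (2 * n)| ≤ 1 / (2 * n) := fun i => by
    have := PiLp.norm_apply_le (l - (WithLp.toLp 2 fun _ => 1 / (2 * n) : Eu n)) i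
    simp only [PiLp.sub_apply, Real.norm_eq_abs] at this
    exact this.trans hl
  refine ⟨fun i => by linarith [(abs_le.1 (h1 i)).1], ?_⟩
  calc ∑ i, l i ≤ ∑ i : Fin n, (1 / n : ℝ) := Finset.sum_le_sum fun i _ => by
        have := (abs_le.1 (h1 i)).2
        have e : (1:ℝ) / n = 1 / (2 * n) + 1 / (2 * n) := by field_simp; norm_num
        linarith
    _ = 1 := by simp; field_simp

theorem Nm.compA (h : Nm c0 C0 w) {s : ℝ} (hs : 0 < s) {A : Eu n →L[ℝ] Eu n}
    (hA : s ^ n = A.det ^ 2) : Nm c0 C0 (fun x => s⁻¹ * w (A x)) := by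
  refine ⟨?_, fun x => mul_nonneg (inv_pos.2 hs).le (h.nn _), by simp [h.z]⟩
  have := h.inW.compA hs hA 0 0 0
  simpa using this

/-- tilt at a point -/
theorem InW.tilt (h : InW c0 C0 w) {x p : Eu n} (hp : ∀ y, w x + ⟪p, y - x⟫_ℝ ≤ w y) :
    Nm c0 C0 (fun y => w (x + y) - w x - ⟪p, y⟫_ℝ) := by
  refine ⟨?_, fun y => ?_, by simp⟩
  · have := h.compA (s := 1) one_pos (A := ContinuousLinearMap.id ℝ _) (by simp [ContinuousLinearMap.det]) x (-p) (-w x)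
    convert this using 2 with y
    simp [add_comm]; ring
  · have := hp (x + y)
    rw [add_sub_cancel_left] at this
    linarith

theorem sq_bound_pow (hn : 0 < n) {a b : ℝ} (hb : 0 ≤ b) (h : a ^ n ≤ b ^ n) : a ≤ b :=
  le_of_pow_le_pow_left₀ hn.ne' hb h

theorem L1u (hn : 0 < n) (hc0 : 0 < c0) (hC0 : 1 ≤ C0) (hw : Nm c0 C0 w) {h D : ℝ} (hh : 0 < h) (hD : 0 < D)
    (hb : ∀ l, w l ≤ h → ‖l‖ ≤ D) : h ≤ 2 * C0 * D ^ 2 := by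
  have hK : IsCompact {x | w x ≤ h} :=
    (isCompact_closedBall (0 : Eu n) D).of_isClosed_subset (isClosed_le hw.inW.cont continuous_const)
      fun x hx => mem_closedBall_zero_iff.2 (hb x hx)
  have ho : IsOpen {x | w x < h} := isOpen_lt hw.inW.cont continuous_const
  have hX : {x | w x < h} ⊆ interior {x | w x ≤ h} := interior_maximal (fun x hx => show w x ≤ h from le_of_lt (show w x < h from hx)) ho
  have := abpW hw.inW hc0 (P := closedBall 0 (h / (2 * D))) hK hX ho.measurableSet (γ := h/2) (by linarith) ?_
  · have h2 : volume {x | w x < h} ≤ volume (closedBall (0 : Eu n) D) :=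
      measure_mono fun x hx => mem_closedBall_zero_iff.2 (hb x (le_of_lt hx))
    have h3 := this.trans (mul_le_mul_right h2 _)
    rw [Measure.addHaar_closedBall _ _ (by positivity), Measure.addHaar_closedBall _ _ (by positivity), ← mul_assoc,
      ENNReal.mul_le_mul_iff_left (measure_ball_pos _ _ one_pos).ne' measure_ball_lt_top.ne,
      ← ENNReal.ofReal_mul (by linarith), ENNReal.ofReal_le_ofReal_iff (by positivity), finrank_euclideanSpace,
      Fintype.card_fin] at h3
    have h4 : h / (2 * D) ≤ C0 * D := sq_bound_pow hn (by positivity) <| h3.trans <| by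
      rw [mul_pow]; gcongr; exact le_self_pow₀ hC0 hn.ne'
    rw [div_le_iff₀ (by positivity)] at h4
    linarith
  · intro p hp
    rw [mem_closedBall_zero_iff] at hp
    refine ⟨0, by simpa [hw.z] using hh.le, fun x hx hxX => ?_⟩
    have e : w x = h := le_antisymm hx (not_lt.1 hxX)
    have := real_inner_le_norm p x
    have h2 : ‖p‖ * ‖x‖ ≤ h / (2 * D) * D := by gcongr; exact hb x hx
    have h3 : h / (2 * D) * D = h / 2 := by field_simp
    simp [hw.z]
    linarith

theorem L1 (hn : 0 < n) (hc0 : 0 < c0) (hc1 : c0 ≤ 1) (hC0 : 1 ≤ C0) : ∃ D : ℝ, 1 ≤ D ∧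
    ∀ w : Eu n → ℝ, Nm c0 C0 w → ∀ R : ℝ, 0 < R → ∃ s A, Nf w D R s A := by
  have hn' : (1:ℝ) ≤ n := by exact_mod_cast hn
  set b := (1:ℝ) / (4 * n) with hb
  have b0 : 0 < b := by positivity
  set D0 := 2 * (n:ℝ) with hD0
  have hcb : 0 < c0 * b ^ 2 := by positivity
  refine ⟨1 / (c0 * b ^ 2) + 2 * C0 * D0 ^ 2 + 2 * n, ?_, fun w hw R hR => ?_⟩
  · have : 0 ≤ 1 / (c0 * b ^ 2) := by positivity
    have : 0 ≤ 2 * C0 * D0 ^ 2 := by positivity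
    linarith
  set cc : Eu n := WithLp.toLp 2 fun _ => 1 / (2 * n) with hcc
  have hbb : (2 * b) = 1 / (2 * n) := by rw [hb]; field_simp; norm_num
  -- upper bound of determinants
  have up : ∀ A : Eu n →L[ℝ] Eu n, (∀ i, w (A (es i)) ≤ R) → ∀ s, 0 < s → s ^ n = A.det ^ 2 →
      s ≤ R / (c0 * b ^ 2) := by
    intro A hA s hs hsd
    have hN := hw.compA hs hsd
    have := LB hn hN.inW hc0 hc1 (c := cc) b0 (h := s⁻¹ * R) fun x hx y hy => by
      rw [hbb] at hx hy
      obtain ⟨x1, x2⟩ := ball_simplex hn hx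
      have := mul_le_mul_of_nonneg_left (simplex_le hw hR hA x1 x2) (inv_pos.2 hs).le
      have := hN.nn y
      linarith
    rw [le_div_iff₀ hcb]
    have h2 := mul_le_mul_of_nonneg_left this hs.le
    rw [mul_inv_cancel_left₀ hs.ne'] at h2
    exact h2
  set Sd : Set ℝ := {d | ∃ A : Eu n →L[ℝ] Eu n, (∀ i, w (A (es i)) ≤ R) ∧ d = |A.det|} with hSd
  have bdd : BddAbove Sd := by
    refine ⟨max 1 ((R / (c0 * b ^ 2)) ^ n), ?_⟩
    rintro d ⟨A, hA, rfl⟩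
    by_cases hd : |A.det| ≤ 1
    · exact le_max_of_le_left hd
    · push Not at hd
      have hd0 : A.det ≠ 0 := fun h => by rw [h] at hd; norm_num at hd
      obtain ⟨s, hs, hsd⟩ := exs hn hd0
      refine le_max_of_le_right ?_
      calc |A.det| ≤ |A.det| ^ 2 := le_self_pow₀ hd.le two_ne_zero
        _ = s ^ n := by rw [sq_abs, hsd]
        _ ≤ _ := pow_le_pow_left₀ hs.le (up A hA s hs hsd) n
  obtain ⟨A, hA, hAd, hAs⟩ : ∃ A : Eu n →L[ℝ] Eu n, (∀ i, w (A (es i)) ≤ R) ∧ 0 < |A.det| ∧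
      sSup Sd ≤ 2 * |A.det| := by
    have hpos : ∃ d ∈ Sd, 0 < d := by
      have : ∀ᶠ x in 𝓝 (0 : Eu n), w x < R :=
        hw.inW.cont.continuousAt.eventually_lt continuousAt_const (by rw [hw.z]; exact hR)
      obtain ⟨ε, hε, hball⟩ := Metric.eventually_nhds_iff.1 this
      refine ⟨_, ⟨(ε/2) • ContinuousLinearMap.id ℝ _, fun i => (hball ?_).le, rfl⟩, ?_⟩
      · simp [norm_smul, abs_of_pos hε, es]; linarith
      · rw [det_smul']; simp [ContinuousLinearMap.det, hε.ne']
    obtain ⟨d, hd, d0⟩ := hpos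
    have hs : 0 < sSup Sd := d0.trans_le (le_csSup bdd hd)
    obtain ⟨_, ⟨A, hA, rfl⟩, h2⟩ := exists_lt_of_lt_csSup ⟨d, hd⟩ (half_lt_self hs)
    exact ⟨A, hA, by linarith, by linarith⟩
  have hAd0 : A.det ≠ 0 := abs_pos.1 hAd
  obtain ⟨s, hs, hsd⟩ := exs hn hAd0
  have hco : ∀ l, w (A l) ≤ R → ∀ i, |l i| ≤ 2 := fun l hl i => by
    have hm : |(A.comp (rk (es i) (l - es i))).det| ∈ Sd := by
      refine ⟨_, fun j => ?_, rfl⟩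
      rw [ContinuousLinearMap.comp_apply, rk_apply]
      by_cases hij : j = i
      · subst hij; simpa [es] using hl
      · have : ⟪es i, es j⟫_ℝ = 0 := by simp [es, EuclideanSpace.inner_single_left, Ne.symm hij]
        rw [this, zero_smul, add_zero]; exact hA j
    have h1 := (le_csSup bdd hm).trans hAs
    rw [det_cmp, rk_det, abs_mul, mul_comm] at h1
    have h2 := le_of_mul_le_mul_right h1 hAd
    have e : 1 + ⟪es i, l - es i⟫_ℝ = l i := by simp [es, inner_sub_right, EuclideanSpace.inner_single_left]
    rwa [e] at h2
  have hbd : ∀ l, w (A l) ≤ R → ‖l‖ ≤ D0 := fun l hl => by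
    have h1 := hco l hl
    calc ‖l‖ = ‖∑ i, l i • es i‖ := by rw [sum_es]
      _ ≤ ∑ i, ‖l i • es i‖ := norm_sum_le _ _
      _ ≤ ∑ i : Fin n, (2:ℝ) := Finset.sum_le_sum fun i _ => by simpa [norm_smul, es] using h1 i
      _ = D0 := by simp [hD0]; ring
  have q1 : 0 ≤ 1 / (c0 * b ^ 2) := by positivity
  have q2 : 0 ≤ 2 * C0 * D0 ^ 2 := by positivity
  have hup := up A hA s hs hsd
  refine ⟨s, A, hs, hsd, ?_, ?_, fun l hl => (hbd l hl).trans (by linarith), cc, ?_, fun l hl => ?_⟩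
  · calc s ≤ 1 / (c0 * b ^ 2) * R := hup.trans (le_of_eq (by ring))
      _ ≤ _ := by gcongr; linarith
  · have h1 := L1u hn hc0 hC0 (hw.compA hs hsd) (h := s⁻¹ * R) (D := D0) (by positivity) (by positivity)
      fun l hl => hbd l (le_of_mul_le_mul_left hl (inv_pos.2 hs))
    rw [inv_mul_le_iff₀ hs] at h1
    calc R ≤ (2 * C0 * D0 ^ 2) * s := h1.trans (le_of_eq (by ring))
      _ ≤ _ := by gcongr; linarith
  · have : ‖cc‖ ≤ ∑ i : Fin n, (1:ℝ) / (2 * n) := by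
      rw [← sum_es cc]
      refine (norm_sum_le _ _).trans (Finset.sum_le_sum fun i _ => ?_)
      simp [norm_smul, es, hcc]
    have h2 : ∑ i : Fin n, (1:ℝ) / (2 * n) ≤ 1 := by simp; field_simp; norm_num
    linarith
  · obtain ⟨x1, x2⟩ := ball_simplex hn (closedBall_subset_closedBall (by
      refine one_div_le_one_div_of_le (by positivity) (by linarith)) hl)
    exact simplex_le hw hR hA x1 x2

theorem Nm.ray (hw : Nm c0 C0 w) (x : Eu n) {a b : ℝ} (ha : 0 ≤ a) (hab : a ≤ b) : w (a • x) ≤ w (b • x) := by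
  obtain ⟨p, hp⟩ := hw.inW.subgrad (a • x)
  have h1 := hp 0
  have h2 := hp (b • x)
  have h3 := hw.nn (a • x)
  rw [hw.z, zero_sub, inner_neg_right, inner_smul_right] at h1
  rw [← sub_smul, inner_smul_right] at h2
  rcases ha.eq_or_lt with rfl | ha
  · rw [zero_smul, hw.z]; exact hw.nn _
  · have : 0 ≤ ⟪p, x⟫_ℝ := by
      by_contra h; push Not at h
      nlinarith [mul_neg_of_pos_of_neg ha h]
    nlinarith [mul_nonneg (sub_nonneg.2 hab) this]

theorem D1n (hn : 0 < n) (hc0 : 0 < c0) (hC0 : 1 ≤ C0) (hw : Nm c0 C0 w) {D h : ℝ} (hD : 1 ≤ D)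
    (hb : ∀ l, w l ≤ 2 * h → ‖l‖ ≤ D) (hh : 1 / (2 * D) ≤ h) {J : ℕ} (hJ : C0 * D ^ n * (16 * D ^ 2) ^ n < J)
    {x : Eu n} (hx : w x ≤ h) : w ((1 + 1 / J : ℝ) • x) ≤ 2 * h := by
  by_contra hc
  push Not at hc
  have h0 : 0 < h := lt_of_lt_of_le (by positivity) hh
  have J0 : (0:ℝ) < J := lt_of_le_of_lt (by positivity) hJ
  have hxD := hb x (by linarith)
  obtain ⟨t, ht, hty⟩ : ∃ t ∈ Icc (0:ℝ) (1 / J), w ((1 + t) • x) = 2 * h := by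
    have hcont : ContinuousOn (fun t : ℝ => w ((1 + t) • x)) (Icc (0:ℝ) (1 / J)) :=
      (hw.inW.cont.comp (by fun_prop)).continuousOn
    have := intermediate_value_Icc (by positivity) hcont
    exact this ⟨by simp; linarith, hc.le⟩
  set y1 := (1 + t) • x with hy1
  have hyx : y1 - x = t • x := by rw [hy1, add_smul, one_smul, add_sub_cancel_left]
  obtain ⟨p, hp⟩ := hw.inW.subgrad y1
  have hPq : h ≤ ⟪p, y1 - x⟫_ℝ := by
    have := hp x
    rw [← neg_sub y1 x, inner_neg_right] at this
    linarith
  set Pq := ⟪p, y1 - x⟫_ℝ with hPqd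
  have P0 : 0 < Pq := h0.trans_le hPq
  set p' := (h / Pq) • p with hp'
  have e1 : ⟪p', y1 - x⟫_ℝ = h := by rw [hp', real_inner_smul_left, ← hPqd]; field_simp
  have hpn : h * J / D ≤ ‖p'‖ := by
    have := real_inner_le_norm p' (y1 - x)
    rw [e1, hyx, norm_smul t, Real.norm_eq_abs, abs_of_nonneg ht.1] at this
    have h2 : ‖p'‖ * (t * ‖x‖) ≤ ‖p'‖ * (1 / J * D) := by gcongr; exact ht.2
    rw [div_le_iff₀ (by positivity)]
    calc h * J ≤ ‖p'‖ * (1 / J * D) * J := by gcongr; linarith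
      _ = _ := by field_simp
  have hbdry : ∀ z, w z ≤ 2 * h → ⟪p', z - y1⟫_ℝ ≤ 0 := fun z hz => by
    have := hp z
    rw [hp', real_inner_smul_left]
    exact mul_nonpos_of_nonneg_of_nonpos (by positivity) (by linarith)
  set b := h / (8 * D) with hbd
  have b0 : 0 < b := by positivity
  set P : Set (Eu n) := ⋃ j : Fin J, closedBall ((j / (2 * J) : ℝ) • p') b with hP
  have hvol : volume P = J * volume (closedBall (0 : Eu n) b) := by
    rw [hP, measure_iUnion]
    · simp [Measure.addHaar_closedBall_center]
    · intro i j hij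
      refine closedBall_disjoint_closedBall ?_
      rw [dist_eq_norm, ← sub_smul, norm_smul, Real.norm_eq_abs]
      have h1 : (1:ℝ) ≤ |(i:ℝ) - (j:ℝ)| := by
        have h2 : ((i:ℕ):ℤ) - ((j:ℕ):ℤ) ≠ 0 := sub_ne_zero.2 (by
          intro h; exact hij (Fin.ext (by exact_mod_cast h)))
        have := Int.one_le_abs h2
        exact_mod_cast this
      have h2 : 1 / (2 * J) ≤ |(i / (2 * J) : ℝ) - j / (2 * J)| := by
        rw [← sub_div, abs_div, abs_of_pos (show (0:ℝ) < 2 * J by positivity)]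
        gcongr
      calc b + b = 1 / 4 * (h / D) := by rw [hbd]; field_simp; norm_num
        _ < 1 / 2 * (h / D) := by gcongr; norm_num
        _ = 1 / (2 * J) * (h * J / D) := by field_simp
        _ ≤ _ := by gcongr
    · intro i; exact measurableSet_closedBall
  have hK : IsCompact {x | w x ≤ 2 * h} :=
    (isCompact_closedBall (0 : Eu n) D).of_isClosed_subset (isClosed_le hw.inW.cont continuous_const)
      fun x hx => mem_closedBall_zero_iff.2 (hb x hx)
  have ho : IsOpen {x | w x < 2 * h} := isOpen_lt hw.inW.cont continuous_const
  have hX : {x | w x < 2 * h} ⊆ interior {x | w x ≤ 2 * h} :=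
    interior_maximal (fun x hx => show w x ≤ 2 * h from le_of_lt (show w x < 2 * h from hx)) ho
  have := abpW hw.inW hc0 (P := P) hK hX ho.measurableSet (γ := h/4) (by linarith) ?_
  · have h2 : volume {x | w x < 2 * h} ≤ volume (closedBall (0 : Eu n) D) :=
      measure_mono fun x hx => mem_closedBall_zero_iff.2 (hb x (le_of_lt hx))
    have h3 := this.trans (mul_le_mul_right h2 _)
    rw [hvol, Measure.addHaar_closedBall _ _ (by positivity), Measure.addHaar_closedBall _ _ (by positivity), ← mul_assoc,
      ← mul_assoc,
      ENNReal.mul_le_mul_iff_left (measure_ball_pos _ _ one_pos).ne' measure_ball_lt_top.ne,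
      ← ENNReal.ofReal_mul (by linarith), ← ENNReal.ofReal_natCast, ← ENNReal.ofReal_mul (by positivity),
      ENNReal.ofReal_le_ofReal_iff (by positivity), finrank_euclideanSpace,
      Fintype.card_fin] at h3
    have h5 : 1 / (16 * D ^ 2) ≤ b := by
      calc 1 / (16 * D ^ 2) = 1 / (2 * D) / (8 * D) := by field_simp; norm_num
        _ ≤ _ := by rw [hbd]; gcongr
    have h6 : (J:ℝ) ≤ C0 * D ^ n * (16 * D ^ 2) ^ n := by
      calc (J:ℝ) = J * (1 / (16 * D ^ 2)) ^ n * (16 * D ^ 2) ^ n := by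
            rw [mul_assoc, ← mul_pow]; field_simp; simp
        _ ≤ J * b ^ n * (16 * D ^ 2) ^ n := by gcongr
        _ ≤ _ := by gcongr
    linarith
  · intro q hq
    rw [hP, mem_iUnion] at hq
    obtain ⟨j, hj⟩ := hq
    rw [mem_closedBall, dist_eq_norm] at hj
    refine ⟨x, show w x ≤ 2 * h by linarith, fun z hz hzX => ?_⟩
    have e : w z = 2 * h := le_antisymm hz (not_lt.1 hzX)
    set σ := (j / (2 * J) : ℝ) with hσ
    have σ0 : 0 ≤ σ := by positivity
    have σ1 : σ ≤ 1 / 2 := by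
      rw [hσ, div_le_iff₀ (by positivity)]
      have : ((j:ℕ):ℝ) ≤ J := by exact_mod_cast j.2.le
      linarith
    have a1 : ⟪q - σ • p', z - x⟫_ℝ ≤ b * (2 * D) := by
      refine (real_inner_le_norm _ _).trans ?_
      gcongr
      have := norm_sub_le z x
      have := hb z hz
      linarith
    have a2 : b * (2 * D) = h / 4 := by rw [hbd]; field_simp; norm_num
    have a3 : ⟪p', z - x⟫_ℝ ≤ h := by
      rw [show z - x = (z - y1) + (y1 - x) by abel, inner_add_right, e1]
      linarith [hbdry z hz]
    have a4 : σ * ⟪p', z - x⟫_ℝ ≤ h / 2 := by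
      nlinarith [mul_le_mul_of_nonneg_left a3 σ0]
    rw [inner_sub_left, real_inner_smul_left] at a1
    have a5 : ⟪q, z - x⟫_ℝ = ⟪q, z⟫_ℝ - ⟪q, x⟫_ℝ := inner_sub_right _ _ _
    linarith

theorem Nf.surj {D R s : ℝ} {A : Eu n →L[ℝ] Eu n} (h : Nf w D R s A) (x : Eu n) : ∃ l, A l = x := by
  have hd : A.det ≠ 0 := fun h0 => by
    have := h.det; rw [h0] at this; have h1 := pow_pos h.pos n; rw [this] at h1; simp at h1
  have h2 : IsUnit (LinearMap.det (A : Eu n →ₗ[ℝ] Eu n)) := isUnit_iff_ne_zero.2 hd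
  obtain ⟨l, hl⟩ := (LinearMap.equivOfIsUnitDet h2).surjective x
  exact ⟨l, by simpa using hl⟩

theorem doubling (hn : 0 < n) (hc0 : 0 < c0) (hc1 : c0 ≤ 1) (hC0 : 1 ≤ C0) : ∃ C1 : ℝ, 1 ≤ C1 ∧
    ∀ w : Eu n → ℝ, Nm c0 C0 w → ∀ x, w ((2:ℝ) • x) ≤ C1 * w x := by
  obtain ⟨D, hD, hL⟩ := L1 (n := n) hn hc0 hc1 hC0
  obtain ⟨J, hJ⟩ := exists_nat_gt (C0 * D ^ n * (16 * D ^ 2) ^ n)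
  have J0 : (0:ℝ) < J := lt_of_le_of_lt (by positivity) hJ
  refine ⟨2 ^ J, one_le_pow₀ one_le_two, fun w hw x => ?_⟩
  have step : ∀ h, 0 < h → ∀ x, w x ≤ h → w ((1 + 1 / J : ℝ) • x) ≤ 2 * h := fun h hh x hx => by
    obtain ⟨s, A, hA⟩ := hL w hw (2 * h) (by positivity)
    obtain ⟨l, rfl⟩ := hA.surj x
    have hs := hA.pos
    have := D1n hn hc0 hC0 (hw.compA hA.pos hA.det) (h := s⁻¹ * h) hD (fun l hl => hA.bd l (by
      rw [show 2 * (s⁻¹ * h) = s⁻¹ * (2 * h) by ring] at hl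
      exact le_of_mul_le_mul_left hl (inv_pos.2 hs))) (by
        rw [div_le_iff₀ (by positivity)]
        have := hA.Rs
        rw [← mul_inv_cancel₀ hs.ne']
        have h3 := hA.sR
        calc s * s⁻¹ ≤ (D * (2 * h)) * s⁻¹ := by gcongr
          _ = _ := by ring) hJ (x := l) (by gcongr)
    rw [map_smul, show 2 * (s⁻¹ * h) = s⁻¹ * (2 * h) by ring] at this
    exact le_of_mul_le_mul_left this (inv_pos.2 hs)
  have key : ∀ h, 0 < h → w x ≤ h → w ((2:ℝ) • x) ≤ 2 ^ J * h := fun h hh hx => by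
    have it : ∀ k : ℕ, w (((1 + 1 / J : ℝ) ^ k) • x) ≤ 2 ^ k * h := fun k => by
      induction k with
      | zero => simpa using hx
      | succ k ih =>
        have := step _ (by positivity) _ ih
        rw [smul_smul] at this
        rw [pow_succ', pow_succ', mul_assoc]; exact this
    refine (hw.ray x (by norm_num) ?_).trans (it J)
    have := one_add_mul_le_pow (a := (1 / J : ℝ)) (by have : (0:ℝ) ≤ 1 / J := by positivity
                                                      linarith) J
    rw [mul_one_div_cancel J0.ne'] at this
    linarith
  refine le_of_forall_pos_le_add fun ε hε => ?_
  have hp : (0:ℝ) < 2 ^ J := by positivity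
  have := key (w x + ε / 2 ^ J) (by have := hw.nn x; positivity) (by have : 0 < ε / 2 ^ J := by positivity
                                                                     linarith)
  rw [mul_add, mul_div_cancel₀ _ hp.ne'] at this
  exact this

theorem L2' {C1 : ℝ} (hd : ∀ w : Eu n → ℝ, Nm c0 C0 w → ∀ x, w ((2:ℝ) • x) ≤ C1 * w x) (h1 : 1 ≤ C1)
    (hw : Nm c0 C0 w) {R : ℝ} {x0 x p : Eu n} (h0 : w x0 ≤ R) (hx : w x = 4 * R)
    (hp : ∀ y, w x0 + ⟪p, y - x0⟫_ℝ ≤ w y) : R / (2 * (1 + C1)) ≤ w x - w x0 - ⟪p, x - x0⟫_ℝ := by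
  set ξ := x - x0 with hξ
  set m := x0 + (1/2:ℝ) • ξ with hm
  have ex : x = m + (1/2:ℝ) • ξ := by rw [hm, hξ]; module
  have ex0 : x0 = m - (1/2:ℝ) • ξ := by rw [hm]; module
  obtain ⟨q, hq⟩ := hw.inW.subgrad m
  have t := hw.inW.tilt hq
  have b1 := hp m
  have b2 := t.nn ((1/2:ℝ) • ξ)
  have b3 := t.nn (-(1/2:ℝ) • ξ)
  have b4 := hd _ t (-(1/2:ℝ) • ξ)
  rw [← ex, inner_smul_right] at b2
  rw [show m + -(1/2:ℝ) • ξ = x0 by rw [hm]; module, inner_smul_right] at b3 b4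
  rw [smul_smul, inner_smul_right] at b4
  rw [show m - x0 = (1/2:ℝ) • ξ by rw [hm]; module, inner_smul_right] at b1
  have b5 := hw.nn (m + (2 * -(1/2:ℝ)) • ξ)
  set δ := w x - w x0 - ⟪p, ξ⟫_ℝ with hδ
  have b6 : w x0 - w m - -(1/2:ℝ) * ⟪q, ξ⟫_ℝ ≤ δ := by linarith
  have b7 := mul_le_mul_of_nonneg_left b6 (show 0 ≤ C1 by linarith)
  rw [div_le_iff₀ (by linarith)]
  have b8 : w m ≤ 5 * R / 2 := by linarith
  linarith

def dd (w : Eu n → ℝ) (h x : Eu n) : ℝ := w (x + h) + w (x - h) - 2 * w x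

theorem InW.dd_nonneg (hw : InW c0 C0 w) (h x : Eu n) : 0 ≤ dd w h x := by
  obtain ⟨p, hp⟩ := hw.subgrad x
  have h1 := hp (x + h)
  have h2 := hp (x - h)
  rw [add_sub_cancel_left] at h1
  rw [sub_sub_cancel_left, inner_neg_right] at h2
  unfold dd; linarith

theorem InW.dd_cont (hw : InW c0 C0 w) (h : Eu n) : Continuous (dd w h) := by
  have := hw.cont
  unfold dd; fun_prop

theorem det_id' : (ContinuousLinearMap.id ℝ (Eu n)).det = 1 := by simp [ContinuousLinearMap.det]

theorem abpD (hn : 0 < n) (hw : InK c0 C0 w) (hc0 : 0 < c0) (hC0 : 0 ≤ C0) {τ : ℝ} (hτ : 0 ≤ τ) {h : Eu n}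
    {K X P : Set (Eu n)} (hK : IsCompact K) (hX : X ⊆ interior K)
    (hXm : MeasurableSet X) {γ : ℝ} (hγ : 0 < γ)
    (hP : ∀ p ∈ P, ∃ x0 ∈ K, ∀ x ∈ K, x ∉ X →
      w x0 - τ * dd w h x0 - ⟪p, x0⟫_ℝ + γ ≤ w x - τ * dd w h x - ⟪p, x⟫_ℝ) :
    volume P ≤ volume X := by
  have := abpK hn hw hc0 hC0 (m := 2) (α := 1 + 2 * τ) (β := fun _ => τ) (A := fun _ => ContinuousLinearMap.id ℝ _)
    (b := ![h, -h]) (fun _ => by rw [det_id']; norm_num) (by positivity) (fun _ => hτ) hK hX hXm hγ (P := P) (by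
      intro p hp
      obtain ⟨x0, h0, h1⟩ := hP p hp
      refine ⟨x0, h0, fun x hx hxX => ?_⟩
      have := h1 x hx hxX
      simp only [Fin.sum_univ_two, Matrix.cons_val_zero, Matrix.cons_val_one, ContinuousLinearMap.coe_id', id,
        ← sub_eq_add_neg]
      unfold dd at this
      linarith)
  have e : (1 + 2 * τ - ∑ _i : Fin 2, τ) = 1 := by simp
  simpa [e] using this

theorem lipOf (hw : InW c0 C0 w) (h0 : ∀ x, 0 ≤ w x) {ρ M : ℝ} (hM : ∀ x, ‖x‖ ≤ ρ + 1 → w x ≤ M) {x y : Eu n} (hx : ‖x‖ ≤ ρ)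
    (hy : ‖y‖ ≤ ρ) : |w x - w y| ≤ M * ‖x - y‖ := by
  have key : ∀ x y : Eu n, ‖x‖ ≤ ρ → w x - w y ≤ M * ‖x - y‖ := fun x y hx => by
    obtain ⟨p, hp⟩ := hw.subgrad x
    have h1 := grad_le (x := x) (p := p) one_pos (M := M) fun z hz => by
      have h3 := norm_add_le (z - x) x
      rw [sub_add_cancel] at h3
      linarith [hp z, h0 x, hM z (by linarith)]
    have h2 := hp y
    have h3 := real_inner_le_norm p (x - y)
    have h4 : ‖p‖ * ‖x - y‖ ≤ M * ‖x - y‖ := by gcongr; linarith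
    rw [← neg_sub x y, inner_neg_right] at h2
    linarith
  rw [abs_le]
  have := key x y hx
  have h2 := key y x hy
  rw [norm_sub_rev] at h2
  constructor <;> linarith

theorem locB {C1 D : ℝ} (hd : ∀ w : Eu n → ℝ, Nm c0 C0 w → ∀ x, w ((2:ℝ) • x) ≤ C1 * w x) (h1 : 1 ≤ C1)
    (hD : 1 ≤ D) (ρ : ℝ) (hρ : 0 ≤ ρ) : ∃ M : ℝ, 0 ≤ M ∧ ∀ w : Eu n → ℝ, Nm c0 C0 w → ∀ (c : Eu n) (h : ℝ), ‖c‖ ≤ D →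
      (∀ l ∈ closedBall c (1 / D), w l ≤ h) → ∀ x, ‖x‖ ≤ ρ → w x ≤ M * h := by
  obtain ⟨k, hk⟩ := pow_unbounded_of_one_lt ((ρ + D) * D) one_lt_two
  refine ⟨C1 ^ k * 2 + 1 + D * (ρ + D), by positivity, fun w hw c h hc hb x hx => ?_⟩
  have D0 : 0 < D := by linarith
  have hh : 0 ≤ h := (hw.nn c).trans (hb c (mem_closedBall_self (by positivity)))
  obtain ⟨p, hp⟩ := hw.inW.subgrad c
  have hpn : ‖p‖ ≤ D * h := by
    have := grad_le (x := c) (p := p) (ρ := 1 / D) (by positivity) (M := h) fun z hz => by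
      have := hb z (by rw [mem_closedBall, dist_eq_norm]; exact hz)
      linarith [hp z, hw.nn c]
    rw [one_div, inv_mul_le_iff₀ D0] at this
    exact this
  have t := hw.inW.tilt hp
  have it : ∀ k : ℕ, ∀ y : Eu n, w (c + (2:ℝ) ^ k • y) - w c - ⟪p, (2:ℝ) ^ k • y⟫_ℝ ≤ C1 ^ k * (w (c + y) - w c - ⟪p, y⟫_ℝ) := fun k => by
    induction k with
    | zero => intro y; simp
    | succ k ih =>
      intro y
      have a1 := hd _ t ((2:ℝ) ^ k • y)
      have a2 := mul_le_mul_of_nonneg_left (ih y) (show 0 ≤ C1 by linarith)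
      rw [smul_smul] at a1
      rw [pow_succ', pow_succ' C1, mul_assoc]
      exact a1.trans a2
  set y := x - c with hy
  have hyn : ‖y‖ ≤ ρ + D := (norm_sub_le _ _).trans (by linarith)
  have hsm : ‖((2:ℝ) ^ k)⁻¹ • y‖ ≤ 1 / D := by
    rw [norm_smul, norm_inv, norm_pow, Real.norm_ofNat, inv_mul_le_iff₀ (by positivity), mul_one_div, le_div_iff₀ D0]
    exact (mul_le_mul_of_nonneg_right hyn D0.le).trans hk.le
  have b1 := it k (((2:ℝ) ^ k)⁻¹ • y)
  rw [smul_inv_smul₀ (by positivity), show c + y = x by rw [hy]; abel] at b1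
  have b2 : w (c + ((2:ℝ) ^ k)⁻¹ • y) - w c - ⟪p, ((2:ℝ) ^ k)⁻¹ • y⟫_ℝ ≤ 2 * h := by
    have c1 := hb (c + ((2:ℝ) ^ k)⁻¹ • y) (by rw [mem_closedBall, dist_eq_norm, add_sub_cancel_left]; exact hsm)
    have c2 := (abs_le.1 (abs_real_inner_le_norm p (((2:ℝ) ^ k)⁻¹ • y))).1
    have c3 : ‖p‖ * ‖((2:ℝ) ^ k)⁻¹ • y‖ ≤ (D * h) * (1 / D) := by gcongr
    have c4 : (D * h) * (1 / D) = h := by field_simp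
    linarith [hw.nn c]
  have b3 := mul_le_mul_of_nonneg_left b2 (show 0 ≤ C1 ^ k by positivity)
  have b4 := real_inner_le_norm p y
  have b5 : ‖p‖ * ‖y‖ ≤ (D * h) * (ρ + D) := by gcongr
  have b6 := hb c (mem_closedBall_self (by positivity))
  nlinarith

theorem ddint (hw : InW c0 C0 w) {D L : ℝ} (hD : 0 ≤ D) (hL : ∀ x y, ‖x‖ ≤ D + 2 → ‖y‖ ≤ D + 3 → |w x - w y| ≤ L * ‖x - y‖)
    {h : Eu n} (hh : ‖h‖ ≤ 1) : ∫ x in closedBall (0 : Eu n) D, dd w h x ≤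
      L * ‖h‖ ^ 2 * volume.real (closedBall (0 : Eu n) (D + 2)) := by
  set χ : Eu n → ℝ := fun x => max 0 (D + 1 - ‖x‖) with hχ
  have χc : Continuous χ := by rw [hχ]; fun_prop
  have χ0 : ∀ x, 0 ≤ χ x := fun x => le_max_left _ _
  have χs : ∀ x, D + 1 ≤ ‖x‖ → χ x = 0 := fun x hx => max_eq_left (by linarith)
  have χl : ∀ x y, |χ x - χ y| ≤ ‖x - y‖ := fun x y => by
    have h1 := abs_max_sub_max_le_abs (D + 1 - ‖x‖) (D + 1 - ‖y‖) 0
    rw [max_comm _ (0:ℝ), max_comm _ (0:ℝ)] at h1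
    refine h1.trans ?_
    have := abs_norm_sub_norm_le y x
    rw [norm_sub_rev] at this
    rwa [show D + 1 - ‖x‖ - (D + 1 - ‖y‖) = ‖y‖ - ‖x‖ by ring]
  have int : ∀ f : Eu n → ℝ, Continuous f → (∀ x, D + 2 < ‖x‖ → f x = 0) → Integrable f := fun f hf h0 =>
    hf.integrable_of_hasCompactSupport (HasCompactSupport.intro (isCompact_closedBall (0 : Eu n) (D + 2)) fun x hx => by
      apply h0; rw [mem_closedBall_zero_iff] at hx; linarith)
  have wc := hw.cont
  have hdc := hw.dd_cont h
  set d : Eu n → ℝ := fun x => w (x + h) - w x with hd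
  have dc : Continuous d := by rw [hd]; fun_prop
  have h1 : ∫ x in closedBall (0 : Eu n) D, dd w h x ≤ ∫ x, χ x * dd w h x := by
    have hi : Integrable (fun x => χ x * dd w h x) := int _ (by fun_prop) fun x hx => by rw [χs x (by linarith), zero_mul]
    calc ∫ x in closedBall (0 : Eu n) D, dd w h x ≤ ∫ x in closedBall (0 : Eu n) D, χ x * dd w h x := by
          refine setIntegral_mono_on (hdc.continuousOn.integrableOn_compact (isCompact_closedBall _ _)) hi.integrableOn
            measurableSet_closedBall fun x hx => ?_
          rw [mem_closedBall_zero_iff] at hx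
          have : 1 ≤ χ x := le_max_of_le_right (by linarith)
          nlinarith [hw.dd_nonneg h x]
      _ ≤ _ := setIntegral_le_integral hi (Eventually.of_forall fun x => mul_nonneg (χ0 x) (hw.dd_nonneg h x))
  have h2 : ∫ x, χ x * dd w h x = ∫ x, (χ x - χ (x + h)) * d x := by
    have i1 : Integrable (fun x => χ x * d x) := int _ (by fun_prop) fun x hx => by rw [χs x (by linarith), zero_mul]
    have far : ∀ x : Eu n, D + 2 < ‖x‖ → D + 1 ≤ ‖x + h‖ := fun x hx => by
      have := norm_sub_le (x + h) h
      rw [add_sub_cancel_right] at this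
      linarith
    have i2 : Integrable (fun x => χ (x + h) * d x) := int _ (by fun_prop) fun x hx => by
      rw [χs _ (far x hx), zero_mul]
    have i3 : Integrable (fun x => χ x * d (x - h)) := by
      refine int _ (by fun_prop) fun x hx => ?_
      rw [χs x (by linarith), zero_mul]
    have e1 : ∫ x, χ (x + h) * d x = ∫ x, χ x * d (x - h) := by
      rw [← integral_add_right_eq_self (fun x => χ x * d (x - h)) h]
      simp
    simp only [sub_mul]
    rw [integral_sub i1 i2, e1, ← integral_sub i1 i3]
    congr 1; ext x
    simp only [hd, dd, sub_add_cancel]; ring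
  have h3 : ∫ x, (χ x - χ (x + h)) * d x ≤ ∫ x, (closedBall (0 : Eu n) (D + 2)).indicator (fun _ => L * ‖h‖ ^ 2) x := by
    refine integral_mono (int _ (by fun_prop) fun x hx => ?_) ?_ fun x => ?_
    · have := norm_sub_le (x + h) h
      rw [add_sub_cancel_right] at this
      rw [χs x (by linarith), χs (x + h) (by linarith)]; simp
    · exact (integrable_indicator_iff measurableSet_closedBall).2 (integrableOn_const (by
        exact measure_closedBall_lt_top.ne))
    · by_cases hx : x ∈ closedBall (0 : Eu n) (D + 2)
      · rw [indicator_of_mem hx]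
        rw [mem_closedBall_zero_iff] at hx
        have a1 := χl x (x + h)
        have a2 := hL x (x + h) hx ((norm_add_le _ _).trans (by linarith))
        rw [sub_add_cancel_left, norm_neg] at a1 a2
        rw [abs_sub_comm] at a2
        calc (χ x - χ (x + h)) * d x ≤ |χ x - χ (x + h)| * |d x| := by rw [← abs_mul]; exact le_abs_self _
          _ ≤ ‖h‖ * (L * ‖h‖) := by gcongr
          _ = _ := by ring
      · rw [indicator_of_notMem hx]
        rw [mem_closedBall_zero_iff, not_le] at hx
        have := norm_sub_le (x + h) h
        rw [add_sub_cancel_right] at this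
        simp only []
        rw [χs x (by linarith), χs (x + h) (by linarith)]; simp
  rw [integral_indicator_const _ measurableSet_closedBall, smul_eq_mul, mul_comm] at h3
  linarith

theorem volr (c : Eu n) {r : ℝ} (hr : 0 ≤ r) : volume.real (closedBall c r) = r ^ n * volume.real (ball (0 : Eu n) 1) := by
  rw [Measure.addHaar_real_closedBall _ _ hr, finrank_euclideanSpace, Fintype.card_fin]

theorem ballr_pos : 0 < volume.real (ball (0 : Eu n) 1) :=
  ENNReal.toReal_pos (measure_ball_pos _ _ one_pos).ne' measure_ball_lt_top.ne

theorem stepAn (hn : 0 < n) (hc0 : 0 < c0) (hC0 : 1 ≤ C0) {C1 D Γ L T k : ℝ}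
    (hd : ∀ w : Eu n → ℝ, Nm c0 C0 w → ∀ x, w ((2:ℝ) • x) ≤ C1 * w x) (h1 : 1 ≤ C1)
    (hD : 1 ≤ D) (hΓ : 2 ≤ Γ) (hwK : InK c0 C0 w) (hw : Nm c0 C0 w) (hT : 1 / (4 * D) ≤ T)
    (hb : ∀ l, w l ≤ 4 * T → ‖l‖ ≤ D)
    (hL : ∀ x y, ‖x‖ ≤ D + 2 → ‖y‖ ≤ D + 3 → |w x - w y| ≤ L * ‖x - y‖)
    {h : Eu n} (hh : ‖h‖ ≤ 1) (hk : ∀ x, w x ≤ 4 * T → dd w h x ≤ Γ * k) {x0 : Eu n} (hx0 : w x0 ≤ T)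
    (hk0 : dd w h x0 = k) :
    k * (1 / (256 * D ^ 2 * (1 + C1) * (Γ - 1))) ^ n ≤ 2 * L * ‖h‖ ^ 2 * (D + 2) ^ n := by
  have D0 : 0 < D := by linarith
  have L0 : 0 ≤ L := by
    by_contra hneg
    push Not at hneg
    have h1 := hL 0 (EuclideanSpace.single ⟨0, hn⟩ 1) (by simp; linarith) (by simp; linarith)
    simp at h1
    linarith [abs_nonneg (w 0 - w (EuclideanSpace.single ⟨0, hn⟩ 1))]
  have k0 : 0 ≤ k := hk0 ▸ hw.inW.dd_nonneg h x0
  have T0 : 0 < T := lt_of_lt_of_le (by positivity) hT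
  rcases k0.eq_or_lt with e | kpos
  · rw [← e, zero_mul]; positivity
  have g1 : 0 < Γ - 1 := by linarith
  set c' := T / (2 * (1 + C1)) with hc'
  have c'0 : 0 < c' := by positivity
  set τ := c' / (4 * (Γ - 1) * k) with hτ
  have τ0 : 0 ≤ τ := by positivity
  set β := c' / (32 * D * (Γ - 1)) with hβ
  have β0 : 0 < β := by positivity
  have τk : (Γ - 1) * (τ * k) = c' / 4 := by rw [hτ]; field_simp
  have βD : (Γ - 1) * (β * (2 * D)) = c' / 16 := by rw [hβ]; field_simp; norm_num
  obtain ⟨p0, hp0⟩ := hw.inW.subgrad x0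
  set X : Set (Eu n) := {x | w x < 4 * T} ∩ {x | k / 2 < dd w h x} with hX
  have hK : IsCompact {x | w x ≤ 4 * T} :=
    (isCompact_closedBall (0 : Eu n) D).of_isClosed_subset (isClosed_le hw.inW.cont continuous_const)
      fun x hx => mem_closedBall_zero_iff.2 (hb x hx)
  have ho : IsOpen X := (isOpen_lt hw.inW.cont continuous_const).inter (isOpen_lt continuous_const (hw.inW.dd_cont h))
  have hXi : X ⊆ interior {x | w x ≤ 4 * T} :=
    interior_maximal (fun x hx => show w x ≤ 4 * T from le_of_lt (show w x < 4 * T from hx.1)) ho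
  have hXD : X ⊆ closedBall (0 : Eu n) D := fun x hx => mem_closedBall_zero_iff.2 (hb x (le_of_lt hx.1))
  have hx0D := hb x0 (by linarith)
  have key := abpD hn hwK hc0 (by linarith) τ0 (h := h) (P := closedBall p0 β) hK hXi ho.measurableSet
    (γ := β * (2 * D)) (by positivity) ?_
  · have f1 : volume.real (closedBall p0 β) ≤ volume.real X :=
      ENNReal.toReal_mono ((measure_mono hXD).trans_lt measure_closedBall_lt_top).ne key
    have f2 := ddint hw.inW D0.le hL hh
    have hi : IntegrableOn (dd w h) (closedBall (0 : Eu n) D) :=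
      (hw.inW.dd_cont h).continuousOn.integrableOn_compact (isCompact_closedBall _ _)
    have f3 : ∫ x in X, k / 2 ≤ ∫ x in X, dd w h x :=
      setIntegral_mono_on (integrableOn_const ((measure_mono hXD).trans_lt measure_closedBall_lt_top).ne)
        (hi.mono_set hXD) ho.measurableSet fun x hx => le_of_lt hx.2
    have f4 : ∫ x in X, dd w h x ≤ ∫ x in closedBall (0 : Eu n) D, dd w h x :=
      setIntegral_mono_set hi (Eventually.of_forall fun x => hw.inW.dd_nonneg h x) hXD.eventuallyLE
    rw [setIntegral_const, smul_eq_mul] at f3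
    rw [volr _ β0.le] at f1
    rw [volr _ (by positivity)] at f2
    have ω := ballr_pos (n := n)
    set om := volume.real (ball (0 : Eu n) 1)
    have f5 : β ^ n * om * (k / 2) ≤ L * ‖h‖ ^ 2 * ((D + 2) ^ n * om) := by
      refine le_trans ?_ (f3.trans (f4.trans f2))
      gcongr
    have f6 : k * β ^ n ≤ 2 * L * ‖h‖ ^ 2 * (D + 2) ^ n := by
      refine le_of_mul_le_mul_right ?_ ω
      linarith
    refine le_trans ?_ f6
    gcongr
    rw [hβ, hc']
    calc 1 / (256 * D ^ 2 * (1 + C1) * (Γ - 1)) = 1 / (4 * D) / (2 * (1 + C1)) / (32 * D * (Γ - 1)) := by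
          field_simp; norm_num
      _ ≤ _ := by gcongr
  · intro p hp
    rw [mem_closedBall, dist_eq_norm] at hp
    refine ⟨x0, show w x0 ≤ 4 * T by linarith, fun z hz hzX => ?_⟩
    have a1 : ⟪p - p0, z - x0⟫_ℝ ≤ β * (2 * D) := by
      refine (real_inner_le_norm _ _).trans ?_
      gcongr
      have := norm_sub_le z x0
      have := hb z hz
      linarith
    rw [inner_sub_left, inner_sub_right] at a1
    have a2 := hp0 z
    have gb : 1 ≤ Γ - 1 := by linarith
    have bp : 0 ≤ β * (2 * D) := by positivity
    have tp : 0 ≤ τ * k := by positivity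
    rw [hk0]
    by_cases hz4 : w z = 4 * T
    · have a3 := L2' hd h1 hw hx0 hz4 hp0
      rw [← hc'] at a3
      have a4 := mul_le_mul_of_nonneg_left (hk z hz) τ0
      have a5 : β * (2 * D) ≤ c' / 16 := by nlinarith
      linarith
    · have hlt : w z < 4 * T := lt_of_le_of_ne hz hz4
      have a3 : dd w h z ≤ k / 2 := by
        by_contra hcon; push Not at hcon; exact hzX ⟨hlt, hcon⟩
      have a4 := mul_le_mul_of_nonneg_left a3 τ0
      have a5 : 4 * (β * (2 * D)) = τ * k := by
        have : (Γ - 1) * (4 * (β * (2 * D))) = (Γ - 1) * (τ * k) := by linarith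
        exact mul_left_cancel₀ g1.ne' this
      linarith

theorem stepA (hn : 0 < n) (hc0 : 0 < c0) (hC0 : 1 ≤ C0) {C1 D Γ : ℝ}
    (hd : ∀ w : Eu n → ℝ, Nm c0 C0 w → ∀ x, w ((2:ℝ) • x) ≤ C1 * w x) (h1 : 1 ≤ C1)
    (hD : 1 ≤ D) (hΓ : 2 ≤ Γ) : ∃ C3 : ℝ, 0 < C3 ∧ ∀ w : Eu n → ℝ, InK c0 C0 w → Nm c0 C0 w → ∀ R s A, 0 < R →
      Nf w D (4 * R) s A → ∀ h : Eu n, ‖h‖ ≤ 1 → ∀ K, (∀ x, w x ≤ 4 * R → dd w (A h) x ≤ Γ * K) →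
      (∃ x0, w x0 ≤ R ∧ dd w (A h) x0 = K) → K ≤ C3 * (s * ‖h‖ ^ 2) := by
  obtain ⟨M, hM0, hM⟩ := locB hd h1 hD (D + 4) (by linarith)
  have D0 : 0 < D := by linarith
  have g1 : 0 < Γ - 1 := by linarith
  set q := (1 / (256 * D ^ 2 * (1 + C1) * (Γ - 1))) ^ n with hq
  have q0 : 0 < q := by positivity
  refine ⟨(2 * (M * D) * (D + 2) ^ n) / q + 1, by positivity, fun w hwK hw R s A hR hA h hh K hK ⟨x0, hx0, hx0K⟩ => ?_⟩
  have hs := hA.pos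
  have hsi := inv_pos.2 hs
  obtain ⟨l0, rfl⟩ := hA.surj x0
  have hWK : InK c0 C0 (fun x => s⁻¹ * w (A x)) := by simpa using hwK.compA hs hA.det 0 0 0
  have hW := hw.compA hs hA.det
  have edd : ∀ l, dd (fun x => s⁻¹ * w (A x)) h l = s⁻¹ * dd w (A h) (A l) := fun l => by
    simp only [dd, map_add, map_sub]; ring
  have hTu : s⁻¹ * (4 * R) ≤ D := by rw [inv_mul_le_iff₀ hs]; linarith [hA.Rs]
  have hWM : ∀ x, ‖x‖ ≤ D + 4 → s⁻¹ * w (A x) ≤ M * D := by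
    obtain ⟨c, hc, hcb⟩ := hA.sim
    intro x hx
    refine hM _ hW c D hc (fun l hl => ?_) x hx
    exact (mul_le_mul_of_nonneg_left (hcb l hl) hsi.le).trans hTu
  have key := stepAn hn hc0 hC0 hd h1 hD hΓ hWK hW (T := s⁻¹ * R) (k := s⁻¹ * K) (L := M * D) (by
      rw [div_le_iff₀ (by positivity), ← inv_mul_cancel₀ hs.ne', mul_assoc]
      have := hA.sR
      gcongr; linarith) (fun l hl => hA.bd l (by
        rw [show 4 * (s⁻¹ * R) = s⁻¹ * (4 * R) by ring] at hl
        exact le_of_mul_le_mul_left hl hsi))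
      (fun x y hx hy => lipOf hW.inW hW.nn (ρ := D + 3) (fun z hz => hWM z (by linarith)) (by linarith) hy) hh
      (fun x hx => by
        rw [edd]
        have := mul_le_mul_of_nonneg_left (hK (A x) (by
          rw [show 4 * (s⁻¹ * R) = s⁻¹ * (4 * R) by ring] at hx
          exact le_of_mul_le_mul_left hx hsi)) hsi.le
        linarith) (x0 := l0) (by gcongr) (by rw [edd, hx0K])
  rw [← hq] at key
  have k2 : K * q ≤ 2 * (M * D) * (D + 2) ^ n * (s * ‖h‖ ^ 2) := by
    have := mul_le_mul_of_nonneg_left key hs.le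
    rw [show s * (s⁻¹ * K * q) = (s * s⁻¹) * (K * q) by ring, mul_inv_cancel₀ hs.ne', one_mul] at this
    linarith
  rw [← le_div_iff₀ q0] at k2
  have : 0 ≤ s * ‖h‖ ^ 2 := by positivity
  calc K ≤ _ := k2
    _ = (2 * (M * D) * (D + 2) ^ n) / q * (s * ‖h‖ ^ 2) := by ring
    _ ≤ _ := by gcongr; linarith

theorem Nm.half (hw : Nm c0 C0 w) (x y : Eu n) : w ((1/2:ℝ) • (x + y)) ≤ (w x + w y) / 2 := by
  have := hw.inW.convex.2 (mem_univ x) (mem_univ y) (show (0:ℝ) ≤ 1/2 by norm_num) (show (0:ℝ) ≤ 1/2 by norm_num) (by norm_num)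
  rw [smul_add]; simp only [smul_eq_mul] at this; linarith

theorem Nf.cmp {D R R' s s' : ℝ} {A A' : Eu n →L[ℝ] Eu n} (hD : 1 ≤ D) (hR : 0 < R) (hRR : R ≤ R') (h : Nf w D R s A)
    (h' : Nf w D R' s' A') {l l' : Eu n} (e : A l = A' l') :
    s' * ‖l'‖ ^ 2 ≤ 4 * D ^ 6 * (R' / R) * (s * ‖l‖ ^ 2) := by
  have D0 : 0 < D := by linarith
  have hs := h.pos
  have hs' := h'.pos
  have hr : 0 ≤ R' / R := div_nonneg (hR.le.trans hRR) hR.le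
  have a1 : s' ≤ D ^ 2 * (R' / R) * s := by
    calc s' ≤ D * R' := h'.sR
      _ = D * (R' / R) * R := by field_simp
      _ ≤ D * (R' / R) * (D * s) := by gcongr; exact h.Rs
      _ = _ := by ring
  have a2 : ‖l'‖ ≤ 2 * D ^ 2 * ‖l‖ := by
    by_cases hl : l = 0
    · have : l' = 0 := by
        by_contra hne
        have hd : A'.det ≠ 0 := fun h0 => by
          have := h'.det; rw [h0] at this; have h1 := pow_pos hs' n; rw [this] at h1; simp at h1
        exact inj_of_det hd hne (by rw [← e, hl, map_zero])
      rw [this, norm_zero]; positivity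
    · obtain ⟨c, hc, hcb⟩ := h.sim
      have l0 : 0 < ‖l‖ := norm_pos_iff.2 hl
      set t := 1 / (D * ‖l‖) with ht
      have t0 : 0 < t := by positivity
      obtain ⟨c', hc'⟩ := h'.surj (A c)
      have b1 : ‖c'‖ ≤ D := h'.bd _ (by
        rw [hc']; exact (hcb c (mem_closedBall_self (by positivity))).trans hRR)
      have b2 : ‖c' + t • l'‖ ≤ D := h'.bd _ (by
        have : A' (c' + t • l') = A (c + t • l) := by simp [hc', e]
        rw [this]
        refine (hcb _ ?_).trans hRR
        rw [mem_closedBall, dist_eq_norm, add_sub_cancel_left, norm_smul, Real.norm_eq_abs, abs_of_pos t0, ht]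
        apply le_of_eq; field_simp)
      have b3 : ‖t • l'‖ ≤ 2 * D := by
        have := norm_sub_le (c' + t • l') c'
        rw [add_sub_cancel_left] at this
        linarith
      rw [norm_smul, Real.norm_eq_abs, abs_of_pos t0, ht, one_div, inv_mul_le_iff₀ (by positivity)] at b3
      linarith
  calc s' * ‖l'‖ ^ 2 ≤ (D ^ 2 * (R' / R) * s) * (2 * D ^ 2 * ‖l‖) ^ 2 := by gcongr
    _ = _ := by ring

theorem Nm.compact (hn : 0 < n) (hc0 : 0 < c0) (hc1 : c0 ≤ 1) (hC0 : 1 ≤ C0) (hw : Nm c0 C0 w) {R : ℝ} (hR : 0 < R) :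
    IsCompact {x | w x ≤ R} := by
  obtain ⟨D, hD, hL⟩ := L1 (n := n) hn hc0 hc1 hC0
  obtain ⟨s, A, hA⟩ := hL w hw R hR
  refine ((isCompact_closedBall (0 : Eu n) D).image A.continuous).of_isClosed_subset
    (isClosed_le hw.inW.cont continuous_const) fun x hx => ?_
  obtain ⟨l, rfl⟩ := hA.surj x
  exact ⟨l, mem_closedBall_zero_iff.2 (hA.bd l hx), rfl⟩

theorem stepB (hn : 0 < n) (hc0 : 0 < c0) (hc1 : c0 ≤ 1) (hC0 : 1 ≤ C0) {D : ℝ} (hD : 1 ≤ D)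
    (hL : ∀ w : Eu n → ℝ, Nm c0 C0 w → ∀ R : ℝ, 0 < R → ∃ s A, Nf w D R s A) : ∃ C3 : ℝ, 0 < C3 ∧
    ∀ w : Eu n → ℝ, InK c0 C0 w → Nm c0 C0 w → ∀ R s A, 0 < R → Nf w D (4 * R) s A →
    ∀ h : Eu n, w (A h) ≤ R → w (-A h) ≤ R → w (D • A h) ≤ 4 * R → ∀ x, w x ≤ R → dd w (A h) x ≤ C3 * (s * ‖h‖ ^ 2) := by
  obtain ⟨C1, h1, hd⟩ := doubling (n := n) hn hc0 hc1 hC0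
  obtain ⟨C3, hC3, hA3⟩ := stepA (Γ := 8) hn hc0 hC0 hd h1 hD (by norm_num)
  have D0 : 0 < D := by linarith
  refine ⟨C3 * (4 * D ^ 6), by positivity, fun w hwK hw R s A hR hA h hh1 hh2 hh3 x hx => ?_⟩
  have hR4 : ∀ j : ℕ, R ≤ 4 ^ j * R := fun j => le_mul_of_one_le_left hR.le (one_le_pow₀ (by norm_num))
  have ex : ∀ j : ℕ, ∃ y, w y ≤ 4 ^ j * R ∧ ∀ x, w x ≤ 4 ^ j * R → dd w (A h) x ≤ dd w (A h) y := fun j => by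
    obtain ⟨y, hy, hm⟩ := (hw.compact hn hc0 hc1 hC0 (show 0 < 4 ^ j * R by positivity)).exists_isMaxOn
      ⟨0, show w 0 ≤ _ by rw [hw.z]; positivity⟩ (hw.inW.dd_cont (A h)).continuousOn
    exact ⟨y, hy, fun x hx => hm hx⟩
  choose y hy hym using ex
  set κ : ℕ → ℝ := fun j => dd w (A h) (y j) with hκ
  have κ0 : ∀ j, 0 ≤ κ j := fun j => hw.inW.dd_nonneg _ _
  have hx0 : dd w (A h) x ≤ κ 0 := hym 0 x (by simpa using hx)
  have gr : ∀ j, κ j ≤ 2 * C1 * (4 ^ j * R) := fun j => by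
    have b1 := hd w hw ((1/2:ℝ) • (y j + A h))
    have b2 := hd w hw ((1/2:ℝ) • (y j + -A h))
    rw [smul_smul, show (2:ℝ) * (1/2) = 1 by norm_num, one_smul] at b1 b2
    rw [← sub_eq_add_neg] at b2
    have b3 := hw.half (y j) (A h)
    have b4 := hw.half (y j) (-A h)
    rw [← sub_eq_add_neg] at b4
    have b5 := mul_le_mul_of_nonneg_left (b3.trans (show _ ≤ 4 ^ j * R by linarith [hy j, hR4 j])) (show 0 ≤ C1 by linarith)
    have b6 := mul_le_mul_of_nonneg_left (b4.trans (show _ ≤ 4 ^ j * R by linarith [hy j, hR4 j])) (show 0 ≤ C1 by linarith)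
    have b7 := hw.nn (y j)
    simp only [hκ, dd]
    linarith
  have iter : ∀ j, (∀ i < j, 8 * κ i ≤ κ (i + 1)) → 8 ^ j * κ 0 ≤ κ j := fun j => by
    induction j with
    | zero => simp
    | succ j ih =>
      intro hi
      have := ih fun i hij => hi i (by omega)
      have h2 := hi j (by omega)
      rw [pow_succ']; linarith
  rcases (κ0 0).eq_or_lt with e | kpos
  · have := hA.pos
    refine (hx0.trans e.symm.le).trans (by positivity)
  have exj : ∃ j, κ (j + 1) ≤ 8 * κ j := by
    by_contra hcon
    push Not at hcon
    obtain ⟨j, hj⟩ := pow_unbounded_of_one_lt (2 * C1 * R / κ 0) one_lt_two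
    rw [div_lt_iff₀ kpos] at hj
    have a1 := iter j fun i _ => (hcon i).le
    have a2 := gr j
    have a3 := mul_lt_mul_of_pos_left hj (show (0:ℝ) < 4 ^ j by positivity)
    have a4 : (8:ℝ) ^ j = 4 ^ j * 2 ^ j := by rw [← mul_pow]; norm_num
    rw [a4] at a1
    linarith
  classical
  set j := Nat.find exj with hj
  have hj1 := Nat.find_spec exj
  have hj2 : ∀ i < j, 8 * κ i ≤ κ (i + 1) := fun i hi => by
    have := Nat.find_min exj hi
    push Not at this; exact this.le
  have f1 := iter j hj2
  obtain ⟨s', A', hA'⟩ := hL w hw (4 * (4 ^ j * R)) (by positivity)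
  obtain ⟨h', hh'⟩ := hA'.surj (A h)
  have hh'n : ‖h'‖ ≤ 1 := by
    have := hA'.bd (D • h') (by rw [map_smul, hh']; exact hh3.trans (by linarith [hR4 j]))
    rw [norm_smul, Real.norm_eq_abs, abs_of_pos D0] at this
    nlinarith
  have f2 := hA3 w hwK hw (4 ^ j * R) s' A' (by positivity) hA' h' hh'n (κ j) (fun x hx => by
      rw [hh']
      refine le_trans (hym (j + 1) x ?_) hj1
      rw [pow_succ']; linarith) ⟨y j, hy j, by rw [hh']⟩
  have f3 := hA.cmp hD (by positivity) (by linarith [hR4 j]) hA' hh'.symm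
  have e3 : 4 * (4 ^ j * R) / (4 * R) = 4 ^ j := by field_simp
  rw [e3] at f3
  have hQ : 0 ≤ s * ‖h‖ ^ 2 := by have := hA.pos; positivity
  have f4 : 8 ^ j * κ 0 ≤ 4 ^ j * (C3 * (4 * D ^ 6) * (s * ‖h‖ ^ 2)) := by
    have := mul_le_mul_of_nonneg_left f3 hC3.le
    linarith
  have f5 : (4:ℝ) ^ j * κ 0 ≤ 8 ^ j * κ 0 := by gcongr; norm_num
  exact hx0.trans (le_of_mul_le_mul_left (f5.trans f4) (by positivity))

theorem inner_spec {T : Eu n →L[ℝ] Eu n} {b : OrthonormalBasis (Fin n) ℝ (Eu n)} {l : Fin n → ℝ}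
    (hl : ∀ i, T (b i) = l i • b i) (x : Eu n) : ⟪T x, x⟫_ℝ = ∑ i, l i * ⟪b i, x⟫_ℝ ^ 2 := by
  have e : T x = ∑ i, ⟪b i, x⟫_ℝ • l i • b i := by
    conv_lhs => rw [← b.sum_repr' x]
    simp [map_sum, hl]
  rw [e, sum_inner]
  refine Finset.sum_congr rfl fun i _ => ?_
  rw [real_inner_smul_left, real_inner_smul_left]; ring

theorem eig_lo {T : Eu n →L[ℝ] Eu n} (hs : Sy T) (hp : Psd T) (hd : T.det = 1) {m : ℝ} (hm : 1 ≤ m)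
    (hT : ∀ x, ⟪T x, x⟫_ℝ ≤ m * ‖x‖ ^ 2) (x : Eu n) : ‖x‖ ^ 2 ≤ m ^ n * ⟪T x, x⟫_ℝ := by
  obtain ⟨b, l, hl, hdet, -⟩ := spec hs
  have l0 := spec_nonneg hp hl
  have l1 : ∀ i, l i ≤ m := fun i => by
    have := hT (b i)
    rw [hl i, real_inner_smul_left, real_inner_self_eq_norm_sq, b.norm_eq_one] at this
    simpa using this
  have l2 : ∀ i, 1 ≤ m ^ n * l i := fun i => by
    rw [← hd, hdet, ← Finset.mul_prod_erase _ _ (Finset.mem_univ i), mul_comm]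
    gcongr
    · exact l0 i
    calc ∏ j ∈ Finset.univ.erase i, l j ≤ ∏ j ∈ Finset.univ.erase i, m := Finset.prod_le_prod (fun j _ => l0 j) fun j _ => l1 j
      _ = m ^ (Finset.univ.erase i).card := by simp
      _ ≤ m ^ n := pow_le_pow_right₀ hm (by
          refine (Finset.card_le_univ _).trans (by simp))
  rw [inner_spec hl, ← b.sum_sq_inner_right x, Finset.mul_sum]
  refine Finset.sum_le_sum fun i _ => ?_
  have := mul_le_mul_of_nonneg_right (l2 i) (sq_nonneg ⟪b i, x⟫_ℝ)
  linarith

theorem upQ (hn : 0 < n) (hc0 : 0 < c0) (hc1 : c0 ≤ 1) (hC0 : 1 ≤ C0) (hwK : InK c0 C0 w) (hw : Nm c0 C0 w) :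
    ∃ Λ : ℝ, 0 < Λ ∧ ∀ h x, dd w h x ≤ Λ * ‖h‖ ^ 2 := by
  obtain ⟨D, hD, hL⟩ := L1 (n := n) hn hc0 hc1 hC0
  obtain ⟨C3, hC3, hB⟩ := stepB hn hc0 hc1 hC0 hD hL
  obtain ⟨L0, hL0⟩ := (hw.compact hn hc0 hc1 hC0 one_pos).isBounded.exists_norm_le
  set L := max L0 0 + 1 with hLd
  have Lp : 0 < L := by positivity
  have hwL : ∀ h : Eu n, ‖h‖ = L → 1 ≤ w h := fun h hh => by
    by_contra hcon
    push Not at hcon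
    have := hL0 h hcon.le
    have := le_max_left L0 0
    linarith
  obtain ⟨R0, hR0⟩ := hw.inW.bdd (D * L)
  set m := max 1 (C3 * L ^ 2) with hm
  refine ⟨C3 * m ^ n, by positivity, fun h x => ?_⟩
  set R := max (max (max R0 1) (w h)) (max (w (-h)) (max (w (D • h)) (w x))) with hR
  have r1 : R0 ≤ R := le_trans (le_max_left _ _) (le_trans (le_max_left _ _) (le_max_left _ _))
  have r2 : 1 ≤ R := le_trans (le_max_right _ _) (le_trans (le_max_left _ _) (le_max_left _ _))
  have r3 : w h ≤ R := le_trans (le_max_right _ _) (le_max_left _ _)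
  have r4 : w (-h) ≤ R := le_trans (le_max_left _ _) (le_max_right _ _)
  have r5 : w (D • h) ≤ R := le_trans (le_max_left _ _) (le_trans (le_max_right _ _) (le_max_right _ _))
  have r6 : w x ≤ R := le_trans (le_max_right _ _) (le_trans (le_max_right _ _) (le_max_right _ _))
  obtain ⟨s, A, hA⟩ := hL w hw (4 * R) (by linarith)
  have hs := hA.pos
  have f1 : ∀ l, ‖A l‖ ^ 2 ≤ s * (C3 * L ^ 2) * ‖l‖ ^ 2 := fun l => by
    by_cases h0 : A l = 0
    · rw [h0]; simp; positivity
    have a0 : 0 < ‖A l‖ := norm_pos_iff.2 h0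
    set t := L / ‖A l‖ with ht
    have t0 : 0 < t := by positivity
    have hn1 : ‖A (t • l)‖ = L := by
      rw [map_smul, norm_smul, Real.norm_eq_abs, abs_of_pos t0, ht]; field_simp
    have LD : L ≤ D * L := by nlinarith
    have := hB w hwK hw R s A (by linarith) hA (t • l)
      ((le_abs_self _).trans ((hR0 _ (by rw [hn1]; exact LD)).trans r1))
      ((le_abs_self _).trans ((hR0 _ (by rw [norm_neg, hn1]; exact LD)).trans r1))
      ((le_abs_self _).trans ((hR0 _ (by
        rw [norm_smul, hn1, Real.norm_eq_abs, abs_of_pos (by linarith)])).trans (by linarith))) 0 (by rw [hw.z]; linarith)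
    simp only [dd, zero_add, zero_sub, hw.z] at this
    have h2 := hwL _ hn1
    have h3 := hw.nn (-A (t • l))
    have h4 : 1 ≤ C3 * (s * ‖t • l‖ ^ 2) := by linarith
    rw [norm_smul, Real.norm_eq_abs, abs_of_pos t0] at h4
    calc ‖A l‖ ^ 2 = ‖A l‖ ^ 2 * 1 := by ring
      _ ≤ ‖A l‖ ^ 2 * (C3 * (s * (t * ‖l‖) ^ 2)) := by gcongr
      _ = _ := by rw [ht]; field_simp
  set T := s⁻¹ • (adj A).comp ((ContinuousLinearMap.id ℝ (Eu n)).comp A) with hT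
  have Ti : ∀ x, ⟪T x, x⟫_ℝ = s⁻¹ * ‖A x‖ ^ 2 := fun x => by
    rw [← real_inner_self_eq_norm_sq]
    simp [hT, real_inner_smul_left, ContinuousLinearMap.adjoint_inner_left]
  have f2 := eig_lo (T := T) (fun a b => by
      simp [hT, real_inner_smul_left, real_inner_smul_right, ContinuousLinearMap.adjoint_inner_left,
        ContinuousLinearMap.adjoint_inner_right]) (fun a => by rw [Ti]; positivity)
    (by rw [hT, det_conjs hs hA.det, det_id']) (m := m) (le_max_left _ _) fun x => by
      rw [Ti, inv_mul_le_iff₀ hs]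
      refine (f1 x).trans ?_
      rw [mul_assoc]
      gcongr
      exact le_max_right _ _
  obtain ⟨l, rfl⟩ := hA.surj h
  have f3 := f2 l
  rw [Ti] at f3
  have f4 := hB w hwK hw R s A (by linarith) hA l r3 r4 (by linarith) x r6
  refine f4.trans ?_
  have f5 := mul_le_mul_of_nonneg_left f3 (show 0 ≤ C3 * s by positivity)
  rw [show C3 * s * (m ^ n * (s⁻¹ * ‖A l‖ ^ 2)) = (s * s⁻¹) * (C3 * m ^ n * ‖A l‖ ^ 2) by ring, mul_inv_cancel₀ hs.ne', one_mul] at f5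
  linarith

structure Quad {n : ℕ} (lo hi : ℝ) (w : Eu n → ℝ) : Prop where
  sub : ∀ x, ∃ p : Eu n, ∀ y, w x + ⟪p, y - x⟫_ℝ ≤ w y
  low : ∀ x p : Eu n, (∀ y, w x + ⟪p, y - x⟫_ℝ ≤ w y) → ∀ ξ, lo * ‖ξ‖ ^ 2 ≤ w (x + ξ) - w x - ⟪p, ξ⟫_ℝ
  up : ∀ x p : Eu n, (∀ y, w x + ⟪p, y - x⟫_ℝ ≤ w y) → ∀ ξ, w (x + ξ) - w x - ⟪p, ξ⟫_ℝ ≤ hi * ‖ξ‖ ^ 2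

theorem upq (hw : InW c0 C0 w) {Λ : ℝ} (hΛ : ∀ h x, dd w h x ≤ Λ * ‖h‖ ^ 2) {x p : Eu n}
    (hp : ∀ y, w x + ⟪p, y - x⟫_ℝ ≤ w y) (ξ : Eu n) : w (x + ξ) - w x - ⟪p, ξ⟫_ℝ ≤ Λ * ‖ξ‖ ^ 2 := by
  have h1 := hp (x - ξ)
  rw [sub_sub_cancel_left, inner_neg_right] at h1
  have h2 := hΛ ξ x
  unfold dd at h2
  linarith

/-- a quadratic growth bound at `y` for nonnegative functions -/
theorem upnn (hw : Nm c0 C0 w) {Λ : ℝ} (hΛ0 : 0 < Λ) (hΛ : ∀ h x, dd w h x ≤ Λ * ‖h‖ ^ 2) {t : ℝ} {y η : Eu n}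
    (hy : w y ≤ t) (hη : Λ * ‖η‖ ^ 2 ≤ t) : w (y + η) ≤ 4 * t := by
  obtain ⟨p, hp⟩ := hw.inW.subgrad y
  have h1 := upq hw.inW hΛ hp ((-(1 / (2 * Λ))) • p)
  have h2 := hw.nn (y + (-(1 / (2 * Λ))) • p)
  rw [inner_smul_right, real_inner_self_eq_norm_sq, norm_smul, Real.norm_eq_abs, abs_neg, abs_of_pos (by positivity)] at h1
  have e : Λ * (1 / (2 * Λ) * ‖p‖) ^ 2 = 1 / (4 * Λ) * ‖p‖ ^ 2 := by field_simp; ring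
  have e2 : 1 / (2 * Λ) * ‖p‖ ^ 2 = 2 * (1 / (4 * Λ) * ‖p‖ ^ 2) := by field_simp; ring
  have h3 : 1 / (4 * Λ) * ‖p‖ ^ 2 ≤ t := by linarith
  rw [div_mul_eq_mul_div, one_mul, div_le_iff₀ (by positivity)] at h3
  have h4 := upq hw.inW hΛ hp η
  have t0 : 0 ≤ t := (hw.nn y).trans hy
  have h5 : ‖p‖ * ‖η‖ ≤ 2 * t := by
    refine abs_le_of_sq_le_sq' ?_ (by positivity) |>.2
    rw [mul_pow]
    have := mul_le_mul h3 hη (by positivity) (by positivity)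
    have h6 : Λ * (‖p‖ ^ 2 * ‖η‖ ^ 2) ≤ Λ * (2 * t) ^ 2 := by linarith
    exact le_of_mul_le_mul_left h6 hΛ0
  have h6 := real_inner_le_norm p η
  linarith

theorem lowQ (hn : 0 < n) (hc0 : 0 < c0) (hc1 : c0 ≤ 1) (hw : Nm c0 C0 w) {Λ : ℝ} (hΛ0 : 0 < Λ)
    (hΛ : ∀ h x, dd w h x ≤ Λ * ‖h‖ ^ 2) (ξ : Eu n) {t : ℝ} (ht : 0 < t) (hξ : w ξ ≤ t) :
    c0 ^ n * ‖ξ‖ ^ 2 ≤ 4 * (4 * Λ) ^ n * 4 ^ n * t / Λ := by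
  by_cases hξ0 : ξ = 0
  · simp [hξ0]; positivity
  have x0 : 0 < ‖ξ‖ := norm_pos_iff.2 hξ0
  set b := Real.sqrt (t / Λ) with hb
  have b0 : 0 < b := Real.sqrt_pos.2 (by positivity)
  have b2 : b ^ 2 = t / Λ := Real.sq_sqrt (by positivity)
  set e := (‖ξ‖⁻¹) • ξ with he
  have en : ‖e‖ = 1 := by rw [he, norm_smul, norm_inv, norm_norm, inv_mul_cancel₀ x0.ne']
  have eξ : ξ = ‖ξ‖ • e := by rw [he, smul_inv_smul₀ x0.ne']
  set κ := ‖ξ‖ / (2 * b) - 1 with hκ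
  set A : Eu n →L[ℝ] Eu n := (b / 2) • rk e (κ • e) with hA
  have hdet : A.det = (b / 2) ^ n * (‖ξ‖ / (2 * b)) := by
    rw [hA, det_smul', rk_det, inner_smul_right, real_inner_self_eq_norm_sq, en, hκ]; ring
  have hd0 : 0 < A.det := by rw [hdet]; positivity
  obtain ⟨s, hs, hsd⟩ := exs hn hd0.ne'
  have hW := hw.inW.compA hs hsd ((1/2:ℝ) • ξ) 0 0
  have bound : ∀ l : Eu n, ‖l‖ ≤ 2 → w (A l + (1/2:ℝ) • ξ) ≤ 4 * t := fun l hl => by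
    have hel : |⟪e, l⟫_ℝ| ≤ 2 := (abs_real_inner_le_norm _ _).trans (by rw [en, one_mul]; exact hl)
    have hel' := abs_le.1 hel
    set a := 1 / 2 + ⟪e, l⟫_ℝ / 4 with ha
    have ez : A l + (1/2:ℝ) • ξ = a • ξ + (b / 2) • (l - ⟪e, l⟫_ℝ • e) := by
      rw [hA, ContinuousLinearMap.smul_apply, rk_apply, ha, add_smul, smul_smul]
      conv_lhs => rw [eξ]
      conv_rhs => rw [eξ]
      have : b / 2 * κ = ‖ξ‖ / 4 - b / 2 := by rw [hκ]; field_simp; ring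
      rw [smul_add, smul_smul, show b / 2 * (⟪e, l⟫_ℝ * κ) = ⟪e, l⟫_ℝ * (b / 2 * κ) by ring, this]
      module
    rw [ez]
    refine upnn hw hΛ0 hΛ ?_ ?_
    · have := hw.ray ξ (a := a) (b := 1) (by rw [ha]; linarith) (by rw [ha]; linarith)
      rw [one_smul] at this
      exact this.trans hξ
    · have hp : ‖l - ⟪e, l⟫_ℝ • e‖ ^ 2 ≤ ‖l‖ ^ 2 := by
        rw [norm_sub_sq_real, inner_smul_right, norm_smul, en, mul_one, Real.norm_eq_abs, sq_abs, real_inner_comm]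
        nlinarith [sq_nonneg ⟪e, l⟫_ℝ]
      have hp2 : ‖l‖ ^ 2 ≤ 4 := by nlinarith [norm_nonneg l]
      rw [norm_smul, mul_pow, Real.norm_eq_abs, abs_of_pos (by positivity), div_pow, b2]
      calc Λ * (t / Λ / 2 ^ 2 * ‖l - ⟪e, l⟫_ℝ • e‖ ^ 2) ≤ Λ * (t / Λ / 2 ^ 2 * 4) := by gcongr; linarith
        _ = t := by field_simp; norm_num
  have hlb := LB hn hW hc0 hc1 (c := 0) one_pos (h := s⁻¹ * (4 * t)) fun x hx y hy => by
    rw [mem_closedBall_zero_iff, mul_one] at hx hy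
    have h1 := mul_le_mul_of_nonneg_left (bound x hx) (inv_pos.2 hs).le
    have h2 := mul_nonneg (inv_pos.2 hs).le (hw.nn (A y + (1/2:ℝ) • ξ))
    simp only [inner_zero_left]
    linarith
  rw [one_pow, mul_one, ← div_eq_inv_mul, le_div_iff₀ hs] at hlb
  have h2 := pow_le_pow_left₀ (by positivity) hlb n
  rw [mul_pow, hsd, hdet, mul_pow, div_pow, div_pow, div_pow, mul_pow, ← pow_mul, ← pow_mul, mul_comm n 2, pow_mul, pow_mul, b2, mul_pow] at h2
  have e4 : c0 ^ n * ((t / Λ) ^ n / (2 ^ 2) ^ n * (‖ξ‖ ^ 2 / (2 ^ 2 * (t / Λ)))) =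
      (c0 ^ n * ‖ξ‖ ^ 2) * (t ^ n * Λ / (4 * t * (4 * Λ) ^ n)) := by
    rw [div_pow, mul_pow]; field_simp; norm_num; try ring
  rw [e4, ← le_div_iff₀ (by positivity)] at h2
  refine h2.trans (le_of_eq ?_)
  field_simp

theorem exQuad (hn : 0 < n) (hc0 : 0 < c0) (hc1 : c0 ≤ 1) (hC0 : 1 ≤ C0) (hwK : InK c0 C0 w) (hw : Nm c0 C0 w) :
    ∃ lo hi : ℝ, 0 < lo ∧ lo ≤ hi ∧ Quad lo hi w := by
  obtain ⟨Λ, hΛ0, hΛ⟩ := upQ hn hc0 hc1 hC0 hwK hw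
  set q := 4 * (4 * Λ) ^ n * 4 ^ n / Λ with hq
  have q0 : 0 < q := by positivity
  have low : ∀ x p : Eu n, (∀ y, w x + ⟪p, y - x⟫_ℝ ≤ w y) → ∀ ξ, (c0 ^ n / q) * ‖ξ‖ ^ 2 ≤ w (x + ξ) - w x - ⟪p, ξ⟫_ℝ := by
    intro x p hp ξ
    have t := hw.inW.tilt hp
    refine le_of_forall_pos_le_add fun ε hε => ?_
    have := lowQ hn hc0 hc1 t hΛ0 (fun h y => by
      have := hΛ h (x + y)
      simp only [dd] at this ⊢
      rw [inner_add_right, inner_sub_right, show x + (y + h) = x + y + h by abel, show x + (y - h) = x + y - h by abel]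
      linarith) ξ (t := w (x + ξ) - w x - ⟪p, ξ⟫_ℝ + ε) (add_pos_of_nonneg_of_pos (t.nn ξ) hε) (by linarith)
    rw [div_mul_eq_mul_div, div_le_iff₀ q0, hq]
    refine this.trans (le_of_eq (by ring))
  refine ⟨min (c0 ^ n / q) Λ, Λ, lt_min (by positivity) hΛ0, min_le_right _ _, hw.inW.subgrad, fun x p hp ξ => ?_,
    fun x p hp ξ => upq hw.inW hΛ hp ξ⟩
  refine le_trans ?_ (low x p hp ξ)
  gcongr
  exact min_le_left _ _

/-- one ABP step -/
theorem grow (hn : 0 < n) (hw : InK c0 C0 w) (hc0 : 0 < c0) (hC0 : 0 ≤ C0) {lo hi : ℝ} (hlo : 0 < lo) (hq : Quad lo hi w)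
    {h : Eu n} {M η r : ℝ} (hM : ∀ x, dd w h x ≤ M) (hη : 0 < η) (hr : 0 < r) {y1 : Eu n} (hy : M - dd w h y1 ≤ η) :
    volume (ball (0 : Eu n) (lo * r / 4)) ≤ volume ({x | M - dd w h x ≤ 3 * η} ∩ closedBall y1 r) := by
  obtain ⟨p1, hp1⟩ := hq.sub y1
  set τ := lo * r ^ 2 / (4 * η) with hτ
  have τ0 : 0 < τ := by positivity
  have hτη : τ * η = lo * r ^ 2 / 4 := by rw [hτ]; field_simp
  have cd := hw.toW.dd_cont h
  have := abpD hn hw hc0 hC0 τ0.le (h := h) (K := closedBall y1 r) (X := {x | M - dd w h x < 3 * η} ∩ ball y1 r)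
    (P := ball p1 (lo * r / 4)) (γ := lo * r ^ 2 / 4) (isCompact_closedBall _ _)
    (fun x hx => ball_subset_interior_closedBall hx.2)
    ((isOpen_lt (by fun_prop) continuous_const).inter isOpen_ball).measurableSet (by positivity) (by
      intro p hp
      refine ⟨y1, mem_closedBall_self hr.le, fun x hx hxX => ?_⟩
      rw [mem_ball, dist_eq_norm] at hp
      rw [mem_closedBall, dist_eq_norm] at hx
      have hl := hq.low y1 p1 hp1 (x - y1)
      rw [add_sub_cancel] at hl
      have hip : ⟪p - p1, x - y1⟫_ℝ ≤ lo * r / 4 * ‖x - y1‖ :=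
        (real_inner_le_norm _ _).trans (by gcongr)
      rw [inner_sub_left, inner_sub_right p] at hip
      have h1 : τ * (M - dd w h y1) ≤ τ * η := by gcongr
      have n0 := norm_nonneg (x - y1)
      by_cases hv : M - dd w h x < 3 * η
      · have : ‖x - y1‖ = r := le_antisymm hx (by
          by_contra hh; push Not at hh
          exact hxX ⟨hv, by rw [mem_ball, dist_eq_norm]; exact hh⟩)
        rw [this] at hl hip
        have h2 : 0 ≤ τ * (M - dd w h x) := mul_nonneg τ0.le (by linarith [hM x])
        nlinarith [mul_nonneg hlo.le (sq_nonneg r)]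
      · push Not at hv
        have h2 : τ * (3 * η) ≤ τ * (M - dd w h x) := by gcongr
        nlinarith [mul_nonneg hlo.le (sq_nonneg (‖x - y1‖ - r / 8)), mul_nonneg hlo.le (sq_nonneg r)])
  rw [Measure.addHaar_ball_center] at this
  refine this.trans (measure_mono fun x hx => ⟨?_, ball_subset_closedBall hx.2⟩)
  exact le_of_lt (show M - dd w h x < 3 * η from hx.1)

/-- comparison: minimum principle for supersolution combinations -/
theorem cmpK (hn : 0 < n) (hw : InK c0 C0 w) (hc0 : 0 < c0) (hC0 : 0 ≤ C0) {m : ℕ} {α : ℝ} {β : Fin m → ℝ}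
    {A : Fin m → Eu n →L[ℝ] Eu n} {b : Fin m → Eu n} (hA : ∀ i, (A i).det ^ 2 = 1) (hα : 0 ≤ α)
    (hβ : ∀ i, 0 ≤ β i) (hab : α ≤ ∑ i, β i) {p0 c : Eu n} {k s : ℝ} (hs : 0 < s)
    (hb : ∀ x, ‖x - c‖ = s → 0 ≤ α * w x - ∑ i, β i * w (A i x + b i) - ⟪p0, x⟫_ℝ + k) (x : Eu n) (hx : ‖x - c‖ ≤ s) :
    0 ≤ α * w x - ∑ i, β i * w (A i x + b i) - ⟪p0, x⟫_ℝ + k := by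
  by_contra hneg
  push Not at hneg
  set δ := -(α * w x - ∑ i, β i * w (A i x + b i) - ⟪p0, x⟫_ℝ + k) with hδ
  have δ0 : 0 < δ := by linarith
  have := abpK hn hw hc0 hC0 hA hα hβ (K := closedBall c s) (X := ball c s) (P := ball p0 (δ / (4 * s))) (b := b) (γ := δ / 2)
    (isCompact_closedBall _ _) ball_subset_interior_closedBall measurableSet_ball (by positivity) (by
      intro p hp
      rw [mem_ball, dist_eq_norm] at hp
      refine ⟨x, by rw [mem_closedBall, dist_eq_norm]; exact hx, fun y hy hyX => ?_⟩
      rw [mem_closedBall, dist_eq_norm] at hy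
      rw [mem_ball, dist_eq_norm] at hyX
      have h1 := hb y (by linarith)
      have h2 : ⟪p - p0, y - x⟫_ℝ ≤ δ / 2 := by
        refine (real_inner_le_norm _ _).trans ?_
        have h3 : ‖y - x‖ ≤ 2 * s := by
          have := norm_sub_le (y - c) (x - c)
          rw [sub_sub_sub_cancel_right] at this
          linarith
        calc _ ≤ δ / (4 * s) * (2 * s) := by gcongr
          _ = δ / 2 := by field_simp; norm_num
      rw [inner_sub_left, inner_sub_right, inner_sub_right] at h2
      linarith)
  rw [max_eq_right (by linarith), zero_pow hn.ne', ENNReal.ofReal_zero, zero_mul] at this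
  exact absurd (measure_ball_pos volume p0 (show 0 < δ / (4 * s) by positivity)) (not_lt.2 this)

set_option maxHeartbeats 800000 in
theorem hopf1 (hn : 0 < n) (hw : InK c0 C0 w) (hc0 : 0 < c0) (hC0 : 0 ≤ C0) {lo hi : ℝ} (hlo : 0 < lo) (hlh : lo ≤ hi)
    (hq : Quad lo hi w) {b N L : ℝ} (hb : b = lo / (8 * hi)) (hN : N = (b ^ (n - 1))⁻¹) (hL : L = hi * N ^ 2)
    {h : Eu n} {M m ρ s τ : ℝ} (hM : ∀ x, dd w h x ≤ M) (hρ : 0 < ρ) (hm : 0 < m) {p ν : Eu n} (hν : ‖ν‖ = 1)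
    (hs : s = lo / (8 * L) * ρ) (hτ : τ * (s ^ 2 * (2 * L + lo / 8)) = m)
    (hv : ∀ x, ‖x - p‖ ≤ ρ → m ≤ M - dd w h x) (ξ : Eu n) (hξ : ‖ξ‖ ≤ s) :
    τ * (-(L * s * ‖ξ‖) - hi / 2 * ‖ξ‖ ^ 2 + lo / 8 * s ^ 2) ≤ M - dd w h (p + ρ • ν + ξ) := by
  have hi0 : 0 < hi := by linarith
  have b0 : 0 < b := by rw [hb]; positivity
  have b1 : b ≤ 1 := by rw [hb, div_le_one (by positivity)]; linarith
  have N1 : 1 ≤ N := by rw [hN]; exact (one_le_inv₀ (by positivity)).2 (pow_le_one₀ b0.le b1)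
  have N0 : 0 < N := by linarith
  have L0 : 0 < L := by rw [hL]; positivity
  have hiL : hi ≤ L := by rw [hL]; nlinarith [mul_le_mul_of_nonneg_left N1 hi0.le]
  have s0 : 0 < s := by rw [hs]; positivity
  have τ0 : 0 < τ := by
    by_contra hh; push Not at hh
    have : 0 < s ^ 2 * (2 * L + lo / 8) := by positivity
    have := mul_nonpos_of_nonpos_of_nonneg hh this.le
    linarith
  set c := p + ρ • ν with hc
  obtain ⟨ph, hph⟩ := hq.sub c
  set q : Eu n → ℝ := fun ξ => w (c + ξ) - w c - ⟪ph, ξ⟫_ℝ with hqd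
  have qlo : ∀ ξ, lo * ‖ξ‖ ^ 2 ≤ q ξ := hq.low c ph hph
  have qhi : ∀ ξ, q ξ ≤ hi * ‖ξ‖ ^ 2 := hq.up c ph hph
  set T : Eu n →L[ℝ] Eu n := b • rk ν ((N / b - 1) • ν) with hT
  have hTd : T.det ^ 2 = 1 := by
    have : T.det = 1 := by
      rw [hT, det_smul', rk_det, inner_smul_right, real_inner_self_eq_norm_sq, hν, hN]
      obtain ⟨k, rfl⟩ : ∃ k, n = k + 1 := ⟨n - 1, by omega⟩
      rw [add_tsub_cancel_right, pow_succ]; field_simp; ring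
    rw [this, one_pow]
  have hTn : ∀ ξ, ‖T ξ‖ ^ 2 ≤ b ^ 2 * ‖ξ‖ ^ 2 + N ^ 2 * ⟪ν, ξ⟫_ℝ ^ 2 := fun ξ => by
    have e : T ξ = b • (ξ - ⟪ν, ξ⟫_ℝ • ν) + (N * ⟪ν, ξ⟫_ℝ) • ν := by
      rw [hT, ContinuousLinearMap.smul_apply, rk_apply, smul_smul, smul_add, smul_smul,
        show b * (⟪ν, ξ⟫_ℝ * (N / b - 1)) = N * ⟪ν, ξ⟫_ℝ - b * ⟪ν, ξ⟫_ℝ by field_simp]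
      module
    rw [e, norm_add_sq_real, norm_smul, norm_smul, inner_smul_left, inner_smul_right, inner_sub_left, inner_smul_left,
      real_inner_self_eq_norm_sq, hν, real_inner_comm ν ξ, mul_pow, mul_one, Real.norm_eq_abs, Real.norm_eq_abs, sq_abs, sq_abs,
      norm_sub_sq_real, inner_smul_right, norm_smul, hν, real_inner_comm ν ξ, mul_one, Real.norm_eq_abs, sq_abs]
    simp only [RCLike.conj_to_real]
    nlinarith [mul_nonneg (sq_nonneg b) (sq_nonneg ⟪ν, ξ⟫_ℝ)]
  set ψ : Eu n → ℝ := fun ξ => τ * (-(L * s * ⟪ν, ξ⟫_ℝ) + q (T ξ) - 1 / 2 * q ξ + lo / 8 * s ^ 2) with hψ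
  have ine : ∀ ξ, |⟪ν, ξ⟫_ℝ| ≤ ‖ξ‖ := fun ξ => (abs_real_inner_le_norm _ _).trans (by rw [hν, one_mul])
  have hLs : L * (lo / (8 * L)) = lo / 8 := by field_simp
  have bd : ∀ ξ, ‖ξ‖ = s → ψ ξ ≤ M - dd w h (c + ξ) := fun ξ hξ => by
    have h1 := hTn ξ
    have h2 := qhi (T ξ)
    have h3 := qlo ξ
    have h4 := abs_le.1 (ine ξ)
    rw [hξ] at h1 h3 h4
    set a := ⟪ν, ξ⟫_ℝ with ha
    have h5 : hi * ‖T ξ‖ ^ 2 ≤ hi * (b ^ 2 * s ^ 2) + L * a ^ 2 := by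
      have := mul_le_mul_of_nonneg_left h1 hi0.le
      rw [hL]; linarith
    have h6 : hi * (b ^ 2 * s ^ 2) ≤ lo / 64 * s ^ 2 := by
      have : hi * b ^ 2 ≤ lo / 64 := by
        rw [hb, div_pow, mul_pow, mul_div_assoc', div_le_iff₀ (by positivity)]
        have := mul_le_mul_of_nonneg_left hlh (mul_pos hlo hi0).le
        linarith
      have := mul_le_mul_of_nonneg_right this (sq_nonneg s)
      linarith
    by_cases hin : ‖c + ξ - p‖ ≤ ρ
    · refine le_trans ?_ (hv _ hin)
      rw [← hτ]
      show τ * _ ≤ _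
      gcongr
      have h7 : L * a ^ 2 ≤ L * s ^ 2 := by
        gcongr 1; exact sq_le_sq' h4.1 h4.2
      have h8 : -(L * s * a) ≤ L * s ^ 2 := by
        have := mul_nonneg (mul_pos L0 s0).le (show 0 ≤ s + a by linarith)
        linarith
      have := mul_pos hlo (pow_pos s0 2)
      linarith
    · push Not at hin
      have hbig : -(s ^ 2) ≤ 2 * ρ * a := by
        have e : c + ξ - p = ρ • ν + ξ := by rw [hc]; abel
        have e2 : ‖c + ξ - p‖ ^ 2 = ρ ^ 2 + 2 * (ρ * a) + s ^ 2 := by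
          rw [e, norm_add_sq_real, norm_smul, hν, inner_smul_left, hξ, Real.norm_eq_abs, abs_of_pos hρ]; simp [ha]
        have : ρ ^ 2 ≤ ‖c + ξ - p‖ ^ 2 := by gcongr
        linarith
      refine le_trans ?_ (show (0:ℝ) ≤ M - dd w h (c + ξ) by linarith [hM (c + ξ)])
      refine mul_nonpos_of_nonneg_of_nonpos τ0.le ?_
      have ls : L * s = lo / 8 * ρ := by rw [hs, ← mul_assoc, hLs]
      have ls2 : 0 < lo * s ^ 2 := by positivity
      by_cases ha0 : 0 ≤ a
      · have : L * a ^ 2 ≤ L * s * a := by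
          have := mul_nonneg (mul_nonneg L0.le ha0) (show 0 ≤ s - a by linarith)
          linarith
        linarith
      · push Not at ha0
        have sρ : s ≤ ρ / 8 := by
          rw [hs, div_mul_eq_mul_div, div_le_iff₀ (by positivity)]
          have := mul_le_mul_of_nonneg_right (hlh.trans hiL) hρ.le
          linarith
        have k1 : -(L * s * a) ≤ lo / 16 * s ^ 2 := by 
          have := mul_le_mul_of_nonneg_left hbig hlo.le
          rw [ls]; linarith
        have k2 : L * a ^ 2 ≤ lo / 16 * s ^ 2 := by
          have : a ^ 2 ≤ s * (-a) := by
            have := mul_nonneg (show 0 ≤ -a by linarith) (show 0 ≤ s + a by linarith)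
            linarith
          have := mul_le_mul_of_nonneg_left this L0.le
          linarith
        linarith
  have fin := cmpK (c0 := c0) (C0 := C0) hn hw hc0 hC0 (m := 3) (α := 2 + τ / 2) (β := ![1, 1, τ])
    (A := ![ContinuousLinearMap.id ℝ _, ContinuousLinearMap.id ℝ _, T]) (b := ![h, -h, c - T c])
    (by intro i; fin_cases i
        · simp [det_id']
        · simp [det_id']
        · simpa using hTd) (by positivity)
    (by intro i; fin_cases i <;> simp [τ0.le])
    (by simp [Fin.sum_univ_three]; linarith) (c := c) (s := s) s0
    (p0 := (-(τ * L * s)) • ν - τ • (adj T ph) + (τ / 2) • ph)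
    (k := M - τ * (L * s * ⟪ν, c⟫_ℝ - w c + ⟪ph, T c⟫_ℝ - 1 / 2 * (- w c + ⟪ph, c⟫_ℝ) + lo / 8 * s ^ 2))
  have id1 : ∀ x, (2 + τ / 2) * w x - ∑ i, (![1, 1, τ] : Fin 3 → ℝ) i * w ((![ContinuousLinearMap.id ℝ _, ContinuousLinearMap.id ℝ _, T] : Fin 3 → _) i x + (![h, -h, c - T c] : Fin 3 → _) i) -
      ⟪(-(τ * L * s)) • ν - τ • (adj T ph) + (τ / 2) • ph, x⟫_ℝ + (M - τ * (L * s * ⟪ν, c⟫_ℝ - w c + ⟪ph, T c⟫_ℝ - 1 / 2 * (- w c + ⟪ph, c⟫_ℝ) + lo / 8 * s ^ 2))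
      = M - dd w h x - ψ (x - c) := fun x => by
    simp only [Fin.sum_univ_three, Matrix.cons_val_zero, Matrix.cons_val_one, Matrix.cons_val,
      ContinuousLinearMap.coe_id', id, ← sub_eq_add_neg, hψ, hqd, dd, inner_add_left, inner_sub_left, inner_smul_left, inner_sub_right,
      ContinuousLinearMap.adjoint_inner_left, map_sub, add_sub_cancel, RCLike.conj_to_real]
    rw [show T x + (c - T c) = c + (T x - T c) by abel]
    ring
  simp only [id1] at fin
  have := fin (fun x hx => by have := bd (x - c) hx; rw [add_sub_cancel] at this; linarith) (c + ξ) (by rwa [add_sub_cancel_left])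
  rw [add_sub_cancel_left] at this
  refine le_trans ?_ (show ψ ξ ≤ _ by linarith)
  show _ ≤ τ * _
  refine mul_le_mul_of_nonneg_left ?_ τ0.le
  have h2 := qlo (T ξ)
  have h3 := qhi ξ
  have h4 := (abs_le.1 (ine ξ)).2
  have h5 : L * s * ⟪ν, ξ⟫_ℝ ≤ L * s * ‖ξ‖ := by gcongr
  have h6 : 0 ≤ lo * ‖T ξ‖ ^ 2 := by positivity
  linarith

theorem hopf (hn : 0 < n) (hc0 : 0 < c0) (hC0 : 0 ≤ C0) {lo hi : ℝ} (hlo : 0 < lo) (hlh : lo ≤ hi) :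
    ∃ σ c : ℝ, 0 < σ ∧ 0 < c ∧ c ≤ 1 ∧ ∀ w : Eu n → ℝ, InK c0 C0 w → Quad lo hi w → ∀ (h : Eu n) (M : ℝ), (∀ x, dd w h x ≤ M) →
      ∀ (p : Eu n) (ρ m : ℝ), 0 < ρ → 0 < m → (∀ x, ‖x - p‖ ≤ ρ → m ≤ M - dd w h x) →
      ∀ x, ‖x - p‖ ≤ (1 + σ) * ρ → c * m ≤ M - dd w h x := by
  have hi0 : 0 < hi := by linarith
  set b := lo / (8 * hi) with hb
  set N := (b ^ (n - 1))⁻¹ with hN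
  set L := hi * N ^ 2 with hL
  have b0 : 0 < b := by positivity
  have b1 : b ≤ 1 := by rw [hb, div_le_one (by positivity)]; linarith
  have N1 : 1 ≤ N := by rw [hN]; exact (one_le_inv₀ (by positivity)).2 (pow_le_one₀ b0.le b1)
  have L0 : 0 < L := by positivity
  have hiL : hi ≤ L := by
    have : 1 ≤ N ^ 2 := one_le_pow₀ N1
    have := mul_le_mul_of_nonneg_left this hi0.le
    rw [hL]; linarith
  set σ1 := lo / (32 * L) with hσ1
  have σ10 : 0 < σ1 := by positivity
  have σ11 : σ1 ≤ 1 / 32 := by rw [hσ1, div_le_iff₀ (by positivity)]; linarith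
  set σ0 := lo / (8 * L) with hσ0
  have σ00 : 0 < σ0 := by positivity
  set c := lo / 16 / (2 * L + lo / 8) with hc
  have c00 : 0 < c := by positivity
  have c01 : c ≤ 1 := by rw [hc, div_le_one (by positivity)]; linarith
  refine ⟨σ1 * σ0, c, by positivity, c00, c01, fun w hw hq h M hM p ρ m hρ hm hv x hx => ?_⟩
  by_cases hin : ‖x - p‖ ≤ ρ
  · have := hv x hin
    have : c * m ≤ 1 * m := by gcongr
    linarith
  push Not at hin
  have x0 : 0 < ‖x - p‖ := by linarith
  set s := σ0 * ρ with hs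
  have s0 : 0 < s := by positivity
  have h1 := hopf1 hn hw hc0 hC0 hlo hlh hq hb hN hL hM hρ hm (p := p) (ν := (‖x - p‖⁻¹) • (x - p)) (s := s)
    (τ := m / (s ^ 2 * (2 * L + lo / 8)))
    (by rw [norm_smul, norm_inv, norm_norm, inv_mul_cancel₀ x0.ne']) hs (by field_simp) hv
    ((1 - ρ * ‖x - p‖⁻¹) • (x - p)) 
  have en : ‖(1 - ρ * ‖x - p‖⁻¹) • (x - p)‖ = ‖x - p‖ - ρ := by
    rw [norm_smul, Real.norm_eq_abs, abs_of_nonneg, sub_mul, mul_assoc, inv_mul_cancel₀ x0.ne', one_mul, mul_one]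
    rw [sub_nonneg, ← div_eq_mul_inv, div_le_one x0]; exact hin.le
  have ex : p + ρ • (‖x - p‖⁻¹) • (x - p) + (1 - ρ * ‖x - p‖⁻¹) • (x - p) = x := by module
  rw [ex, en] at h1
  have d0 : 0 ≤ ‖x - p‖ - ρ := by linarith
  have d1 : ‖x - p‖ - ρ ≤ σ1 * s := by rw [hs]; linarith
  have d2 : σ1 * s ≤ s / 32 := by
    have := mul_le_mul_of_nonneg_right σ11 s0.le; linarith
  refine le_trans ?_ (h1 (by linarith))
  have e1 : c * m = m / (s ^ 2 * (2 * L + lo / 8)) * (lo / 16 * s ^ 2) := by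
    rw [hc]; field_simp
  rw [e1]
  gcongr
  have k1 : L * s * (‖x - p‖ - ρ) ≤ lo / 32 * s ^ 2 := by
    calc _ ≤ L * s * (σ1 * s) := by gcongr
      _ = lo / 32 * s ^ 2 := by rw [hσ1]; field_simp
  have k2 : hi / 2 * (‖x - p‖ - ρ) ^ 2 ≤ lo / 32 * s ^ 2 := by
    calc _ ≤ L / 2 * (σ1 * s) ^ 2 := by gcongr
      _ = L * σ1 * (σ1 * s ^ 2) / 2 := by ring
      _ = lo / 32 * (σ1 * s ^ 2) / 2 := by rw [show L * σ1 = lo / 32 by rw [hσ1]; field_simp]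
      _ ≤ lo / 32 * (1 * s ^ 2) := by
        have : σ1 * s ^ 2 ≤ 1 * s ^ 2 := by gcongr; linarith
        have h3 := mul_le_mul_of_nonneg_left this (show 0 ≤ lo / 32 by positivity)
        have h4 : 0 ≤ lo / 32 * (σ1 * s ^ 2) := by positivity
        linarith
      _ = _ := by ring
  linarith

theorem hopfN (hn : 0 < n) (hc0 : 0 < c0) (hC0 : 0 ≤ C0) {lo hi : ℝ} (hlo : 0 < lo) (hlh : lo ≤ hi) (κ : ℝ) :
    ∃ c : ℝ, 0 < c ∧ c ≤ 1 ∧ ∀ w : Eu n → ℝ, InK c0 C0 w → Quad lo hi w → ∀ (h : Eu n) (M : ℝ), (∀ x, dd w h x ≤ M) →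
      ∀ (p : Eu n) (ρ m : ℝ), 0 < ρ → 0 < m → (∀ x, ‖x - p‖ ≤ ρ → m ≤ M - dd w h x) →
      ∀ x, ‖x - p‖ ≤ κ * ρ → c * m ≤ M - dd w h x := by
  obtain ⟨σ, c, hσ, hc, hc1, H⟩ := hopf hn hc0 hC0 hlo hlh
  have key : ∀ k : ℕ, ∀ w : Eu n → ℝ, InK c0 C0 w → Quad lo hi w → ∀ (h : Eu n) (M : ℝ), (∀ x, dd w h x ≤ M) →
      ∀ (p : Eu n) (ρ m : ℝ), 0 < ρ → 0 < m → (∀ x, ‖x - p‖ ≤ ρ → m ≤ M - dd w h x) →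
      ∀ x, ‖x - p‖ ≤ (1 + σ) ^ k * ρ → c ^ k * m ≤ M - dd w h x := by
    intro k w hw hq h M hM p ρ m hρ hm hv
    induction k with
    | zero => simpa using hv
    | succ k ih =>
      intro x hx
      have := H w hw hq h M hM p ((1 + σ) ^ k * ρ) (c ^ k * m) (by positivity) (by positivity) ih x (by rw [pow_succ] at hx; linarith)
      rw [pow_succ]; linarith
  obtain ⟨k, hk⟩ := pow_unbounded_of_one_lt κ (show 1 < 1 + σ by linarith)
  refine ⟨c ^ k, by positivity, pow_le_one₀ hc.le hc1, fun w hw hq h M hM p ρ m hρ hm hv x hx => ?_⟩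
  exact key k w hw hq h M hM p ρ m hρ hm hv x (hx.trans (by gcongr))

/-- good points spread -/
theorem spread (hn : 0 < n) (hc0 : 0 < c0) (hC0 : 0 ≤ C0) {lo hi : ℝ} (hlo : 0 < lo) (hlh : lo ≤ hi) :
    ∃ C : ℝ, 1 ≤ C ∧ ∀ w : Eu n → ℝ, InK c0 C0 w → Quad lo hi w → ∀ (h : Eu n) (M : ℝ), (∀ x, dd w h x ≤ M) →
      ∀ (p y0 : Eu n) (ρ η : ℝ), 0 < ρ → 0 < η → M - dd w h y0 ≤ η → ‖y0 - p‖ ≤ 9 * ρ →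
      volume (ball (0 : Eu n) (lo * ρ / 8)) ≤ volume ({x | M - dd w h x ≤ C * η} ∩ closedBall p ρ) := by
  obtain ⟨c, hc, hc1, H⟩ := hopfN hn hc0 hC0 hlo hlh 18
  refine ⟨3 * (2 / c), ?_, fun w hw hq h M hM p y0 ρ η hρ hη hy hyp => ?_⟩
  · rw [← mul_div_assoc, le_div_iff₀ hc]; linarith
  obtain ⟨y1, h1, h2⟩ : ∃ y1, ‖y1 - p‖ ≤ ρ / 2 ∧ M - dd w h y1 ≤ 2 / c * η := by
    by_contra hh
    push Not at hh
    have := H w hw hq h M hM p (ρ / 2) (2 / c * η) (by positivity) (by positivity) (fun x hx => (hh x hx).le) y0 (by linarith)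
    rw [← mul_assoc, mul_div_cancel₀ _ hc.ne'] at this
    linarith
  have := grow hn hw hc0 hC0 hlo hq hM (η := 2 / c * η) (r := ρ / 2) (by positivity) (by positivity) h2
  rw [show lo * (ρ / 2) / 4 = lo * ρ / 8 by ring] at this
  refine this.trans (measure_mono fun x hx => ⟨?_, ?_⟩)
  · have h3 : M - dd w h x ≤ 3 * (2 / c * η) := hx.1
    show M - dd w h x ≤ _
    linarith
  · have h3 := hx.2
    rw [mem_closedBall, dist_eq_norm] at h3 ⊢
    have := norm_add_le (x - y1) (y1 - p)
    rw [sub_add_sub_cancel] at this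
    linarith

theorem cover (hn : 0 < n) {F0 F1 : Set (Eu n)} {R κ : ℝ} (hR : 0 < R) (hκ : 0 < κ) (hκ1 : κ ≤ 1) (h0 : IsClosed F0) (h1 : IsClosed F1)
    {y0 : Eu n} (hy : y0 ∈ F0) (hyR : ‖y0‖ ≤ R) (hsub : F0 ⊆ F1)
    (H : ∀ (p y : Eu n) (ρ : ℝ), 0 < ρ → y ∈ F0 → ‖y - p‖ ≤ 9 * ρ → volume (ball (0 : Eu n) (κ * ρ)) ≤ volume (F1 ∩ closedBall p ρ)) :
    volume.real (closedBall 0 R \ F1) ≤ (1 - (κ / 5) ^ n) * volume.real (closedBall (0 : Eu n) R \ F0) := by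
  set U := closedBall (0 : Eu n) R \ F0 with hU
  set F := F0 ∩ closedBall (0 : Eu n) R with hF
  have Fc : IsClosed F := h0.inter isClosed_closedBall
  have Fn : F.Nonempty := ⟨y0, hy, mem_closedBall_zero_iff.2 hyR⟩
  set r : Eu n → ℝ := fun x => infDist x F with hr
  set c : Eu n → Eu n := fun x => (1 - r x / (4 * R)) • x with hc
  have rpos : ∀ x ∈ U, 0 < r x := fun x hx => (Fc.notMem_iff_infDist_pos Fn).1 fun h => hx.2 h.1
  have rle : ∀ x ∈ U, r x ≤ 2 * R := fun x hx => by
    refine (infDist_le_dist_of_mem (show y0 ∈ F from ⟨hy, mem_closedBall_zero_iff.2 hyR⟩)).trans ?_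
    have h3 := norm_sub_le x y0
    rw [dist_eq_norm]
    have := mem_closedBall_zero_iff.1 hx.1
    linarith
  have xc : ∀ x ∈ U, ‖x - c x‖ ≤ r x / 4 := fun x hx => by
    have e : x - c x = (r x / (4 * R)) • x := by rw [hc]; module
    have h3 := rpos x hx
    rw [e, norm_smul, Real.norm_eq_abs, abs_of_pos (by positivity)]
    calc r x / (4 * R) * ‖x‖ ≤ r x / (4 * R) * R := by
          gcongr; exact mem_closedBall_zero_iff.1 hx.1
      _ = r x / 4 := by field_simp
  have bU : ∀ x ∈ U, closedBall (c x) (r x / 4) ⊆ U := fun x hx z hz => by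
    have h3 := rpos x hx
    have h4 := rle x hx
    have h5 := mem_closedBall_zero_iff.1 hx.1
    rw [mem_closedBall, dist_eq_norm] at hz
    have zR : ‖z‖ ≤ R := by
      have h6 := norm_add_le (z - c x) (c x)
      rw [sub_add_cancel] at h6
      have h7 : ‖c x‖ ≤ R - r x / 4 := by
        have h8 : r x / (4 * R) ≤ 1 := by rw [div_le_one (by positivity)]; linarith
        rw [hc, norm_smul, Real.norm_eq_abs, abs_of_nonneg (by linarith)]
        calc (1 - r x / (4 * R)) * ‖x‖ ≤ (1 - r x / (4 * R)) * R := by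
              gcongr
          _ = R - r x / 4 := by field_simp
      linarith
    refine ⟨mem_closedBall_zero_iff.2 zR, fun hzF => ?_⟩
    have h6 : r x ≤ dist x z := infDist_le_dist_of_mem ⟨hzF, mem_closedBall_zero_iff.2 zR⟩
    have h7 := norm_sub_le (x - c x) (z - c x)
    rw [sub_sub_sub_cancel_right, ← dist_eq_norm] at h7
    linarith [xc x hx]
  obtain ⟨t, htU, hdis, hcov⟩ := Vitali.exists_disjoint_subfamily_covering_enlargement_closedBall U c (fun x => r x / 4) (2 * R)
    (fun x hx => by have := rle x hx; have := rpos x hx; linarith) 5 (by norm_num)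
  have tc : t.Countable := hdis.countable_of_nonempty_interior fun x hx => by
    have := rpos x (htU hx)
    exact ⟨c x, ball_subset_interior_closedBall (mem_ball_self (by positivity))⟩
  have k1 : volume U ≤ ∑' b : t, volume (closedBall (c b) (5 * (r b / 4))) := by
    refine (measure_mono fun x hx => ?_).trans (measure_biUnion_le volume tc fun b => closedBall (c b) (5 * (r b / 4)))
    obtain ⟨b, hb, hb2⟩ := hcov x hx
    exact mem_biUnion hb (hb2 (by rw [mem_closedBall, dist_eq_norm]; exact xc x hx))
  have k2 : ∀ b : t, volume (closedBall (c b) (5 * (r b / 4))) ≤ ENNReal.ofReal ((5 / κ) ^ n) * volume (F1 ∩ closedBall (c b) (r b / 4)) := fun b => by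
    have h3 := rpos b (htU b.2)
    obtain ⟨y, hy1, hy2⟩ := Fc.exists_infDist_eq_dist Fn (b : Eu n)
    have h5 : r b = dist (b : Eu n) y := hy2
    have h4 := H (c b) y (r b / 4) (by positivity) hy1.1 (by
      have h6 := norm_add_le (y - b) (b - c b)
      rw [sub_add_sub_cancel, norm_sub_rev, ← dist_eq_norm, dist_comm, norm_sub_rev y, ← dist_eq_norm, ← h5, dist_eq_norm] at h6
      linarith [xc b (htU b.2)])
    refine le_trans (le_of_eq ?_) (mul_le_mul_right h4 _)
    rw [Measure.addHaar_closedBall _ _ (by positivity), Measure.addHaar_ball_of_pos _ (0 : Eu n) (show 0 < κ * (r b / 4) by positivity), ← mul_assoc,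
      ← ENNReal.ofReal_mul (by positivity), finrank_euclideanSpace, Fintype.card_fin, ← mul_pow, show 5 / κ * (κ * (r b / 4)) = 5 * (r b / 4) by field_simp]
  have k3 : volume U ≤ ENNReal.ofReal ((5 / κ) ^ n) * volume (U ∩ F1) := by
    refine k1.trans ((ENNReal.tsum_le_tsum k2).trans ?_)
    rw [ENNReal.tsum_mul_left]
    refine mul_le_mul_right ?_ _
    rw [← measure_biUnion tc (hdis.mono fun b => inter_subset_right) fun b _ => (h1.inter isClosed_closedBall).measurableSet]
    refine measure_mono (iUnion₂_subset fun b hb x hx => ⟨bU b (htU hb) hx.2, hx.1⟩)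
  have Ufin : volume U ≠ ⊤ := ((measure_mono diff_subset).trans_lt measure_closedBall_lt_top).ne
  have k4 : volume.real U ≤ (5 / κ) ^ n * volume.real (U ∩ F1) := by
    have := ENNReal.toReal_mono (ENNReal.mul_ne_top ENNReal.ofReal_ne_top ((measure_mono inter_subset_left).trans_lt Ufin.lt_top).ne) k3
    rwa [ENNReal.toReal_mul, ENNReal.toReal_ofReal (by positivity)] at this
  have k5 := measureReal_inter_add_diff (μ := volume) (s := U) h1.measurableSet Ufin
  have e : closedBall (0 : Eu n) R \ F1 = U \ F1 := by
    ext x; constructor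
    · exact fun hx => ⟨⟨hx.1, fun h => hx.2 (hsub h)⟩, hx.2⟩
    · exact fun hx => ⟨hx.1.1, hx.2⟩
  rw [e]
  have k6 : (κ / 5) ^ n * volume.real U ≤ volume.real (U ∩ F1) := by
    calc _ ≤ (κ / 5) ^ n * ((5 / κ) ^ n * volume.real (U ∩ F1)) := by gcongr
      _ = _ := by rw [← mul_assoc, ← mul_pow, show κ / 5 * (5 / κ) = 1 by field_simp, one_pow, one_mul]
  linarith

theorem WH (hn : 0 < n) (hc0 : 0 < c0) (hC0 : 0 ≤ C0) {lo hi : ℝ} (hlo : 0 < lo) (hlh : lo ≤ hi) :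
    ∃ C θ : ℝ, 1 ≤ C ∧ 0 ≤ θ ∧ θ < 1 ∧ ∀ w : Eu n → ℝ, InK c0 C0 w → Quad lo hi w → ∀ (h : Eu n) (M : ℝ), (∀ x, dd w h x ≤ M) →
      ∀ (y0 : Eu n) (R η : ℝ), 0 < R → 0 < η → M - dd w h y0 ≤ η → ‖y0‖ ≤ R → ∀ j : ℕ,
      volume.real (closedBall 0 R \ {x | M - dd w h x ≤ C ^ j * η}) ≤ θ ^ j * volume.real (closedBall (0 : Eu n) R) := by
  obtain ⟨C, hC, H⟩ := spread (c0 := c0) (C0 := C0) hn hc0 hC0 hlo hlh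
  set κ := min (lo / 8) 1 with hκ
  have κ0 : 0 < κ := lt_min (by positivity) one_pos
  have κ1 : κ ≤ 1 := min_le_right _ _
  refine ⟨C, 1 - (κ / 5) ^ n, hC, ?_, ?_, fun w hw hq h M hM y0 R η hR hη hy hyR j => ?_⟩
  · have : (κ / 5) ^ n ≤ 1 := pow_le_one₀ (by positivity) (by linarith)
    linarith
  · have : 0 < (κ / 5) ^ n := by positivity
    linarith
  have cd := hw.toW.dd_cont h
  have cl : ∀ t, IsClosed {x | M - dd w h x ≤ t} := fun t => isClosed_le (by fun_prop) continuous_const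
  induction j with
  | zero =>
    rw [pow_zero, pow_zero, one_mul, one_mul]
    exact measureReal_mono diff_subset measure_closedBall_lt_top.ne
  | succ j ih =>
    have hle : C ^ j * η ≤ C ^ (j + 1) * η := mul_le_mul_of_nonneg_right (pow_le_pow_right₀ hC (by omega)) hη.le
    have h1 : η ≤ C ^ j * η := le_mul_of_one_le_left hη.le (one_le_pow₀ hC)
    have := cover hn hR κ0 κ1 (cl (C ^ j * η)) (cl (C ^ (j + 1) * η)) (y0 := y0) (hy.trans h1) hyR
      (fun x hx => le_trans (show M - dd w h x ≤ _ from hx) hle) (fun p y ρ hρ hy hyp => by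
        have h2 := H w hw hq h M hM p y ρ (C ^ j * η) hρ (by positivity) hy hyp
        rw [← mul_assoc, ← pow_succ'] at h2
        refine le_trans (measure_mono (ball_subset_ball ?_)) h2
        have := mul_le_mul_of_nonneg_right (min_le_left (lo / 8) 1) hρ.le
        rw [hκ]; linarith)
    refine this.trans ?_
    rw [pow_succ', mul_assoc]
    refine mul_le_mul_of_nonneg_left ih ?_
    have : (κ / 5) ^ n ≤ 1 := pow_le_one₀ (by positivity) (by linarith)
    linarith

theorem meanS (hn : 0 < n) (hc0 : 0 < c0) (hc1 : c0 ≤ 1) (hC0 : 1 ≤ C0) (hwK : InK c0 C0 w) (hw : Nm c0 C0 w) (h : Eu n) :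
    ∃ M : ℝ, (∀ x, dd w h x ≤ M) ∧ ∀ ε : ℝ, 0 < ε → ∃ R0 : ℝ, ∀ R, R0 ≤ R →
      ∫⁻ x in closedBall (0 : Eu n) R, ENNReal.ofReal (M - dd w h x) ≤ ENNReal.ofReal ε * volume (closedBall (0 : Eu n) R) := by
  obtain ⟨Λ, hΛ0, hΛ⟩ := upQ hn hc0 hc1 hC0 hwK hw
  obtain ⟨lo, hi, hlo, hlh, hq⟩ := exQuad hn hc0 hc1 hC0 hwK hw
  obtain ⟨C, θ, hC, hθ0, hθ1, W⟩ := WH (c0 := c0) (C0 := C0) hn hc0 (by linarith) hlo hlh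
  have bdd : BddAbove (range (dd w h)) := ⟨_, by rintro _ ⟨x, rfl⟩; exact hΛ h x⟩
  set M := sSup (range (dd w h)) with hM
  have hle : ∀ x, dd w h x ≤ M := fun x => le_csSup bdd ⟨x, rfl⟩
  have hdc := hw.inW.dd_cont h
  refine ⟨M, hle, fun ε hε => ?_⟩
  have M0 : 0 ≤ M := (hw.inW.dd_nonneg h 0).trans (hle 0)
  obtain ⟨j, hj⟩ : ∃ j : ℕ, θ ^ j < ε / (2 * (M + 1)) := exists_pow_lt_of_lt_one (by positivity) hθ1
  have hj' : M * θ ^ j ≤ ε / 2 := by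
    calc M * θ ^ j ≤ (M + 1) * (ε / (2 * (M + 1))) := by gcongr; linarith
      _ = ε / 2 := by field_simp
  have Cj : 0 < C ^ j := by positivity
  obtain ⟨_, ⟨y0, rfl⟩, hy0⟩ := exists_lt_of_lt_csSup (range_nonempty (dd w h)) (show M - ε / (2 * C ^ j) < sSup (range (dd w h)) by
    rw [← hM]; have : 0 < ε / (2 * C ^ j) := by positivity
    linarith)
  refine ⟨max ‖y0‖ 1, fun R hR => ?_⟩
  have hR1 : 1 ≤ R := (le_max_right _ _).trans hR
  have k := W w hwK hq h M hle y0 R (ε / (2 * C ^ j)) (by linarith) (by positivity) (by linarith) ((le_max_left _ _).trans hR) j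
  rw [show C ^ j * (ε / (2 * C ^ j)) = ε / 2 by field_simp] at k
  set F := {x | M - dd w h x ≤ ε / 2} with hF
  have Fc : IsClosed F := isClosed_le (by fun_prop) continuous_const
  set B := closedBall (0 : Eu n) R with hB
  have Bf : volume B ≠ ⊤ := measure_closedBall_lt_top.ne
  have k2 : volume (B \ F) ≤ ENNReal.ofReal (θ ^ j) * volume B := by
    rw [← ENNReal.ofReal_toReal Bf, ← ENNReal.ofReal_mul (by positivity)]
    refine (ENNReal.le_ofReal_iff_toReal_le ?_ (by positivity)).2 k
    exact ((measure_mono diff_subset).trans_lt Bf.lt_top).ne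
  calc ∫⁻ x in B, ENNReal.ofReal (M - dd w h x)
      ≤ ∫⁻ x in B, (ENNReal.ofReal (ε / 2) + Fᶜ.indicator (fun _ => ENNReal.ofReal M) x) := by
        refine lintegral_mono fun x => ?_
        by_cases hx : x ∈ F
        · rw [indicator_of_notMem (by simpa using hx), add_zero]
          exact ENNReal.ofReal_le_ofReal hx
        · rw [indicator_of_mem (by simpa using hx)]
          exact le_add_left (ENNReal.ofReal_le_ofReal (by linarith [hw.inW.dd_nonneg h x]))
    _ = ENNReal.ofReal (ε / 2) * volume B + ENNReal.ofReal M * volume (B \ F) := by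
        rw [lintegral_add_left measurable_const, setLIntegral_const, lintegral_indicator Fc.measurableSet.compl, lintegral_const,
          Measure.restrict_apply MeasurableSet.univ, univ_inter, Measure.restrict_apply Fc.measurableSet.compl, inter_comm, diff_eq]
    _ ≤ ENNReal.ofReal (ε / 2) * volume B + ENNReal.ofReal M * (ENNReal.ofReal (θ ^ j) * volume B) := by gcongr
    _ = ENNReal.ofReal (ε / 2 + M * θ ^ j) * volume B := by
        rw [← mul_assoc, ← ENNReal.ofReal_mul M0, ← add_mul, ENNReal.ofReal_add (by positivity) (by positivity)]
    _ ≤ _ := by gcongr; linarith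

theorem lshift {f : Eu n → ℝ≥0∞} (h : Eu n) (ρ r : ℝ) (hr : ‖h‖ ≤ r) :
    ∫⁻ x in closedBall (0 : Eu n) ρ, f (x + h) ≤ ∫⁻ x in closedBall (0 : Eu n) (ρ + r), f x := by
  rw [← lintegral_indicator measurableSet_closedBall, ← lintegral_indicator measurableSet_closedBall,
    ← lintegral_add_right_eq_self ((closedBall (0 : Eu n) (ρ + r)).indicator f) h]
  refine lintegral_mono fun x => ?_
  by_cases hx : x ∈ closedBall (0 : Eu n) ρ
  · rw [indicator_of_mem hx, indicator_of_mem]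
    rw [mem_closedBall_zero_iff] at *
    exact (norm_add_le _ _).trans (by linarith)
  · rw [indicator_of_notMem hx]; exact zero_le

theorem dd_two (w : Eu n → ℝ) (h x : Eu n) : dd w ((2:ℝ) • h) x = dd w h (x + h) + 2 * dd w h x + dd w h (x + -h) := by
  simp only [dd]
  rw [show x + (2:ℝ) • h = x + h + h by module, show x - (2:ℝ) • h = x + -h - h by module, show x + h - h = x by module,
    show x + -h + h = x by module, ← sub_eq_add_neg]
  ring

theorem avg (hw : InW c0 C0 w) {h : Eu n} {M : ℝ} (hM : ∀ x, dd w h x ≤ M) (j : ℕ) :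
    (∀ x, dd w ((2:ℝ) ^ j • h) x ≤ 4 ^ j * M) ∧ ∀ ρ, ∫⁻ x in closedBall (0 : Eu n) ρ, ENNReal.ofReal (4 ^ j * M - dd w ((2:ℝ) ^ j • h) x) ≤
      4 ^ j * ∫⁻ x in closedBall (0 : Eu n) (ρ + 2 ^ j * ‖h‖), ENNReal.ofReal (M - dd w h x) := by
  induction j with
  | zero =>
    refine ⟨fun x => by simpa using hM x, fun ρ => ?_⟩
    simp only [pow_zero, one_smul, one_mul]
    exact lintegral_mono_set (closedBall_subset_closedBall (by linarith [norm_nonneg h]))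
  | succ j ih =>
    obtain ⟨i1, i2⟩ := ih
    have e : (2:ℝ) ^ (j + 1) • h = (2:ℝ) • ((2:ℝ) ^ j • h) := by rw [smul_smul, pow_succ']
    set k := (2:ℝ) ^ j • h with hk
    have nk : ‖k‖ = 2 ^ j * ‖h‖ := by rw [hk, norm_smul]; simp
    rw [e]
    refine ⟨fun x => ?_, fun ρ => ?_⟩
    · rw [dd_two, pow_succ]; linarith [i1 x, i1 (x + k), i1 (x + -k)]
    set f := fun x => ENNReal.ofReal (4 ^ j * M - dd w k x) with hf
    have kc := hw.dd_cont k
    have fc : Continuous f := ENNReal.continuous_ofReal.comp (by fun_prop)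
    have fe : ∀ x, ENNReal.ofReal (4 ^ (j + 1) * M - dd w ((2:ℝ) • k) x) = f (x + k) + (f x + f x) + f (x + -k) := fun x => by
      rw [dd_two, hf, ← ENNReal.ofReal_add, ← ENNReal.ofReal_add, ← ENNReal.ofReal_add]
      · congr 1; rw [pow_succ]; ring
      all_goals first | linarith [i1 x, i1 (x + k), i1 (x + -k)]
    simp only [fe]
    have h1 := lshift (f := f) k ρ (2 ^ j * ‖h‖) nk.le
    have h2 := lshift (f := f) (-k) ρ (2 ^ j * ‖h‖) (by rw [norm_neg, nk])
    have h3 : ∫⁻ x in closedBall (0 : Eu n) ρ, f x ≤ ∫⁻ x in closedBall (0 : Eu n) (ρ + 2 ^ j * ‖h‖), f x :=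
      lintegral_mono_set (closedBall_subset_closedBall (by have := norm_nonneg k; linarith))
    rw [lintegral_add_left (by fun_prop), lintegral_add_left (by fun_prop), lintegral_add_left (by fun_prop)]
    have h4 := i2 (ρ + 2 ^ j * ‖h‖)
    rw [add_assoc, ← two_mul, ← mul_assoc, ← pow_succ'] at h4
    calc _ ≤ (∫⁻ x in closedBall (0 : Eu n) (ρ + 2 ^ j * ‖h‖), f x) + ((∫⁻ x in closedBall (0 : Eu n) (ρ + 2 ^ j * ‖h‖), f x) + ∫⁻ x in closedBall (0 : Eu n) (ρ + 2 ^ j * ‖h‖), f x) +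
          (∫⁻ x in closedBall (0 : Eu n) (ρ + 2 ^ j * ‖h‖), f x) := by gcongr
      _ = 4 * ∫⁻ x in closedBall (0 : Eu n) (ρ + 2 ^ j * ‖h‖), f x := by ring
      _ ≤ 4 * _ := mul_le_mul_right h4 _
      _ = _ := by rw [← mul_assoc, ← pow_succ']

theorem InW.lim (h : ∀ r ε : ℝ, 0 < ε → ∃ w', InW c0 C0 w' ∧ ∀ x, ‖x‖ ≤ r → |w' x - w x| ≤ ε) :
    InW c0 C0 w := fun r ε hε => by
  obtain ⟨w', h1, h2⟩ := h r (ε/2) (by linarith)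
  obtain ⟨u, G, H, g1, g2⟩ := h1 r (ε/2) (by linarith)
  refine ⟨u, G, H, g1, fun x hx => ?_⟩
  have := abs_sub_le (u x) (w' x) (w x)
  linarith [h2 x hx, g2 x hx]

theorem ultra {wk : ℕ → Eu n → ℝ} (hk : ∀ k, Nm c0 C0 (wk k)) (hb : ∀ ρ : ℝ, ∃ M, ∀ k x, ‖x‖ ≤ ρ → wk k x ≤ M) :
    ∃ w, Nm c0 C0 w ∧ ∀ r ε : ℝ, 0 < ε → ∀ᶠ k in (hyperfilter ℕ : Filter ℕ), ∀ x, ‖x‖ ≤ r → |wk k x - w x| ≤ ε := by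
  have h1 : ∀ x, ∃ a, Tendsto (fun k => wk k x) (hyperfilter ℕ : Filter ℕ) (𝓝 a) := fun x => by
    obtain ⟨M, hM⟩ := hb ‖x‖
    obtain ⟨a, -, ha⟩ := (isCompact_Icc (a := (0:ℝ)) (b := M)).ultrafilter_le_nhds ((hyperfilter ℕ).map fun k => wk k x)
      (by rw [Ultrafilter.coe_map, le_principal_iff]; exact mem_map.2 (Eventually.of_forall fun k => ⟨(hk k).nn x, hM k x le_rfl⟩))
    exact ⟨a, ha⟩
  choose w hw using h1
  have key : ∀ r ε : ℝ, 0 < ε → ∀ᶠ k in (hyperfilter ℕ : Filter ℕ), ∀ x, ‖x‖ ≤ r → |wk k x - w x| ≤ ε := fun r ε hε => by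
    obtain ⟨M, hM⟩ := hb (r + 1)
    have lip : ∀ k x y, ‖x‖ ≤ r → ‖y‖ ≤ r → |wk k x - wk k y| ≤ M * ‖x - y‖ := fun k x y hx hy =>
      lipOf (hk k).inW (hk k).nn (hM k) hx hy
    by_cases hr : r < 0
    · exact Eventually.of_forall fun k x hx => absurd (norm_nonneg x) (by linarith)
    push Not at hr
    have M0 : 0 ≤ M := by
      have := hM 0 0 (by rw [norm_zero]; linarith)
      rwa [(hk 0).z] at this
    have lipw : ∀ x y, ‖x‖ ≤ r → ‖y‖ ≤ r → |w x - w y| ≤ M * ‖x - y‖ := fun x y hx hy =>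
      le_of_tendsto ((hw x).sub (hw y)).abs (Eventually.of_forall fun k => lip k x y hx hy)
    set δ := ε / (3 * (M + 1)) with hδ
    have δ0 : 0 < δ := by positivity
    have hMδ : M * δ ≤ ε / 3 := by
      calc M * δ ≤ (M + 1) * δ := by gcongr; linarith
        _ = ε / 3 := by rw [hδ]; field_simp
    obtain ⟨t, ht1, ht2, ht3⟩ := finite_cover_balls_of_compact (isCompact_closedBall (0 : Eu n) r) δ0
    have h2 : ∀ᶠ k in (hyperfilter ℕ : Filter ℕ), ∀ y ∈ t, |wk k y - w y| ≤ ε / 3 := by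
      rw [eventually_all_finite ht2]
      intro y _
      have := (Metric.tendsto_nhds.1 (hw y)) (ε / 3) (by positivity)
      exact this.mono fun k h => le_of_lt h
    refine h2.mono fun k hk x hx => ?_
    obtain ⟨y, hy, hxy⟩ := mem_iUnion₂.1 (ht3 (mem_closedBall_zero_iff.2 hx))
    rw [mem_ball, dist_eq_norm] at hxy
    have hyr := mem_closedBall_zero_iff.1 (ht1 hy)
    have a1 := lip k x y hx hyr
    have a2 := lipw x y hx hyr
    have a3 := hk y hy
    have a4 : M * ‖x - y‖ ≤ M * δ := by gcongr
    rw [abs_le] at *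
    constructor <;> linarith
  refine ⟨w, ⟨InW.lim fun r ε hε => ?_, fun x => ge_of_tendsto (hw x) (Eventually.of_forall fun k => (hk k).nn x), ?_⟩, key⟩
  · obtain ⟨k, h⟩ := (key r ε hε).exists
    exact ⟨_, (hk k).inW, h⟩
  · refine tendsto_nhds_unique (hw 0) ?_
    simp only [(hk _).z]; exact tendsto_const_nhds

theorem parQ {f : Eu n → ℝ} (hc : Continuous f) (hf : ∀ x h, f (x + h) + f (x - h) = 2 * f x + 2 * f h) :
    ∃ P : Eu n →L[ℝ] Eu n, Sy P ∧ ∀ x, f x = ⟪P x, x⟫_ℝ / 2 := by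
  set B : Eu n → Eu n → ℝ := fun x y => f (x + y) - f x - f y with hB
  have f0 : f 0 = 0 := by have := hf 0 0; simp at this; linarith
  have Bs : ∀ x y, B x y = B y x := fun x y => by simp only [hB, add_comm]; ring
  have Ba : ∀ z x y, B z (x + y) = B z x + B z y := fun z x y => by
    have e1 := hf (x + z) y
    have e2 := hf (y + z) x
    have e3 := hf z (x - y)
    have e4 := hf x y
    rw [show x + z + y = z + (x + y) by module] at e1
    rw [show y + z + x = z + (x + y) by module, show y + z - x = z - (x - y) by module] at e2
    rw [show z + (x - y) = x + z - y by module] at e3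
    simp only [hB]; rw [add_comm z x, add_comm z y]; linarith
  have Bc : ∀ z, Continuous (B z) := fun z => by simp only [hB]; fun_prop
  let L : Eu n → (Eu n →L[ℝ] ℝ) := fun z => (AddMonoidHom.mk' (B z) (Ba z)).toRealLinearMap (Bc z)
  have hL : ∀ z y, L z y = B z y := fun z y => rfl
  let P0 : Eu n → Eu n := fun z => (InnerProductSpace.toDual ℝ (Eu n)).symm (L z)
  have hP : ∀ z y, ⟪P0 z, y⟫_ℝ = B z y := fun z y => by
    rw [← hL]; exact InnerProductSpace.toDual_symm_apply
  let P1 : Eu n →ₗ[ℝ] Eu n := { toFun := P0, map_add' := fun x y => ext_inner_right ℝ fun v => by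
                                  rw [inner_add_left, hP, hP, hP, Bs, Ba, Bs x, Bs y]
                                map_smul' := fun c x => ext_inner_right ℝ fun v => by
                                  rw [RingHom.id_apply, inner_smul_left, hP, hP, Bs, Bs x, ← hL, ← hL, map_smul]; simp }
  refine ⟨LinearMap.toContinuousLinearMap P1, fun x y => ?_, fun x => ?_⟩
  · change ⟪P0 x, y⟫_ℝ = ⟪x, P0 y⟫_ℝ
    rw [real_inner_comm (P0 y), hP, hP, Bs]
  · change _ = ⟪P0 x, x⟫_ℝ / 2
    rw [hP]; have := hf x x
    simp only [hB]; rw [sub_self, f0] at this; linarith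

theorem det_le_of {T : Eu n →L[ℝ] Eu n} {β : ℝ} (hs : Sy T) (hp : Psd T) (hT : ∀ x, ⟪T x, x⟫_ℝ ≤ β * ‖x‖ ^ 2) : T.det ≤ β ^ n := by
  obtain ⟨b, l, h1, h2, h3⟩ := spec hs
  rw [h2]
  calc ∏ i, l i ≤ ∏ i : Fin n, β := Finset.prod_le_prod (fun i _ => spec_nonneg hp h1 i) fun i _ => by
        have := hT (b i)
        rwa [h1, inner_smul_left, real_inner_self_eq_norm_sq, b.norm_eq_one, one_pow, mul_one, mul_one] at this
    _ = _ := by simp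

theorem oneA (hn : 0 < n) (hc0 : 0 < c0) (hC0 : 0 ≤ C0) {a : ℝ} (ha : 0 < a) (h : InK c0 C0 (fun x : Eu n => a * (‖x‖ ^ 2 / 2))) : a = 1 := by
  have vb : ∀ (c : Eu n) {r : ℝ}, 0 < r → volume (ball c r) = ENNReal.ofReal (r ^ n) * volume (ball (0 : Eu n) 1) := fun c r hr => by
    rw [Measure.addHaar_ball_of_pos _ _ hr, finrank_euclideanSpace, Fintype.card_fin]
  have b1 : volume (ball (0 : Eu n) 1) ≠ 0 := (measure_ball_pos _ _ one_pos).ne'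
  have b2 : volume (ball (0 : Eu n) 1) ≠ ⊤ := measure_ball_lt_top.ne
  refine le_antisymm ?_ ?_
  · by_contra! h1
    have := abpK hn h hc0 hC0 (m := 0) (α := 1) (β := 0) (A := 0) (b := 0) (fun i => i.elim0) zero_le_one (fun i => i.elim0)
      (K := closedBall (0 : Eu n) 2) (X := ball 0 1) (P := ball 0 ((a + 1) / 2)) (isCompact_closedBall _ _) (by
        rw [interior_closedBall _ (by norm_num)]; exact ball_subset_ball (by norm_num)) measurableSet_ball
      (γ := (a / 2) * (1 - (a + 1) / 2 / a) ^ 2) (by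
        have : (a + 1) / 2 / a < 1 := by rw [div_lt_one ha]; linarith
        have : 0 < 1 - (a + 1) / 2 / a := by linarith
        positivity) (fun p hp => by
          rw [mem_ball_zero_iff] at hp
          have np : ‖a⁻¹ • p‖ ≤ (a + 1) / 2 / a := by
            rw [norm_smul, Real.norm_of_nonneg (by positivity), inv_mul_eq_div]; gcongr
          have l1 : (a + 1) / 2 / a < 1 := by rw [div_lt_one ha]; linarith
          refine ⟨a⁻¹ • p, mem_closedBall_zero_iff.2 (by linarith), fun x _ hx => ?_⟩
          rw [mem_ball_zero_iff, not_lt] at hx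
          have e : ∀ y : Eu n, a * (‖y‖ ^ 2 / 2) - ⟪p, y⟫_ℝ = (a / 2) * ‖y - a⁻¹ • p‖ ^ 2 - ‖p‖ ^ 2 / (2 * a) := fun y => by
            rw [norm_sub_sq_real, inner_smul_right, norm_smul, Real.norm_of_nonneg (by positivity), real_inner_comm]
            field_simp; ring
          simp only [Finset.univ_eq_empty, Finset.sum_empty, one_mul, sub_zero]
          rw [e, e, sub_self, norm_zero]
          have : 1 - (a + 1) / 2 / a ≤ ‖x - a⁻¹ • p‖ := by
            have := norm_sub_norm_le x (a⁻¹ • p); linarith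
          have := pow_le_pow_left₀ (by linarith) this 2
          have := mul_le_mul_of_nonneg_left this (show 0 ≤ a / 2 by positivity)
          linarith)
    rw [vb _ (by positivity), vb 0 one_pos] at this
    simp only [Finset.univ_eq_empty, Finset.sum_empty, sub_zero, one_pow, ENNReal.ofReal_one, one_mul, max_eq_left zero_le_one] at this
    have h2 := (ENNReal.mul_le_mul_iff_left b1 b2).1 (this.trans_eq (one_mul _).symm)
    rw [ENNReal.ofReal_le_one] at h2
    have := one_lt_pow₀ (show 1 < (a + 1) / 2 by linarith) hn.ne'
    linarith
  · by_contra! h1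
    set β := (a + 1) / 2 with hβ
    set δ := β - a with hδ
    have δ0 : 0 < δ := by rw [hδ]; linarith
    have βn : β ^ n < 1 := pow_lt_one₀ (by linarith) (by linarith) hn.ne'
    set V := (volume (ball (0 : Eu n) 1)).toReal with hV
    have V0 : 0 < V := ENNReal.toReal_pos b1 b2
    set q := (δ / 4) ^ n * V with hq
    have q0 : 0 < q := by positivity
    set ε := min (δ / 16) (min (1 - β ^ n) (q / 2)) / 2 with hε
    have εm : 0 < min (δ / 16) (min (1 - β ^ n) (q / 2)) := lt_min (by positivity) (lt_min (by linarith) (by positivity))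
    have ε0 : 0 < ε := by positivity
    have ε1 : ε < δ / 16 := by have := min_le_left (δ / 16) (min (1 - β ^ n) (q / 2)); linarith
    have ε2 : ε < 1 - β ^ n := by have := (min_le_right (δ / 16) _).trans (min_le_left (1 - β ^ n) (q / 2)); linarith
    have ε3 : ε < q := by have := (min_le_right (δ / 16) _).trans (min_le_right (1 - β ^ n) (q / 2)); linarith
    obtain ⟨u, G, H, g, g1, g2⟩ := h 1 ε ε0
    have C := ((C2.hsq (0 : Eu n)).smul β).add (g.toC2.smul (-1))
    simp only [sub_zero] at C
    have val : ∀ x d, ⟪(β • ContinuousLinearMap.id ℝ (Eu n) + (-1 : ℝ) • H x) d, d⟫_ℝ = β * ‖d‖ ^ 2 - ⟪H x d, d⟫_ℝ := fun x d => by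
      simp [inner_add_left, inner_sub_left, inner_smul_left, ← sub_eq_add_neg]
    have sy : ∀ x, Sy (β • ContinuousLinearMap.id ℝ (Eu n) + (-1 : ℝ) • H x) := fun x a b => by
      simp only [ContinuousLinearMap.add_apply, ContinuousLinearMap.smul_apply, ContinuousLinearMap.id_apply, inner_add_left, inner_add_right,
        inner_smul_left, inner_smul_right, g.symm x a b]; simp
    have key := abp_meas C (K := closedBall 0 1) (X := ball 0 1) (P := ball 0 (δ / 4)) (Bd := bad H ε) (isCompact_closedBall _ _)
      (by rw [interior_closedBall _ one_ne_zero]) measurableSet_ball (fun p hp => by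
        refine ⟨0, by simp, fun x hx hx' => ?_⟩
        rw [mem_ball_zero_iff] at hp hx'
        rw [mem_closedBall_zero_iff] at hx
        have e : ‖x‖ = 1 := le_antisymm hx (not_lt.1 hx')
        have a1 := g1 x hx
        have a2 := g1 0 (by simp)
        have a3 := real_inner_le_norm p x
        rw [abs_le] at a1 a2
        simp only [norm_zero, inner_zero_right, e] at *
        linarith [a1.1, a1.2, a2.1, a2.2]) (c1 := 0) (c2 := 1) (g.toC2.badm ε).measurableSet (fun x _ hx hpsd => by
          exfalso
          have := det_le_of (g.symm x) (g.pos x).psd (β := β) (fun d => by have := hpsd d; rw [val] at this; linarith)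
          apply hx
          change ε < |_|
          rw [abs_sub_comm]
          exact lt_of_lt_of_le (by linarith) (le_abs_self _)) (fun x _ _ hpsd => by
          have d0 := (det_le_tr hn (sy x) hpsd).1
          rw [abs_of_nonneg d0]
          exact (det_le_of (sy x) hpsd (β := β) fun d => by rw [val]; linarith [(g.pos x).psd d]).trans βn.le)
    rw [ENNReal.ofReal_zero, zero_mul, zero_add, ENNReal.ofReal_one, one_mul, vb _ (by positivity)] at key
    have k2 : volume (bad H ε ∩ ball 0 1) ≤ ENNReal.ofReal ε := by
      rw [inter_comm]; exact (measure_mono (inter_subset_inter_left _ ball_subset_closedBall)).trans g2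
    have k3 := key.trans k2
    rw [← ENNReal.ofReal_toReal b2, ← ENNReal.ofReal_mul (by positivity)] at k3
    have := (ENNReal.ofReal_le_ofReal_iff ε0.le).1 k3
    linarith

theorem blow (hn : 0 < n) (hc0 : 0 < c0) (hc1 : c0 ≤ 1) (hC0 : 1 ≤ C0) (hwK : InK c0 C0 w) (hw : Nm c0 C0 w) {ε : ℝ} (hε : 0 < ε) :
    ∃ s S, 1 ≤ s ∧ s ^ n = ContinuousLinearMap.det (S : Eu n →L[ℝ] Eu n) ^ 2 ∧ ∀ ξ : Eu n, ‖ξ‖ ≤ 1 → |s⁻¹ * w (S ξ) - ‖ξ‖ ^ 2 / 2| ≤ ε := by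
  obtain ⟨Λ, hΛ0, hΛ⟩ := upQ hn hc0 hc1 hC0 hwK hw
  set I := ContinuousLinearMap.id ℝ (Eu n) with hI
  set wk : ℕ → Eu n → ℝ := fun j x => ((4:ℝ) ^ j)⁻¹ * w (((2:ℝ) ^ j • I) x) with hwk
  have hdet : ∀ j : ℕ, ((4:ℝ) ^ j) ^ n = ((2:ℝ) ^ j • I).det ^ 2 := fun j => by
    rw [det_smul', det_id', mul_one, ← pow_mul, ← pow_mul, ← pow_mul, show (4:ℝ) = 2 ^ 2 by norm_num, ← pow_mul]
    congr 1; ring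
  have hNm : ∀ j, Nm c0 C0 (wk j) := fun j => hw.compA (by positivity) (hdet j)
  have hK : ∀ j, InK c0 C0 (wk j) := fun j => by
    simpa [hwk] using hwK.compA (s := (4:ℝ) ^ j) (by positivity) (hdet j) 0 0 0
  have wle : ∀ x, w x ≤ Λ * ‖x‖ ^ 2 := fun x => by
    have := hΛ x 0
    simp only [dd, zero_add, zero_sub, hw.z] at this
    linarith [hw.nn (-x)]
  obtain ⟨W, hW, hcv⟩ := ultra hNm (fun ρ => ⟨Λ * ρ ^ 2, fun j x hx => by
    have := wle (((2:ℝ) ^ j • I) x)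
    have e : ‖((2:ℝ) ^ j • I) x‖ ^ 2 = 4 ^ j * ‖x‖ ^ 2 := by
      rw [ContinuousLinearMap.smul_apply, hI, ContinuousLinearMap.id_apply, norm_smul, mul_pow, norm_pow, Real.norm_ofNat, ← pow_mul, mul_comm j, pow_mul]
      norm_num
    rw [e] at this
    calc wk j x ≤ ((4:ℝ) ^ j)⁻¹ * (Λ * (4 ^ j * ‖x‖ ^ 2)) := mul_le_mul_of_nonneg_left this (by positivity)
      _ = Λ * ‖x‖ ^ 2 := by field_simp
      _ ≤ _ := by gcongr⟩)
  have hWK : InK c0 C0 W := InK.lim fun r ε hε => by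
    obtain ⟨k, h⟩ := (hcv r ε hε).exists
    exact ⟨_, hK k, h⟩
  have wkd : ∀ j h x, dd (wk j) h x = ((4:ℝ) ^ j)⁻¹ * dd w ((2:ℝ) ^ j • h) ((2:ℝ) ^ j • x) := fun j h x => by
    simp only [dd, hwk, hI, ContinuousLinearMap.smul_apply, ContinuousLinearMap.id_apply, smul_add, smul_sub]; ring
  have const : ∀ h x, dd W h x = dd W h 0 := by
    have : ∀ h, ∃ M, ∀ x, dd W h x = M := fun h => by
      obtain ⟨M, hM, hI⟩ := meanS hn hc0 hc1 hC0 hwK hw h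
      refine ⟨M, fun x0 => le_antisymm ?_ ?_⟩
      · refine le_of_forall_pos_le_add fun e he => ?_
        obtain ⟨j, hj⟩ := (hcv (‖x0‖ + ‖h‖) (e / 4) (by positivity)).exists
        have a1 := hj (x0 + h) (norm_add_le _ _)
        have a2 := hj (x0 - h) (norm_sub_le _ _)
        have a3 := hj x0 (by linarith [norm_nonneg h])
        have a4 := (avg hw.inW hM j).1 ((2:ℝ) ^ j • x0)
        have a5 : dd (wk j) h x0 ≤ M := by
          rw [wkd, inv_mul_le_iff₀ (by positivity)]; exact a4
        simp only [dd] at a5 ⊢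
        rw [abs_le] at a1 a2 a3
        linarith
      · by_contra! hlt
        set δ := M - dd W h x0 with hδ
        have δ0 : 0 < δ := by linarith
        obtain ⟨r, r0, hr⟩ := Metric.continuous_iff.1 (hW.inW.dd_cont h) x0 (δ / 2) (by positivity)
        set N := ‖x0‖ + r + ‖h‖ + 1 with hN
        have N0 : 0 < N := by positivity
        set e := δ / 4 * r ^ n / (2 * (N + ‖h‖) ^ n) with he
        have e0 : 0 < e := by positivity
        obtain ⟨R0, hR0⟩ := hI e e0
        have ev : ∀ᶠ j in (hyperfilter ℕ : Filter ℕ), R0 ≤ (2:ℝ) ^ j * (N + ‖h‖) := by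
          refine Filter.Eventually.filter_mono (hyperfilter_le_cofinite.trans Nat.cofinite_eq_atTop.le) ?_
          exact ((tendsto_pow_atTop_atTop_of_one_lt (one_lt_two (α := ℝ))).atTop_mul_const (by positivity)).eventually_ge_atTop R0
        obtain ⟨j, hj, hjR⟩ := ((hcv N (δ / 16) (by positivity)).and ev).exists
        have low : ∀ x ∈ ball ((2:ℝ) ^ j • x0) (2 ^ j * r), 4 ^ j * (δ / 4) ≤ 4 ^ j * M - dd w ((2:ℝ) ^ j • h) x := fun x hx => by
          set y := ((2:ℝ) ^ j)⁻¹ • x with hy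
          have xe : x = (2:ℝ) ^ j • y := by rw [hy, smul_inv_smul₀ (by positivity)]
          have yd : ‖y - x0‖ < r := by
            rw [mem_ball, dist_eq_norm, xe, ← smul_sub, norm_smul, norm_pow, Real.norm_ofNat] at hx
            exact lt_of_mul_lt_mul_left hx (by positivity)
          have yn : ‖y‖ ≤ ‖x0‖ + r := by have := norm_add_le (y - x0) x0; rw [sub_add_cancel] at this; linarith
          have a1 := hj (y + h) ((norm_add_le _ _).trans (by linarith))
          have a2 := hj (y - h) ((norm_sub_le _ _).trans (by linarith))
          have a3 := hj y (by linarith [norm_nonneg h])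
          have a4 := hr y (by rwa [dist_eq_norm])
          rw [Real.dist_eq, abs_lt] at a4
          have a5 := wkd j h y
          rw [← xe, eq_inv_mul_iff_mul_eq₀ (by positivity)] at a5
          rw [← a5, ← mul_sub]
          refine mul_le_mul_of_nonneg_left ?_ (by positivity)
          simp only [dd] at a4 ⊢
          simp only [dd] at hδ
          rw [abs_le] at a1 a2 a3
          linarith
        have up := (avg hw.inW hM j).2 (2 ^ j * N)
        rw [← mul_add] at up
        replace up := up.trans (mul_le_mul_right (hR0 _ hjR) _)
        have sub : ball ((2:ℝ) ^ j • x0) (2 ^ j * r) ⊆ closedBall 0 (2 ^ j * N) := fun x hx => by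
          rw [mem_closedBall_zero_iff]; rw [mem_ball, dist_eq_norm] at hx
          have := norm_add_le (x - (2:ℝ) ^ j • x0) ((2:ℝ) ^ j • x0)
          rw [sub_add_cancel, norm_smul, norm_pow, Real.norm_ofNat] at this
          have h2 : (2:ℝ) ^ j * N = 2 ^ j * ‖x0‖ + 2 ^ j * r + 2 ^ j * (‖h‖ + 1) := by rw [hN]; ring
          have : 0 ≤ (2:ℝ) ^ j * (‖h‖ + 1) := by positivity
          linarith
        have dn : ENNReal.ofReal (4 ^ j * (δ / 4)) * volume (ball ((2:ℝ) ^ j • x0) (2 ^ j * r)) ≤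
            ∫⁻ x in closedBall (0 : Eu n) (2 ^ j * N), ENNReal.ofReal (4 ^ j * M - dd w ((2:ℝ) ^ j • h) x) := by
          rw [← setLIntegral_const]
          refine le_trans (setLIntegral_mono' measurableSet_ball fun x hx => ENNReal.ofReal_le_ofReal (low x hx)) (lintegral_mono_set sub)
        have fin := dn.trans up
        have b1 : volume (ball (0 : Eu n) 1) ≠ 0 := (measure_ball_pos _ _ one_pos).ne'
        have b2 : volume (ball (0 : Eu n) 1) ≠ ⊤ := measure_ball_lt_top.ne
        rw [Measure.addHaar_ball_of_pos _ ((2:ℝ) ^ j • x0) (by positivity), Measure.addHaar_closedBall _ _ (by positivity), finrank_euclideanSpace, Fintype.card_fin,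
          ← mul_assoc, ← mul_assoc, ← mul_assoc, ENNReal.mul_le_mul_iff_left b1 b2, show (4:ℝ≥0∞) ^ j = ENNReal.ofReal (4 ^ j) by
            rw [ENNReal.ofReal_pow (by norm_num), ENNReal.ofReal_ofNat], ← ENNReal.ofReal_mul (by positivity), ← ENNReal.ofReal_mul (by positivity),
          ← ENNReal.ofReal_mul (by positivity), ENNReal.ofReal_le_ofReal_iff (by positivity), mul_pow, mul_pow] at fin
        have e1 : (4:ℝ) ^ j * e * ((2 ^ j) ^ n * (N + ‖h‖) ^ n) = 4 ^ j * (δ / 4) * ((2 ^ j) ^ n * r ^ n) / 2 := by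
          rw [he]; field_simp
        have : 0 < 4 ^ j * (δ / 4) * (((2:ℝ) ^ j) ^ n * r ^ n) := by positivity
        linarith
    intro h x
    obtain ⟨M, hM⟩ := this h
    rw [hM, hM]
  have E : ∀ x h, W (x + h) + W (x - h) - 2 * W x = W h + W (-h) := fun x h => by
    have := const h x
    simpa [dd, hW.z] using this
  have Oadd : ∀ x, W ((2:ℝ) • x) - W (-((2:ℝ) • x)) = 2 * (W x - W (-x)) := fun x => by
    have e1 := E x x
    have e2 := E (-x) x
    rw [sub_self, hW.z, ← two_smul ℝ] at e1
    rw [neg_add_cancel, hW.z, show -x - x = -((2:ℝ) • x) by module] at e2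
    linarith
  have Eadd : ∀ x, W ((2:ℝ) • x) + W (-((2:ℝ) • x)) = 4 * (W x + W (-x)) := fun x => by
    have e1 := E x x
    have e2 := E (-x) x
    rw [sub_self, hW.z, ← two_smul ℝ] at e1
    rw [neg_add_cancel, hW.z, show -x - x = -((2:ℝ) • x) by module] at e2
    linarith
  have even : ∀ x, W (-x) = W x := fun x => by
    have k : ∀ (m : ℕ) (x : Eu n), 2 ^ m * |W x - W (-x)| ≤ W x + W (-x) := fun m => by
      induction m with
      | zero =>
        intro x; rw [pow_zero, one_mul, abs_le]; constructor <;> linarith [hW.nn x, hW.nn (-x)]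
      | succ m ih =>
        intro x
        have h1 := ih ((1/2:ℝ) • x)
        have h2 := Oadd ((1/2:ℝ) • x)
        have h3 := Eadd ((1/2:ℝ) • x)
        rw [smul_smul, show (2:ℝ) * (1/2) = 1 by norm_num, one_smul] at h2 h3
        rw [h2, h3, abs_mul, abs_two, pow_succ]
        linarith
    have h0 : W x - W (-x) = 0 := by
      by_contra hne
      have h1 : 0 < |W x - W (-x)| := abs_pos.2 hne
      obtain ⟨m, hm⟩ := pow_unbounded_of_one_lt ((W x + W (-x)) / |W x - W (-x)|) (one_lt_two (α := ℝ))
      rw [div_lt_iff₀ h1] at hm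
      linarith [k m x]
    linarith
  obtain ⟨P, Ps, hP⟩ := parQ hW.inW.cont (fun x h => by have := E x h; rw [even h] at this; linarith)
  obtain ⟨lo, hi, hlo, hlh, hq⟩ := exQuad hn hc0 hc1 hC0 hWK hW
  have Pp : Pd P := fun x hx => by
    have := hq.low 0 0 (fun y => by rw [hW.z, inner_zero_left, add_zero]; exact hW.nn y) x
    rw [zero_add, hW.z, inner_zero_left, hP] at this
    have h2 : 0 < lo * ‖x‖ ^ 2 := by have := norm_pos_iff.2 hx; positivity
    linarith
  obtain ⟨S, hS, hSd⟩ := exS Ps Pp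
  have Sd : S.det ≠ 0 := fun h => by rw [h] at hSd; simp at hSd
  have WS : ∀ ξ, W (S ξ) = ‖ξ‖ ^ 2 / 2 := fun ξ => by
    have := congrArg (fun T : Eu n →L[ℝ] Eu n => ⟪T ξ, ξ⟫_ℝ) hS
    simp only [ContinuousLinearMap.comp_apply, ContinuousLinearMap.id_apply, ContinuousLinearMap.adjoint_inner_left, real_inner_self_eq_norm_sq] at this
    rw [hP, this]
  obtain ⟨a, a0, ha⟩ := exs hn Sd
  have a1 : a⁻¹ = 1 := oneA (c0 := c0) (C0 := C0) hn hc0 (by linarith) (inv_pos.2 a0) (by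
    simpa [WS] using hWK.compA a0 ha 0 0 0)
  rw [inv_eq_one] at a1
  obtain ⟨j, hj⟩ := (hcv ‖S‖ ε hε).exists
  refine ⟨4 ^ j, ((2:ℝ) ^ j • I).comp S, one_le_pow₀ (by norm_num), ?_, fun ξ hξ => ?_⟩
  · rw [det_cmp, mul_pow, ← hdet, ← ha, a1, one_pow, mul_one]
  · have := hj (S ξ) ((S.le_opNorm ξ).trans (mul_le_of_le_one_right (norm_nonneg _) hξ))
    rw [WS] at this
    exact this

theorem A1 (hn : 0 < n) (hc0 : 0 < c0) (hc1 : c0 ≤ 1) (hC0 : 1 ≤ C0) (g : Good c0 C0 u G H) (u0 : ∀ x, 0 ≤ u x) (uz : u 0 = 0)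
    (hfar : ∀ ε : ℝ, 0 < ε → ∃ R, ∀ x, R < ‖x‖ → |(H x).det - 1| ≤ ε) {ε N : ℝ} (hε : 0 < ε) :
    ∃ s S, N ≤ s ∧ 0 < s ∧ s ^ n = ContinuousLinearMap.det (S : Eu n →L[ℝ] Eu n) ^ 2 ∧
      ∀ ξ : Eu n, ‖ξ‖ ≤ 1 → |s⁻¹ * u (S ξ) - ‖ξ‖ ^ 2 / 2| ≤ ε := by
  have hu : Nm c0 C0 u := ⟨g.toW, u0, uz⟩
  obtain ⟨D, hD, hL⟩ := L1 (n := n) hn hc0 hc1 hC0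
  obtain ⟨C1, hC1, hdb⟩ := doubling (n := n) hn hc0 hc1 hC0
  choose s A hA using fun k : ℕ => hL u hu ((k:ℝ) + 1) (by positivity)
  set wk : ℕ → Eu n → ℝ := fun k x => (s k)⁻¹ * u (A k x) with hwk
  have hNm : ∀ k, Nm c0 C0 (wk k) := fun k => hu.compA (hA k).pos (hA k).det
  obtain ⟨W, hW, hcv⟩ := ultra hNm (fun ρ => by
    obtain ⟨M, hM0, hM⟩ := locB hdb hC1 hD (max ρ 0) (le_max_right _ _)
    refine ⟨M * D, fun k x hx => ?_⟩
    obtain ⟨c, hc, hc2⟩ := (hA k).sim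
    refine hM (wk k) (hNm k) c D hc (fun l hl => ?_) x (hx.trans (le_max_left _ _))
    have := (hc2 l hl).trans (hA k).Rs
    have h2 := (hA k).pos
    rw [hwk]; dsimp only
    rw [inv_mul_le_iff₀ h2]; linarith)
  have big : ∀ N : ℝ, ∀ᶠ k in (hyperfilter ℕ : Filter ℕ), N ≤ s k := fun N => by
    refine Filter.Eventually.filter_mono (hyperfilter_le_cofinite.trans Nat.cofinite_eq_atTop.le) ?_
    refine (tendsto_natCast_atTop_atTop (R := ℝ)).eventually_ge_atTop (D * N) |>.mono fun k hk => ?_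
    have := (hA k).Rs
    exact le_of_mul_le_mul_left (show D * N ≤ D * s k by linarith) (by linarith)
  have hWK : InK c0 C0 W := fun r ε hε => by
    obtain ⟨R, hR⟩ := hfar ε hε
    set V := (volume (closedBall (0 : Eu n) R)).toReal with hV
    obtain ⟨k, h1, h2⟩ := ((hcv r ε hε).and (big (max 1 ((V / ε) ^ 2)))).exists
    refine ⟨_, _, _, g.compA (hA k).pos (hA k).det 0 0 0, fun x hx => by simpa [hwk] using h1 x hx, ?_⟩
    have s1 : 1 ≤ s k := (le_max_left _ _).trans h2
    have s2 : (V / ε) ^ 2 ≤ s k := (le_max_right _ _).trans h2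
    have d1 : s k ≤ (A k).det ^ 2 := by rw [← (hA k).det]; exact le_self_pow₀ s1 hn.ne'
    have hd : (A k).det ≠ 0 := fun h => by rw [h] at d1; norm_num at d1; linarith
    have d2 : V / ε ≤ |(A k).det| := by
      refine abs_le_of_sq_le_sq' ?_ (abs_nonneg _) |>.2
      rw [sq_abs]; linarith
    calc _ ≤ volume ((fun x => A k x + 0) ⁻¹' (closedBall 0 R)) := by
          refine measure_mono fun x hx => ?_
          have := hx.2
          simp only [bad, mem_ofPred_eq, add_zero, det_conjs (hA k).pos (hA k).det] at this
          rw [mem_preimage, mem_closedBall_zero_iff, add_zero]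
          by_contra! h
          linarith [hR _ h]
      _ = ENNReal.ofReal |(A k).det⁻¹| * ENNReal.ofReal V := by rw [vol_pre hd 0, hV, ENNReal.ofReal_toReal measure_closedBall_lt_top.ne]
      _ ≤ ENNReal.ofReal ε := by
          rw [← ENNReal.ofReal_mul (abs_nonneg _), abs_inv]
          refine ENNReal.ofReal_le_ofReal ?_
          rw [inv_mul_le_iff₀ (abs_pos.2 hd)]
          rwa [div_le_iff₀ hε] at d2
  obtain ⟨t, S, ht, hS, hb⟩ := blow hn hc0 hc1 hC0 hWK hW (half_pos hε)
  obtain ⟨k, h1, h2⟩ := ((hcv ‖S‖ (ε / 2) (half_pos hε)).and (big (max 1 N))).exists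
  have s1 : 1 ≤ s k := (le_max_left _ _).trans h2
  have s2 : N ≤ s k := (le_max_right _ _).trans h2
  refine ⟨t * s k, (A k).comp S, s2.trans (le_mul_of_one_le_left (by linarith) ht), by positivity, ?_, fun ξ hξ => ?_⟩
  · rw [det_cmp, mul_pow, mul_pow, hS, (hA k).det]; ring
  · have a1 := h1 (S ξ) ((S.le_opNorm ξ).trans (mul_le_of_le_one_right (norm_nonneg _) hξ))
    have a2 := hb ξ hξ
    have t1 : t⁻¹ ≤ 1 := inv_le_one_of_one_le₀ ht
    have t0 : 0 < t⁻¹ := by positivity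
    have e : (t * s k)⁻¹ * u ((A k).comp S ξ) - ‖ξ‖ ^ 2 / 2 = t⁻¹ * (wk k (S ξ) - W (S ξ)) + (t⁻¹ * W (S ξ) - ‖ξ‖ ^ 2 / 2) := by
      simp only [hwk, ContinuousLinearMap.comp_apply]; rw [mul_inv]; ring
    rw [e]
    refine (abs_add_le _ _).trans ?_
    rw [abs_mul, abs_of_pos t0]
    have := mul_le_mul t1 a1 (abs_nonneg _) zero_le_one
    linarith
/-! ### Part 7 : improvement of flatness -/
noncomputable def trC (n : ℕ) : (Eu n →L[ℝ] Eu n) →L[ℝ] ℝ :=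
  LinearMap.toContinuousLinearMap
    { toFun := tr, map_add' := tr_add, map_smul' := fun c A => by simp [tr_smul] }
theorem trC_apply (A : Eu n →L[ℝ] Eu n) : trC n A = tr A := rfl
theorem tr_cont : Continuous (tr : (Eu n →L[ℝ] Eu n) → ℝ) := (trC n).continuous

theorem tr_inner (A : Eu n →L[ℝ] Eu n) :
    tr A = ∑ i, ⟪EuclideanSpace.basisFun (Fin n) ℝ i, A (EuclideanSpace.basisFun (Fin n) ℝ i)⟫_ℝ :=
  LinearMap.trace_eq_sum_inner _ _

theorem tr_rank (a b : Eu n) : tr ((innerSL ℝ a).smulRight b) = ⟪a, b⟫_ℝ := by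
  rw [tr_inner, ← (EuclideanSpace.basisFun (Fin n) ℝ).sum_inner_mul_inner a b]
  simp [inner_smul_right]

theorem C2.ofCD (hu : ContDiff ℝ 2 u) : ∃ G H, C2 u G H := by
  have h1 : ContDiff ℝ 1 (fderiv ℝ u) := hu.fderiv_right (by norm_num)
  have h2 : ContDiff ℝ 1 (fun x => (InnerProductSpace.toDual ℝ (Eu n)).symm (fderiv ℝ u x)) :=
    (LinearIsometryEquiv.contDiff _).comp h1
  refine ⟨fun x => (InnerProductSpace.toDual ℝ (Eu n)).symm (fderiv ℝ u x), _, fun x => ?_,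
    fun x => (h2.differentiable (by norm_num) x).hasFDerivAt, h2.continuous_fderiv (by norm_num)⟩
  refine ((hu.differentiable (by norm_num) x).hasFDerivAt).congr_fderiv ?_
  ext y
  simp

theorem csup {E : Type*} [Zero E] {f : Eu n → E} {R : ℝ} (h : ∀ x, R < ‖x‖ → f x = 0) : HasCompactSupport f :=
  HasCompactSupport.intro (isCompact_closedBall 0 R) fun x hx => h x (by simpa using hx)

theorem cint {f : Eu n → ℝ} (hf : Continuous f) {R : ℝ} (h : ∀ x, R < ‖x‖ → f x = 0) : Integrable f :=
  hf.integrable_of_hasCompactSupport (csup h)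

theorem divP (h : C2 v G H) {a : Eu n → ℝ} {ga : Eu n → Eu n} (ha : ∀ x, HasFDerivAt a (innerSL ℝ (ga x)) x)
    (hga : Continuous ga) {R : ℝ} (h0 : ∀ x, R < ‖x‖ → a x • G x = 0) :
    ∫ x, (a x * tr (H x) + ⟪ga x, G x⟫_ℝ) = 0 := by
  set F' : Eu n → (Eu n →L[ℝ] Eu n) := fun x => a x • H x + (innerSL ℝ (ga x)).smulRight (G x) with hF'
  have hF : ∀ x, HasFDerivAt (fun x => a x • G x) (F' x) x := fun x => (ha x).smul (h.hess x)
  have ca : Continuous a := continuous_iff_continuousAt.2 fun x => (ha x).continuousAt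
  have cG := h.contG
  have cH := h.cont
  have c1 : Continuous F' := by
    have : Continuous fun x => innerSL ℝ (ga x) := (innerSL ℝ : Eu n →L[ℝ] _).continuous.comp hga
    exact (ca.smul cH).add (((ContinuousLinearMap.smulRightL ℝ (Eu n) (Eu n)).continuous.comp this).clm_apply cG)
  have s0 : HasCompactSupport (fun x => a x • G x) := csup h0
  have s1 : HasCompactSupport F' := by
    have : F' = fderiv ℝ (fun x => a x • G x) := funext fun x => (hF x).fderiv.symm
    rw [this]; exact s0.fderiv ℝ
  have e : ∀ x, a x * tr (H x) + ⟪ga x, G x⟫_ℝ = ∑ i, ⟪EuclideanSpace.basisFun (Fin n) ℝ i,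
      F' x (EuclideanSpace.basisFun (Fin n) ℝ i)⟫_ℝ := fun x => by
    rw [← tr_inner, hF']; simp only [tr_add, tr_smul, tr_rank]
  simp_rw [e]
  have ii : ∀ b : Eu n, Integrable fun x => ⟪b, F' x b⟫_ℝ := fun b =>
    (by fun_prop : Continuous fun x => ⟪b, F' x b⟫_ℝ).integrable_of_hasCompactSupport
      (s1.comp_left (g := fun T : Eu n →L[ℝ] Eu n => ⟪b, T b⟫_ℝ) (by simp))
  rw [integral_finsetSum _ fun i _ => ii _]
  refine Finset.sum_eq_zero fun i _ => ?_
  set b := EuclideanSpace.basisFun (Fin n) ℝ i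
  have t : ∫ x, ⟪b, F' x b⟫_ℝ = - ∫ x, ⟪(0:Eu n), a x • G x⟫_ℝ :=
    integral_bilinear_hasFDerivAt_right_eq_neg_left_of_integrable (μ := (volume : Measure (Eu n)))
      (f := fun _ => b) (f' := fun _ => 0) (g := fun x => a x • G x) (g' := F') (v := b) (B := innerSL ℝ)
      ((integrable_zero (Eu n) ℝ volume).congr (Eventually.of_forall fun x => (inner_zero_left (𝕜 := ℝ) (a x • G x)).symm)) (ii b)
      ((by fun_prop : Continuous fun x => ⟪b, a x • G x⟫_ℝ).integrable_of_hasCompactSupport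
        (s0.comp_left (g := fun y : Eu n => ⟪b, y⟫_ℝ) (by simp)))
      (fun x _ => hasFDerivAt_const _ _) (fun x _ => hF x)
  rw [t]; simp

structure Bm {n : ℕ} (R M : ℝ) (χ : Eu n → ℝ) (G : Eu n → Eu n) (H : Eu n → (Eu n →L[ℝ] Eu n)) : Prop
    extends C2 χ G H where
  z : ∀ x, R < ‖x‖ → χ x = 0 ∧ G x = 0 ∧ H x = 0
  M0 : 0 ≤ M
  b0 : ∀ x, |χ x| ≤ M
  b1 : ∀ x, ‖G x‖ ≤ M
  b2 : ∀ x, ‖H x‖ ≤ M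
  bt : ∀ x, |tr (H x)| ≤ M

theorem exBm {χ : Eu n → ℝ} (hχ : ContDiff ℝ 2 χ) {R : ℝ} (h0 : ∀ x, R < ‖x‖ → χ x = 0) :
    ∃ M G H, Bm R M χ G H := by
  obtain ⟨G, H, h⟩ := C2.ofCD hχ
  have op : ∀ x : Eu n, R < ‖x‖ → ∀ᶠ y in 𝓝 x, R < ‖y‖ := fun x hx =>
    continuous_norm.continuousAt.eventually (lt_mem_nhds hx)
  have g0 : ∀ x, R < ‖x‖ → G x = 0 := fun x hx => by
    have e : (fun _ => (0:ℝ)) =ᶠ[𝓝 x] χ := (op x hx).mono fun y hy => (h0 y hy).symm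
    have := ((h.grad x).congr_of_eventuallyEq e).unique (hasFDerivAt_const 0 x)
    simpa using congrArg (fun f => f (G x)) this
  have k0 : ∀ x, R < ‖x‖ → H x = 0 := fun x hx => by
    have e : (fun _ => (0:Eu n)) =ᶠ[𝓝 x] G := (op x hx).mono fun y hy => (g0 y hy).symm
    exact ((h.hess x).congr_of_eventuallyEq e).unique (hasFDerivAt_const 0 x)
  obtain ⟨M0, m0⟩ := h.contu.bounded_above_of_compact_support (csup h0)
  obtain ⟨M1, m1⟩ := h.contG.bounded_above_of_compact_support (csup g0)
  obtain ⟨M2, m2⟩ := h.cont.bounded_above_of_compact_support (csup k0)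
  obtain ⟨M3, m3⟩ := (tr_cont.comp h.cont).bounded_above_of_compact_support
    (csup (R := R) fun x hx => by simp [k0 x hx, tr])
  have p0 := (norm_nonneg _).trans (m0 0)
  have p1 := (norm_nonneg _).trans (m1 0)
  have p2 := (norm_nonneg _).trans (m2 0)
  have p3 := (norm_nonneg _).trans (m3 0)
  exact ⟨M0 + M1 + M2 + M3, G, H, h, fun x hx => ⟨h0 x hx, g0 x hx, k0 x hx⟩, by positivity,
    fun x => (m0 x).trans (by linarith), fun x => (m1 x).trans (by linarith),
    fun x => (m2 x).trans (by linarith), fun x => (m3 x).trans (by linarith)⟩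

theorem exCut {r R : ℝ} (hr : 0 < r) (hR : r < R) : ∃ (χ : Eu n → ℝ) (M : ℝ) (G : Eu n → Eu n)
    (H : Eu n → (Eu n →L[ℝ] Eu n)), Bm R M χ G H ∧ (∀ x, 0 ≤ χ x) ∧ (∀ x, ‖x‖ ≤ r → χ x = 1) := by
  let b : ContDiffBump (0 : Eu n) := ⟨r, R, hr, hR⟩
  obtain ⟨M, G, H, h⟩ := exBm (χ := b) b.contDiff (R := R) fun x hx =>
    b.zero_of_le_dist (by simpa using hx.le)
  exact ⟨b, M, G, H, h, fun x => b.nonneg, fun x hx => b.one_of_mem_closedBall (by simpa using hx)⟩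

theorem C2.taylor (h : C2 u G H) (y d : Eu n) {b M : ℝ}
    (hM : ∀ t ∈ Icc (0:ℝ) 1, |⟪H (y + t • d) d, d⟫_ℝ - b| ≤ M) :
    |u (y + d) - u y - ⟪G y, d⟫_ℝ - b / 2| ≤ M := by
  have M0 : 0 ≤ M := (abs_nonneg _).trans (hM 0 (by simp))
  have s1 : ∀ t ∈ Icc (0:ℝ) 1, |⟪G (y + t • d), d⟫_ℝ - ⟪G y, d⟫_ℝ - b * t| ≤ M := fun t ht => by
    have := (convex_Icc (0:ℝ) 1).norm_image_sub_le_of_norm_hasDerivWithin_le (C := M)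
      (f := fun t => ⟪G (y + t • d), d⟫_ℝ - b * t) (f' := fun t => ⟪H (y + t • d) d, d⟫_ℝ - b * 1)
      (fun s _ => ((h.seg2 y d s).sub ((hasDerivAt_id s).const_mul b)).hasDerivWithinAt)
      (fun s hs => by simpa using hM s hs) (x := 0) (y := t) (by simp) ht
    simp only [Real.norm_eq_abs, zero_smul, add_zero, mul_zero, sub_zero, abs_of_nonneg ht.1] at this
    rw [show ⟪G (y + t • d), d⟫_ℝ - ⟪G y, d⟫_ℝ - b * t = ⟪G (y + t • d), d⟫_ℝ - b * t - ⟪G y, d⟫_ℝ by ring]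
    nlinarith [ht.2]
  have := (convex_Icc (0:ℝ) 1).norm_image_sub_le_of_norm_hasDerivWithin_le (C := M)
      (f := fun t => u (y + t • d) - (⟪G y, d⟫_ℝ * t + b / 2 * t ^ 2))
      (f' := fun t => ⟪G (y + t • d), d⟫_ℝ - (⟪G y, d⟫_ℝ * 1 + b / 2 * (2 * t)))
      (fun s _ => ((h.seg y d s).sub (((hasDerivAt_id s).const_mul _).add
        (((hasDerivAt_pow 2 s).const_mul (b/2)).congr_deriv (by norm_num)))).hasDerivWithinAt)
      (fun s hs => by
        rw [Real.norm_eq_abs]; convert s1 s hs using 2; ring) (x := 0) (y := 1) (by simp) (by simp)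
  simp only [Real.norm_eq_abs, zero_smul, add_zero, mul_zero, sub_zero, one_smul, abs_one, mul_one] at this
  convert this using 2; ring
noncomputable def vB (n : ℕ) : ℝ := volume.real (closedBall (0 : Eu n) 1)
theorem vB0 : 0 ≤ vB n := measureReal_nonneg

theorem ibd2 {f : Eu n → ℝ} {S Bd : Set (Eu n)} {a b β : ℝ} (hS : MeasurableSet S) (hS1 : S ⊆ closedBall 0 1)
    (hf : IntegrableOn f S) (hBd : MeasurableSet Bd) (hβ : volume (closedBall 0 1 ∩ Bd) ≤ ENNReal.ofReal β)
    (hβ0 : 0 ≤ β) (ha : 0 ≤ a) (hb : 0 ≤ b) (h1 : ∀ x ∈ S, x ∉ Bd → f x ≤ a) (h2 : ∀ x ∈ S, f x ≤ a + b) :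
    ∫ x in S, f x ≤ a * vB n + b * β := by
  have fin : volume (closedBall (0:Eu n) 1) ≠ ⊤ := measure_closedBall_lt_top.ne
  have finS : volume S ≠ ⊤ := ((measure_mono hS1).trans_lt measure_closedBall_lt_top).ne
  have i1 : IntegrableOn (fun _ : Eu n => a) S := integrableOn_const finS
  have i2 : IntegrableOn (Bd.indicator fun _ : Eu n => b) S := (integrableOn_const finS).indicator hBd
  calc ∫ x in S, f x ≤ ∫ x in S, (a + Bd.indicator (fun _ => b) x) := by
        refine setIntegral_mono_on hf (i1.add i2) hS fun x hx => ?_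
        by_cases hx2 : x ∈ Bd
        · simpa [hx2] using h2 x hx
        · simpa [hx2] using h1 x hx hx2
    _ = a * volume.real S + b * volume.real (Bd ∩ S) := by
        rw [integral_add i1 i2, integral_indicator hBd, Measure.restrict_restrict hBd]
        simp [mul_comm]
    _ ≤ _ := by
        have e1 : volume.real S ≤ vB n := measureReal_mono hS1 fin
        have e2 : volume.real (Bd ∩ S) ≤ β := by
          refine ENNReal.toReal_le_of_le_ofReal hβ0 ((measure_mono ?_).trans hβ)
          exact fun x hx => ⟨hS1 hx.2, hx.1⟩
        exact add_le_add (mul_le_mul_of_nonneg_left e1 ha) (mul_le_mul_of_nonneg_left e2 hb)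

theorem toB {f : Eu n → ℝ} {R : ℝ} (h : ∀ x, R < ‖x‖ → f x = 0) : ∫ x in closedBall 0 R, f x = ∫ x, f x :=
  setIntegral_eq_integral_of_forall_compl_eq_zero fun x hx => h x (by simpa using hx)

theorem ibd {f : Eu n → ℝ} (hf : Continuous f) {M : ℝ} (hM : 0 ≤ M) (h : ∀ x, ‖x‖ ≤ 1 → |f x| ≤ M)
    (h0 : ∀ x, 1 < ‖x‖ → f x = 0) : |∫ x, f x| ≤ M * vB n := by
  have k : ∀ g : Eu n → ℝ, Continuous g → (∀ x, ‖x‖ ≤ 1 → g x ≤ M) → (∀ x, 1 < ‖x‖ → g x = 0) →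
      ∫ x, g x ≤ M * vB n := fun g hg h1 h2 => by
    rw [← toB h2]
    have := ibd2 (f := g) (Bd := ∅) (β := 0) (a := M) (b := 0) measurableSet_closedBall subset_rfl
      ((cint hg h2).integrableOn) MeasurableSet.empty (by simp) le_rfl hM le_rfl
      (fun x hx _ => h1 x (by simpa using hx)) (fun x hx => by simpa using h1 x (by simpa using hx))
    simpa using this
  rw [abs_le]
  have a1 := k f hf (fun x hx => (abs_le.1 (h x hx)).2) h0
  have a2 := k (fun x => - f x) hf.neg (fun x hx => by linarith [(abs_le.1 (h x hx)).1])
    (fun x hx => by simp [h0 x hx])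
  rw [integral_neg] at a2
  constructor <;> linarith

theorem C2.subsq (h : C2 u G H) : C2 (fun x => u x - ‖x‖ ^ 2 / 2) (fun x => G x - x)
    (fun x => H x - ContinuousLinearMap.id ℝ (Eu n)) := by
  have := h.add ((C2.hsq (0:Eu n)).smul (-1))
  convert this using 2 <;> simp [sub_eq_add_neg]
  ext1 y; simp

theorem tr_subid (A : Eu n →L[ℝ] Eu n) : tr (A - ContinuousLinearMap.id ℝ (Eu n)) = tr A - n := by
  rw [← tr_id]; simp [tr]

/-- Flatness at unit scale -/
structure Fl {n : ℕ} (c0 C0 ε : ℝ) (u : Eu n → ℝ) (G : Eu n → Eu n) (H : Eu n → (Eu n →L[ℝ] Eu n)) : Prop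
    extends Good c0 C0 u G H where
  e0 : 0 < ε
  e1 : ε ≤ 1 / 1000
  fl : ∀ x, ‖x‖ ≤ 1 → |u x - ‖x‖ ^ 2 / 2| ≤ ε
  bv : volume (closedBall 0 1 ∩ bad H (ε ^ 2)) ≤ ENNReal.ofReal (ε ^ 2)

variable {ε : ℝ}

theorem Fl.lap (f : Fl c0 C0 ε u G H) (hn : 0 < n) (x : Eu n) : -(n:ℝ) ≤ tr (H x) - n ∧
    (x ∉ bad H (ε ^ 2) → - (n * ε ^ 2) ≤ tr (H x) - n) := by
  obtain ⟨h1, h2, h3⟩ := det_le_tr hn (f.symm x) (f.pos x).psd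
  have hn' : (0:ℝ) < n := by exact_mod_cast hn
  refine ⟨by linarith, fun hx => ?_⟩
  simp only [bad, mem_ofPred_eq, not_lt] at hx
  have e0 := f.e0
  have e1 := f.e1
  have e2 : ε ^ 2 ≤ 1 := by nlinarith
  have k1 : 1 - ε ^ 2 ≤ (tr (H x) / n) ^ n := by linarith [(abs_le.1 hx).1]
  have k2 : (1 - ε ^ 2) ^ n ≤ (tr (H x) / n) ^ n :=
    (pow_le_of_le_one (by linarith) (by linarith [sq_nonneg ε]) hn.ne').trans k1
  have k3 := le_of_pow_le_pow_left₀ hn.ne' (by positivity) k2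
  rw [le_div_iff₀ hn'] at k3
  linarith

/-- `∫χ|Δv| ≤ ∫χΔv + Cε²` -/
theorem Fl.labs (f : Fl c0 C0 ε u G H) (hn : 0 < n) {χ : Eu n → ℝ} {R M : ℝ} (hR : R ≤ 1) (hc : Continuous χ)
    (hz : ∀ x, R < ‖x‖ → χ x = 0) (hM : 0 ≤ M) (hχM : ∀ x, χ x ≤ M) (hχ : ∀ x, 0 ≤ χ x) :
    ∫ x, χ x * |tr (H x) - n| ≤ (∫ x, χ x * (tr (H x) - n)) + 2 * M * n * (vB n + 1) * ε ^ 2 := by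
  have ct : Continuous fun x => tr (H x) - n := (tr_cont.comp f.cont).sub continuous_const
  have z1 : ∀ x, 1 < ‖x‖ → χ x = 0 := fun x hx => hz x (by linarith)
  have i1 : Integrable fun x => χ x * |tr (H x) - n| := cint (hc.mul ct.abs) (R := 1) fun x hx => by simp [z1 x hx]
  have i2 : Integrable fun x => χ x * (tr (H x) - n) := cint (hc.mul ct) (R := 1) fun x hx => by simp [z1 x hx]
  have e : ∫ x, (χ x * |tr (H x) - n| - χ x * (tr (H x) - n)) ≤ 2 * M * n * ε ^ 2 * vB n + 2 * M * n * ε ^ 2 := by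
    rw [← toB (R := 1) fun x hx => by simp [z1 x hx]]
    have nn : ∀ e x, 0 ≤ e → - e ≤ tr (H x) - n → χ x * |tr (H x) - n| - χ x * (tr (H x) - n) ≤ M * (2 * e) := by
      intro e x he h1
      rw [← mul_sub]
      refine mul_le_mul (hχM x) ?_ (by linarith [le_abs_self (tr (H x) - n)]) hM
      rcases abs_cases (tr (H x) - n) with h | h <;> linarith
    refine ibd2 measurableSet_closedBall subset_rfl (i1.sub i2).integrableOn (f.badm (ε ^ 2)).measurableSet f.bv
      (sq_nonneg _) (by positivity) (by positivity) (fun x _ hx => ?_) (fun x _ => ?_)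
    · linarith [nn _ x (by positivity) ((f.lap hn x).2 hx)]
    · have : 0 ≤ 2 * M * n * ε ^ 2 := by positivity
      linarith [nn _ x (by positivity) (f.lap hn x).1]
  rw [integral_sub i1 i2] at e
  linarith

theorem Fl.byp (f : Fl c0 C0 ε u G H) {χ : Eu n → ℝ} {Gχ : Eu n → Eu n} {Hχ : Eu n → (Eu n →L[ℝ] Eu n)} {R M : ℝ}
    (b : Bm R M χ Gχ Hχ) (hR : R ≤ 1) :
    ∫ x, χ x * (tr (H x) - n) = - ∫ x, ⟪Gχ x, G x - x⟫_ℝ ∧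
    ∫ x, χ x * (tr (H x) - n) = ∫ x, (u x - ‖x‖ ^ 2 / 2) * tr (Hχ x) ∧
    |∫ x, χ x * (tr (H x) - n)| ≤ ε * M * vB n := by
  have hv := f.toC2.subsq
  have z1 : ∀ x, 1 < ‖x‖ → χ x = 0 ∧ Gχ x = 0 ∧ Hχ x = 0 := fun x hx => b.z x (by linarith)
  have cu := f.contu; have cG := f.contG; have cχ := b.contu; have cGχ := b.contG
  have ct := tr_cont.comp f.cont; have ctχ := tr_cont.comp b.cont
  have d1 := divP hv b.grad b.contG (R := 1) fun x hx => by simp [z1 x hx]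
  have d2 := divP b.toC2 hv.grad hv.contG (R := 1) fun x hx => by simp [z1 x hx]
  simp only [tr_subid] at d1
  have i1 : Integrable fun x => χ x * (tr (H x) - n) :=
    cint (cχ.mul (ct.sub continuous_const)) (R := 1) fun x hx => by simp [z1 x hx]
  have i2 : Integrable fun x => ⟪Gχ x, G x - x⟫_ℝ := cint (by fun_prop) (R := 1) fun x hx => by simp [z1 x hx]
  have c3 : Continuous fun x => (u x - ‖x‖ ^ 2 / 2) * tr (Hχ x) := (by fun_prop : Continuous fun x => u x - ‖x‖^2/2).mul ctχ
  have z3 : ∀ x, 1 < ‖x‖ → (u x - ‖x‖ ^ 2 / 2) * tr (Hχ x) = 0 := fun x hx => by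
    rw [(z1 x hx).2.2]; simp [tr]
  have i3 := cint c3 z3
  have i4 : Integrable fun x => ⟪G x - x, Gχ x⟫_ℝ := i2.congr (Eventually.of_forall fun x => real_inner_comm _ _)
  rw [integral_add i1 i2] at d1
  rw [integral_add i3 i4] at d2
  have e4 : ∫ x, ⟪G x - x, Gχ x⟫_ℝ = ∫ x, ⟪Gχ x, G x - x⟫_ℝ := integral_congr_ae (Eventually.of_forall fun x => real_inner_comm _ _)
  have e : ∫ x, χ x * (tr (H x) - n) = ∫ x, (u x - ‖x‖ ^ 2 / 2) * tr (Hχ x) := by linarith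
  refine ⟨by linarith, e, ?_⟩
  rw [e]
  refine ibd c3 (mul_nonneg f.e0.le b.M0) (fun x hx => ?_) z3
  rw [abs_mul]
  exact mul_le_mul (f.fl x hx) (b.bt x) (abs_nonneg _) f.e0.le

/-- `∫χ|∇v|² ≤ Cε²` -/
theorem Fl.grd (f : Fl c0 C0 ε u G H) (hn : 0 < n) {χ : Eu n → ℝ} {Gχ : Eu n → Eu n} {Hχ : Eu n → (Eu n →L[ℝ] Eu n)} {R M : ℝ}
    (b : Bm R M χ Gχ Hχ) (hR : R ≤ 1) (hχ : ∀ x, 0 ≤ χ x) :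
    ∫ x, χ x * ‖G x - x‖ ^ 2 ≤ 2 * (M * (2 * n + 1) * (vB n + 1)) * ε ^ 2 := by
  have hv := f.toC2.subsq
  have e0 := f.e0; have e1 := f.e1; have M0 := b.M0; have v0 := vB0 (n := n)
  have z1 : ∀ x, 1 < ‖x‖ → χ x = 0 ∧ Gχ x = 0 ∧ Hχ x = 0 := fun x hx => b.z x (by linarith)
  have cu := f.contu; have cG := f.contG; have cχ := b.contu; have cGχ := b.contG
  have ct : Continuous fun x => tr (H x) - n := (tr_cont.comp f.cont).sub continuous_const
  have ctχ : Continuous fun x => tr (Hχ x) := tr_cont.comp b.cont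
  have L1 : ∫ x, χ x * |tr (H x) - n| ≤ M * (2 * n + 1) * (vB n + 1) * ε := by
    have a1 := f.labs hn hR cχ (fun x hx => (b.z x hx).1) M0 (fun x => (abs_le.1 (b.b0 x)).2) hχ
    have a2 := (abs_le.1 (f.byp b hR).2.2).2
    have a3 : 2 * M * n * (vB n + 1) * ε ^ 2 ≤ 2 * M * n * (vB n + 1) * ε :=
      mul_le_mul_of_nonneg_left (by nlinarith) (by positivity)
    have a4 : 0 ≤ M * ε := by positivity
    nlinarith
  have d1 := divP hv (a := fun x => χ x * (u x - ‖x‖^2/2)) (ga := fun x => χ x • (G x - x) + (u x - ‖x‖^2/2) • Gχ x)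
    (fun x => ((b.grad x).mul (hv.grad x)).congr_fderiv (by ext y; simp [inner_add_left, inner_smul_left]))
    (by fun_prop) (R := 1) fun x hx => by simp [z1 x hx]
  have d2 := divP b.toC2 (a := fun x => (u x - ‖x‖^2/2)^2) (ga := fun x => (2 * (u x - ‖x‖^2/2)) • (G x - x))
    (fun x => ((hv.grad x).pow 2).congr_fderiv (by ext y; simp [inner_smul_left])) (by fun_prop) (R := 1)
    fun x hx => by simp [z1 x hx]
  simp only [tr_subid] at d1
  have i1 : Integrable fun x => χ x * (u x - ‖x‖^2/2) * (tr (H x) - n) :=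
    cint ((by fun_prop : Continuous fun x => χ x * (u x - ‖x‖^2/2)).mul ct) (R := 1) fun x hx => by simp [z1 x hx]
  have i2 : Integrable fun x => χ x * ‖G x - x‖ ^ 2 := cint (by fun_prop) (R := 1) fun x hx => by simp [z1 x hx]
  have i3 : Integrable fun x => (u x - ‖x‖^2/2) * ⟪Gχ x, G x - x⟫_ℝ := cint (by fun_prop) (R := 1) fun x hx => by simp [z1 x hx]
  have c4 : Continuous fun x => (u x - ‖x‖ ^ 2 / 2) ^ 2 * tr (Hχ x) := (by fun_prop : Continuous fun x => (u x - ‖x‖^2/2)^2).mul ctχ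
  have z4 : ∀ x, 1 < ‖x‖ → (u x - ‖x‖ ^ 2 / 2) ^ 2 * tr (Hχ x) = 0 := fun x hx => by
    rw [(z1 x hx).2.2]; simp [tr]
  have i4 := cint c4 z4
  have i5 : Integrable fun x => χ x * |tr (H x) - n| := cint (cχ.mul ct.abs) (R := 1) fun x hx => by simp [z1 x hx]
  have E1 : (∫ x, χ x * (u x - ‖x‖^2/2) * (tr (H x) - n)) + ((∫ x, χ x * ‖G x - x‖ ^ 2) +
      ∫ x, (u x - ‖x‖^2/2) * ⟪Gχ x, G x - x⟫_ℝ) = 0 := by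
    have s1 : Integrable fun x => χ x * ‖G x - x‖ ^ 2 + (u x - ‖x‖^2/2) * ⟪Gχ x, G x - x⟫_ℝ := i2.add i3
    rw [← d1, ← integral_add i2 i3, ← integral_add i1 s1]
    refine integral_congr_ae (Eventually.of_forall fun x => ?_)
    simp only [inner_add_left, inner_smul_left, real_inner_self_eq_norm_sq]; simp
  have E2 : (∫ x, (u x - ‖x‖ ^ 2 / 2) ^ 2 * tr (Hχ x)) + 2 * ∫ x, (u x - ‖x‖^2/2) * ⟪Gχ x, G x - x⟫_ℝ = 0 := by
    rw [← d2, ← integral_const_mul, ← integral_add i4 (i3.const_mul 2)]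
    refine integral_congr_ae (Eventually.of_forall fun x => ?_)
    have e := real_inner_comm (Gχ x) (G x - x)
    simp only [inner_smul_left, e]; simp; ring
  have B1 : -∫ x, χ x * (u x - ‖x‖^2/2) * (tr (H x) - n) ≤ ε * ∫ x, χ x * |tr (H x) - n| := by
    rw [← integral_neg, ← integral_const_mul]
    refine integral_mono i1.neg (i5.const_mul ε) fun x => ?_
    by_cases hx : 1 < ‖x‖
    · simp [z1 x hx]
    · have h1 := f.fl x (by linarith)
      have : |(u x - ‖x‖^2/2) * (tr (H x) - n)| ≤ ε * |tr (H x) - n| := by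
        rw [abs_mul]; exact mul_le_mul_of_nonneg_right h1 (abs_nonneg _)
      have := mul_le_mul_of_nonneg_left ((neg_le_abs _).trans this) (hχ x)
      simp only; linarith
  have B2 := (abs_le.1 (ibd c4 (M := ε ^ 2 * M) (by positivity) (fun x hx => by
    rw [abs_mul, abs_pow]
    exact mul_le_mul (pow_le_pow_left₀ (abs_nonneg _) (f.fl x hx) 2) (b.bt x) (abs_nonneg _) (by positivity)) z4)).2
  have B3 := mul_le_mul_of_nonneg_left L1 e0.le
  have : ε ^ 2 * M * vB n ≤ 2 * ((M * (2 * n + 1) * (vB n + 1)) * ε ^ 2) := by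
    have : 0 ≤ ε ^ 2 * M := by positivity
    have h2 : (0:ℝ) ≤ n := by positivity
    have : 0 ≤ ε ^ 2 * M * vB n := by positivity
    have : 0 ≤ ε ^ 2 * M * vB n * n := by positivity
    have : 0 ≤ ε ^ 2 * M * n := by positivity
    linarith
  linarith
theorem Fl.gb (f : Fl c0 C0 ε u G H) {x : Eu n} (hx : ‖x‖ ≤ 3 / 4) : ‖G x - x‖ ≤ 4 := by
  have e1 := f.e1
  have := grad_le (x := x) (p := G x) (ρ := 1/4) (M := 1/2 + 2 * ε) (by norm_num) fun y hy => by
    have h1 : ‖y‖ ≤ 1 := by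
      have := norm_add_le (y - x) x
      rw [sub_add_cancel] at this; linarith
    have h2 := (abs_le.1 (f.fl y h1)).2
    have h3 := (abs_le.1 (f.fl x (by linarith))).1
    have h4 := f.conv x y
    have : ‖y‖ ^ 2 ≤ 1 := by nlinarith [norm_nonneg y]
    nlinarith [sq_nonneg ‖x‖]
  have h5 := norm_sub_le (G x) x
  linarith

theorem Fl.img (f : Fl c0 C0 ε u G H) : closedBall (0:Eu n) (5/8) ⊆ G '' ball 0 (3/4) := by
  have := abp_core f.toC2 (K := closedBall 0 1) (X := ball 0 (3/4)) (P := closedBall 0 (5/8))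
    (isCompact_closedBall 0 1) (by
      rw [interior_closedBall _ (by norm_num)]; exact ball_subset_ball (by norm_num)) ?_
  · exact this.trans (image_mono fun x hx => hx.1)
  · intro p hp
    have hp' : ‖p‖ ≤ 5/8 := by simpa using hp
    refine ⟨p, closedBall_subset_closedBall (by norm_num) hp, fun x hx hx2 => ?_⟩
    have hx' : ‖x‖ ≤ 1 := by simpa using hx
    have hx3 : 3/4 ≤ ‖x‖ := by simpa using hx2
    have h1 := (abs_le.1 (f.fl p (by linarith))).2
    have h2 := (abs_le.1 (f.fl x hx')).1
    have h3 := norm_sub_norm_le x p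
    have h4 := norm_sub_sq_real x p
    rw [real_inner_comm] at h4
    have h5 : (1/8:ℝ)^2 ≤ ‖x - p‖ ^ 2 := pow_le_pow_left₀ (by norm_num) (by linarith) 2
    rw [real_inner_self_eq_norm_sq]
    linarith [f.e1]

theorem Fl.transp (f : Fl c0 C0 ε u G H) (hc0 : 0 < c0) {g : Eu n → ℝ} (hg : Continuous g)
    (h0 : ∀ x, 5/8 < ‖x‖ → g x = 0) :
    ∫ x in ball 0 (3/4), (H x).det * g (G x) = ∫ x in ball 0 (3/4), g x := by
  have h1 := integral_image_eq_integral_abs_det_fderiv_smul (volume : Measure (Eu n)) (s := ball 0 (3/4))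
    measurableSet_ball (fun x _ => (f.hess x).hasFDerivWithinAt) f.inj.injOn g
  have h2 : ∫ x in G '' ball 0 (3/4), g x = ∫ x, g x :=
    setIntegral_eq_integral_of_forall_compl_eq_zero fun x hx => h0 x (by
      by_contra h; exact hx (f.img (by simpa using h)))
  have h3 : ∫ x in ball 0 (3/4), g x = ∫ x, g x :=
    setIntegral_eq_integral_of_forall_compl_eq_zero fun x hx => h0 x (by
      have : 3/4 ≤ ‖x‖ := by simpa using hx
      linarith)
  rw [h3, ← h2, h1]
  refine integral_congr_ae (Eventually.of_forall fun x => ?_)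
  simp only [smul_eq_mul]
  rw [abs_of_pos (hc0.trans_le (f.lo x))]

theorem lapL1 (hn : 0 < n) (hc0 : 0 < c0) (hC0 : 1 ≤ C0) : ∃ C, 0 ≤ C ∧ ∀ (u : Eu n → ℝ) G H ε,
    Fl c0 C0 ε u G H → ∫ x in closedBall 0 (9/16), |tr (H x) - n| ≤ C * ε ^ 2 := by
  obtain ⟨χ, M, Gχ, Hχ, b, χ0, χ1⟩ := exCut (n := n) (r := 3/4) (R := 7/8) (by norm_num) (by norm_num)
  obtain ⟨g, m, Gg, Hg, bg, g0, g1⟩ := exCut (n := n) (r := 9/16) (R := 5/8) (by norm_num) (by norm_num)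
  have M0 := b.M0; have m0 := bg.M0; have v0 := vB0 (n := n)
  set C1 := 2 * (M * (2 * n + 1) * (vB n + 1)) with hC1
  refine ⟨C0 * m * C1 + 5 * m * vB n + (C0 + 1) * (5 * m) + 2 * m * n * (vB n + 1), by positivity, fun u G H ε f => ?_⟩
  have e0 := f.e0; have e1 := f.e1
  have cu := f.contu; have cG := f.contG; have cχ := b.contu; have cg := bg.contu; have cGg := bg.contG
  have cd := f.contdet
  have ct : Continuous fun x => tr (H x) - n := (tr_cont.comp f.cont).sub continuous_const
  have S1 : ball (0:Eu n) (3/4) ⊆ closedBall 0 1 := ball_subset_closedBall.trans (closedBall_subset_closedBall (by norm_num))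
  have io : ∀ k : Eu n → ℝ, Continuous k → IntegrableOn k (ball 0 (3/4)) := fun k hk =>
    (hk.continuousOn.integrableOn_compact (isCompact_closedBall 0 1)).mono_set S1
  have gr : ∫ x in ball 0 (3/4), ‖G x - x‖ ^ 2 ≤ C1 * ε ^ 2 := by
    refine le_trans ?_ (f.grd hn b (by norm_num) χ0)
    have i : Integrable fun x => χ x * ‖G x - x‖ ^ 2 := cint (by fun_prop) (R := 7/8) fun x hx => by simp [b.z x hx]
    refine le_trans ?_ (setIntegral_le_integral (s := ball 0 (3/4)) i
      (Eventually.of_forall fun x => mul_nonneg (χ0 x) (sq_nonneg _)))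
    refine setIntegral_mono_on (io _ (by fun_prop)) i.integrableOn measurableSet_ball fun x hx => ?_
    rw [χ1 x (by simpa using (mem_ball.1 hx).le), one_mul]
  have key : ∀ σ : ℝ, |σ| = 1 → ∫ x in ball 0 (3/4), σ * ⟪Gg x, G x - x⟫_ℝ ≤
      (C0 * m * C1 + 5 * m * vB n + (C0 + 1) * (5 * m)) * ε ^ 2 := by
    intro σ hσ
    have t := f.transp hc0 cg fun x hx => (bg.z x hx).1
    have e : ∫ x in ball 0 (3/4), (σ * ⟪Gg x, G x - x⟫_ℝ + σ * ((H x).det * g (G x) - g x)) =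
        ∫ x in ball 0 (3/4), σ * ⟪Gg x, G x - x⟫_ℝ := by
      rw [integral_add (io _ (by fun_prop)) (io _ (by fun_prop)), integral_const_mul (r := σ) (f := fun x => (H x).det * g (G x) - g x),
        integral_sub (io _ (by fun_prop)) (io _ (by fun_prop)), t]
      simp
    have k : ∫ x in ball 0 (3/4), ((σ * ⟪Gg x, G x - x⟫_ℝ - σ * ((H x).det * g (G x) - g x)) - C0 * m * ‖G x - x‖ ^ 2) ≤
        (ε ^ 2 * (5 * m)) * vB n + ((C0 + 1) * (5 * m)) * ε ^ 2 := by
      have pt : ∀ x ∈ ball (0:Eu n) (3/4), (σ * ⟪Gg x, G x - x⟫_ℝ - σ * ((H x).det * g (G x) - g x)) - C0 * m * ‖G x - x‖ ^ 2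
          ≤ |(H x).det - 1| * (5 * m) := fun x hx => by
        have ty := bg.taylor x (G x - x) (b := 0) (M := m * ‖G x - x‖ ^ 2) fun t _ => by
          rw [sub_zero]
          refine (abs_real_inner_le_norm _ _).trans ?_
          rw [sq, ← mul_assoc]
          exact mul_le_mul_of_nonneg_right ((ContinuousLinearMap.le_opNorm _ _).trans
            (mul_le_mul_of_nonneg_right (bg.b2 _) (norm_nonneg _))) (norm_nonneg _)
        rw [add_sub_cancel, zero_div, sub_zero] at ty
        set q := g (G x) - g x - ⟪Gg x, G x - x⟫_ℝ
        set p := g x + ⟪Gg x, G x - x⟫_ℝ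
        have d0 := hc0.trans_le (f.lo x)
        have p1 : |p| ≤ 5 * m := by
          have := (abs_real_inner_le_norm (Gg x) (G x - x)).trans (mul_le_mul (bg.b1 x)
            (f.gb (x := x) (by simpa using (mem_ball.1 hx).le)) (norm_nonneg _) m0)
          linarith [abs_add_le (g x) ⟪Gg x, G x - x⟫_ℝ, bg.b0 x]
        have id : σ * ⟪Gg x, G x - x⟫_ℝ - σ * ((H x).det * g (G x) - g x) = (-σ) * ((H x).det * q) + (-σ) * (((H x).det - 1) * p) := by
          simp only [q, p]; ring
        have a1 : (-σ) * ((H x).det * q) ≤ C0 * (m * ‖G x - x‖ ^ 2) := by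
          refine (le_abs_self _).trans ?_
          rw [abs_mul, abs_neg, hσ, one_mul, abs_mul, abs_of_pos d0]
          exact mul_le_mul (f.hi x) ty (abs_nonneg _) (by linarith)
        have a2 : (-σ) * (((H x).det - 1) * p) ≤ |(H x).det - 1| * (5 * m) := by
          refine (le_abs_self _).trans ?_
          rw [abs_mul, abs_neg, hσ, one_mul, abs_mul]
          exact mul_le_mul_of_nonneg_left p1 (abs_nonneg _)
        rw [id]; linarith
      refine ibd2 measurableSet_ball S1 (io _ (by fun_prop)) (f.badm (ε ^ 2)).measurableSet f.bv (sq_nonneg _)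
        (by positivity) (by positivity) (fun x hx hx2 => (pt x hx).trans ?_) (fun x hx => (pt x hx).trans ?_)
      · simp only [bad, mem_ofPred_eq, not_lt] at hx2
        exact mul_le_mul_of_nonneg_right hx2 (by positivity)
      · have : |(H x).det - 1| ≤ C0 + 1 := by
          rw [abs_le]; constructor <;> linarith [f.lo x, f.hi x]
        have := mul_le_mul_of_nonneg_right this (by positivity : 0 ≤ 5 * m)
        have : 0 ≤ ε ^ 2 * (5 * m) := by positivity
        linarith
    have e2 : ∫ x in ball 0 (3/4), ((σ * ⟪Gg x, G x - x⟫_ℝ - σ * ((H x).det * g (G x) - g x)) - C0 * m * ‖G x - x‖ ^ 2) =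
        (∫ x in ball 0 (3/4), σ * ⟪Gg x, G x - x⟫_ℝ) - C0 * m * ∫ x in ball 0 (3/4), ‖G x - x‖ ^ 2 := by
      rw [integral_sub (io _ (by fun_prop)) (io _ (by fun_prop)), integral_const_mul (r := C0 * m),
        integral_sub (io _ (by fun_prop)) (io _ (by fun_prop)), integral_const_mul (r := σ) (f := fun x => (H x).det * g (G x) - g x),
        integral_sub (io _ (by fun_prop)) (io _ (by fun_prop)), t]
      simp
    rw [e2] at k
    have := mul_le_mul_of_nonneg_left gr (by positivity : 0 ≤ C0 * m)
    linarith
  have k1 := key (-1) (by simp)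
  have e3 : ∫ x in ball 0 (3/4), (-1) * ⟪Gg x, G x - x⟫_ℝ = ∫ x, g x * (tr (H x) - n) := by
    rw [(f.byp bg (by norm_num)).1, ← integral_neg]
    simp only [neg_one_mul]
    refine setIntegral_eq_integral_of_forall_compl_eq_zero fun x hx => ?_
    have : 3/4 ≤ ‖x‖ := by simpa using hx
    rw [(bg.z x (by linarith)).2.1]; simp
  rw [e3] at k1
  have k2 := f.labs hn (R := 5/8) (by norm_num) cg (fun x hx => (bg.z x hx).1) m0 (fun x => (abs_le.1 (bg.b0 x)).2) g0
  have i : Integrable fun x => g x * |tr (H x) - n| := cint (cg.mul ct.abs) (R := 5/8) fun x hx => by simp [bg.z x hx]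
  have k3 : ∫ x in closedBall 0 (9/16), |tr (H x) - n| ≤ ∫ x, g x * |tr (H x) - n| := by
    refine le_trans ?_ (setIntegral_le_integral (s := closedBall 0 (9/16)) i
      (Eventually.of_forall fun x => mul_nonneg (g0 x) (abs_nonneg _)))
    refine setIntegral_mono_on (ct.abs.continuousOn.integrableOn_compact (isCompact_closedBall 0 _)) i.integrableOn measurableSet_closedBall fun x hx => ?_
    rw [g1 x (by simpa using hx), one_mul]
  linarith
theorem exMol (n : ℕ) : ∃ (Ψ η : Eu n → ℝ) (m : ℝ), ContDiff ℝ 2 η ∧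
    (∀ y, HasFDerivAt Ψ (innerSL ℝ ((-η y) • y)) y) ∧ 0 ≤ m ∧ (∀ y, |Ψ y| ≤ m) ∧ (∀ y, 0 ≤ η y) ∧
    (∀ y, 1 < ‖y‖ → Ψ y = 0 ∧ η y = 0) ∧ ∫ y, η y = 1 := by
  let q : ℝ → ℝ := fun t => (t⁻¹) ^ 2 * expNegInvGlue t
  have hq : ∀ t, HasDerivAt expNegInvGlue (q t) t := fun t => by
    simpa [q] using expNegInvGlue.hasDerivAt_polynomial_eval_inv_mul 1 t
  have cq : ContDiff ℝ 2 q := by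
    have := expNegInvGlue.contDiff_polynomial_eval_inv_mul (n := 2) (Polynomial.X ^ 2)
    simpa [q] using this
  let η0 : Eu n → ℝ := fun y => 2 * q (1 - ‖y‖ ^ 2)
  let Ψ0 : Eu n → ℝ := fun y => expNegInvGlue (1 - ‖y‖ ^ 2)
  have cη : ContDiff ℝ 2 η0 := contDiff_const.mul (cq.comp (contDiff_const.sub (contDiff_norm_sq ℝ)))
  have dΨ : ∀ y, HasFDerivAt Ψ0 (innerSL ℝ ((-η0 y) • y)) y := fun y => by
    have h1 : HasFDerivAt (fun y : Eu n => 1 - ‖y‖ ^ 2) (-(2 • innerSL ℝ y)) y := by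
      simpa using ((hasFDerivAt_id y).norm_sq).const_sub 1
    refine ((hq _).comp_hasFDerivAt y h1).congr_fderiv ?_
    ext z
    simp [η0, inner_smul_left]; ring
  have cΨ : Continuous Ψ0 := continuous_iff_continuousAt.2 fun x => (dΨ x).continuousAt
  have zz : ∀ y : Eu n, 1 ≤ ‖y‖ → expNegInvGlue (1 - ‖y‖ ^ 2) = 0 := fun y hy =>
    expNegInvGlue.zero_of_nonpos (by nlinarith)
  have z0 : ∀ y, 1 < ‖y‖ → Ψ0 y = 0 := fun y hy => zz y hy.le
  have z1 : ∀ y, 1 < ‖y‖ → η0 y = 0 := fun y hy => by simp [η0, q, zz y hy.le]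
  have n1 : ∀ y, 0 ≤ η0 y := fun y => by
    have := expNegInvGlue.nonneg (1 - ‖y‖ ^ 2)
    simp only [η0, q]; positivity
  have pos : 0 < ∫ y, η0 y := by
    refine cη.continuous.integral_pos_of_hasCompactSupport_nonneg_nonzero (csup z1) n1 (x := 0) ?_
    have := expNegInvGlue.pos_of_pos (x := 1) one_pos
    simp [η0, q, this.ne']
  obtain ⟨m, hm⟩ := cΨ.bounded_above_of_compact_support (csup z0)
  set c := ∫ y, η0 y
  refine ⟨fun y => c⁻¹ * Ψ0 y, fun y => c⁻¹ * η0 y, c⁻¹ * m, contDiff_const.mul cη, fun y => ?_,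
    mul_nonneg (inv_pos.2 pos).le ((norm_nonneg _).trans (hm 0)), fun y => ?_, fun y => mul_nonneg (inv_pos.2 pos).le (n1 y),
    fun y hy => by simp [z0 y hy, z1 y hy], ?_⟩
  · refine ((dΨ y).const_mul c⁻¹).congr_fderiv ?_
    ext z; simp [inner_smul_left]; ring
  · rw [abs_mul, abs_of_pos (inv_pos.2 pos)]
    exact mul_le_mul_of_nonneg_left (hm y) (inv_pos.2 pos).le
  · rw [integral_const_mul, inv_mul_cancel₀ pos.ne']

theorem C2.scl (h : C2 v G H) (s : ℝ) (x : Eu n) :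
    C2 (fun y => v (x + s • y)) (fun y => s • G (x + s • y)) (fun y => (s * s) • H (x + s • y)) := by
  have hA : ∀ y : Eu n, HasFDerivAt (fun y => x + s • y) (s • ContinuousLinearMap.id ℝ (Eu n)) y := fun y =>
    ((hasFDerivAt_id y).const_smul s).const_add x
  refine ⟨fun y => ?_, fun y => ?_, ?_⟩
  · refine ((h.grad _).comp y (hA y)).congr_fderiv ?_
    ext z; simp [inner_smul_left, inner_smul_right]
  · refine (((h.hess _).comp y (hA y)).const_smul s).congr_fderiv ?_
    ext1 z; simp [mul_smul]
  · have := h.cont; fun_prop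

theorem mollId (h : C2 v G H) {Ψ η : Eu n → ℝ} (cη : Continuous η) (dΨ : ∀ y, HasFDerivAt Ψ (innerSL ℝ ((-η y) • y)) y)
    (z : ∀ y, 1 < ‖y‖ → Ψ y = 0 ∧ η y = 0) (h1 : ∫ y, η y = 1) (x : Eu n) :
    (∫ y, η y * v (x + (1/4:ℝ) • y)) - v x =
      ∫ s in (0:ℝ)..(1/4), ∫ y in closedBall 0 1, s * (Ψ y * tr (H (x + s • y))) := by
  have cΨ : Continuous Ψ := continuous_iff_continuousAt.2 fun x => (dΨ x).continuousAt
  have cv := h.contu; have cG := h.contG; have cH := h.cont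
  have ct := tr_cont (n := n)
  have e1 : (∫ y, η y * v (x + (1/4:ℝ) • y)) - v x = ∫ y, η y * (v (x + (1/4:ℝ) • y) - v x) := by
    have i1 : Integrable fun y => η y * v (x + (1/4:ℝ) • y) := cint (by fun_prop) (R := 1) fun y hy => by simp [z y hy]
    have i2 : Integrable fun y => η y * v x := cint (by fun_prop) (R := 1) fun y hy => by simp [z y hy]
    simp_rw [mul_sub]
    rw [integral_sub i1 i2, integral_mul_const, h1, one_mul]
  rw [e1, ← toB (R := 1) fun y hy => by simp [z y hy]]
  have e2 : ∀ y, η y * (v (x + (1/4:ℝ) • y) - v x) = ∫ s in (0:ℝ)..(1/4), η y * ⟪G (x + s • y), y⟫_ℝ := fun y => by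
    rw [intervalIntegral.integral_const_mul, intervalIntegral.integral_eq_sub_of_hasDerivAt (fun s _ => h.seg x y s)
      ((by fun_prop : Continuous fun s : ℝ => ⟪G (x + s • y), y⟫_ℝ).intervalIntegrable _ _)]
    simp
  simp_rw [e2]
  rw [← intervalIntegral_integral_swap]
  · refine intervalIntegral.integral_congr_ae (Eventually.of_forall fun s hs => ?_)
    rw [uIoc_of_le (by norm_num)] at hs
    have d := divP (h.scl s x) dΨ (by fun_prop) (R := 1) fun y hy => by simp [z y hy]
    rw [toB (R := 1) fun y hy => by simp [z y hy], toB (R := 1) fun y hy => by simp [z y hy]]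
    have i1 : Integrable fun y => s * (Ψ y * tr (H (x + s • y))) := cint (by fun_prop) (R := 1) fun y hy => by simp [z y hy]
    have i2 : Integrable fun y => η y * ⟪G (x + s • y), y⟫_ℝ := cint (by fun_prop) (R := 1) fun y hy => by simp [z y hy]
    have : ∫ y, s * (s * (Ψ y * tr (H (x + s • y))) - η y * ⟪G (x + s • y), y⟫_ℝ) = 0 := by
      rw [← d]
      refine integral_congr_ae (Eventually.of_forall fun y => ?_)
      have e := real_inner_comm y (G (x + s • y))
      simp only [tr_smul, inner_smul_left, inner_smul_right, ← e]; simp; ring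
    rw [integral_const_mul, integral_sub i1 i2] at this
    have := (mul_eq_zero.1 this).resolve_left hs.1.ne'
    linarith
  · rw [Measure.prod_restrict]
    have : Continuous (Function.uncurry fun (s : ℝ) (y : Eu n) => η y * ⟪G (x + s • y), y⟫_ℝ) := by
      simp only [Function.uncurry_def]; fun_prop
    refine (this.continuousOn.integrableOn_compact ((isCompact_Icc (a := (0:ℝ)) (b := 1/4)).prod (isCompact_closedBall 0 1))).mono_set
      (prod_mono ?_ subset_rfl)
    rw [uIoc_of_le (by norm_num)]; exact Ioc_subset_Icc_self

theorem mollL1 (h : C2 v G H) {Ψ η : Eu n → ℝ} {m : ℝ} (cη : Continuous η) (dΨ : ∀ y, HasFDerivAt Ψ (innerSL ℝ ((-η y) • y)) y)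
    (z : ∀ y, 1 < ‖y‖ → Ψ y = 0 ∧ η y = 0) (h1 : ∫ y, η y = 1) (hm : ∀ y, |Ψ y| ≤ m) :
    ∫⁻ x in closedBall 0 (1/4), ‖(∫ y, η y * v (x + (1/4:ℝ) • y)) - v x‖ₑ ≤
      ENNReal.ofReal m * volume (closedBall (0:Eu n) 1) * ∫⁻ x in closedBall 0 (9/16), ‖tr (H x)‖ₑ := by
  have ct := tr_cont (n := n); have cH := h.cont
  set μ := volume.restrict (Ioc (0:ℝ) (1/4)) with hμ
  set ν := volume.restrict (closedBall (0:Eu n) 1) with hν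
  have pt : ∀ x, ‖(∫ y, η y * v (x + (1/4:ℝ) • y)) - v x‖ₑ ≤
      ENNReal.ofReal m * ∫⁻ p, ‖tr (H (x + p.1 • p.2))‖ₑ ∂(μ.prod ν) := fun x => by
    rw [mollId h cη dΨ z h1, intervalIntegral.integral_of_le (by norm_num)]
    refine (enorm_integral_le_lintegral_enorm _).trans ?_
    have mm : Measurable fun p : ℝ × Eu n => ‖tr (H (x + p.1 • p.2))‖ₑ :=
      (by fun_prop : Continuous fun p : ℝ × Eu n => tr (H (x + p.1 • p.2))).enorm.measurable
    rw [← lintegral_const_mul _ mm, lintegral_prod _ (mm.const_mul _).aemeasurable]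
    refine setLIntegral_mono' measurableSet_Ioc fun s hs => (enorm_integral_le_lintegral_enorm _).trans ?_
    refine lintegral_mono fun y => ?_
    simp only [enorm_mul, ← mul_assoc]
    gcongr
    rw [← enorm_mul, Real.enorm_eq_ofReal_abs]
    refine ENNReal.ofReal_le_ofReal ?_
    rw [abs_mul, abs_of_pos hs.1]
    have := hm y
    nlinarith [abs_nonneg (Ψ y), hs.1, hs.2]
  have mF : Measurable (Function.uncurry fun (x : Eu n) (p : ℝ × Eu n) => ‖tr (H (x + p.1 • p.2))‖ₑ) := by
    simp only [Function.uncurry_def]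
    exact (by fun_prop : Continuous fun p : Eu n × (ℝ × Eu n) => tr (H (p.1 + p.2.1 • p.2.2))).enorm.measurable
  have mT : Measurable fun x => ‖tr (H x)‖ₑ := (ct.comp cH).enorm.measurable
  calc _ ≤ ∫⁻ x in closedBall 0 (1/4), ENNReal.ofReal m * ∫⁻ p, ‖tr (H (x + p.1 • p.2))‖ₑ ∂(μ.prod ν) := lintegral_mono pt
    _ = ENNReal.ofReal m * ∫⁻ p, (∫⁻ x in closedBall 0 (1/4), ‖tr (H (x + p.1 • p.2))‖ₑ) ∂(μ.prod ν) := by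
        rw [lintegral_const_mul' _ _ ENNReal.ofReal_ne_top, lintegral_lintegral_swap mF.aemeasurable]
    _ ≤ ENNReal.ofReal m * ∫⁻ p, (∫⁻ x in closedBall 0 (9/16), ‖tr (H x)‖ₑ) ∂(μ.prod ν) := by
        refine mul_le_mul' le_rfl ?_
        rw [hμ, hν, Measure.prod_restrict]
        refine setLIntegral_mono' (measurableSet_Ioc.prod measurableSet_closedBall) fun p hp => ?_
        rw [← lintegral_indicator measurableSet_closedBall, ← lintegral_indicator measurableSet_closedBall,
          ← lintegral_add_right_eq_self (μ := volume) (fun x => (closedBall (0:Eu n) (9/16)).indicator (fun x => ‖tr (H x)‖ₑ) x) (p.1 • p.2)]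
        refine lintegral_mono fun x => ?_
        by_cases hx : x ∈ closedBall (0:Eu n) (1/4)
        · have h2 : x + p.1 • p.2 ∈ closedBall (0:Eu n) (9/16) := by
            have a1 : ‖x‖ ≤ 1/4 := by simpa using hx
            have a2 : ‖p.2‖ ≤ 1 := by simpa using hp.2
            have a3 := norm_add_le x (p.1 • p.2)
            rw [norm_smul, Real.norm_eq_abs, abs_of_pos hp.1.1] at a3
            have := mul_le_mul hp.1.2 a2 (norm_nonneg _) (by norm_num)
            simp; linarith
          rw [indicator_of_mem hx, indicator_of_mem h2]
        · rw [indicator_of_notMem hx]; exact zero_le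
    _ ≤ _ := by
        rw [lintegral_const, mul_assoc]
        refine mul_le_mul' le_rfl ?_
        rw [mul_comm]
        refine mul_le_mul' ?_ le_rfl
        rw [hμ, hν, ← univ_prod_univ, Measure.prod_prod, Measure.restrict_apply_univ, Measure.restrict_apply_univ]
        refine (mul_le_mul' (b := 1) ?_ le_rfl).trans (one_mul _).le
        rw [Real.volume_Ioc]
        exact ENNReal.ofReal_le_one.2 (by norm_num)

theorem slide (hn : 0 < n) (h : C2 v G H) {Bd : Set (Eu n)} (hBd : MeasurableSet Bd) {κ η δ β μ C1 : ℝ}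
    (hδ : 0 ≤ δ) (hη : 0 ≤ η) (hβ : 0 ≤ β) (hC1 : 0 ≤ C1) (hκ : 0 < κ)
    (d1 : ∀ (a : ℝ) x, 0 < a → a ≤ 1 → x ∉ Bd → Psd (H x + a • ContinuousLinearMap.id ℝ (Eu n)) →
      |(H x + a • ContinuousLinearMap.id ℝ (Eu n)).det| ≤ (a + δ) ^ n)
    (d2 : ∀ (a : ℝ) x, 0 < a → a ≤ 1 → Psd (H x + a • ContinuousLinearMap.id ℝ (Eu n)) →
      |(H x + a • ContinuousLinearMap.id ℝ (Eu n)).det| ≤ C1)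
    (hL : ∫⁻ x in closedBall 0 1, ‖v x‖ₑ ≤ ENNReal.ofReal η) (hv : volume (closedBall 0 1 ∩ Bd) ≤ ENNReal.ofReal β)
    (hμ : ∀ x, ‖x‖ ≤ 1 → |v x| ≤ μ)
    (k1 : 8 * (16 * 2 ^ n) ^ n * 2 ^ n * η ≤ vB n * κ) (k2 : 2 ^ n * δ ≤ κ)
    (k3 : 2 * C1 * (2 ^ n) ^ n * β ≤ vB n * κ ^ n) (k4 : (8 * 2 ^ n) ^ n * 4 ^ n * μ ^ (n + 2) ≤ κ ^ 2)
    (z : Eu n) (hz : ‖z‖ ≤ 1 / 2) : -κ ≤ v z := by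
  by_contra hlt
  push Not at hlt
  have ω0 : 0 < vB n := by
    rw [vB, measureReal_def]
    exact ENNReal.toReal_pos (measure_closedBall_pos _ _ one_pos).ne' measure_closedBall_lt_top.ne
  have cv := h.contu
  obtain ⟨x0, hx0, hmax⟩ := (isCompact_closedBall (0:Eu n) 1).exists_isMaxOn (f := fun x => -v x * (1 - ‖x‖) ^ n)
    ⟨0, by simp⟩ (by fun_prop)
  have hx0' : ‖x0‖ ≤ 1 := by simpa using hx0
  have F0 : κ * (1/2) ^ n < -v x0 * (1 - ‖x0‖) ^ n := by
    have a1 : -v z * (1 - ‖z‖) ^ n ≤ _ := hmax (show z ∈ closedBall 0 1 by simp; linarith)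
    have a2 : (1/2:ℝ) ^ n ≤ (1 - ‖z‖) ^ n := pow_le_pow_left₀ (by norm_num) (by linarith) n
    have a3 : κ * (1/2:ℝ) ^ n < -v z * (1/2:ℝ) ^ n := mul_lt_mul_of_pos_right (by linarith) (by positivity)
    have a4 := mul_le_mul_of_nonneg_left a2 (show 0 ≤ -v z by linarith)
    linarith
  set d := 1 - ‖x0‖ with hd
  set k := -v x0 with hk
  have dnn : 0 ≤ d := by linarith
  have d1' : d ≤ 1 := by linarith [norm_nonneg x0]
  have d0 : 0 < d := by
    rcases dnn.eq_or_lt with e | e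
    · rw [← e, zero_pow hn.ne'] at F0
      have : 0 < κ * (1/2) ^ n := by positivity
      linarith
    · exact e
  have dn0 : 0 < d ^ n := by positivity
  have kk0 : 0 < k := by
    have : 0 < κ * (1/2) ^ n := by positivity
    by_contra hc
    have := mul_nonpos_of_nonpos_of_nonneg (not_lt.1 hc) dn0.le
    linarith
  have F1 : κ < 2 ^ n * k * d ^ n := by
    have : κ = 2 ^ n * (κ * (1/2) ^ n) := by
      rw [one_div, inv_pow]; field_simp
    rw [this, mul_assoc]
    exact mul_lt_mul_of_pos_left F0 (by positivity)
  have F2 : κ < 2 ^ n * k := F1.trans_le (mul_le_of_le_one_right (by positivity) (pow_le_one₀ dnn d1'))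
  have lowb : ∀ x, ‖x - x0‖ ≤ d / 2 → -(2 ^ n * k) ≤ v x := fun x hx => by
    by_cases hp : 0 ≤ v x
    · linarith [show 0 < 2 ^ n * k by positivity]
    have hx1 : ‖x‖ ≤ 1 - d / 2 := by
      have := norm_add_le x0 (x - x0); rw [add_sub_cancel] at this; linarith
    have a1 : -v x * (1 - ‖x‖) ^ n ≤ k * d ^ n := hmax (show x ∈ closedBall 0 1 by simp; linarith)
    have a2 : (d/2) ^ n ≤ (1 - ‖x‖) ^ n := pow_le_pow_left₀ (by linarith) (by linarith) n
    have a4 := mul_le_mul_of_nonneg_left a2 (show 0 ≤ -v x by linarith)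
    have a5 : -v x * (d / 2) ^ n ≤ (2 ^ n * k) * (d / 2) ^ n := by
      rw [div_pow]; rw [div_pow] at a4
      have : 2 ^ n * k * (d ^ n / 2 ^ n) = k * d ^ n := by field_simp
      linarith
    have := le_of_mul_le_mul_right a5 (by positivity)
    linarith
  set a := 8 * 2 ^ n * k / d ^ 2 with ha
  have a0 : 0 < a := by positivity
  have kμ : k ≤ μ := by have := hμ x0 hx0'; rw [abs_le] at this; linarith
  have ale : a ≤ 1 := by
    by_contra hc
    push Not at hc
    have e1 : 1 < a ^ n := one_lt_pow₀ hc hn.ne'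
    have e2 : a ^ n = (8 * 2 ^ n) ^ n * k ^ n / (d ^ n) ^ 2 := by
      rw [ha, div_pow, mul_pow, ← pow_mul, ← pow_mul, mul_comm 2 n]
    rw [e2, lt_div_iff₀ (by positivity), one_mul] at e1
    have e3 : κ ^ 2 < (2 ^ n * k * d ^ n) ^ 2 := by gcongr
    have e4 : (2 ^ n * k * d ^ n) ^ 2 = 4 ^ n * k ^ 2 * (d ^ n) ^ 2 := by
      rw [show (4:ℝ) = 2 ^ 2 by norm_num, ← pow_mul, mul_comm 2 n, pow_mul]; ring
    have e5 : (8 * 2 ^ n) ^ n * 4 ^ n * k ^ (n + 2) ≤ (8 * 2 ^ n) ^ n * 4 ^ n * μ ^ (n + 2) := by gcongr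
    have e6 := mul_lt_mul_of_pos_left e1 (show 0 < 4 ^ n * k ^ 2 by positivity)
    have e7 : 4 ^ n * k ^ 2 * ((8 * 2 ^ n) ^ n * k ^ n) = (8 * 2 ^ n) ^ n * 4 ^ n * k ^ (n + 2) := by ring
    linarith
  have δa : δ ≤ a := by
    have b1 : δ ≤ k := by
      have : 2 ^ n * δ ≤ 2 ^ n * k := by linarith
      exact le_of_mul_le_mul_left this (by positivity)
    have b2 : k ≤ a := by
      rw [ha, le_div_iff₀ (by positivity)]
      have h1 : d ^ 2 ≤ 1 := pow_le_one₀ dnn d1'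
      have h2 : (1:ℝ) ≤ 2 ^ n := one_le_pow₀ (by norm_num)
      have h3 := mul_le_mul_of_nonneg_left h1 kk0.le
      have h4 := mul_le_mul_of_nonneg_right h2 kk0.le
      linarith
    linarith
  set X := ball x0 (d / 2) ∩ {x | v x < -(k / 4)} with hX
  have Xm : MeasurableSet X := isOpen_ball.measurableSet.inter (isOpen_lt cv continuous_const).measurableSet
  have Xin : X ⊆ closedBall 0 1 := fun x hx => by
    have a1 : dist x x0 < d / 2 := hx.1
    rw [dist_eq_norm] at a1
    have := norm_add_le x0 (x - x0); rw [add_sub_cancel] at this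
    simp; linarith
  have hC2 := h.add ((C2.hsq x0).smul a)
  have A := abp_meas hC2 (K := closedBall x0 (d / 2)) (X := X) (P := closedBall 0 (k / d)) (isCompact_closedBall _ _)
    (inter_subset_left.trans ball_subset_interior_closedBall) Xm ?_ (c1 := (2 * a) ^ n) (c2 := C1) hBd ?_ ?_
  · have vX : volume X ≤ ENNReal.ofReal (4 * η / k) := by
      have c1 := mul_meas_ge_le_lintegral₀ (μ := volume.restrict (closedBall 0 1)) (f := fun x => ‖v x‖ₑ) cv.enorm.measurable.aemeasurable (ENNReal.ofReal (k/4))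
      have c2 : volume X ≤ (volume.restrict (closedBall 0 1)) {x | ENNReal.ofReal (k/4) ≤ ‖v x‖ₑ} := by
        rw [Measure.restrict_apply' measurableSet_closedBall]
        refine measure_mono fun x hx => ⟨?_, Xin hx⟩
        have : v x < -(k/4) := hx.2
        show ENNReal.ofReal (k/4) ≤ ‖v x‖ₑ
        rw [Real.enorm_eq_ofReal_abs]
        exact ENNReal.ofReal_le_ofReal (by rw [abs_of_neg (by linarith)]; linarith)
      have c3 : ENNReal.ofReal (k/4) * volume X ≤ ENNReal.ofReal η := ((mul_le_mul' le_rfl c2).trans c1).trans hL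
      rw [mul_comm, ← ENNReal.le_div_iff_mul_le (by simp [kk0]) (by simp), ← ENNReal.ofReal_div_of_pos (by positivity)] at c3
      convert c3 using 2; field_simp
    have vBd : volume (Bd ∩ X) ≤ ENNReal.ofReal β :=
      (measure_mono (show Bd ∩ X ⊆ closedBall 0 1 ∩ Bd from fun x hx => ⟨Xin hx.2, hx.1⟩)).trans hv
    have B : volume (closedBall (0:Eu n) (k/d)) = ENNReal.ofReal ((k/d) ^ n * vB n) := by
      rw [Measure.addHaar_closedBall' _ _ (by positivity), finrank_euclideanSpace, Fintype.card_fin, ENNReal.ofReal_mul (by positivity),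
        vB, measureReal_def, ENNReal.ofReal_toReal measure_closedBall_lt_top.ne]
    have Cc : ENNReal.ofReal ((k/d) ^ n * vB n) ≤ ENNReal.ofReal ((2 * a) ^ n * (4 * η / k) + C1 * β) := by
      rw [← B, ENNReal.ofReal_add (by positivity) (by positivity), ENNReal.ofReal_mul (by positivity), ENNReal.ofReal_mul hC1]
      exact A.trans (add_le_add (mul_le_mul' le_rfl vX) (mul_le_mul' le_rfl vBd))
    rw [ENNReal.ofReal_le_ofReal_iff (by positivity)] at Cc
    set q := (k/d) ^ n with hq
    have q0 : 0 < q := by positivity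
    have t1 : (2 * a) ^ n * (4 * η / k) * 2 ≤ q * vB n := by
      have e : (2 * a) ^ n * (4 * η / k) * 2 * (k * d ^ n) = q * (8 * (16 * 2 ^ n) ^ n * η) := by
        rw [ha, hq, show 2 * (8 * 2 ^ n * k / d ^ 2) = 16 * 2 ^ n * k / d ^ 2 by ring, div_pow, div_pow, mul_pow, ← pow_mul d 2 n, mul_comm 2 n, pow_mul d n 2]
        field_simp; ring
      have e2 : 8 * (16 * 2 ^ n) ^ n * η * 2 ^ n ≤ vB n * (k * d ^ n) * 2 ^ n := by
        have := mul_le_mul_of_nonneg_left F1.le ω0.le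
        linarith
      have e3 := mul_le_mul_of_nonneg_left (le_of_mul_le_mul_right e2 (by positivity)) q0.le
      rw [← e, ← mul_assoc q] at e3
      exact le_of_mul_le_mul_right e3 (by positivity)
    have t2 : 2 * (C1 * β) < q * vB n := by
      have e1 : κ ^ n < (2 ^ n * k) ^ n := pow_lt_pow_left₀ F2 hκ.le hn.ne'
      have e2 : k ^ n ≤ q := pow_le_pow_left₀ kk0.le ((le_div_iff₀ d0).2 (mul_le_of_le_one_right kk0.le d1')) n
      have e3 := mul_lt_mul_of_pos_left e1 ω0
      rw [mul_pow] at e3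
      have e4 : 2 * (C1 * β) * (2 ^ n) ^ n < vB n * k ^ n * (2 ^ n) ^ n := by linarith
      have e5 := lt_of_mul_lt_mul_right e4 (by positivity)
      have := mul_le_mul_of_nonneg_left e2 ω0.le
      linarith
    linarith
  · intro p hp
    have hp : ‖p‖ ≤ k / d := by simpa using hp
    refine ⟨x0, by simp; linarith, fun x hx hxX => ?_⟩
    have hx' : ‖x - x0‖ ≤ d / 2 := by simpa [dist_eq_norm] using hx
    have ip : ⟪p, x⟫_ℝ - ⟪p, x0⟫_ℝ ≤ k / 2 := by
      rw [← inner_sub_right]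
      refine (real_inner_le_norm _ _).trans ((mul_le_mul hp hx' (norm_nonneg _) (by positivity)).trans_eq ?_)
      field_simp
    have q0 : 0 ≤ a * (‖x - x0‖ ^ 2 / 2) := by positivity
    simp only [sub_self, norm_zero]
    by_cases hb : v x < -(k/4)
    · have hbd : ‖x - x0‖ = d / 2 := by
        refine le_antisymm hx' (not_lt.1 fun hlt => hxX ⟨?_, hb⟩)
        simpa [dist_eq_norm] using hlt
      have l := lowb x hx'
      have e : a * (‖x - x0‖ ^ 2 / 2) = 2 ^ n * k := by rw [hbd, ha]; field_simp; norm_num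
      norm_num
      linarith
    · norm_num
      linarith
  · intro x hx hxB hp
    exact (d1 a x a0 ale hxB hp).trans (pow_le_pow_left₀ (by linarith) (by linarith) n)
  · intro x hx hxB hp
    exact d2 a x a0 ale hp
theorem det_id1 : (ContinuousLinearMap.id ℝ (Eu n)).det = 1 := by
  have := LinearMap.det_id (A := ℝ) (M := Eu n)
  simpa [ContinuousLinearMap.det] using this

theorem vB_pos : 0 < vB n := by
  rw [vB, measureReal_def]
  exact ENNReal.toReal_pos (measure_closedBall_pos _ _ one_pos).ne' measure_closedBall_lt_top.ne

theorem slide2 (hn : 0 < n) (hc0 : 0 < c0) (hC0 : 1 ≤ C0) : ∃ M : ℝ, 0 < M ∧ ∀ (u : Eu n → ℝ) (G : Eu n → Eu n)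
    (H : Eu n → (Eu n →L[ℝ] Eu n)) (κ η δ β μ : ℝ), Good c0 C0 u G H → 0 ≤ δ → δ ≤ 1 → 0 ≤ η → 0 ≤ β → 0 < κ → 0 ≤ μ →
    ∫⁻ x in closedBall 0 1, ‖u x - ‖x‖ ^ 2 / 2‖ₑ ≤ ENNReal.ofReal η →
    volume (closedBall 0 1 ∩ bad H δ) ≤ ENNReal.ofReal β → (∀ x, ‖x‖ ≤ 1 → |u x - ‖x‖ ^ 2 / 2| ≤ μ) →
    M * η ≤ κ → M * δ ≤ κ → M * β ≤ κ ^ n → M * μ ^ (n + 2) ≤ κ ^ 2 →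
    ∀ x, ‖x‖ ≤ 1 / 2 → |u x - ‖x‖ ^ 2 / 2| ≤ κ := by
  have ω := vB_pos (n := n)
  set C1 := 2 ^ n + C0 with hC1
  have C10 : 0 ≤ C1 := by positivity
  set M1 := 8 * (16 * 2 ^ n) ^ n * 2 ^ n / vB n with hM1
  set M3 := 2 * C1 * (2 ^ n) ^ n / vB n with hM3
  set M4 : ℝ := (8 * 2 ^ n) ^ n * 4 ^ n with hM4
  have p1 : 0 < M1 := by positivity
  have p3 : 0 ≤ M3 := by positivity
  have p4 : 0 < M4 := by positivity
  refine ⟨M1 + 2 ^ n + M3 + M4, by positivity, fun u G H κ η δ β μ g hδ hδ1 hη hβ hκ hμ hL hv hb q1 q2 q3 q4 x hx => ?_⟩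
  have p2 : (0:ℝ) < 2 ^ n := by positivity
  have k1 : 8 * (16 * 2 ^ n) ^ n * 2 ^ n * η ≤ vB n * κ := by
    have : M1 * η ≤ κ := (mul_le_mul_of_nonneg_right (by linarith) hη).trans q1
    rw [hM1, div_mul_eq_mul_div, div_le_iff₀ ω] at this; linarith
  have k2 : 2 ^ n * δ ≤ κ := (mul_le_mul_of_nonneg_right (by linarith) hδ).trans q2
  have k3 : 2 * C1 * (2 ^ n) ^ n * β ≤ vB n * κ ^ n := by
    have : M3 * β ≤ κ ^ n := (mul_le_mul_of_nonneg_right (by linarith) hβ).trans q3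
    rw [hM3, div_mul_eq_mul_div, div_le_iff₀ ω] at this; linarith
  have k4 : (8 * 2 ^ n) ^ n * 4 ^ n * μ ^ (n + 2) ≤ κ ^ 2 :=
    (mul_le_mul_of_nonneg_right (by linarith) (by positivity)).trans q4
  have bm := (g.badm δ).measurableSet
  have ids : Sy (ContinuousLinearMap.id ℝ (Eu n)) := fun a b => by simp
  have idp : Pd (ContinuousLinearMap.id ℝ (Eu n)) := fun a ha => by simp [ha]
  have rt : ∀ x, ((H x).det ^ ((n:ℝ)⁻¹)) ^ n = (H x).det := fun x => by
    rw [← Real.rpow_natCast, ← Real.rpow_mul (hc0.le.trans (g.lo x)), inv_mul_cancel₀ (by positivity), Real.rpow_one]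
  have hle : ∀ t : ℝ, 0 ≤ t → t ≤ 1 → t ^ n ≤ t := fun t a b => pow_le_of_le_one a b hn.ne'
  rw [abs_le]
  constructor
  · have c2 := g.toC2.subsq
    have sK : ∀ (a : ℝ) x, Sy ((H x - ContinuousLinearMap.id ℝ (Eu n)) + a • ContinuousLinearMap.id ℝ (Eu n)) := fun a x p q => by
      have := g.symm x p q
      simp only [ContinuousLinearMap.add_apply, ContinuousLinearMap.sub_apply, ContinuousLinearMap.smul_apply, ContinuousLinearMap.id_apply,
        inner_add_left, inner_sub_left, inner_add_right, inner_sub_right, inner_smul_left, inner_smul_right, this]; simp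
    have eK : ∀ (a : ℝ) x, (1:ℝ) • H x = ((H x - ContinuousLinearMap.id ℝ (Eu n)) + a • ContinuousLinearMap.id ℝ (Eu n)) +
        ∑ i : Fin 1, (fun _ => 1 - a) i • (fun _ : Fin 1 => ContinuousLinearMap.id ℝ (Eu n)) i := fun a x => by
      ext1 y; simp [sub_smul]
    refine slide hn c2 bm hδ hη hβ C10 hκ (fun a x a0 a1 hxb hp => ?_) (fun a x a0 a1 hp => ?_) hL hv hb k1 k2 k3 k4 x hx
    · have hb1 : |(H x).det - 1| ≤ δ := not_lt.1 hxb
      obtain ⟨e1, e2, e3⟩ := mink hn (g.symm x) (g.pos x) (sK a x) hp (fun _ => ids) (fun _ => idp.psd) (fun _ => by linarith)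
        zero_le_one (t := 1 + δ) (ti := fun _ => 1) (by linarith) (fun _ => zero_le_one) (eK a x)
        (by have := le_self_pow₀ (show 1 ≤ 1 + δ by linarith) hn.ne'
            linarith [(abs_le.1 hb1).2]) (fun _ => by rw [det_id1, one_pow])
      rw [abs_of_nonneg e2]
      refine e3.trans_eq ?_
      simp; ring
    · obtain ⟨e1, e2, e3⟩ := mink hn (g.symm x) (g.pos x) (sK a x) hp (fun _ => ids) (fun _ => idp.psd) (fun _ => by linarith)
        zero_le_one (t := (H x).det ^ ((n:ℝ)⁻¹)) (ti := fun _ => 0) (Real.rpow_nonneg (hc0.le.trans (g.lo x)) _) (fun _ => le_rfl) (eK a x)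
        (rt x).ge (fun _ => by rw [det_id1, zero_pow hn.ne']; exact zero_le_one)
      rw [abs_of_nonneg e2]
      refine e3.trans ?_
      simp only [mul_zero, Finset.sum_const_zero, sub_zero, one_mul, rt]
      linarith [g.hi x]
  · have c2 := g.toC2.subsq.smul (-1)
    have sK : ∀ (a : ℝ) x, Sy ((-1:ℝ) • (H x - ContinuousLinearMap.id ℝ (Eu n)) + a • ContinuousLinearMap.id ℝ (Eu n)) := fun a x p q => by
      have := g.symm x p q
      simp only [ContinuousLinearMap.add_apply, ContinuousLinearMap.sub_apply, ContinuousLinearMap.smul_apply, ContinuousLinearMap.id_apply,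
        inner_add_left, inner_sub_left, inner_add_right, inner_sub_right, inner_smul_left, inner_smul_right, this]; simp
    have eK : ∀ (a : ℝ) x, (1 + a) • ContinuousLinearMap.id ℝ (Eu n) = ((-1:ℝ) • (H x - ContinuousLinearMap.id ℝ (Eu n)) + a • ContinuousLinearMap.id ℝ (Eu n)) +
        ∑ i : Fin 1, (fun _ => (1:ℝ)) i • (fun _ : Fin 1 => H x) i := fun a x => by
      ext1 y; simp [add_smul]; abel
    have := slide hn c2 bm hδ hη hβ C10 hκ (fun a x a0 a1 hxb hp => ?_) (fun a x a0 a1 hp => ?_) (by simpa only [neg_one_mul, enorm_neg] using hL) hv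
      (fun x hx => by simpa only [neg_one_mul, abs_neg] using hb x hx) k1 k2 k3 k4 x hx
    · linarith
    · have hb1 : |(H x).det - 1| ≤ δ := not_lt.1 hxb
      obtain ⟨e1, e2, e3⟩ := mink hn ids idp (sK a x) hp (fun _ => g.symm x) (fun _ => (g.pos x).psd) (fun _ => zero_le_one)
        (show 0 ≤ 1 + a by linarith) (t := 1) (ti := fun _ => 1 - δ) (by linarith) (fun _ => by linarith) (eK a x)
        (by rw [det_id1, one_pow]) (fun _ => by linarith [(abs_le.1 hb1).1, hle (1 - δ) (by linarith) (by linarith)])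
      rw [abs_of_nonneg e2]
      refine e3.trans_eq ?_
      simp
    · obtain ⟨e1, e2, e3⟩ := mink hn ids idp (sK a x) hp (fun _ => g.symm x) (fun _ => (g.pos x).psd) (fun _ => zero_le_one)
        (show 0 ≤ 1 + a by linarith) (t := 1) (ti := fun _ => 0) (by linarith) (fun _ => le_rfl) (eK a x)
        (by rw [det_id1, one_pow]) (fun _ => by rw [zero_pow hn.ne']; exact hc0.le.trans (g.lo x))
      rw [abs_of_nonneg e2]
      refine e3.trans ?_
      simp only [mul_zero, Finset.sum_const_zero, sub_zero, mul_one]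
      have := pow_le_pow_left₀ (by linarith) (show 1 + a ≤ 2 by linarith) n
      linarith

theorem quadV (hn : 0 < n) (hc0 : 0 < c0) (hC0 : 1 ≤ C0) {η : Eu n → ℝ} (cη : ContDiff ℝ 2 η) (zη : ∀ y, 1 < ‖y‖ → η y = 0) :
    ∃ C : ℝ, 0 ≤ C ∧ ∀ τ : ℝ, 0 < τ → ∃ r0 : ℝ, 0 < r0 ∧ r0 ≤ 1/4 ∧ ∀ u G H ε, Fl c0 C0 ε u G H →
      ∃ (E0 : Eu n →L[ℝ] Eu n) (p : Eu n) (c : ℝ), Sy E0 ∧ (∀ x, |⟪E0 x, x⟫_ℝ| ≤ C * ε * ‖x‖ ^ 2) ∧ |tr E0| ≤ C * ε ^ 2 ∧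
      ∀ x, ‖x‖ ≤ r0 → |(∫ y, η y * (u (x + (1/4:ℝ) • y) - ‖x + (1/4:ℝ) • y‖ ^ 2 / 2)) - (c + ⟪p, x⟫_ℝ + ⟪E0 x, x⟫_ℝ / 2)| ≤ τ * ε * ‖x‖ ^ 2 := by
  obtain ⟨Cl, Cl0, hCl⟩ := lapL1 hn hc0 hC0 (n := n)
  set K : Eu n → ℝ := fun z => 4 ^ n * η ((4:ℝ) • z) with hK
  have cK : ContDiff ℝ 2 K := by fun_prop
  obtain ⟨M, GK, HK, b⟩ := exBm cK (R := 1/4) fun z hz => by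
    rw [hK]; simp only; rw [zη _ (by rw [norm_smul]; norm_num; linarith), mul_zero]
  have M0 := b.M0
  have ω := vB_pos (n := n)
  have cGK := b.contG; have cHK := b.cont; have cKK := b.contu; have ct := tr_cont (n := n)
  have z1 : ∀ x, 1 < ‖x‖ → K x = 0 ∧ GK x = 0 ∧ HK x = 0 := fun x hx => b.z x (by linarith)
  refine ⟨M * vB n + M * Cl, by positivity, fun τ hτ => ?_⟩
  have uc : UniformContinuous HK := cHK.uniformContinuous_of_tendsto_cocompact (x := 0)
    ((csup fun x hx => (b.z x hx).2.2).is_zero_at_infty)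
  obtain ⟨δ, δ0, hδ⟩ := Metric.uniformContinuous_iff.1 uc (τ / vB n) (by positivity)
  refine ⟨min (1/4) (δ/2), by positivity, min_le_left _ _, fun u G H ε f => ?_⟩
  have cu := f.contu; have cH := f.cont
  have e0 := f.e0
  set v : Eu n → ℝ := fun z => u z - ‖z‖ ^ 2 / 2 with hv
  have cv : Continuous v := by fun_prop
  have iE : Integrable fun z => v z • HK z := (by fun_prop : Continuous fun z => v z • HK z).integrable_of_hasCompactSupport
    (csup (E := Eu n →L[ℝ] Eu n) (R := 1) fun z hz => by rw [(z1 z hz).2.2]; exact smul_zero (A := Eu n →L[ℝ] Eu n) (v z))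
  have ip : Integrable fun z => v z • GK z := (by fun_prop : Continuous fun z => v z • GK z).integrable_of_hasCompactSupport
    (csup (R := 1) fun z hz => by simp [z1 z hz])
  set E0 := ∫ z, v z • HK z with hE0
  set p := ∫ z, v z • GK z with hp
  have eE : ∀ x y, ⟪E0 x, y⟫_ℝ = ∫ z, v z * ⟪HK z x, y⟫_ℝ := fun x y => by
    have := ((innerSL ℝ y).comp (ContinuousLinearMap.apply ℝ (Eu n) x)).integral_comp_comm iE
    rw [real_inner_comm]
    refine Eq.trans this.symm ?_
    refine integral_congr_ae (Eventually.of_forall fun z => ?_)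
    simp [inner_smul_right, real_inner_comm]
  have eP : ∀ x, ⟪p, x⟫_ℝ = ∫ z, v z * ⟪GK z, x⟫_ℝ := fun x => by
    have := (innerSL ℝ x).integral_comp_comm ip
    rw [real_inner_comm]
    refine Eq.trans this.symm ?_
    refine integral_congr_ae (Eventually.of_forall fun z => ?_)
    simp [inner_smul_right, real_inner_comm]
  have eT : tr E0 = ∫ z, v z * tr (HK z) := by
    have := (trC n).integral_comp_comm iE
    refine Eq.trans this.symm ?_
    refine integral_congr_ae (Eventually.of_forall fun z => ?_)
    simp [trC_apply, tr_smul]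
  refine ⟨E0, -p, ∫ z, v z * K z, fun x y => ?_, fun x => ?_, ?_, fun x hx => ?_⟩
  · rw [eE, real_inner_comm, eE]
    refine integral_congr_ae (Eventually.of_forall fun z => ?_)
    simp only
    rw [b.symm z x y, real_inner_comm]
  · rw [eE]
    refine (ibd (M := ε * (M * ‖x‖ ^ 2)) (by fun_prop) (by positivity) (fun z hz => ?_) fun z hz => by simp [z1 z hz]).trans ?_
    · rw [abs_mul]
      refine mul_le_mul (f.fl z hz) ?_ (abs_nonneg _) e0.le
      refine (abs_real_inner_le_norm _ _).trans ?_
      have a1 := (HK z).le_opNorm x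
      have a2 := mul_le_mul_of_nonneg_right (b.b2 z) (norm_nonneg x)
      have a3 := mul_le_mul_of_nonneg_right (a1.trans a2) (norm_nonneg x)
      linarith
    · have : 0 ≤ M * Cl * ε * ‖x‖ ^ 2 := by positivity
      linarith
  · rw [eT, ← (f.byp b (by norm_num)).2.1]
    have cT : Continuous fun x => tr (H x) - n := by fun_prop
    have h1 : |∫ x, K x * (tr (H x) - n)| ≤ ∫ x in closedBall 0 (9/16), M * |tr (H x) - n| := by
      rw [← toB (R := 9/16) fun z hz => by simp [b.z z (by linarith)]]
      refine (norm_integral_le_integral_norm (μ := volume.restrict (closedBall 0 (9/16))) (fun x => K x * (tr (H x) - n))).trans ?_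
      refine setIntegral_mono ((by fun_prop : Continuous fun x => ‖K x * (tr (H x) - n)‖).continuousOn.integrableOn_compact (isCompact_closedBall _ _))
        ((by fun_prop : Continuous fun x => M * |tr (H x) - n|).continuousOn.integrableOn_compact (isCompact_closedBall _ _)) fun x => ?_
      rw [norm_mul]
      exact mul_le_mul_of_nonneg_right (b.b0 x) (abs_nonneg _)
    rw [integral_const_mul] at h1
    have h2 := mul_le_mul_of_nonneg_left (hCl u G H ε f) M0
    have : 0 ≤ M * vB n * ε ^ 2 := by positivity
    linarith
  · have hx4 : ‖x‖ ≤ 1/4 := hx.trans (min_le_left _ _)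
    have hxd : ‖x‖ < δ := (hx.trans (min_le_right _ _)).trans_lt (by linarith)
    have zx : ∀ z, 1 < ‖z‖ → K (z + -x) = 0 := fun z hz => (b.z _ (by
      have := norm_add_le (z + -x) x; rw [neg_add_cancel_right] at this; linarith)).1
    have eV : ∫ y, η y * (u (x + (1/4:ℝ) • y) - ‖x + (1/4:ℝ) • y‖ ^ 2 / 2) = ∫ z, v z * K (z + -x) := by
      have a1 := Measure.integral_comp_smul volume (fun y => v (x + y) * K (x + y + -x)) (1/4:ℝ)
      rw [integral_add_left_eq_self (μ := volume) (fun z => v z * K (z + -x)) x, finrank_euclideanSpace, Fintype.card_fin] at a1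
      have e4 : |((1/4:ℝ) ^ n)⁻¹| = 4 ^ n := by
        rw [abs_of_pos (by positivity), one_div, inv_pow, inv_inv]
      rw [e4] at a1
      have a2 : ∫ y, v (x + (1/4:ℝ) • y) * K (x + (1/4:ℝ) • y + -x) = 4 ^ n * ∫ y, η y * (u (x + (1/4:ℝ) • y) - ‖x + (1/4:ℝ) • y‖ ^ 2 / 2) := by
        rw [← integral_const_mul]
        refine integral_congr_ae (Eventually.of_forall fun y => ?_)
        have : (4:ℝ) • (x + (1/4:ℝ) • y + -x) = y := by
          rw [add_neg_cancel_comm, smul_smul]; norm_num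
        simp only [hK, hv, this]; ring
      rw [a2, smul_eq_mul] at a1
      exact mul_left_cancel₀ (by positivity) a1
    have i1 : Integrable fun z => v z * K (z + -x) := cint (R := 1) (by fun_prop) fun z hz => by simp [zx z hz]
    have i2 : Integrable fun z => v z * K z := cint (R := 1) (by fun_prop) fun z hz => by simp [z1 z hz]
    have i3 : Integrable fun z => v z * ⟪GK z, x⟫_ℝ := cint (R := 1) (by fun_prop) fun z hz => by simp [z1 z hz]
    have i4 : Integrable fun z => v z * ⟪HK z x, x⟫_ℝ := cint (R := 1) (by fun_prop) fun z hz => by simp [z1 z hz]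
    have eD : (∫ z, v z * K (z + -x)) - ((∫ z, v z * K z) + ⟪-p, x⟫_ℝ + ⟪E0 x, x⟫_ℝ / 2) =
        ∫ z, v z * (K (z + -x) - K z - ⟪GK z, -x⟫_ℝ - ⟪HK z x, x⟫_ℝ / 2) := by
      have j1 : Integrable fun z => v z * K (z + -x) - v z * K z := i1.sub i2
      have j2 : Integrable fun z => v z * K (z + -x) - v z * K z + v z * ⟪GK z, x⟫_ℝ := j1.add i3
      have e : ∀ z, v z * (K (z + -x) - K z - ⟪GK z, -x⟫_ℝ - ⟪HK z x, x⟫_ℝ / 2) =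
          v z * K (z + -x) - v z * K z + v z * ⟪GK z, x⟫_ℝ - v z * ⟪HK z x, x⟫_ℝ / 2 := fun z => by
        rw [inner_neg_right]; ring
      simp_rw [e]
      rw [integral_sub j2 (i4.div_const 2), integral_add j1 i3, integral_sub i1 i2, integral_div, ← eE, ← eP, inner_neg_left]
      ring
    rw [eV, eD]
    refine (ibd (M := ε * (τ / vB n * ‖x‖ ^ 2)) (by fun_prop) (by positivity) (fun z hz => ?_) fun z hz => by simp [z1 z hz, zx z hz]).trans_eq ?_
    · rw [abs_mul]
      refine mul_le_mul (f.fl z hz) ?_ (abs_nonneg _) e0.le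
      refine b.taylor z (-x) fun t ht => ?_
      have a0 : ⟪HK (z + t • -x) (-x), -x⟫_ℝ - ⟪HK z x, x⟫_ℝ = ⟪(HK (z + t • -x) - HK z) x, x⟫_ℝ := by
        simp [inner_sub_left]
      rw [a0]
      have a1 : ‖HK (z + t • -x) - HK z‖ ≤ τ / vB n := by
        rw [← dist_eq_norm]
        refine (hδ ?_).le
        rw [dist_eq_norm, add_sub_cancel_left, norm_smul, norm_neg, Real.norm_eq_abs, abs_of_nonneg ht.1]
        exact (mul_le_of_le_one_left (norm_nonneg _) ht.2).trans_lt hxd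
      refine (abs_real_inner_le_norm _ _).trans ?_
      have a2 := ((HK (z + t • -x) - HK z)).le_opNorm x
      have a3 := mul_le_mul_of_nonneg_right a1 (norm_nonneg x)
      have a4 := mul_le_mul_of_nonneg_right (a2.trans a3) (norm_nonneg x)
      linarith
    · field_simp
theorem nrm (hn : 0 < n) {C : ℝ} (hC : 0 ≤ C) : ∃ C2 ε0 : ℝ, 0 ≤ C2 ∧ 0 < ε0 ∧ ∀ (ε : ℝ) (E : Eu n →L[ℝ] Eu n), 0 < ε → ε ≤ ε0 → Sy E →
    (∀ x, |⟪E x, x⟫_ℝ| ≤ C * ε * ‖x‖ ^ 2) → |tr E| ≤ C * ε ^ 2 →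
    ∃ S : Eu n →L[ℝ] Eu n, S.det ^ 2 = 1 ∧ (∀ ξ, ‖S ξ‖ ≤ 2 * ‖ξ‖) ∧
      ∀ ξ, |‖ξ‖ ^ 2 - ‖S ξ‖ ^ 2 - ⟪E (S ξ), S ξ⟫_ℝ| ≤ C2 * ε ^ 2 * ‖ξ‖ ^ 2 := by
  set D := C + 2 * n * C ^ 2 with hD
  have D0 : 0 ≤ D := by positivity
  refine ⟨2 * D * 2 * 4, min (1 / (2 * C + 1)) (min 1 (1 / (4 * D + 1))), by positivity, by positivity, fun ε E e0 e1 hs hq ht => ?_⟩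
  have hn' : (0:ℝ) < n := by exact_mod_cast hn
  have n1 : (1:ℝ) ≤ n := by exact_mod_cast hn
  have f1 : C * ε ≤ 1 / 2 := by
    have := e1.trans (min_le_left _ _)
    rw [le_div_iff₀ (by positivity)] at this
    linarith
  have f2 : ε ≤ 1 := e1.trans ((min_le_right _ _).trans (min_le_left _ _))
  have f3 : D * ε ^ 2 ≤ 1 / 4 := by
    have := e1.trans ((min_le_right _ _).trans (min_le_right _ _))
    rw [le_div_iff₀ (by positivity)] at this
    have h2 : D * ε ^ 2 ≤ D * ε := mul_le_mul_of_nonneg_left (by nlinarith) D0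
    linarith
  have De : 0 ≤ D * ε ^ 2 := by positivity
  obtain ⟨b, l, hl, -, htr⟩ := spec hs
  have lb : ∀ i, |l i| ≤ C * ε := fun i => by
    have := hq (b i)
    rwa [hl i, inner_smul_left, real_inner_self_eq_norm_sq, b.norm_eq_one, one_pow, mul_one, mul_one] at this
  set B := ContinuousLinearMap.id ℝ (Eu n) + E with hB
  have hBs : Sy B := fun p q => by simp [hB, inner_add_left, inner_add_right, hs p q]
  have hBq : ∀ x, ⟪B x, x⟫_ℝ = ‖x‖ ^ 2 + ⟪E x, x⟫_ℝ := fun x => by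
    simp [hB, inner_add_left, real_inner_self_eq_norm_sq]
  have hBl : ∀ x, ‖x‖ ^ 2 / 2 ≤ ⟪B x, x⟫_ℝ ∧ ⟪B x, x⟫_ℝ ≤ 2 * ‖x‖ ^ 2 := fun x => by
    have h1 := abs_le.1 (hq x)
    have h2 := mul_le_mul_of_nonneg_right f1 (sq_nonneg ‖x‖)
    rw [hBq]
    have := sq_nonneg ‖x‖
    constructor <;> linarith
  have hdet : B.det = ∏ i, (1 + l i) := by
    have e : (B : Eu n →ₗ[ℝ] Eu n) = Matrix.toLin b.toBasis b.toBasis (Matrix.diagonal fun i => 1 + l i) := by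
      refine b.toBasis.ext fun i => ?_
      rw [Matrix.toLin_self]
      simp [Matrix.diagonal_apply, hB, hl, add_smul]
    rw [ContinuousLinearMap.det, e, LinearMap.det_toLin, Matrix.det_diagonal]
  have lp : ∀ i, 1 / 2 ≤ 1 + l i := fun i => by linarith [(abs_le.1 (lb i)).1]
  have up : B.det ≤ Real.exp (D * ε ^ 2) := by
    rw [hdet]
    calc ∏ i, (1 + l i) ≤ ∏ i, Real.exp (l i) := Finset.prod_le_prod (fun i _ => by linarith [lp i]) fun i _ => by
          linarith [Real.add_one_le_exp (l i)]
      _ = Real.exp (tr E) := by rw [← Real.exp_sum, htr]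
      _ ≤ _ := by
          refine Real.exp_le_exp.2 ?_
          have := (abs_le.1 ht).2
          have : 0 ≤ 2 * n * C ^ 2 * ε ^ 2 := by positivity
          rw [hD]; linarith
  have lo : Real.exp (-(D * ε ^ 2)) ≤ B.det := by
    rw [hdet]
    calc Real.exp (-(D * ε ^ 2)) ≤ Real.exp (∑ i, l i / (1 + l i)) := by
          refine Real.exp_le_exp.2 ?_
          have h1 : ∀ i, l i - 2 * (C * ε) ^ 2 ≤ l i / (1 + l i) := fun i => by
            have := lp i
            rw [le_div_iff₀ (by linarith)]
            have h2 : l i ^ 2 ≤ (C * ε) ^ 2 := sq_le_sq' (abs_le.1 (lb i)).1 (abs_le.1 (lb i)).2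
            have h3 := mul_le_mul_of_nonneg_left this (show 0 ≤ 2 * (C * ε) ^ 2 by positivity)
            nlinarith
          have h2 := Finset.sum_le_sum (s := Finset.univ) fun i _ => h1 i
          rw [Finset.sum_sub_distrib, ← htr] at h2
          simp only [Finset.sum_const, Finset.card_univ, Fintype.card_fin, nsmul_eq_mul] at h2
          have := (abs_le.1 ht).1
          rw [hD]; linarith
      _ = ∏ i, Real.exp (l i / (1 + l i)) := Real.exp_sum _ _
      _ ≤ _ := Finset.prod_le_prod (fun i _ => (Real.exp_pos _).le) fun i _ => by
          have h1 := lp i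
          have h2 := Real.add_one_le_exp (-(l i / (1 + l i)))
          rw [Real.exp_neg] at h2
          have h3 : -(l i / (1 + l i)) + 1 = (1 + l i)⁻¹ := by field_simp; ring
          rw [h3] at h2
          exact (inv_le_inv₀ (by linarith) (Real.exp_pos _)).1 h2
  have Bd : 0 < B.det := (Real.exp_pos _).trans_le lo
  set a := B.det ^ (-(n:ℝ)⁻¹) with ha
  have a0 : 0 < a := Real.rpow_pos_of_pos Bd _
  have an : a ^ n * B.det = 1 := by
    rw [ha, ← Real.rpow_natCast, ← Real.rpow_mul Bd.le, neg_mul, inv_mul_cancel₀ hn'.ne', Real.rpow_neg_one, inv_mul_cancel₀ Bd.ne']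
  have alog : |Real.log a| ≤ D * ε ^ 2 := by
    rw [ha, Real.log_rpow Bd, abs_mul, abs_neg, abs_of_pos (inv_pos.2 hn')]
    have h1 : |Real.log B.det| ≤ D * ε ^ 2 := abs_le.2 ⟨(Real.le_log_iff_exp_le Bd).2 lo, (Real.log_le_iff_le_exp Bd).2 up⟩
    exact (mul_le_of_le_one_left (abs_nonneg _) (inv_le_one_of_one_le₀ n1)).trans h1
  have a1 : |a - 1| ≤ 2 * (D * ε ^ 2) := by
    have := Real.abs_exp_sub_one_le (x := Real.log a) (by linarith)
    rw [Real.exp_log a0] at this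
    linarith
  have hA : Pd (a • B) := fun x hx => by
    have := (hBl x).1
    have h0 : 0 < ‖x‖ := norm_pos_iff.2 hx
    rw [ContinuousLinearMap.smul_apply, inner_smul_left]
    exact mul_pos a0 (by nlinarith)
  obtain ⟨S, hS, hSd⟩ := exS (fun p q => by simp [inner_smul_left, inner_smul_right, hBs p q]) hA
  rw [det_smul', an, mul_one] at hSd
  have key : ∀ ξ, a * ⟪B (S ξ), S ξ⟫_ℝ = ‖ξ‖ ^ 2 := fun ξ => by
    have : ⟪((adj S).comp ((a • B).comp S)) ξ, ξ⟫_ℝ = ‖ξ‖ ^ 2 := by rw [hS]; simp [real_inner_self_eq_norm_sq]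
    rw [← this]
    simp [adj, ContinuousLinearMap.adjoint_inner_left, inner_smul_left]
  have Sb : ∀ ξ, ‖S ξ‖ ^ 2 ≤ 4 * ‖ξ‖ ^ 2 := fun ξ => by
    have h1 := (hBl (S ξ)).1
    have h2 : 1 / 2 ≤ a := by have := (abs_le.1 a1).1; linarith
    have h3 := mul_le_mul h2 h1 (by positivity) a0.le
    rw [key] at h3
    linarith
  refine ⟨S, hSd, fun ξ => ?_, fun ξ => ?_⟩
  · refine abs_le_of_sq_le_sq' ?_ (by positivity) |>.2
    linarith [Sb ξ]
  · have e : ‖ξ‖ ^ 2 - ‖S ξ‖ ^ 2 - ⟪E (S ξ), S ξ⟫_ℝ = (a - 1) * ⟪B (S ξ), S ξ⟫_ℝ := by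
      rw [← key ξ, hBq]; ring
    rw [e, abs_mul]
    have h0 : 0 ≤ ⟪B (S ξ), S ξ⟫_ℝ := le_trans (by positivity) (hBl (S ξ)).1
    rw [abs_of_nonneg h0]
    have h1 := mul_le_mul a1 ((hBl (S ξ)).2.trans (mul_le_mul_of_nonneg_left (Sb ξ) zero_le_two)) h0 (by positivity)
    linarith

theorem lscale {A : Eu n →L[ℝ] Eu n} (hA : A.det ≠ 0) {F : Eu n → ℝ≥0∞} (hF : Measurable F) :
    ∫⁻ x, F (A x) = ENNReal.ofReal |A.det⁻¹| * ∫⁻ x, F x := by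
  have h := Measure.map_linearMap_addHaar_eq_smul_addHaar (volume : Measure (Eu n)) (f := (A : Eu n →ₗ[ℝ] Eu n)) hA
  have : ∫⁻ x, F (A x) = ∫⁻ x, F x ∂(Measure.map (A : Eu n →ₗ[ℝ] Eu n) volume) :=
    (lintegral_map hF A.continuous.measurable).symm
  rw [this, h, lintegral_smul_measure]; rfl

theorem l1V (hn : 0 < n) (hc0 : 0 < c0) (hC0 : 1 ≤ C0) : ∃ (η : Eu n → ℝ) (C : ℝ), 0 ≤ C ∧ ContDiff ℝ 2 η ∧ (∀ y, 1 < ‖y‖ → η y = 0) ∧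
    ∀ u G H ε, Fl c0 C0 ε u G H →
    ∃ V : Eu n → ℝ, Continuous V ∧ (∀ x, V x = ∫ y, η y * (u (x + (1/4:ℝ) • y) - ‖x + (1/4:ℝ) • y‖ ^ 2 / 2)) ∧
      (∀ x, ‖x‖ ≤ 1/4 → |V x| ≤ ε) ∧
      ∫⁻ x in closedBall 0 (1/4), ‖V x - (u x - ‖x‖ ^ 2 / 2)‖ₑ ≤ ENNReal.ofReal (C * ε ^ 2) := by
  obtain ⟨Ψ, η, m, cη, dΨ, m0, hm, η0, z, h1⟩ := exMol n
  obtain ⟨Cl, Cl0, hCl⟩ := lapL1 hn hc0 hC0 (n := n)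
  have ω := vB_pos (n := n)
  have cc := cη.continuous
  refine ⟨η, m * vB n * Cl, by positivity, cη, fun y hy => (z y hy).2, fun u G H ε f => ?_⟩
  have cu := f.contu; have cH := f.cont; have ct := tr_cont (n := n)
  have e0 := f.e0
  refine ⟨_, ?_, fun x => rfl, fun x hx => ?_, ?_⟩
  · have : ∀ x, ∫ y, η y * (u (x + (1/4:ℝ) • y) - ‖x + (1/4:ℝ) • y‖ ^ 2 / 2) =
        ∫ y in closedBall 0 1, η y * (u (x + (1/4:ℝ) • y) - ‖x + (1/4:ℝ) • y‖ ^ 2 / 2) := fun x =>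
      (toB fun y hy => by simp [z y hy]).symm
    simp_rw [this]
    refine continuous_parametric_integral_of_continuous ?_ (isCompact_closedBall _ _)
    simp only [Function.uncurry_def]; fun_prop
  · have i1 : Integrable fun y => η y * ε := cint (R := 1) (by fun_prop) fun y hy => by simp [z y hy]
    have i2 : Integrable fun y => |η y * (u (x + (1/4:ℝ) • y) - ‖x + (1/4:ℝ) • y‖ ^ 2 / 2)| :=
      cint (R := 1) (by fun_prop) fun y hy => by simp [z y hy]
    refine (abs_integral_le_integral_abs).trans ((integral_mono i2 i1 fun y => ?_).trans_eq ?_)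
    · by_cases hy : 1 < ‖y‖
      · simp [z y hy]
      simp only
      rw [abs_mul, abs_of_nonneg (η0 y)]
      refine mul_le_mul_of_nonneg_left (f.fl _ ?_) (η0 y)
      have := norm_add_le x ((1/4:ℝ) • y)
      rw [norm_smul] at this
      norm_num at this
      linarith [not_lt.1 hy]
    · rw [integral_mul_const, h1, one_mul]
  · refine (mollL1 f.toC2.subsq cc dΨ z h1 hm).trans ?_
    have i : IntegrableOn (fun x => tr (H x) - n) (closedBall 0 (9/16)) :=
      (by fun_prop : Continuous fun x => tr (H x) - n).continuousOn.integrableOn_compact (isCompact_closedBall _ _)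
    simp_rw [tr_subid]
    rw [← ofReal_integral_norm_eq_lintegral_enorm i, ← ENNReal.ofReal_toReal (measure_closedBall_lt_top (μ := volume) (x := (0:Eu n)) (r := 1)).ne,
      ← ENNReal.ofReal_mul m0, ← ENNReal.ofReal_mul (by positivity)]
    refine ENNReal.ofReal_le_ofReal ?_
    rw [mul_assoc _ Cl]
    exact mul_le_mul_of_nonneg_left (hCl u G H ε f) (by rw [vB, measureReal_def] at ω; positivity)

theorem step (hn : 0 < n) (hc0 : 0 < c0) (hC0 : 1 ≤ C0) : ∃ r ε0 : ℝ, 0 < r ∧ r < 1 ∧ 0 < ε0 ∧ ∀ (u : Eu n → ℝ) G H ε, Fl c0 C0 ε u G H →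
    ε ≤ ε0 → volume (closedBall 0 1 ∩ bad H (ε ^ 2)) ≤ ENNReal.ofReal (ε ^ (n + 1)) →
    ∃ (S : Eu n →L[ℝ] Eu n) (p : Eu n) (c : ℝ), S.det ^ 2 = 1 ∧ (∀ ξ, ‖S ξ‖ ≤ 2 * ‖ξ‖) ∧
      ∀ ξ, ‖ξ‖ ≤ 1 → |(r ^ 2)⁻¹ * u (r • S ξ) + (⟪p, ξ⟫_ℝ + c) - ‖ξ‖ ^ 2 / 2| ≤ ε / 2 := by
  have ω := vB_pos (n := n)
  obtain ⟨η, CV, CV0, cη, zη, hV⟩ := l1V hn hc0 hC0 (n := n)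
  obtain ⟨CQ, CQ0, hQ⟩ := quadV hn hc0 hC0 cη zη
  obtain ⟨C2, ε1, C20, ε10, hN⟩ := nrm hn CQ0 (n := n)
  obtain ⟨M, M0, hM⟩ := slide2 hn hc0 hC0 (n := n)
  set τ := 1 / (128 * M * vB n) with hτ
  have τ0 : 0 < τ := by positivity
  obtain ⟨r0, r00, r01, hQ⟩ := hQ τ τ0
  set ρ := r0 / 2 with hρ
  have ρ0 : 0 < ρ := by positivity
  set B := (ρ ^ 2)⁻¹ * (ρ ^ n)⁻¹ * CV with hB
  set μ0 := 2 * (ρ ^ 2)⁻¹ + 4 * τ + C2 with hμ0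
  set Z := 32 * M * (B + C2 * vB n) + 8 * M + M * (ρ ^ n)⁻¹ * 8 ^ n + M * μ0 ^ (n + 2) * 64 with hZ
  have B0 : 0 ≤ B := by positivity
  have z1 : 0 ≤ 32 * M * (B + C2 * vB n) := by positivity
  have z2 : 0 ≤ 8 * M := by positivity
  have z3 : 0 ≤ M * (ρ ^ n)⁻¹ * 8 ^ n := by positivity
  have z4 : 0 ≤ M * μ0 ^ (n + 2) * 64 := by positivity
  have Z0 : 0 ≤ Z := by positivity
  refine ⟨ρ / 2, min ε1 (1 / (Z + 1)), by positivity, by linarith, by positivity, fun u G H ε f he hbv => ?_⟩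
  have e0 := f.e0
  have e1 : ε ≤ 1 := f.e1.trans (by norm_num)
  have eZ : Z * ε ≤ 1 := by
    have := he.trans (min_le_right _ _)
    rw [le_div_iff₀ (by positivity)] at this; linarith
  have eZ' : ∀ t, t ≤ Z → t * ε ≤ 1 := fun t ht => (mul_le_mul_of_nonneg_right ht e0.le).trans eZ
  obtain ⟨V, cV, eV, bV, lV⟩ := hV u G H ε f
  obtain ⟨E, p, c, Es, Eq, Et, hT⟩ := hQ u G H ε f
  obtain ⟨S, Sd, Sb, hS⟩ := hN ε E e0 (he.trans (min_le_left _ _)) Es Eq Et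
  have cu := f.contu
  set A := ρ • S with hA
  have Ad : (ρ ^ 2) ^ n = A.det ^ 2 := by rw [hA, det_smul', mul_pow, Sd, mul_one]; ring
  have Adn : A.det ≠ 0 := fun h => by
    rw [h] at Ad; have : 0 < (ρ ^ 2) ^ n := by positivity
    rw [Ad] at this; simp at this
  have Aab : |A.det⁻¹| = (ρ ^ n)⁻¹ := by
    rw [abs_inv, inv_inj, ← sq_eq_sq₀ (abs_nonneg _) (by positivity), sq_abs, ← Ad]; ring
  have g := f.toGood.compA (s := ρ ^ 2) (by positivity) Ad 0 (-((ρ ^ 2)⁻¹ • adj A p)) (-((ρ ^ 2)⁻¹ * c))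
  simp only [add_zero] at g
  set ut : Eu n → ℝ := fun x => (ρ ^ 2)⁻¹ * u (A x) + (⟪-((ρ ^ 2)⁻¹ • adj A p), x⟫_ℝ + -((ρ ^ 2)⁻¹ * c)) with hut
  have An : ∀ x, ‖x‖ ≤ 1 → ‖A x‖ ≤ 2 * ρ * ‖x‖ ∧ ‖A x‖ ≤ r0 := fun x hx => by
    have : ‖A x‖ = ρ * ‖S x‖ := by rw [hA, ContinuousLinearMap.smul_apply, norm_smul, Real.norm_eq_abs, abs_of_pos ρ0]
    have h2 := mul_le_mul_of_nonneg_left (Sb x) ρ0.le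
    have h3 := mul_le_mul_of_nonneg_left hx ρ0.le
    constructor <;> linarith
  have split : ∀ x, ‖x‖ ≤ 1 → |ut x - ‖x‖ ^ 2 / 2| ≤ (ρ ^ 2)⁻¹ * |V (A x) - (u (A x) - ‖A x‖ ^ 2 / 2)| + (4 * τ * ε + C2 * ε ^ 2) := fun x hx => by
    have a1 := hT (A x) (An x hx).2
    rw [← eV] at a1
    have a2 := hS x
    have n0 := norm_nonneg x
    have x2 : ‖x‖ ^ 2 ≤ 1 := pow_le_one₀ n0 hx
    have a3 : ‖A x‖ ^ 2 ≤ 4 * ρ ^ 2 := by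
      have h1 : ‖A x‖ ≤ 2 * ρ := by linarith [(An x hx).1, mul_le_mul_of_nonneg_left hx ρ0.le]
      have := pow_le_pow_left₀ (norm_nonneg _) h1 2
      linarith
    have e : ut x - ‖x‖ ^ 2 / 2 = - ((ρ ^ 2)⁻¹ * (V (A x) - (u (A x) - ‖A x‖ ^ 2 / 2))) +
        (ρ ^ 2)⁻¹ * (V (A x) - (c + ⟪p, A x⟫_ℝ + ⟪E (A x), A x⟫_ℝ / 2)) + -((‖x‖ ^ 2 - ‖S x‖ ^ 2 - ⟪E (S x), S x⟫_ℝ) / 2) := by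
      have h1 : ⟪E (A x), A x⟫_ℝ = ρ ^ 2 * ⟪E (S x), S x⟫_ℝ := by
        simp [hA, inner_smul_left, inner_smul_right]; ring
      have h2 : ‖A x‖ ^ 2 = ρ ^ 2 * ‖S x‖ ^ 2 := by
        simp [hA, norm_smul, mul_pow]
      have h3 : ⟪adj A p, x⟫_ℝ = ⟪p, A x⟫_ℝ := by simp [adj, ContinuousLinearMap.adjoint_inner_left]
      rw [hut]; simp only [inner_neg_left, inner_smul_left, h3, h1, h2]
      simp
      field_simp
      ring
    have b1 : |(ρ ^ 2)⁻¹ * (V (A x) - (c + ⟪p, A x⟫_ℝ + ⟪E (A x), A x⟫_ℝ / 2))| ≤ 4 * τ * ε := by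
      rw [abs_mul, abs_of_pos (by positivity), inv_mul_le_iff₀ (by positivity)]
      have := mul_le_mul_of_nonneg_left a3 (show 0 ≤ τ * ε by positivity)
      linarith
    have b2 : |(‖x‖ ^ 2 - ‖S x‖ ^ 2 - ⟪E (S x), S x⟫_ℝ) / 2| ≤ C2 * ε ^ 2 := by
      rw [abs_div, abs_two]
      have := mul_le_mul_of_nonneg_left x2 (show 0 ≤ C2 * ε ^ 2 by positivity)
      have h0 : 0 ≤ C2 * ε ^ 2 := by positivity
      linarith
    rw [e]
    refine (abs_add_three _ _ _).trans ?_
    rw [abs_neg, abs_neg, abs_mul, abs_of_pos (show 0 < (ρ ^ 2)⁻¹ by positivity)]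
    linarith
  have concl := hM ut _ _ (ε / 8) (B * ε ^ 2 + (4 * τ * ε + C2 * ε ^ 2) * vB n) (ε ^ 2) ((ρ ^ n)⁻¹ * ε ^ (n + 1)) (μ0 * ε) g (by positivity)
    (pow_le_one₀ e0.le e1) (by positivity) (by positivity) (by positivity) (by positivity) ?_ ?_ ?_ ?_ ?_ ?_ ?_
  · refine ⟨S, (2:ℝ) • (-((ρ ^ 2)⁻¹ • adj A p)), 4 * -((ρ ^ 2)⁻¹ * c), Sd, Sb, fun ξ hξ => ?_⟩
    have := concl ((1/2:ℝ) • ξ) (by rw [norm_smul]; norm_num; linarith)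
    have e : ((ρ / 2) ^ 2)⁻¹ * u ((ρ / 2) • S ξ) + (⟪(2:ℝ) • (-((ρ ^ 2)⁻¹ • adj A p)), ξ⟫_ℝ + 4 * -((ρ ^ 2)⁻¹ * c)) - ‖ξ‖ ^ 2 / 2 =
        4 * (ut ((1/2:ℝ) • ξ) - ‖(1/2:ℝ) • ξ‖ ^ 2 / 2) := by
      have h1 : A ((1/2:ℝ) • ξ) = (ρ / 2) • S ξ := by
        simp only [hA, ContinuousLinearMap.smul_apply, map_smul, smul_smul]; ring_nf
      simp only [hut, h1, norm_smul, inner_smul_left, inner_smul_right, inner_neg_left]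
      norm_num
      field_simp
      ring
    rw [e, abs_mul, abs_of_pos (by norm_num)]
    linarith
  · have cA := A.continuous
    have cut : Continuous ut := by fun_prop
    set F : Eu n → ℝ≥0∞ := (closedBall 0 (1/4)).indicator fun x => ‖V x - (u x - ‖x‖ ^ 2 / 2)‖ₑ with hF
    have mF : Measurable F := ((by fun_prop : Continuous fun x => V x - (u x - ‖x‖ ^ 2 / 2)).enorm.measurable).indicator measurableSet_closedBall
    have k0 : 0 ≤ 4 * τ * ε + C2 * ε ^ 2 := by positivity
    calc ∫⁻ x in closedBall 0 1, ‖ut x - ‖x‖ ^ 2 / 2‖ₑ ≤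
        ∫⁻ x in closedBall 0 1, (ENNReal.ofReal ((ρ ^ 2)⁻¹) * F (A x) + ENNReal.ofReal (4 * τ * ε + C2 * ε ^ 2)) := by
          refine setLIntegral_mono' measurableSet_closedBall fun x hx => ?_
          have hx : ‖x‖ ≤ 1 := by simpa using hx
          have hm : A x ∈ closedBall (0:Eu n) (1/4) := by simp; linarith [(An x hx).2]
          rw [hF, indicator_of_mem hm, Real.enorm_eq_ofReal_abs, Real.enorm_eq_ofReal_abs, ← ENNReal.ofReal_mul (by positivity), ← ENNReal.ofReal_add (by positivity) k0]
          exact ENNReal.ofReal_le_ofReal (split x hx)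
      _ = (∫⁻ x in closedBall 0 1, ENNReal.ofReal ((ρ ^ 2)⁻¹) * F (A x)) + ENNReal.ofReal (4 * τ * ε + C2 * ε ^ 2) * volume (closedBall (0:Eu n) 1) := by
          rw [lintegral_add_right _ measurable_const, setLIntegral_const]
      _ ≤ ENNReal.ofReal ((ρ ^ 2)⁻¹) * (ENNReal.ofReal ((ρ ^ n)⁻¹) * ENNReal.ofReal (CV * ε ^ 2)) + ENNReal.ofReal (4 * τ * ε + C2 * ε ^ 2) * ENNReal.ofReal (vB n) := by
          refine add_le_add ?_ (mul_le_mul' le_rfl ?_)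
          · refine (setLIntegral_le_lintegral _ _).trans ?_
            rw [lintegral_const_mul' _ _ ENNReal.ofReal_ne_top, lscale Adn mF, Aab]
            refine mul_le_mul' le_rfl (mul_le_mul' le_rfl ?_)
            rw [hF, lintegral_indicator measurableSet_closedBall]
            exact lV
          · rw [vB, measureReal_def, ENNReal.ofReal_toReal measure_closedBall_lt_top.ne]
      _ = _ := by
          rw [← ENNReal.ofReal_mul (by positivity), ← ENNReal.ofReal_mul (by positivity), ← ENNReal.ofReal_mul k0, ← ENNReal.ofReal_add (by positivity) (by positivity)]
          congr 1; rw [hB]; ring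
  · calc volume (closedBall 0 1 ∩ bad (fun x => (ρ ^ 2)⁻¹ • (adj A).comp ((H (A x)).comp A)) (ε ^ 2)) ≤
        volume ((fun x => A x + 0) ⁻¹' (closedBall 0 1 ∩ bad H (ε ^ 2))) := by
          refine measure_mono fun x hx => ?_
          have hx1 : ‖x‖ ≤ 1 := by simpa using hx.1
          have h2 : ε ^ 2 < |((ρ ^ 2)⁻¹ • (adj A).comp ((H (A x)).comp A)).det - 1| := hx.2
          rw [det_conjs (by positivity) Ad] at h2
          refine ⟨?_, ?_⟩
          · simp; linarith [(An x hx1).2]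
          · simpa [bad] using h2
      _ ≤ ENNReal.ofReal ((ρ ^ n)⁻¹) * ENNReal.ofReal (ε ^ (n + 1)) := by
          rw [vol_pre Adn, Aab]; exact mul_le_mul' le_rfl hbv
      _ = _ := by rw [← ENNReal.ofReal_mul (by positivity)]
  · intro x hx
    refine (split x hx).trans ?_
    have h1 := bV (A x) (by linarith [(An x hx).2])
    have h2 := f.fl (A x) (by linarith [(An x hx).2])
    have h3 : |V (A x) - (u (A x) - ‖A x‖ ^ 2 / 2)| ≤ 2 * ε := (abs_sub _ _).trans (by linarith)
    have h4 := mul_le_mul_of_nonneg_left h3 (show 0 ≤ (ρ ^ 2)⁻¹ by positivity)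
    have h5 : C2 * ε ^ 2 ≤ C2 * ε := mul_le_mul_of_nonneg_left (by nlinarith) C20
    rw [hμ0]; linarith
  · have h1 := eZ' _ (show 32 * M * (B + C2 * vB n) ≤ Z by linarith)
    have h2 : M * (4 * τ * vB n) = 1 / 32 := by rw [hτ]; field_simp; norm_num
    have h3 := mul_le_mul_of_nonneg_right h1 e0.le
    have e : M * (B * ε ^ 2 + (4 * τ * ε + C2 * ε ^ 2) * vB n) = 32 * M * (B + C2 * vB n) * ε * ε / 32 + M * (4 * τ * vB n) * ε := by ring
    rw [e, h2]; linarith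
  · have h1 := eZ' _ (show 8 * M ≤ Z by linarith)
    have h3 := mul_le_mul_of_nonneg_right h1 e0.le
    linarith
  · have h1 := eZ' _ (show M * (ρ ^ n)⁻¹ * 8 ^ n ≤ Z by linarith)
    have h3 := mul_le_mul_of_nonneg_right h1 (pow_nonneg e0.le n)
    rw [div_pow ε 8 n, le_div_iff₀ (by positivity), pow_succ]
    linarith
  · have h1 := eZ' _ (show M * μ0 ^ (n + 2) * 64 ≤ Z by linarith)
    have h3 := mul_le_mul_of_nonneg_right h1 (pow_nonneg e0.le 2)
    have h4 : ε ^ (n + 2) ≤ ε ^ 3 := pow_le_pow_of_le_one e0.le e1 (by omega)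
    have h5 := mul_le_mul_of_nonneg_left h4 z4
    rw [mul_pow, div_pow ε 8 2]
    linarith

/-- Flatness of `u` at scale `s` through the linear map `B` -/
def Flat (u : Eu n → ℝ) (B : Eu n →L[ℝ] Eu n) (s e : ℝ) : Prop :=
  0 < s ∧ s ^ n = B.det ^ 2 ∧ ∃ (p : Eu n) (c : ℝ), ∀ ξ : Eu n, ‖ξ‖ ≤ 1 →
    |s⁻¹ * u (B ξ) + (⟪p, ξ⟫_ℝ + c) - ‖ξ‖ ^ 2 / 2| ≤ e

theorem flatStep (hn : 0 < n) (hc0 : 0 < c0) (hC0 : 1 ≤ C0) (g : Good c0 C0 u G H)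
    {K0 R : ℝ} (hd : ∀ x, R ≤ ‖x‖ → ‖x‖ * |(H x).det - 1| ≤ K0) :
    ∃ r e0 : ℝ, 0 < r ∧ r < 1 ∧ 0 < e0 ∧ ∃ K : ℝ, 1 ≤ K ∧ ∀ B s e, 0 < e → e ≤ e0 → K ≤ s * e ^ 8 →
      Flat u B s e → ∃ B', Flat u B' (r ^ 2 * s) e := by
  obtain ⟨r, e0, hr, hr1, he0, hst⟩ := step (n := n) (c0 := c0) (C0 := C0) hn hc0 hC0
  set K1 := 1 + |K0| + |R| with hK1
  have k1 : 1 ≤ K1 := by have := abs_nonneg K0; have := abs_nonneg R; linarith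
  refine ⟨r, min e0 (1/1000), hr, hr1, lt_min he0 (by norm_num), K1 ^ 2 * (1 + vB n ^ 2), ?_, ?_⟩
  · have := sq_nonneg (vB n); have : 1 ≤ K1 ^ 2 := one_le_pow₀ k1
    nlinarith
  intro B s e e0' he hK ⟨hs, hB, p, c, hp⟩
  have he1 : e ≤ 1/1000 := he.trans (min_le_right _ _)
  have hsn : 0 < s ^ n := by positivity
  have Bd : B.det ≠ 0 := fun h0 => by rw [h0] at hB; simp [hB, hn.ne'] at hsn
  have g2 := g.compA hs hB 0 p c
  simp only [add_zero] at g2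
  have sub : bad H (e ^ 2) ⊆ closedBall 0 (K1 / e ^ 2) := fun x hx => by
    have hx : e ^ 2 < |(H x).det - 1| := hx
    rw [mem_closedBall_zero_iff]
    by_contra h; push Not at h
    have h1 : K1 ≤ K1 / e ^ 2 := by
      rw [le_div_iff₀ (by positivity)]
      have : e ^ 2 ≤ 1 := by nlinarith
      nlinarith
    have h2 : R ≤ ‖x‖ := by have := le_abs_self R; have := abs_nonneg K0; linarith
    have h3 := hd x h2
    have h4 : 0 < ‖x‖ := by linarith
    rw [div_lt_iff₀ (by positivity)] at h
    have h5 := mul_lt_mul_of_pos_left hx h4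
    have := le_abs_self K0; have := abs_nonneg R
    linarith
  have bv : volume (closedBall 0 1 ∩ bad (fun x => s⁻¹ • (adj B).comp ((H (B x)).comp B)) (e ^ 2)) ≤
      ENNReal.ofReal (e ^ (n + 1)) := by
    calc _ ≤ volume ((fun x => B x + 0) ⁻¹' (closedBall 0 (K1 / e ^ 2))) := by
          refine measure_mono fun x hx => ?_
          have h2 : e ^ 2 < |(s⁻¹ • (adj B).comp ((H (B x)).comp B)).det - 1| := hx.2
          rw [det_conjs hs hB] at h2
          simpa using sub h2
      _ = ENNReal.ofReal (|B.det⁻¹| * ((K1 / e ^ 2) ^ n * vB n)) := by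
          have p1 : (0:ℝ) ≤ K1 / e ^ 2 := by positivity
          rw [vol_pre Bd, Measure.addHaar_closedBall' _ _ p1, finrank_euclideanSpace, Fintype.card_fin,
            ENNReal.ofReal_mul (abs_nonneg _), ENNReal.ofReal_mul (by positivity), vB, measureReal_def,
            ENNReal.ofReal_toReal measure_closedBall_lt_top.ne]
      _ ≤ _ := by
          refine ENNReal.ofReal_le_ofReal ?_
          have hBp : 0 < |B.det| := abs_pos.2 Bd
          rw [abs_inv, inv_mul_le_iff₀ hBp, div_pow, div_mul_eq_mul_div, div_le_iff₀ (by positivity)]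
          have v0 := vB0 (n := n)
          refine le_of_sq_le_sq ?_ (by positivity)
          have h1 : (K1 ^ 2 * (1 + vB n ^ 2)) ^ n ≤ (s * e ^ 8) ^ n := pow_le_pow_left₀ (by positivity) hK n
          have h2 : 1 + vB n ^ 2 ≤ (1 + vB n ^ 2) ^ n := le_self_pow₀ (by nlinarith) hn.ne'
          have h3 : (K1 ^ 2) ^ n * (vB n ^ 2) ≤ (K1 ^ 2 * (1 + vB n ^ 2)) ^ n := by
            rw [mul_pow]; exact mul_le_mul_of_nonneg_left (by linarith) (by positivity)
          have h4 : (e ^ 8) ^ n ≤ (e ^ (n + 1) * (e ^ 2) ^ n) ^ 2 := by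
            rw [show (e ^ (n + 1) * (e ^ 2) ^ n) ^ 2 = e ^ (6 * n + 2) by ring, ← pow_mul]
            exact pow_le_pow_of_le_one e0'.le (by linarith) (by omega)
          calc (K1 ^ n * vB n) ^ 2 = (K1 ^ 2) ^ n * (vB n ^ 2) := by ring
            _ ≤ s ^ n * (e ^ 8) ^ n := by rw [← mul_pow]; exact h3.trans h1
            _ ≤ s ^ n * (e ^ (n + 1) * (e ^ 2) ^ n) ^ 2 := mul_le_mul_of_nonneg_left h4 hsn.le
            _ = _ := by rw [hB, ← sq_abs B.det]; ring
  have f : Fl c0 C0 e _ _ _ := ⟨g2, e0', he1, hp, bv.trans (ENNReal.ofReal_le_ofReal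
    (pow_le_pow_of_le_one e0'.le (by linarith) (by omega)))⟩
  obtain ⟨S, p', c', hS, -, hS3⟩ := hst _ _ _ _ f (he.trans (min_le_left _ _)) bv
  refine ⟨r • B.comp S, by positivity, ?_, (r ^ 2)⁻¹ • (r • adj S p) + p', (r ^ 2)⁻¹ * c + c', fun ξ hξ => ?_⟩
  · rw [det_smul', det_cmp, mul_pow, hB, mul_pow, mul_pow, hS]; ring
  · refine (le_of_eq ?_).trans ((hS3 ξ hξ).trans (by linarith))
    congr 1
    simp only [inner_add_left, inner_smul_left, inner_smul_right, ContinuousLinearMap.adjoint_inner_left,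
      ContinuousLinearMap.smul_apply, ContinuousLinearMap.comp_apply, map_smul, mul_inv]
    simp; ring

theorem flatAll (hn : 0 < n) (hc0 : 0 < c0) (hc1 : c0 ≤ 1) (hC0 : 1 ≤ C0) (g : Good c0 C0 u G H)
    (u0 : ∀ x, 0 ≤ u x) (uz : u 0 = 0)
    {K0 R : ℝ} (hd : ∀ x, R ≤ ‖x‖ → ‖x‖ * |(H x).det - 1| ≤ K0) :
    ∃ r e0 : ℝ, 0 < r ∧ r < 1 ∧ 0 < e0 ∧ ∃ K : ℝ, 1 ≤ K ∧ ∀ t e, 0 < e → e ≤ e0 → K ≤ t * e ^ 8 →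
      ∃ s B, t ≤ s ∧ r ^ 2 * s ≤ t ∧ Flat u B s e := by
  obtain ⟨r, e0, hr, hr1, he0, K, hK, hst⟩ := flatStep (n := n) hn hc0 hC0 g hd
  refine ⟨r, e0, hr, hr1, he0, K, hK, fun t e ep ee ht => ?_⟩
  have t0 : 0 < t := by
    by_contra h; push Not at h
    have : t * e ^ 8 ≤ 0 := mul_nonpos_of_nonpos_of_nonneg h (by positivity)
    linarith
  have hfar : ∀ ε : ℝ, 0 < ε → ∃ R, ∀ x, R < ‖x‖ → |(H x).det - 1| ≤ ε := fun ε hε => by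
    refine ⟨max (max R 1) (K0 / ε), fun x hx => ?_⟩
    obtain ⟨h1, h3⟩ := max_lt_iff.1 hx
    obtain ⟨h1, h2⟩ := max_lt_iff.1 h1
    have h4 := hd x h1.le
    rw [div_lt_iff₀ hε] at h3
    have : ‖x‖ * |(H x).det - 1| ≤ ‖x‖ * ε := by linarith
    exact le_of_mul_le_mul_left this (by linarith)
  obtain ⟨s, S, hs, hs0, hdet, hfl⟩ := A1 hn hc0 hc1 hC0 g u0 uz hfar (N := t) ep
  have key : ∀ k : ℕ, (∃ s B, t ≤ s ∧ r ^ 2 * s ≤ t ∧ Flat u B s e) ∨ (t ≤ (r ^ 2) ^ k * s ∧ ∃ B, Flat u B ((r ^ 2) ^ k * s) e) := by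
    intro k
    induction k with
    | zero => exact Or.inr ⟨by simpa using hs, S, by simpa using hs0, by simpa using hdet, 0, 0, by simpa using hfl⟩
    | succ k ih =>
      rcases ih with h | ⟨h1, B, hB⟩
      · exact Or.inl h
      by_cases h2 : r ^ 2 * ((r ^ 2) ^ k * s) ≤ t
      · exact Or.inl ⟨_, B, h1, h2, hB⟩
      push Not at h2
      obtain ⟨B', hB'⟩ := hst B _ e ep ee (ht.trans (mul_le_mul_of_nonneg_right h1 (by positivity))) hB
      have e1 : (r ^ 2) ^ (k + 1) * s = r ^ 2 * ((r ^ 2) ^ k * s) := by ring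
      rw [e1]
      exact Or.inr ⟨h2.le, B', hB'⟩
  have hr2 : r ^ 2 < 1 := by nlinarith
  obtain ⟨k, hk⟩ := exists_pow_lt_of_lt_one (show 0 < t / s by positivity) hr2
  rw [lt_div_iff₀ hs0] at hk
  rcases key k with h | h
  · exact h
  · linarith [h.1]

/-- what flatness says about `u` in terms of an inverse `D = √s B⁻¹` -/
theorem Flat.inv {B : Eu n →L[ℝ] Eu n} {s e : ℝ} (hn : 0 < n) (u0 : ∀ x, 0 ≤ u x) (uz : u 0 = 0) (e0 : 0 < e) (e1 : e ≤ 1)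
    (f : Flat u B s (e ^ 2)) : ∃ D : Eu n →L[ℝ] Eu n, D.det ^ 2 = 1 ∧
      (∀ h, ‖D h‖ ^ 2 ≤ s → |u h + u (-h) - ‖D h‖ ^ 2| ≤ 4 * e ^ 2 * s ∧ |u h - ‖D h‖ ^ 2 / 2| ≤ 5 * e * s) := by
  obtain ⟨hs, hB, p, c, hp⟩ := f
  have hsn : 0 < s ^ n := by positivity
  have Bd : B.det ≠ 0 := fun h0 => by rw [h0] at hB; simp [hB, hn.ne'] at hsn
  have hu : IsUnit (LinearMap.det (B : Eu n →ₗ[ℝ] Eu n)) := isUnit_iff_ne_zero.2 Bd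
  set E := (LinearMap.equivOfIsUnitDet hu).toContinuousLinearEquiv with hE
  have EB : ∀ x, E x = B x := fun x => by simp [hE]
  set Bi : Eu n →L[ℝ] Eu n := (E.symm : Eu n →L[ℝ] Eu n) with hBi
  have BBi : ∀ x, B (Bi x) = x := fun x => by rw [← EB]; simp [hBi]
  have dd : B.det * Bi.det = 1 := by
    rw [← det_cmp, show B.comp Bi = ContinuousLinearMap.id ℝ (Eu n) from by ext1 x; simp [BBi], det_id1]
  set q := Real.sqrt s with hq
  have q0 : 0 < q := Real.sqrt_pos.2 hs
  have qq : q ^ 2 = s := Real.sq_sqrt hs.le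
  have cc : |c| ≤ e ^ 2 := by simpa [uz] using hp 0 (by simp)
  have pe : ‖p‖ ≤ 5 / 2 * e := by
    by_cases hp0 : p = 0
    · rw [hp0]; simp; linarith
    have pn : 0 < ‖p‖ := norm_pos_iff.2 hp0
    have nn : ‖(e / ‖p‖) • p‖ = e := by
      rw [norm_smul, Real.norm_eq_abs, abs_of_pos (by positivity)]; field_simp
    have h1 := hp ((e / ‖p‖) • p) (by rw [nn]; exact e1)
    rw [nn, inner_smul_right, real_inner_self_eq_norm_sq, show e / ‖p‖ * ‖p‖ ^ 2 = e * ‖p‖ by field_simp] at h1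
    have h2 : 0 ≤ s⁻¹ * u (B ((e / ‖p‖) • p)) := mul_nonneg (by positivity) (u0 _)
    have h3 := (abs_le.1 h1).2
    have h4 := (abs_le.1 cc).1
    have h5 : e * ‖p‖ ≤ e * (5 / 2 * e) := by linarith
    exact le_of_mul_le_mul_left h5 e0
  refine ⟨q • Bi, ?_, fun h hh => ?_⟩
  · rw [det_smul', mul_pow, ← pow_mul, mul_comm n 2, pow_mul, qq, hB, ← mul_pow, dd, one_pow]
  have nD : ‖(q • Bi) h‖ ^ 2 = s * ‖Bi h‖ ^ 2 := by
    rw [ContinuousLinearMap.smul_apply, norm_smul, mul_pow, Real.norm_eq_abs, sq_abs, qq]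
  rw [nD] at hh ⊢
  have n1 : ‖Bi h‖ ≤ 1 := by
    have : ‖Bi h‖ ^ 2 ≤ 1 := by
      by_contra h; push Not at h
      have := mul_lt_mul_of_pos_left h hs
      linarith
    exact abs_le_one_iff_mul_self_le_one.2 (by nlinarith) |> fun h => (le_abs_self _).trans h
  have a1 := hp _ n1
  have a2 := hp (-Bi h) (by rwa [norm_neg])
  rw [BBi] at a1
  rw [map_neg, BBi, norm_neg, inner_neg_right] at a2
  have ip : |⟪p, Bi h⟫_ℝ| ≤ 5 / 2 * e := (abs_real_inner_le_norm _ _).trans (by nlinarith [norm_nonneg p, norm_nonneg (Bi h)])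
  have b1 : u h = s * (s⁻¹ * u h) := by field_simp
  have b2 : u (-h) = s * (s⁻¹ * u (-h)) := by field_simp
  set X := s⁻¹ * u h
  set Y := s⁻¹ * u (-h)
  obtain ⟨a11, a12⟩ := abs_le.1 a1
  obtain ⟨a21, a22⟩ := abs_le.1 a2
  obtain ⟨c1, c2⟩ := abs_le.1 cc
  obtain ⟨i1, i2⟩ := abs_le.1 ip
  have ee : e ^ 2 ≤ e := by nlinarith
  constructor
  · rw [b1, b2, show s * X + s * Y - s * ‖Bi h‖ ^ 2 = (X + Y - ‖Bi h‖ ^ 2) * s by ring, abs_mul, abs_of_pos hs]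
    exact mul_le_mul_of_nonneg_right (abs_le.2 ⟨by linarith, by linarith⟩) hs.le
  · rw [b1, show s * X - s * ‖Bi h‖ ^ 2 / 2 = (X - ‖Bi h‖ ^ 2 / 2) * s by ring, abs_mul, abs_of_pos hs]
    exact mul_le_mul_of_nonneg_right (abs_le.2 ⟨by linarith, by linarith⟩) hs.le

/-- comparison of two quadratic forms at comparable scales -/
theorem cmpQ {U : Eu n → ℝ} {D D' : Eu n →L[ℝ] Eu n} {s s' e L : ℝ} (hs : 0 < s) (hs' : 0 < s') (hL : 1 ≤ L)
    (h1 : s ≤ L * s') (h2 : s' ≤ L * s) (e0 : 0 ≤ e) (he : 32 * L * e ≤ 1)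
    (hD : D.det ^ 2 = 1)
    (hU : ∀ h, ‖D h‖ ^ 2 ≤ s → |U h - ‖D h‖ ^ 2| ≤ 4 * e * s)
    (hU' : ∀ h, ‖D' h‖ ^ 2 ≤ s' → |U h - ‖D' h‖ ^ 2| ≤ 4 * e * s') (h : Eu n) :
    |‖D h‖ ^ 2 - ‖D' h‖ ^ 2| ≤ 32 * L ^ 2 * e * ‖D h‖ ^ 2 := by
  by_cases h0 : h = 0
  · simp [h0]
  have Dd : D.det ≠ 0 := fun h => by simp [h] at hD
  have Dp : 0 < ‖D h‖ := norm_pos_iff.2 (inj_of_det Dd h0)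
  set a := Real.sqrt (s / (4 * L)) / ‖D h‖ with ha
  have a0 : 0 < a := by positivity
  have aa : a ^ 2 * ‖D h‖ ^ 2 = s / (4 * L) := by
    rw [← mul_pow, ha, div_mul_cancel₀ _ Dp.ne', Real.sq_sqrt (by positivity)]
  have hom : ∀ (t : ℝ) (A : Eu n →L[ℝ] Eu n), ‖A (t • h)‖ ^ 2 = t ^ 2 * ‖A h‖ ^ 2 := fun t A => by
    rw [map_smul, norm_smul, mul_pow, Real.norm_eq_abs, sq_abs]
  have s4 : s / (4 * L) ≤ s := div_le_self hs.le (by linarith)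
  have s4' : s / (4 * L) ≤ s' / 4 := by
    rw [div_le_div_iff₀ (by positivity) (by norm_num)]; nlinarith
  have es : 4 * e * s ≤ s' / 8 := by
    have i1 := mul_le_mul_of_nonneg_left h1 (show 0 ≤ 32 * e by positivity)
    have i2 := mul_le_mul_of_nonneg_right he hs'.le
    linarith
  have es' : 4 * e * s' ≤ s' / 8 := by
    have i2 := mul_le_mul_of_nonneg_right he hs'.le
    have i3 : 32 * 1 * e * s' ≤ 32 * L * e * s' := by gcongr
    linarith
  have bd : a ^ 2 * ‖D' h‖ ^ 2 ≤ s' := by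
    by_contra hb; push Not at hb
    have Dp' : 0 < ‖D' h‖ ^ 2 := by
      by_contra hh
      have : a ^ 2 * ‖D' h‖ ^ 2 ≤ 0 := mul_nonpos_of_nonneg_of_nonpos (by positivity) (by linarith)
      linarith
    set b := Real.sqrt (s' / ‖D' h‖ ^ 2) with hb'
    have bb : b ^ 2 = s' / ‖D' h‖ ^ 2 := Real.sq_sqrt (by positivity)
    have bb2 : b ^ 2 * ‖D' h‖ ^ 2 = s' := by rw [bb, div_mul_cancel₀ _ Dp'.ne']
    have ba : b ^ 2 ≤ a ^ 2 := by rw [bb, div_le_iff₀ Dp']; exact hb.le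
    have k1 : b ^ 2 * ‖D h‖ ^ 2 ≤ s / (4 * L) := by rw [← aa]; gcongr
    have k2 := hU (b • h) (by rw [hom]; linarith)
    have k3 := hU' (b • h) (by rw [hom]; linarith)
    rw [hom] at k2 k3
    have k4 := (abs_le.1 k2).2
    have k5 := (abs_le.1 k3).1
    linarith
  have k2 := hU (a • h) (by rw [hom]; linarith)
  have k3 := hU' (a • h) (by rw [hom]; linarith)
  rw [hom] at k2 k3
  have k4 : |a ^ 2 * ‖D h‖ ^ 2 - a ^ 2 * ‖D' h‖ ^ 2| ≤ 4 * e * s + 4 * e * s' := by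
    have := abs_sub_le (a ^ 2 * ‖D h‖ ^ 2) (U (a • h)) (a ^ 2 * ‖D' h‖ ^ 2)
    rw [abs_sub_comm _ (U _)] at this
    linarith
  rw [← mul_sub, abs_mul, abs_of_pos (by positivity : 0 < a ^ 2)] at k4
  have k5 : 4 * e * s + 4 * e * s' ≤ a ^ 2 * (32 * L ^ 2 * e * ‖D h‖ ^ 2) := by
    rw [show a ^ 2 * (32 * L ^ 2 * e * ‖D h‖ ^ 2) = 32 * L ^ 2 * e * (a ^ 2 * ‖D h‖ ^ 2) by ring, aa]
    rw [show 32 * L ^ 2 * e * (s / (4 * L)) = 8 * e * (L * s) by field_simp; ring]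
    have i1 := mul_le_mul_of_nonneg_left h2 (show 0 ≤ 4 * e by positivity)
    have i2 : 4 * e * (1 * s) ≤ 4 * e * (L * s) := by gcongr
    linarith
  exact le_of_mul_le_mul_left (k4.trans k5) (by positivity)

/-- limit of a sequence of quadratic forms with geometric differences -/
theorem limQ {D : ℕ → (Eu n →L[ℝ] Eu n)} (hD : ∀ m, (D m).det ^ 2 = 1)
    (hc : ∀ m h, |‖D m h‖ ^ 2 - ‖D (m + 1) h‖ ^ 2| ≤ 1 / 16 / 2 ^ m * ‖D m h‖ ^ 2) :
    ∃ E : Eu n →L[ℝ] Eu n, E.det ^ 2 = 1 ∧ ∀ m h, |‖D m h‖ ^ 2 - ‖E h‖ ^ 2| ≤ ‖E h‖ ^ 2 / 2 / 2 ^ m := by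
  have b0 : ∀ h m, ‖D m h‖ ^ 2 ≤ (2 - 1 / 2 ^ m) * ‖D 0 h‖ ^ 2 := fun h m => by
    induction m with
    | zero => norm_num
    | succ m ih =>
      have h1 := (abs_le.1 (hc m h)).1
      set y := ‖D 0 h‖ ^ 2
      have y0 : 0 ≤ y := by positivity
      have t1 : (1:ℝ) / 2 ^ m ≤ 1 := by rw [div_le_one (by positivity)]; exact one_le_pow₀ (by norm_num)
      have t0 : (0:ℝ) ≤ 1 / 2 ^ m := by positivity
      rw [show (1:ℝ) / 16 / 2 ^ m = 1 / 16 * (1 / 2 ^ m) by ring] at h1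
      rw [show (1:ℝ) / 2 ^ (m + 1) = 1 / 2 * (1 / 2 ^ m) by rw [pow_succ]; field_simp]
      set t := (1:ℝ) / 2 ^ m
      have h2 := mul_le_mul_of_nonneg_left ih (show 0 ≤ 1 + 1 / 16 * t by positivity)
      have h3 : 0 ≤ t * y := by positivity
      have h4 : 0 ≤ t * t * y := by positivity
      nlinarith
  have b1 : ∀ h m, ‖D m h‖ ^ 2 ≤ 2 * ‖D 0 h‖ ^ 2 := fun h m => (b0 h m).trans (by
    refine mul_le_mul_of_nonneg_right ?_ (by positivity)
    have : (0:ℝ) ≤ 1 / 2 ^ m := by positivity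
    linarith)
  have geo : ∀ h m, dist (‖D m h‖ ^ 2) (‖D (m + 1) h‖ ^ 2) ≤ ‖D 0 h‖ ^ 2 / 4 / 2 / 2 ^ m := fun h m => by
    rw [Real.dist_eq]
    refine (hc m h).trans ?_
    have h1 := mul_le_mul_of_nonneg_left (b1 h m) (show (0:ℝ) ≤ 1 / 16 / 2 ^ m by positivity)
    refine h1.trans (le_of_eq ?_)
    field_simp; ring
  have bd : ∀ m, ‖D m‖ ≤ 2 * ‖D 0‖ := fun m => by
    refine ContinuousLinearMap.opNorm_le_bound _ (by positivity) fun h => ?_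
    have h1 := (D 0).le_opNorm h
    have h2 := b1 h m
    have : ‖D m h‖ ^ 2 ≤ (2 * ‖D 0‖ * ‖h‖) ^ 2 := by nlinarith [norm_nonneg (D 0 h)]
    exact le_of_sq_le_sq this (by positivity)
  haveI : ProperSpace (Eu n →L[ℝ] Eu n) := FiniteDimensional.proper ℝ _
  obtain ⟨E, -, φ, hφ, hE⟩ := tendsto_subseq_of_bounded (isBounded_closedBall (x := (0 : Eu n →L[ℝ] Eu n)) (r := 2 * ‖D 0‖))
    (fun m => by simpa using bd m : ∀ m, D m ∈ closedBall (0 : Eu n →L[ℝ] Eu n) (2 * ‖D 0‖))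
  refine ⟨E, ?_, fun m h => ?_⟩
  · have t1 := ((ContinuousLinearMap.continuous_det.tendsto E).comp hE).pow 2
    refine tendsto_nhds_unique t1 ?_
    simp only [Function.comp_apply, hD]
    exact tendsto_const_nhds
  · have cs := cauchySeq_of_le_geometric_two (geo h)
    obtain ⟨l, hl⟩ := cauchySeq_tendsto_of_complete cs
    have t1 : Tendsto (fun k => ‖D (φ k) h‖ ^ 2) atTop (𝓝 (‖E h‖ ^ 2)) := by
      have : Continuous fun A : Eu n →L[ℝ] Eu n => ‖A h‖ ^ 2 := by fun_prop
      exact (this.tendsto E).comp hE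
    have el := tendsto_nhds_unique t1 (hl.comp hφ.tendsto_atTop)
    rw [← el] at hl
    have d0 := dist_le_of_le_geometric_two_of_tendsto₀ (geo h) hl
    have dm := dist_le_of_le_geometric_two_of_tendsto (geo h) hl m
    rw [Real.dist_eq] at d0 dm
    refine dm.trans (div_le_div_of_nonneg_right ?_ (by positivity))
    have := (abs_le.1 d0).2
    nlinarith [sq_nonneg ‖D 0 h‖]

theorem core (hn : 0 < n) (hc0 : 0 < c0) (hc1 : c0 ≤ 1) (hC0 : 1 ≤ C0) (g : Good c0 C0 u G H)
    (u0 : ∀ x, 0 ≤ u x) (uz : u 0 = 0)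
    {K0 R : ℝ} (hd : ∀ x, R ≤ ‖x‖ → ‖x‖ * |(H x).det - 1| ≤ K0) :
    ∃ (E : Eu n →L[ℝ] Eu n) (C : ℝ), E.det ^ 2 = 1 ∧ 0 < C ∧ ∀ h, 1 ≤ ‖E h‖ →
      |u h - ‖E h‖ ^ 2 / 2| ≤ C * ‖E h‖ ^ ((2:ℝ) - 1 / 8) := by
  obtain ⟨r, e0, hr, hr1, he0, K, hK, hF⟩ := flatAll (n := n) hn hc0 hc1 hC0 g u0 uz hd
  set L := 2 ^ 16 / r ^ 2 with hL
  have r2 : r ^ 2 ≤ 1 := by nlinarith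
  have L1 : 1 ≤ L := by rw [hL, le_div_iff₀ (by positivity)]; linarith
  have L0 : 0 < L := by linarith
  set η0 := min 1 (min e0 (1 / (512 * L ^ 2))) with hη0
  have p0 : 0 < η0 := lt_min one_pos (lt_min he0 (by positivity))
  have p1 : η0 ≤ 1 := min_le_left _ _
  have p2 : η0 ≤ e0 := (min_le_right _ _).trans (min_le_left _ _)
  have p3 : η0 * (512 * L ^ 2) ≤ 1 := by
    rw [← le_div_iff₀ (by positivity)]; exact (min_le_right _ _).trans (min_le_right _ _)
  set η : ℕ → ℝ := fun m => η0 / 2 ^ m with hη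
  have ηp : ∀ m, 0 < η m := fun m => by positivity
  have ηs : ∀ m, η (m + 1) = η m / 2 := fun m => by simp only [hη]; rw [pow_succ]; field_simp
  have ηl : ∀ m, η m ≤ η0 := fun m => div_le_self p0.le (one_le_pow₀ (by norm_num))
  have η1 : ∀ m, η m ≤ 1 := fun m => (ηl m).trans p1
  have ηq : ∀ m, η m ^ 2 ≤ η m := fun m => by nlinarith [ηp m, η1 m]
  set t : ℕ → ℝ := fun m => K / η m ^ 16 with ht
  have tp : ∀ m, 0 < t m := fun m => by have := ηp m; positivity
  have ts : ∀ m, t (m + 1) = 2 ^ 16 * t m := fun m => by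
    have := ηp m
    simp only [ht]; rw [ηs, div_pow]; field_simp
  have ch : ∀ m, ∃ s, t m ≤ s ∧ r ^ 2 * s ≤ t m ∧ ∃ D : Eu n →L[ℝ] Eu n, D.det ^ 2 = 1 ∧
      (∀ h, ‖D h‖ ^ 2 ≤ s → |u h + u (-h) - ‖D h‖ ^ 2| ≤ 4 * η m ^ 2 * s ∧ |u h - ‖D h‖ ^ 2 / 2| ≤ 5 * η m * s) := fun m => by
    have := ηp m
    obtain ⟨s, B, h1, h2, h3⟩ := hF (t m) (η m ^ 2) (by positivity) ((ηq m).trans ((ηl m).trans p2))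
      (le_of_eq (by simp only [ht]; rw [← pow_mul]; field_simp))
    exact ⟨s, h1, h2, h3.inv hn u0 uz this (η1 m)⟩
  choose s hs1 hs2 D hD hDu using ch
  have sp : ∀ m, 0 < s m := fun m => (tp m).trans_le (hs1 m)
  have hs3 : ∀ m, s m ≤ t m / r ^ 2 := fun m => by rw [le_div_iff₀ (by positivity)]; linarith [hs2 m]
  obtain ⟨E, hE, hEm⟩ := limQ hD fun m h => by
    have q0 := ηp m
    have sc : s m ≤ L * s (m + 1) := by
      have h1 := hs1 (m + 1)
      rw [ts] at h1
      have h2 := mul_le_mul_of_nonneg_left h1 L0.le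
      refine (hs3 m).trans (le_trans ?_ h2)
      rw [hL, div_mul_eq_mul_div]
      refine div_le_div_of_nonneg_right ?_ (by positivity)
      linarith [tp m]
    have sc' : s (m + 1) ≤ L * s m := by
      refine (hs3 (m + 1)).trans ?_
      rw [ts, hL, div_mul_eq_mul_div]
      refine div_le_div_of_nonneg_right ?_ (by positivity)
      linarith [hs1 m]
    have LL : L ≤ L ^ 2 := by nlinarith
    have k1 : 32 * L ^ 2 * η m ^ 2 ≤ 1 / 16 / 2 ^ m := by
      have h1 := mul_le_mul_of_nonneg_left (ηq m) (show 0 ≤ 32 * L ^ 2 by positivity)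
      refine h1.trans ?_
      simp only [hη]
      rw [mul_div_assoc']
      refine div_le_div_of_nonneg_right ?_ (by positivity)
      linarith
    have k2 : 32 * L * η m ^ 2 ≤ 1 := by
      have h1 := mul_le_mul_of_nonneg_right LL (show 0 ≤ 32 * η m ^ 2 by positivity)
      have h2 : (1:ℝ) / 16 / 2 ^ m ≤ 1 / 16 := div_le_self (by norm_num) (one_le_pow₀ (by norm_num))
      linarith
    have := cmpQ (U := fun h => u h + u (-h)) (D := D m) (D' := D (m + 1)) (sp m) (sp (m + 1)) L1 sc sc' (by positivity) k2 (hD m)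
      (fun h hh => (hDu m h hh).1) (fun h hh => ((hDu (m + 1) h hh).1).trans (by
        have : η (m + 1) ^ 2 ≤ η m ^ 2 := pow_le_pow_left₀ (ηp _).le (by rw [ηs]; linarith) 2
        have := mul_le_mul_of_nonneg_right this (sp (m + 1)).le
        linarith)) h
    exact this.trans (mul_le_mul_of_nonneg_right k1 (by positivity))
  set M := max (t 0) (2 ^ 17) with hM
  have M0 : 0 < M := (tp 0).trans_le (le_max_left _ _)
  set C1 := 5 * M / r ^ 2 + 1 / (4 * η0) with hC1
  have C10 : 0 < C1 := by positivity
  refine ⟨E, C1 * K, hE, by positivity, fun h hh => ?_⟩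
  set N := ‖E h‖ with hN
  set X := N ^ 2 with hX
  have N0 : 0 < N := by linarith
  have X1 : 1 ≤ X := one_le_pow₀ hh
  have ex : ∃ m, 2 * X ≤ t m := by
    obtain ⟨m, hm⟩ := pow_unbounded_of_one_lt (2 * X / t 0) (show (1:ℝ) < 2 ^ 16 by norm_num)
    refine ⟨m, ?_⟩
    have e : t m = (2 ^ 16) ^ m * t 0 := by
      clear hm
      induction m with
      | zero => simp
      | succ m ih => rw [ts, ih]; ring
    rw [e]; rw [div_lt_iff₀ (tp 0)] at hm; exact hm.le
  obtain ⟨m, m1, m2⟩ : ∃ m, 2 * X ≤ t m ∧ t m ≤ M * X := by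
    classical
    refine ⟨Nat.find ex, Nat.find_spec ex, ?_⟩
    rcases hk : Nat.find ex with _ | k
    · have := mul_le_mul (le_max_left (t 0) (2 ^ 17)) X1 zero_le_one M0.le
      linarith
    · have h1 := Nat.find_min ex (m := k) (by omega)
      push Not at h1
      rw [ts]
      have := mul_le_mul_of_nonneg_right (le_max_right (t 0) (2 ^ 17)) (show 0 ≤ X by linarith)
      linarith
  have q0 := ηp m
  have d := hEm m h
  have dd : X / 2 / 2 ^ m ≤ X / 2 := div_le_self (by linarith) (one_le_pow₀ (by norm_num))
  have am : ‖D m h‖ ^ 2 ≤ s m := by linarith [(abs_le.1 d).2, hs1 m]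
  have z1 := (hDu m h am).2
  have z2 : 5 * η m * s m ≤ 5 * M / r ^ 2 * (η m * X) := by
    have h1 : s m ≤ M * X / r ^ 2 := (hs3 m).trans (div_le_div_of_nonneg_right m2 (by positivity))
    have h2 := mul_le_mul_of_nonneg_left h1 (show 0 ≤ 5 * η m by positivity)
    refine h2.trans (le_of_eq ?_); ring
  have z3 : X / 2 / 2 ^ m / 2 = 1 / (4 * η0) * (η m * X) := by
    simp only [hη]; field_simp; ring
  have z4 : |u h - X / 2| ≤ C1 * (η m * X) := by
    rw [hC1, add_mul, ← z3]
    obtain ⟨a1, a2⟩ := abs_le.1 z1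
    obtain ⟨a3, a4⟩ := abs_le.1 d
    refine abs_le.2 ⟨by linarith, by linarith⟩
  refine z4.trans ?_
  rw [mul_assoc]
  refine mul_le_mul_of_nonneg_left ?_ C10.le
  have NN : N ^ ((2:ℝ) - 1 / 8) = X / N ^ ((1:ℝ) / 8) := by
    rw [Real.rpow_sub N0, hX]; norm_num
  have np : 0 < N ^ ((1:ℝ) / 8) := Real.rpow_pos_of_pos N0 _
  rw [NN, mul_div_assoc', le_div_iff₀ np]
  set y := η m * N ^ ((1:ℝ) / 8) with hy
  have y0 : 0 ≤ y := by positivity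
  have y16 : y ^ 16 ≤ K := by
    have e : (N ^ ((1:ℝ) / 8)) ^ 16 = X := by
      rw [← Real.rpow_natCast, ← Real.rpow_mul N0.le, hX, ← Real.rpow_natCast]; norm_num
    rw [hy, mul_pow, e]
    have m3 : 2 * X ≤ K / η m ^ 16 := m1
    rw [le_div_iff₀ (by positivity)] at m3
    have : 0 ≤ X * η m ^ 16 := by positivity
    linarith
  have yK : y ≤ K := by
    by_contra hc; push Not at hc
    have : y ≤ y ^ 16 := le_self_pow₀ (by linarith) (by norm_num)
    linarith
  have := mul_le_mul_of_nonneg_right yK (show 0 ≤ X by linarith)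
  rw [hy] at this
  linarith

theorem C2.gradIneq (h : C2 u G H) (hc : ConvexOn ℝ univ u) (x y : Eu n) : u x + ⟪G x, y - x⟫_ℝ ≤ u y := by
  have c1 : ConvexOn ℝ univ (u ∘ (AffineMap.lineMap x y : ℝ →ᵃ[ℝ] Eu n)) := by
    simpa using hc.comp_affineMap (AffineMap.lineMap x y : ℝ →ᵃ[ℝ] Eu n)
  have d1 : HasDerivAt (u ∘ (AffineMap.lineMap x y : ℝ →ᵃ[ℝ] Eu n)) (⟪G x, y - x⟫_ℝ) 0 := by
    have h1 : HasDerivAt (AffineMap.lineMap x y : ℝ →ᵃ[ℝ] Eu n) (y - x) 0 := AffineMap.hasDerivAt_lineMap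
    have h2 : HasFDerivAt u (innerSL ℝ (G x)) ((AffineMap.lineMap x y : ℝ →ᵃ[ℝ] Eu n) 0) := by
      simpa using h.grad x
    simpa using h2.comp_hasDerivAt 0 h1
  have := c1.le_slope_of_hasDerivAt (mem_univ 0) (mem_univ 1) zero_lt_one d1
  simp [slope] at this
  linarith

theorem pd_of {T : Eu n →L[ℝ] Eu n} (hs : Sy T) (hp : Psd T) (hd : T.det ≠ 0) : Pd T := fun a ha => by
  refine lt_of_le_of_ne (hp a) fun h0 => ?_
  have hT : T a ≠ 0 := inj_of_det hd ha
  set q := ‖T a‖ ^ 2 with hq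
  have q0 : 0 < q := by have := norm_pos_iff.2 hT; positivity
  set m := ⟪T (T a), T a⟫_ℝ with hm
  have m0 : 0 ≤ m := hp _
  set t := q / (m + 1) with ht
  have t0 : 0 < t := by positivity
  have tm : t * (m + 1) = q := by rw [ht]; field_simp
  have h1 := hp (a - t • T a)
  have e1 : ⟪T (T a), a⟫_ℝ = q := by rw [hs, real_inner_self_eq_norm_sq]
  have e2 : ⟪T a, T a⟫_ℝ = q := real_inner_self_eq_norm_sq _
  rw [map_sub, map_smul, inner_sub_left, inner_sub_right, inner_sub_right, inner_smul_left, inner_smul_left,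
    inner_smul_right, inner_smul_right, ← h0, e1, e2, ← hm] at h1
  simp at h1
  nlinarith

theorem detH (hu : ContDiff ℝ 2 u) (h : C2 u G H) (x : Eu n) : (hess u x).det = (H x).det := by
  have e : hess u x = LinearMap.toMatrix (EuclideanSpace.basisFun (Fin n) ℝ).toBasis
      (EuclideanSpace.basisFun (Fin n) ℝ).toBasis (H x : Eu n →ₗ[ℝ] Eu n) := by
    ext i j
    have g1 : fderiv ℝ u = fun x => innerSL ℝ (G x) := funext fun x => (h.grad x).fderiv
    have g2 : HasFDerivAt (fun x => innerSL ℝ (G x)) ((innerSL ℝ).comp (H x)) x :=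
      (innerSL ℝ : Eu n →L[ℝ] _).hasFDerivAt.comp x (h.hess x)
    simp only [hess, Matrix.of_apply, iteratedFDeriv_two_apply, LinearMap.toMatrix_apply]
    rw [g1, g2.fderiv]
    simp
    have := h.symm x (EuclideanSpace.single i 1) (EuclideanSpace.single j 1)
    simp [EuclideanSpace.inner_single_left, EuclideanSpace.inner_single_right] at this
    simpa [EuclideanSpace.inner_single_left, EuclideanSpace.inner_single_right] using this
  rw [e, LinearMap.det_toMatrix]

theorem exRefl (hn : 0 < n) : ∃ R : Eu n →L[ℝ] Eu n, R.det = -1 ∧ ∀ x, ‖R x‖ = ‖x‖ := by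
  set e : Eu n := EuclideanSpace.single ⟨0, hn⟩ 1
  have e0 : e ≠ 0 := by simp [e]
  set K := (Submodule.span ℝ {e})ᗮ
  refine ⟨(K.reflection : Eu n ≃L[ℝ] Eu n), ?_, fun x => by simp⟩
  have := K.det_reflection
  rw [Submodule.orthogonal_orthogonal, finrank_span_singleton e0, pow_one] at this
  exact this

theorem mainThm (n : ℕ) (hn : 3 ≤ n) (ζ : ℝ) (hζ : 1 < ζ) (f : Eu n → ℝ) (finf : ℝ) (hf : Continuous f)
    (hdc : ∃ C R : ℝ, 0 < C ∧ 0 < R ∧ ∀ x : Eu n, R ≤ ‖x‖ → ‖x‖ ^ ζ * |f x - finf| ≤ C)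
    (u : Eu n → ℝ) (hu : ContDiff ℝ 2 u) (hc : ConvexOn ℝ univ u)
    (hMA : ∀ x, (hess u x).det = Real.exp (n * f x)) :
    ∃ (T : Eu n ≃ₗ[ℝ] Eu n) (C ε : ℝ), LinearMap.det (T : Eu n →ₗ[ℝ] Eu n) = 1 ∧ 0 < C ∧ 0 < ε ∧
      ∀ x : Eu n, 1 ≤ ‖x‖ → |u (T x) - Real.exp finf / 2 * ‖x‖ ^ 2| ≤ C * ‖x‖ ^ ((2 : ℝ) - ε) := by
  obtain ⟨C, R, C0, R0, hC⟩ := hdc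
  have n0 : 0 < n := by omega
  obtain ⟨G, H, h⟩ := C2.ofCD hu
  have hdet : ∀ x, (H x).det = Real.exp (n * f x) := fun x => by rw [← detH hu h, hMA]
  have gi := h.gradIneq hc
  have pd : ∀ x, Pd (H x) := fun x => by
    refine pd_of (h.symm x) ?_ (by rw [hdet]; positivity)
    have h2 := h.add (C2.lin (-G x) 0)
    have lm : IsLocalMin (fun y => u y + (⟪-G x, y⟫_ℝ + 0)) x := Eventually.of_forall fun y => by
      have := gi x y
      rw [inner_sub_right] at this
      simp only [inner_neg_left]; linarith
    intro d
    simpa using (h2.locmin lm).2 d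
  set F := Real.exp finf with hF
  have F0 : 0 < F := Real.exp_pos _
  set p : Eu n := -(F⁻¹ • G 0) with hp
  set c : ℝ := -(F⁻¹ * u 0) with hcc
  set u1 : Eu n → ℝ := fun x => F⁻¹ * u x + (⟪p, x⟫_ℝ + c) with hu1
  have h1 : C2 u1 (fun x => F⁻¹ • G x + p) (fun x => F⁻¹ • H x + 0) := (h.smul F⁻¹).add (C2.lin p c)
  have det1 : ∀ x, (F⁻¹ • H x + 0).det = Real.exp (n * (f x - finf)) := fun x => by
    rw [add_zero, det_smul', hdet, mul_sub, Real.exp_sub, mul_comm (n:ℝ) finf, ← Real.rpow_natCast, Real.inv_rpow F0.le,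
      hF, ← Real.exp_mul, div_eq_inv_mul]
  -- boundedness
  obtain ⟨M, hM⟩ : ∃ M, ∀ x, |f x - finf| ≤ M := by
    obtain ⟨M1, hM1⟩ := (isCompact_closedBall (0:Eu n) (max R 1)).exists_bound_of_continuousOn (f := fun x => f x - finf) (by fun_prop)
    refine ⟨max M1 C, fun x => ?_⟩
    by_cases hx : ‖x‖ ≤ max R 1
    · exact (hM1 x (by simpa using hx)).trans (le_max_left _ _)
    · push Not at hx
      obtain ⟨x1, x2⟩ := max_lt_iff.1 hx
      have a1 := hC x x1.le
      have a2 : 1 ≤ ‖x‖ ^ ζ := Real.one_le_rpow x2.le (by linarith)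
      have a3 := mul_le_mul_of_nonneg_right a2 (abs_nonneg (f x - finf))
      exact le_trans (by linarith) (le_max_right _ _)
  have M0 : 0 ≤ M := (abs_nonneg _).trans (hM 0)
  have nM : (0:ℝ) ≤ n * M := by positivity
  have yb : ∀ x, |(n:ℝ) * (f x - finf)| ≤ n * M := fun x => by
    rw [abs_mul, Nat.abs_cast]; exact mul_le_mul_of_nonneg_left (hM x) (by positivity)
  have C1 : 1 ≤ Real.exp (n * M) := Real.one_le_exp nM
  have g : Good (Real.exp (-(n * M))) (Real.exp (n * M)) u1 _ _ :=
    { toC2 := h1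
      conv := fun x y => by
        have a1 := mul_le_mul_of_nonneg_left (gi x y) (inv_pos.2 F0).le
        have a2 : ⟪F⁻¹ • G x + p, y - x⟫_ℝ = F⁻¹ * ⟪G x, y - x⟫_ℝ + (⟪p, y⟫_ℝ - ⟪p, x⟫_ℝ) := by
          rw [inner_add_left, inner_smul_left, inner_sub_right p]; simp
        rw [a2]; simp only [hu1]; linarith
      pos := fun x a ha => by
        have := pd x a ha
        have := inv_pos.2 F0
        simp only [add_zero, ContinuousLinearMap.smul_apply, inner_smul_left]
        simp; positivity
      lo := fun x => by rw [det1]; exact Real.exp_le_exp.2 (by linarith [(abs_le.1 (yb x)).1])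
      hi := fun x => by rw [det1]; exact Real.exp_le_exp.2 (by linarith [(abs_le.1 (yb x)).2]) }
  have uz : u1 0 = 0 := by simp [hu1, hcc]
  have u10 : ∀ x, 0 ≤ u1 x := fun x => by
    have := g.conv 0 x
    rw [uz] at this
    simpa [hp] using this
  obtain ⟨E, C2', hE, C20, hEu⟩ := core n0 (Real.exp_pos _) (Real.exp_le_one_iff.2 (by linarith)) C1 g u10 uz
    (K0 := Real.exp (n * M) * (n * C)) (R := max R 1) fun x hx => by
      have x1 : R ≤ ‖x‖ := (le_max_left _ _).trans hx
      have x2 : 1 ≤ ‖x‖ := (le_max_right _ _).trans hx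
      rw [det1]
      have a1 := hC x x1
      have a2 : ‖x‖ ≤ ‖x‖ ^ ζ := by
        conv_lhs => rw [← Real.rpow_one ‖x‖]
        exact Real.rpow_le_rpow_of_exponent_le x2 hζ.le
      have a3 := mul_le_mul_of_nonneg_right a2 (abs_nonneg (f x - finf))
      set y := (n:ℝ) * (f x - finf) with hy
      have ya : |y| = n * |f x - finf| := by rw [hy, abs_mul, Nat.abs_cast]
      have b1 : |Real.exp y - 1| ≤ Real.exp (n * M) * |y| := by
        have k1 := Real.add_one_le_exp y
        have k2 := mul_le_mul_of_nonneg_right (Real.add_one_le_exp (-y)) (Real.exp_pos y).le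
        rw [← Real.exp_add, neg_add_cancel, Real.exp_zero] at k2
        have k3 : Real.exp y ≤ Real.exp (n * M) := Real.exp_le_exp.2 (by linarith [(abs_le.1 (yb x)).2])
        have k4 := mul_le_mul_of_nonneg_right k3 (abs_nonneg y)
        have k5 := mul_le_mul_of_nonneg_right (le_abs_self y) (Real.exp_pos y).le
        have k6 := mul_le_mul_of_nonneg_right C1 (abs_nonneg y)
        have k7 := neg_abs_le y
        exact abs_le.2 ⟨by linarith, by linarith⟩
      calc ‖x‖ * |Real.exp y - 1| ≤ ‖x‖ * (Real.exp (n * M) * |y|) := mul_le_mul_of_nonneg_left b1 (norm_nonneg _)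
        _ = Real.exp (n * M) * (n * (‖x‖ * |f x - finf|)) := by rw [ya]; ring
        _ ≤ _ := by
          refine mul_le_mul_of_nonneg_left (mul_le_mul_of_nonneg_left (by linarith) (by positivity)) (by positivity)
  -- fix the sign
  obtain ⟨D, hD, hDE⟩ : ∃ D : Eu n →L[ℝ] Eu n, D.det = 1 ∧ ∀ x, ‖D x‖ = ‖E x‖ := by
    rcases sq_eq_sq_iff_eq_or_eq_neg.1 (hE.trans (one_pow 2).symm) with hh | hh
    · exact ⟨E, hh, fun x => rfl⟩
    · obtain ⟨Rf, r1, r2⟩ := exRefl n0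
      exact ⟨Rf.comp E, by rw [det_cmp, r1, hh]; norm_num, fun x => r2 _⟩
  have hD' : LinearMap.det (D : Eu n →ₗ[ℝ] Eu n) = 1 := hD
  set Te := LinearMap.equivOfIsUnitDet (f := (D : Eu n →ₗ[ℝ] Eu n)) (by rw [hD']; exact isUnit_one) with hT
  set T := Te.symm
  have DT : ∀ x, D (T x) = x := fun x => by
    have a1 : Te (T x) = x := Te.apply_symm_apply x
    have a2 : ∀ y, Te y = D y := fun y => by simp [hT]
    rw [← a2, a1]
  have Td : LinearMap.det (T : Eu n →ₗ[ℝ] Eu n) = 1 := by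
    have a1 : (D : Eu n →ₗ[ℝ] Eu n) ∘ₗ (T : Eu n →ₗ[ℝ] Eu n) = LinearMap.id := LinearMap.ext DT
    have a2 := congrArg LinearMap.det a1
    rw [LinearMap.det_comp, hD', one_mul, LinearMap.det_id] at a2
    exact a2
  set A := ‖(LinearMap.toContinuousLinearMap (T : Eu n →ₗ[ℝ] Eu n))‖ with hA
  have TA : ∀ x, ‖T x‖ ≤ A * ‖x‖ := fun x => (LinearMap.toContinuousLinearMap (T : Eu n →ₗ[ℝ] Eu n)).le_opNorm x
  have A0 : 0 ≤ A := norm_nonneg _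
  refine ⟨T, F * (C2' + ‖p‖ * A + |c|), 1 / 8, Td, by positivity, by norm_num, fun x hx => ?_⟩
  have k1 := hEu (T x) (by rw [← hDE, DT]; exact hx)
  rw [← hDE, DT] at k1
  set z := ‖x‖ ^ ((2:ℝ) - 1 / 8) with hz
  have z1 : 1 ≤ z := Real.one_le_rpow hx (by norm_num)
  have z2 : ‖x‖ ≤ z := by
    conv_lhs => rw [← Real.rpow_one ‖x‖]
    exact Real.rpow_le_rpow_of_exponent_le hx (by norm_num)
  have k2 : |⟪p, T x⟫_ℝ| ≤ ‖p‖ * A * z := by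
    refine (abs_real_inner_le_norm _ _).trans ?_
    rw [mul_assoc]
    refine mul_le_mul_of_nonneg_left ((TA x).trans (mul_le_mul_of_nonneg_left z2 A0)) (norm_nonneg _)
  have k3 : |c| ≤ |c| * z := le_mul_of_one_le_right (abs_nonneg _) z1
  have e : u (T x) - F / 2 * ‖x‖ ^ 2 = F * ((u1 (T x) - ‖x‖ ^ 2 / 2) - ⟪p, T x⟫_ℝ - c) := by
    simp only [hu1]; field_simp; ring
  rw [e, abs_mul, abs_of_pos F0, mul_assoc]
  refine mul_le_mul_of_nonneg_left ?_ F0.le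
  rw [add_mul, add_mul]
  obtain ⟨a1, a2⟩ := abs_le.1 k1
  obtain ⟨a3, a4⟩ := abs_le.1 k2
  have a5 := neg_abs_le c
  have a6 := le_abs_self c
  exact abs_le.2 ⟨by linarith, by linarith⟩

end PartB

/-- **Corollary 2.4**: if `u` is a convex (classical) solution of `det D²u = e^{n f}` in
`ℝⁿ`, `n ≥ 3`, where `f` is continuous with `limsup_{|x|→∞}|x|^ζ|f - f(∞)| < ∞` for some
`ζ > 1`, then there is a linear transform `T` with `det T = 1` such that
`|u(Tx) - (e^{f(∞)}/2)|x|²| ≤ C|x|^{2-ε}` for all `|x| ≥ 1`. -/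
theorem MongeAmpere_rough_asymptotics_exponential_rhs
    (n : ℕ) (hn : 3 ≤ n) (ζ : ℝ) (hζ : 1 < ζ)
    (f : EuclideanSpace ℝ (Fin n) → ℝ) (finf : ℝ)
    (hf_cont : Continuous f)
    (hf_lim : Tendsto f (cocompact _) (nhds finf))
    (hf_decay : ∃ C R : ℝ, 0 < C ∧ 0 < R ∧ ∀ x : EuclideanSpace ℝ (Fin n), R ≤ ‖x‖ →
      ‖x‖ ^ ζ * |f x - finf| ≤ C)
    (u : EuclideanSpace ℝ (Fin n) → ℝ) (hu : ContDiff ℝ 2 u)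
    (hconvex : ConvexOn ℝ Set.univ u)
    (hMA : ∀ x, (hess u x).det = Real.exp (n * f x)) :
    ∃ (T : EuclideanSpace ℝ (Fin n) ≃ₗ[ℝ] EuclideanSpace ℝ (Fin n)) (C ε : ℝ),
      LinearMap.det (T : EuclideanSpace ℝ (Fin n) →ₗ[ℝ] EuclideanSpace ℝ (Fin n)) = 1 ∧
      0 < C ∧ 0 < ε ∧
      ∀ x : EuclideanSpace ℝ (Fin n), 1 ≤ ‖x‖ →
        |u (T x) - Real.exp finf / 2 * ‖x‖ ^ 2| ≤ C * ‖x‖ ^ ((2 : ℝ) - ε) := by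
  exact mainThm n hn ζ hζ f finf hf_cont hf_decay u hu hconvex hMA
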